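/- Global existence (Theorem 3.6). Assume d > 0, δ > 0, and f satisfies conditions (f2) and (f3). Then for every h₀ > 0 and every u₀ ∈ X(h₀), there exists a classical solution (u,g,h) of the free boundary problem (c) with initial datum u₀ defined for all t ∈ [0,∞), with u(t,x) > 0 for all t > 0 and x ∈ [g(t), h(t)], and this solution is unique. -/

import Mathlib

open Set Filter

/-- A function `f` is of Allee type `(f_A)` with distinguished zero `θ ∈ [0,1)`. -/
def AlleeType (f : ℝ → ℝ) (θ : ℝ) : Prop :=
  ContDiffOn ℝ 1 f (Ici (0:ℝ)) ∧ θ ∈ Ico (0:ℝ) 1 ∧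
    f 0 = 0 ∧ f θ = 0 ∧ f 1 = 0 ∧
    derivWithin f (Ici (0:ℝ)) 0 ≤ 0 ∧ derivWithin f (Ici (0:ℝ)) 1 < 0 ∧
    (∀ u ∈ Icc (0:ℝ) θ, f u ≤ 0) ∧ (∀ u ∈ Ioo θ (1:ℝ), 0 < f u) ∧
    (∀ u ∈ Ioi (1:ℝ), f u < 0) ∧ 0 < ∫ s in (0:ℝ)..1, f s

/-- `θs` is the number `θ*_f ∈ [θ,1)` attached to an Allee type `f`. -/
def IsThetaStar (f : ℝ → ℝ) (θ θs : ℝ) : Prop :=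
  θs ∈ Ico θ (1:ℝ) ∧ (∫ s in (0:ℝ)..θs, f s) = 0 ∧
    ∀ u ∈ Ioc θs (1:ℝ), 0 < ∫ s in (0:ℝ)..u, f s

/-- Membership in the initial class `X(h₀)`. -/
def InX (δ h₀ : ℝ) (φ : ℝ → ℝ) : Prop :=
  ContDiffOn ℝ 2 φ (Icc (-h₀) h₀) ∧ φ (-h₀) = δ ∧ φ h₀ = δ ∧
    ∀ x ∈ Icc (-h₀) h₀, 0 < φ x

/-- A classical solution `(u,g,h)` of the free boundary problem (with reaction
term `f = f(t,x,u)`) with initial datum `u₀ ∈ X(h₀)` on the time interval `I`. -/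
structure ClassicalSolution (d δ h₀ : ℝ) (f : ℝ → ℝ → ℝ → ℝ) (u₀ : ℝ → ℝ)
    (I : Set ℝ) (u : ℝ → ℝ → ℝ) (g h : ℝ → ℝ) : Prop where
  g_reg : ContDiffOn ℝ 1 g I
  h_reg : ContDiffOn ℝ 1 h I
  g_lt_h : ∀ t ∈ I, g t < h t
  u_cont : ContinuousOn (fun p : ℝ × ℝ => u p.1 p.2)
      {p : ℝ × ℝ | p.1 ∈ I ∧ p.2 ∈ Icc (g p.1) (h p.1)}
  ux_cont : ContinuousOn (fun p : ℝ × ℝ => deriv (u p.1) p.2)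
      {p : ℝ × ℝ | p.1 ∈ I ∧ 0 < p.1 ∧ p.2 ∈ Icc (g p.1) (h p.1)}
  ut_diff : ∀ t ∈ I, 0 < t → ∀ x ∈ Ioo (g t) (h t),
      DifferentiableAt ℝ (fun s => u s x) t
  ux_diff : ∀ t ∈ I, 0 < t → ∀ x ∈ Icc (g t) (h t), DifferentiableAt ℝ (u t) x
  uxx_diff : ∀ t ∈ I, 0 < t → ∀ x ∈ Ioo (g t) (h t),
      DifferentiableAt ℝ (deriv (u t)) x
  ut_cont : ContinuousOn (fun p : ℝ × ℝ => deriv (fun s => u s p.2) p.1)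
      {p : ℝ × ℝ | p.1 ∈ I ∧ 0 < p.1 ∧ p.2 ∈ Ioo (g p.1) (h p.1)}
  uxx_cont : ContinuousOn (fun p : ℝ × ℝ => deriv (deriv (u p.1)) p.2)
      {p : ℝ × ℝ | p.1 ∈ I ∧ 0 < p.1 ∧ p.2 ∈ Ioo (g p.1) (h p.1)}
  pde : ∀ t ∈ I, 0 < t → ∀ x ∈ Ioo (g t) (h t),
      deriv (fun s => u s x) t = d * deriv (deriv (u t)) x + f t x (u t x)
  bc_g : ∀ t ∈ I, 0 < t → u t (g t) = δ
  bc_h : ∀ t ∈ I, 0 < t → u t (h t) = δ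
  stefan_g : ∀ t ∈ I, 0 < t → deriv g t = -(d / δ) * deriv (u t) (g t)
  stefan_h : ∀ t ∈ I, 0 < t → deriv h t = -(d / δ) * deriv (u t) (h t)
  g_init : g 0 = -h₀
  h_init : h 0 = h₀
  u_init : ∀ x ∈ Icc (-h₀) h₀, u 0 x = u₀ x

/-- A semi-wave pair `(c,q)` for `(f, δ, d)`. -/
def SemiWavePair (d δ : ℝ) (f : ℝ → ℝ) (c : ℝ) (q : ℝ → ℝ) : Prop :=
  0 < c ∧ ContDiffOn ℝ 2 q (Ici (0:ℝ)) ∧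
    (∀ z ∈ Ici (0:ℝ),
      d * derivWithin (derivWithin q (Ici (0:ℝ))) (Ici (0:ℝ)) z
        - c * derivWithin q (Ici (0:ℝ)) z + f (q z) = 0) ∧
    (∀ z ∈ Ioi (0:ℝ), 0 < q z) ∧ q 0 = δ ∧
    Tendsto q atTop (nhds 1) ∧
    derivWithin q (Ici (0:ℝ)) 0 = c * δ / d ∧
    ∀ z ∈ Ici (0:ℝ), 0 < derivWithin q (Ici (0:ℝ)) z

/-- Condition `(f2)` with Hölder exponent `β`. -/
def CondF2 (f : ℝ → ℝ → ℝ → ℝ) (β : ℝ) : Prop :=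
  β ∈ Ioo (0:ℝ) 1 ∧
    (∀ M > 0, ∃ C > 0, ∀ t₁ ∈ Ici (0:ℝ), ∀ t₂ ∈ Ici (0:ℝ), ∀ x₁ x₂ : ℝ,
        ∀ v ∈ Icc (0:ℝ) M,
        |f t₁ x₁ v - f t₂ x₂ v| ≤ C * (|t₁ - t₂| ^ (β / 2) + |x₁ - x₂| ^ β)) ∧
    (∀ t ∈ Ici (0:ℝ), ∀ x : ℝ, ContDiffOn ℝ 1 (f t x) (Ici (0:ℝ))) ∧
    (∀ t ∈ Ici (0:ℝ), ∀ x : ℝ, f t x 0 = 0) ∧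
    (∀ M > 0, ∃ L > 0, ∀ t ∈ Ici (0:ℝ), ∀ x : ℝ,
        ∀ v₁ ∈ Icc (0:ℝ) M, ∀ v₂ ∈ Icc (0:ℝ) M,
        |f t x v₁ - f t x v₂| ≤ L * |v₁ - v₂|)

/-- Condition `(f3)` with constant `M₀`. -/
def CondF3 (f : ℝ → ℝ → ℝ → ℝ) (M₀ : ℝ) : Prop :=
  0 < M₀ ∧ ∀ t ∈ Ici (0:ℝ), ∀ x : ℝ, ∀ v, M₀ ≤ v → f t x v < 0

/-- Part (i) of condition `(f4)`, with upper bound function `fbar`. -/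
def CondF4i (f : ℝ → ℝ → ℝ → ℝ) (fbar : ℝ → ℝ) (β : ℝ) : Prop :=
  CondF2 f β ∧ (∀ t ∈ Ici (0:ℝ), ∀ x : ℝ, f t x 1 = 0) ∧
    ContinuousOn fbar (Ici (1:ℝ)) ∧
    ∀ t ∈ Ici (0:ℝ), ∀ x : ℝ, ∀ v, 1 < v → f t x v ≤ fbar v ∧ fbar v < 0

/-- Condition `(f4)`, with bounds `fbar` (above, for `u > 1`) and
`funder` (below, of Allee type). -/
def CondF4 (f : ℝ → ℝ → ℝ → ℝ) (fbar funder : ℝ → ℝ) (θ β : ℝ) : Prop :=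
  CondF4i f fbar β ∧ AlleeType funder θ ∧
    ∀ t ∈ Ici (0:ℝ), ∀ x : ℝ, ∀ v, 0 ≤ v → funder v ≤ f t x v

/-- Combustion-type nonlinearity `(f_c)` with ignition value `θ`. -/
def CombustionType (f : ℝ → ℝ) (θ : ℝ) : Prop :=
  ContDiffOn ℝ 1 f (Ici (0:ℝ)) ∧ θ ∈ Ioo (0:ℝ) 1 ∧
    (∀ u ∈ Icc (0:ℝ) θ, f u = 0) ∧ f 1 = 0 ∧ derivWithin f (Ici (0:ℝ)) 1 < 0 ∧
    (∀ u ∈ Ioo θ (1:ℝ), 0 < f u) ∧ (∀ u ∈ Ioi (1:ℝ), f u < 0)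

/-- The (unnormalised) bistable condition `(F_b)` with constants `0 < P < Q`. -/
def CondFb (F : ℝ → ℝ) (P Q : ℝ) : Prop :=
  0 < P ∧ P < Q ∧ ContDiffOn ℝ 1 F (Ici (0:ℝ)) ∧
    F 0 = 0 ∧ F P = 0 ∧ F Q = 0 ∧
    derivWithin F (Ici (0:ℝ)) 0 < 0 ∧ derivWithin F (Ici (0:ℝ)) Q < 0 ∧
    (∀ u ∈ Ioo (0:ℝ) P, F u < 0) ∧ (∀ u ∈ Ioi Q, F u < 0) ∧
    (∀ u ∈ Ioo P Q, 0 < F u) ∧ 0 < ∫ s in (0:ℝ)..Q, F s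


namespace FBP
open MeasureTheory Topology

/-- Polynomial factor of the `j`-th space derivative of the heat kernel. -/
noncomputable def PK (j : ℕ) (θ x : ℝ) : ℝ :=
  match j with
  | 0 => 1
  | 1 => -(x / (2 * θ))
  | 2 => x ^ 2 / (4 * θ ^ 2) - 1 / (2 * θ)
  | 3 => 3 * x / (4 * θ ^ 2) - x ^ 3 / (8 * θ ^ 3)
  | _ => 0

/-- The `j`-th space derivative of the heat kernel. -/
noncomputable def GK (j : ℕ) (θ x : ℝ) : ℝ :=
  PK j θ x * (Real.exp (-(x ^ 2) / (4 * θ)) / √(4 * Real.pi * θ))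

lemma GK0_pos {θ : ℝ} (hθ : 0 < θ) (x : ℝ) : 0 < GK 0 θ x := by
  simp only [GK, PK]
  have := Real.pi_pos
  positivity

lemma GK0_eq (θ x : ℝ) : GK 0 θ x = (√(4 * Real.pi * θ))⁻¹ * Real.exp (-(1 / (4 * θ)) * x ^ 2) := by
  simp only [GK, PK]
  rw [one_mul, div_eq_mul_inv, mul_comm]
  congr 2
  ring

lemma GK0_integrable {θ : ℝ} (hθ : 0 < θ) : Integrable (GK 0 θ) := by
  have : GK 0 θ = fun x => (√(4 * Real.pi * θ))⁻¹ * Real.exp (-(1 / (4 * θ)) * x ^ 2) := by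
    funext x; exact GK0_eq θ x
  rw [this]
  exact (integrable_exp_neg_mul_sq (by positivity)).const_mul _

lemma GK0_integral {θ : ℝ} (hθ : 0 < θ) : ∫ x, GK 0 θ x = 1 := by
  simp_rw [GK0_eq]
  rw [integral_const_mul, integral_gaussian]
  have : Real.pi / (1 / (4 * θ)) = 4 * Real.pi * θ := by field_simp
  rw [this]
  have : 0 < √(4 * Real.pi * θ) := by have := Real.pi_pos; positivity
  field_simp

lemma one_add_pow4_le (s : ℝ) : 1 + s ^ 4 ≤ 129 * Real.exp (s ^ 2 / 8) := by
  have h1 := Real.quadratic_le_exp_of_nonneg (x := s ^ 2 / 8) (by positivity)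
  nlinarith [sq_nonneg s]

lemma poly_bound {s : ℝ} (hs : 0 ≤ s) {q : ℝ} (hq : q ≤ 1 ∨ q ≤ s / 2 ∨ q ≤ s ^ 2 / 4 + 1 / 2 ∨
    q ≤ 3 * s / 4 + s ^ 3 / 8) : q * (1 + s) ≤ 2 * (1 + s ^ 4) := by
  have e1 : 0 ≤ s ^ 2 := by positivity
  have e2 : 0 ≤ s ^ 3 := by positivity
  rcases hq with h | h | h | h
  all_goals
    refine (mul_le_mul_of_nonneg_right h (by linarith)).trans ?_
    nlinarith [sq_nonneg (s - 1), sq_nonneg (s ^ 2 - 1), sq_nonneg (s ^ 2 - s)]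

lemma PK_scaled {j : ℕ} (hj : j ≤ 3) {r : ℝ} (hr : 0 < r) (s : ℝ) (hs : 0 ≤ s) (x : ℝ)
    (hx : |x| = r * s) :
    ∃ q, 0 ≤ q ∧ |PK j (r ^ 2) x| ≤ q / r ^ j ∧ (q ≤ 1 ∨ q ≤ s / 2 ∨ q ≤ s ^ 2 / 4 + 1 / 2 ∨
    q ≤ 3 * s / 4 + s ^ 3 / 8) := by
  have hx2 : x ^ 2 = r ^ 2 * s ^ 2 := by rw [← sq_abs, hx]; ring
  interval_cases j
  · exact ⟨1, by norm_num, by simp [PK], Or.inl le_rfl⟩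
  · refine ⟨s / 2, by positivity, ?_, Or.inr (Or.inl le_rfl)⟩
    simp only [PK, abs_neg, abs_div, hx]
    rw [abs_of_pos (by positivity : (0:ℝ) < 2 * r ^ 2)]
    apply le_of_eq; field_simp
  · refine ⟨s ^ 2 / 4 + 1 / 2, by positivity, ?_, Or.inr (Or.inr (Or.inl le_rfl))⟩
    simp only [PK, hx2]
    refine (abs_sub _ _).trans (le_of_eq ?_)
    rw [abs_of_nonneg (by positivity), abs_of_nonneg (by positivity)]
    field_simp
  · refine ⟨3 * s / 4 + s ^ 3 / 8, by positivity, ?_, Or.inr (Or.inr (Or.inr le_rfl))⟩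
    simp only [PK]
    refine (abs_sub _ _).trans (le_of_eq ?_)
    rw [abs_div, abs_div, abs_mul, abs_pow, hx, abs_of_pos (by norm_num : (0:ℝ) < 3),
      abs_of_pos (by positivity : (0:ℝ) < 4 * (r ^ 2) ^ 2),
      abs_of_pos (by positivity : (0:ℝ) < 8 * (r ^ 2) ^ 3)]
    field_simp

/-- Main pointwise bound of kernels. -/
lemma GK_bound {j : ℕ} (hj : j ≤ 3) {a : ℝ} (ha0 : 0 ≤ a) (ha1 : a ≤ 1) {θ : ℝ} (hθ : 0 < θ)
    (x : ℝ) : |GK j θ x| * |x| ^ a ≤ 400 * θ ^ ((a - j) / 2) * GK 0 (2 * θ) x := by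
  set r := √θ with hr
  have hr0 : 0 < r := Real.sqrt_pos.2 hθ
  have hrθ : θ = r ^ 2 := (Real.sq_sqrt hθ.le).symm
  set s := |x| / r with hs
  have hs0 : 0 ≤ s := by positivity
  have hx : |x| = r * s := by rw [hs]; field_simp
  obtain ⟨q, hq0, hq1, hq2⟩ := PK_scaled hj hr0 s hs0 x hx
  have hx2 : x ^ 2 = r ^ 2 * s ^ 2 := by rw [← sq_abs, hx]; ring
  have hsa : s ^ a ≤ 1 + s := by
    have := Real.rpow_le_rpow hs0 (by linarith : s ≤ 1 + s) ha0
    refine this.trans ?_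
    conv_rhs => rw [← Real.rpow_one (1 + s)]
    exact Real.rpow_le_rpow_of_exponent_le (by linarith) ha1
  have hxa : |x| ^ a = r ^ a * s ^ a := by rw [hx, Real.mul_rpow hr0.le hs0]
  have hpow : θ ^ ((a - j) / 2) = r ^ a / r ^ j := by
    rw [hrθ, ← Real.rpow_natCast r 2, ← Real.rpow_mul hr0.le]
    rw [show ((2:ℕ):ℝ) * ((a - j) / 2) = a - j by push_cast; ring, Real.rpow_sub hr0,
      Real.rpow_natCast]
  have hkey : q * s ^ a ≤ 258 * Real.exp (s ^ 2 / 8) := by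
    calc q * s ^ a ≤ q * (1 + s) := mul_le_mul_of_nonneg_left hsa hq0
      _ ≤ 2 * (1 + s ^ 4) := poly_bound hs0 hq2
      _ ≤ _ := by linarith [one_add_pow4_le s]
  have hsq : √(4 * Real.pi * (2 * θ)) = √2 * √(4 * Real.pi * θ) := by
    rw [← Real.sqrt_mul (by norm_num)]; congr 1; ring
  have h2 : √2 ≤ 400 / 258 := by
    rw [Real.sqrt_le_left (by norm_num)]; norm_num
  have hS : 0 < √(4 * Real.pi * θ) := by have := Real.pi_pos; positivity
  have e1 : Real.exp (-(x ^ 2) / (4 * θ)) = Real.exp (-(s ^ 2 / 8)) * Real.exp (-(s ^ 2 / 8)) := by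
    rw [← Real.exp_add, hx2, hrθ]; congr 1; field_simp; ring
  have e2 : Real.exp (-(x ^ 2) / (4 * (2 * θ))) = Real.exp (-(s ^ 2 / 8)) := by
    rw [hx2, hrθ]; congr 1; field_simp; ring
  have eG0 : GK 0 (2 * θ) x = Real.exp (-(s ^ 2 / 8)) / (√2 * √(4 * Real.pi * θ)) := by
    simp only [GK, PK, one_mul]; rw [e2, hsq]
  have eG : |GK j θ x| = |PK j θ x| * (Real.exp (-(s ^ 2 / 8)) * Real.exp (-(s ^ 2 / 8)) / √(4 * Real.pi * θ)) := by
    simp only [GK, abs_mul]; rw [e1, abs_of_pos (by positivity : 0 < Real.exp (-(s ^ 2 / 8)) * Real.exp (-(s ^ 2 / 8)) / √(4 * Real.pi * θ))]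
  rw [eG, eG0, hxa, hpow]
  rw [← hrθ] at hq1
  set E := Real.exp (-(s ^ 2 / 8)) with hE
  have hE0 : 0 < E := Real.exp_pos _
  have hEE : E * Real.exp (s ^ 2 / 8) = 1 := by rw [hE, ← Real.exp_add]; simp
  have hra : 0 < r ^ a := Real.rpow_pos_of_pos hr0 a
  have hrj : 0 < r ^ j := by positivity
  calc |PK j θ x| * (E * E / √(4 * Real.pi * θ)) * (r ^ a * s ^ a)
      ≤ q / r ^ j * (E * E / √(4 * Real.pi * θ)) * (r ^ a * s ^ a) := by gcongr
    _ = (r ^ a / r ^ j) * (E / √(4 * Real.pi * θ)) * (E * (q * s ^ a)) := by ring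
    _ ≤ (r ^ a / r ^ j) * (E / √(4 * Real.pi * θ)) * (E * (258 * Real.exp (s ^ 2 / 8))) := by
        gcongr
    _ = 258 * (r ^ a / r ^ j) * (E / √(4 * Real.pi * θ)) := by
        linear_combination (r ^ a / r ^ j) * (E / √(4 * Real.pi * θ)) * 258 * hEE
    _ ≤ (400 / √2) * (r ^ a / r ^ j) * (E / √(4 * Real.pi * θ)) := by
        gcongr
        rw [le_div_iff₀ (by positivity)]; linarith
    _ = _ := by field_simp

lemma GK_bound0 {j : ℕ} (hj : j ≤ 3) {θ : ℝ} (hθ : 0 < θ)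
    (x : ℝ) : |GK j θ x| ≤ 400 * θ ^ (-(j:ℝ) / 2) * GK 0 (2 * θ) x := by
  have := GK_bound hj le_rfl zero_le_one hθ x
  simpa using this

lemma GK_measurable (j : ℕ) : Measurable (fun q : ℝ × ℝ => GK j q.1 q.2) := by
  unfold GK
  refine Measurable.mul ?_ (by fun_prop)
  unfold PK
  rcases j with _ | _ | _ | _ | j <;> simp only <;> fun_prop

lemma GK_measurable2 (j : ℕ) (θ : ℝ) : Measurable (GK j θ) :=
  (GK_measurable j).comp (measurable_const.prodMk measurable_id)

/-- HasDerivAt in space. -/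
lemma GK_hasDerivAt_x {j : ℕ} (hj : j ≤ 2) {θ : ℝ} (hθ : 0 < θ) (x : ℝ) :
    HasDerivAt (GK j θ) (GK (j + 1) θ x) x := by
  have hE : HasDerivAt (fun x : ℝ => Real.exp (-(x ^ 2) / (4 * θ)) / √(4 * Real.pi * θ))
      (-(x / (2 * θ)) * (Real.exp (-(x ^ 2) / (4 * θ)) / √(4 * Real.pi * θ))) x := by
    have h1 : HasDerivAt (fun x : ℝ => -(x ^ 2) / (4 * θ)) (-(x / (2 * θ))) x := by
      have := ((hasDerivAt_pow 2 x).neg).div_const (4 * θ)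
      refine this.congr_deriv ?_
      push_cast; field_simp; ring
    have := (h1.exp).div_const (√(4 * Real.pi * θ))
    refine this.congr_deriv ?_
    ring
  have hP : ∃ P', HasDerivAt (PK j θ) P' x ∧ P' + PK j θ x * (-(x / (2 * θ))) = PK (j + 1) θ x := by
    interval_cases j
    · exact ⟨0, hasDerivAt_const x (1:ℝ), by simp [PK]⟩
    · refine ⟨-(1 / (2 * θ)), ((hasDerivAt_id x).div_const (2 * θ)).neg, ?_⟩
      simp only [PK]; field_simp; ring
    · refine ⟨2 * x / (4 * θ ^ 2), ?_, ?_⟩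
      · have := ((hasDerivAt_pow 2 x).div_const (4 * θ ^ 2)).sub_const (1 / (2 * θ))
        refine this.congr_deriv ?_
        push_cast; ring
      · simp only [PK]; field_simp; ring
  obtain ⟨P', hP1, hP2⟩ := hP
  have := hP1.mul hE
  refine this.congr_deriv ?_
  unfold GK
  rw [← hP2]; ring

/-- HasDerivAt in time. -/
lemma GK_hasDerivAt_t {j : ℕ} (hj : j ≤ 1) {θ : ℝ} (hθ : 0 < θ) (x : ℝ) :
    HasDerivAt (fun θ => GK j θ x) (GK (j + 2) θ x) θ := by
  have hpi := Real.pi_pos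
  have hE : HasDerivAt (fun θ : ℝ => Real.exp (-(x ^ 2) / (4 * θ)) / √(4 * Real.pi * θ))
      ((x ^ 2 / (4 * θ ^ 2) - 1 / (2 * θ)) * (Real.exp (-(x ^ 2) / (4 * θ)) / √(4 * Real.pi * θ))) θ := by
    have h1 : HasDerivAt (fun θ : ℝ => -(x ^ 2) / (4 * θ)) (x ^ 2 / (4 * θ ^ 2)) θ := by
      have := (hasDerivAt_const θ (-(x ^ 2))).div ((hasDerivAt_id θ).const_mul 4) (by simp; positivity)
      refine this.congr_deriv ?_
      simp only [id]; field_simp; ring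
    have h2 : HasDerivAt (fun θ : ℝ => √(4 * Real.pi * θ)) (√(4 * Real.pi * θ) / (2 * θ)) θ := by
      have := ((hasDerivAt_id θ).const_mul (4 * Real.pi)).sqrt (by simp; positivity)
      refine this.congr_deriv ?_
      simp only [id]
      rw [div_eq_div_iff (by positivity) (by positivity)]
      have := Real.mul_self_sqrt (by positivity : 0 ≤ 4 * Real.pi * θ)
      linear_combination -2 * this
    have := (h1.exp).div h2 (by positivity)
    refine this.congr_deriv ?_
    have hS : 0 < √(4 * Real.pi * θ) := by positivity
    field_simp
  interval_cases j
  · simpa [GK, PK] using hE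
  · have hP : HasDerivAt (fun θ => PK 1 θ x) (x / (2 * θ ^ 2)) θ := by
      have := ((hasDerivAt_const θ x).div ((hasDerivAt_id θ).const_mul 2) (by simp; positivity)).neg
      refine this.congr_deriv ?_
      simp only [id]; field_simp; ring
    have := hP.mul hE
    refine this.congr_deriv ?_
    simp only [GK, PK]
    field_simp; ring

lemma GK_continuousAt (j : ℕ) (hj : j ≤ 3) {θ x : ℝ} (hθ : 0 < θ) :
    ContinuousAt (fun q : ℝ × ℝ => GK j q.1 q.2) (θ, x) := by
  have hpi := Real.pi_pos
  unfold GK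
  have h1 : ContinuousAt (fun q : ℝ × ℝ => Real.exp (-(q.2 ^ 2) / (4 * q.1)) / √(4 * Real.pi * q.1)) (θ, x) := by
    refine ContinuousAt.div ?_ (by fun_prop) (by positivity)
    refine Real.continuous_exp.continuousAt.comp ?_
    exact ContinuousAt.div (by fun_prop) (by fun_prop) (by simp; positivity)
  refine ContinuousAt.mul ?_ h1
  unfold PK
  interval_cases j
  · exact continuousAt_const
  · exact (ContinuousAt.div (by fun_prop) (by fun_prop) (by simp; positivity)).neg
  · exact (ContinuousAt.div (by fun_prop) (by fun_prop) (by simp; positivity)).sub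
      (ContinuousAt.div (by fun_prop) (by fun_prop) (by simp; positivity))
  · exact (ContinuousAt.div (by fun_prop) (by fun_prop) (by simp; positivity)).sub
      (ContinuousAt.div (by fun_prop) (by fun_prop) (by simp; positivity))

/-- domination function -/
noncomputable def domG (a b x : ℝ) : ℝ :=
  (400 * (1 + a ^ (-(1:ℝ) / 2) + a ^ (-(2:ℝ) / 2) + a ^ (-(3:ℝ) / 2)) / √(4 * Real.pi * (2 * a)) * Real.exp (1 / (8 * b))) *
    Real.exp (-(1 / (16 * b)) * x ^ 2)

lemma domG_integrable {a b : ℝ} (hb : 0 < b) : Integrable (domG a b) :=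
  (integrable_exp_neg_mul_sq (by positivity)).const_mul _

lemma GK_dom {j : ℕ} (hj : j ≤ 3) {a b θ : ℝ} (ha : 0 < a) (h1 : a ≤ θ) (h2 : θ ≤ b)
    {x x₀ : ℝ} (hx : |x - x₀| ≤ 1) : |GK j θ x| ≤ domG a b x₀ := by
  have hθ : 0 < θ := ha.trans_le h1
  have hb : 0 < b := hθ.trans_le h2
  have hpi := Real.pi_pos
  refine (GK_bound0 hj hθ x).trans ?_
  have e1 : θ ^ (-(j:ℝ) / 2) ≤ 1 + a ^ (-(1:ℝ) / 2) + a ^ (-(2:ℝ) / 2) + a ^ (-(3:ℝ) / 2) := by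
    have p1 : 0 < a ^ (-(1:ℝ) / 2) := Real.rpow_pos_of_pos ha _
    have p2 : 0 < a ^ (-(2:ℝ) / 2) := Real.rpow_pos_of_pos ha _
    have p3 : 0 < a ^ (-(3:ℝ) / 2) := Real.rpow_pos_of_pos ha _
    have : θ ^ (-(j:ℝ) / 2) ≤ a ^ (-(j:ℝ) / 2) := by
      apply Real.rpow_le_rpow_of_nonpos ha h1
      have : (0:ℝ) ≤ j := Nat.cast_nonneg j
      linarith
    refine this.trans ?_
    interval_cases j
    · simp; linarith
    · push_cast; linarith
    · push_cast; linarith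
    · push_cast; linarith
  have e2 : GK 0 (2 * θ) x ≤ Real.exp (1 / (8 * b)) * Real.exp (-(1 / (16 * b)) * x₀ ^ 2) / √(4 * Real.pi * (2 * a)) := by
    simp only [GK, PK, one_mul]
    rw [← Real.exp_add]
    gcongr
    have hxx : x₀ ^ 2 / 2 - 1 ≤ x ^ 2 := by
      have := abs_le.1 hx
      nlinarith [sq_nonneg (x + (x - x₀))]
    have : x ^ 2 / (8 * b) ≤ x ^ 2 / (4 * (2 * θ)) := by
      rw [show 4 * (2 * θ) = 8 * θ by ring]
      gcongr
    have h3 : (x₀ ^ 2 / 2 - 1) / (8 * b) ≤ x ^ 2 / (8 * b) := by gcongr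
    have h4 : (x₀ ^ 2 / 2 - 1) / (8 * b) = 1 / (16 * b) * x₀ ^ 2 - 1 / (8 * b) := by field_simp; ring
    rw [neg_div]; linarith
  calc 400 * θ ^ (-(j:ℝ) / 2) * GK 0 (2 * θ) x ≤ 400 * (1 + a ^ (-(1:ℝ) / 2) + a ^ (-(2:ℝ) / 2) + a ^ (-(3:ℝ) / 2)) * (Real.exp (1 / (8 * b)) * Real.exp (-(1 / (16 * b)) * x₀ ^ 2) / √(4 * Real.pi * (2 * a))) := by
        gcongr
        exact (GK0_pos (by positivity) x).le
    _ = _ := by unfold domG; ring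

end FBP

namespace FBP
open MeasureTheory Topology

/-- Convolution with the `j`-th derivative of the heat kernel. -/
noncomputable def cv (j : ℕ) (θ : ℝ) (φ : ℝ → ℝ) (y : ℝ) : ℝ := ∫ ξ, GK j θ (y - ξ) * φ ξ

lemma GK_integrable {j : ℕ} (hj : j ≤ 3) {θ : ℝ} (hθ : 0 < θ) : Integrable (GK j θ) := by
  refine Integrable.mono' ((GK0_integrable (by positivity : 0 < 2 * θ)).const_mul
    (400 * θ ^ (-(j:ℝ) / 2))) (GK_measurable2 j θ).aestronglyMeasurable ?_
  exact Eventually.of_forall fun x => GK_bound0 hj hθ x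

lemma cv_integrable {j : ℕ} (hj : j ≤ 3) {θ : ℝ} (hθ : 0 < θ) {φ : ℝ → ℝ} (hm : Measurable φ)
    {B : ℝ} (hB : ∀ ξ, |φ ξ| ≤ B) (y : ℝ) : Integrable (fun ξ => GK j θ (y - ξ) * φ ξ) := by
  have h1 : Integrable (fun ξ => GK j θ (y - ξ)) := (GK_integrable hj hθ).comp_sub_left y
  refine h1.mul_bdd (c := B) hm.aestronglyMeasurable (Eventually.of_forall hB)

lemma cv_weighted {j : ℕ} (hj : j ≤ 3) {a : ℝ} (ha0 : 0 ≤ a) (ha1 : a ≤ 1) {θ : ℝ} (hθ : 0 < θ)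
    {φ : ℝ → ℝ} {H : ℝ} {y : ℝ} (hH : ∀ ξ, |φ ξ| ≤ H * |ξ - y| ^ a) :
    |cv j θ φ y| ≤ 400 * H * θ ^ ((a - j) / 2) := by
  unfold cv
  have hH0 : 0 ≤ H := by
    have := (abs_nonneg _).trans (hH (y + 1)); simpa using this
  have hI : Integrable (fun ξ => 400 * H * θ ^ ((a - j) / 2) * GK 0 (2 * θ) (y - ξ)) :=
    ((GK0_integrable (by positivity : 0 < 2 * θ)).comp_sub_left y).const_mul _
  have := norm_integral_le_of_norm_le (μ := volume) (f := fun ξ => GK j θ (y - ξ) * φ ξ) hI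
    (Eventually.of_forall fun ξ => by
      rw [Real.norm_eq_abs, abs_mul]
      have h1 := GK_bound hj ha0 ha1 hθ (y - ξ)
      have h2 := hH ξ
      rw [abs_sub_comm] at h2
      calc |GK j θ (y - ξ)| * |φ ξ| ≤ |GK j θ (y - ξ)| * (H * |y - ξ| ^ a) := by gcongr
        _ = H * (|GK j θ (y - ξ)| * |y - ξ| ^ a) := by ring
        _ ≤ H * (400 * θ ^ ((a - j) / 2) * GK 0 (2 * θ) (y - ξ)) := by gcongr
        _ = _ := by ring)
  rw [Real.norm_eq_abs] at this
  refine this.trans (le_of_eq ?_)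
  rw [integral_const_mul, integral_sub_left_eq_self (fun x => GK 0 (2 * θ) x) volume y,
    GK0_integral (by positivity), mul_one]

lemma cv_bound {j : ℕ} (hj : j ≤ 3) {θ : ℝ} (hθ : 0 < θ) {φ : ℝ → ℝ}
    {B : ℝ} (hB : ∀ ξ, |φ ξ| ≤ B) (y : ℝ) : |cv j θ φ y| ≤ 400 * B * θ ^ (-(j:ℝ) / 2) := by
  have := cv_weighted (j := j) hj (a := 0) le_rfl zero_le_one hθ (φ := φ) (H := B) (y := y)
    (by simpa using hB)
  simpa using this

lemma cv_hasDerivAt_y {j : ℕ} (hj : j ≤ 2) {θ : ℝ} (hθ : 0 < θ) {φ : ℝ → ℝ} (hm : Measurable φ)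
    {B : ℝ} (hB : ∀ ξ, |φ ξ| ≤ B) (y : ℝ) : HasDerivAt (cv j θ φ) (cv (j + 1) θ φ y) y := by
  unfold cv
  have hB0 : 0 ≤ B := (abs_nonneg _).trans (hB 0)
  refine (hasDerivAt_integral_of_dominated_loc_of_deriv_le (s := Metric.ball y 1)
    (bound := fun ξ => domG θ θ (y - ξ) * B)
    (F' := fun y ξ => GK (j + 1) θ (y - ξ) * φ ξ)
    (Metric.ball_mem_nhds y one_pos) ?_ ?_ ?_ ?_ ?_ ?_).2
  · exact Eventually.of_forall fun z => (cv_integrable (by omega) hθ hm hB z).1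
  · exact cv_integrable (by omega) hθ hm hB y
  · exact (cv_integrable (by omega) hθ hm hB y).1
  · refine Eventually.of_forall fun ξ z hz => ?_
    rw [Real.norm_eq_abs, abs_mul]
    have : |GK (j + 1) θ (z - ξ)| ≤ domG θ θ (y - ξ) := by
      apply GK_dom (by omega) hθ le_rfl le_rfl
      rw [Metric.mem_ball, Real.dist_eq] at hz
      rw [show z - ξ - (y - ξ) = z - y by ring]; exact hz.le
    exact mul_le_mul this (hB ξ) (abs_nonneg _) ((abs_nonneg _).trans this)
  · exact ((domG_integrable hθ).comp_sub_left y).mul_const B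
  · refine Eventually.of_forall fun ξ z hz => ?_
    have h1 := (GK_hasDerivAt_x hj hθ (z - ξ)).comp z ((hasDerivAt_id z).sub_const ξ)
    simpa using h1.mul_const (φ ξ)

lemma cv_hasDerivAt_t {j : ℕ} (hj : j ≤ 1) {θ : ℝ} (hθ : 0 < θ) {φ : ℝ → ℝ} (hm : Measurable φ)
    {B : ℝ} (hB : ∀ ξ, |φ ξ| ≤ B) (y : ℝ) :
    HasDerivAt (fun θ => cv j θ φ y) (cv (j + 2) θ φ y) θ := by
  unfold cv
  have hB0 : 0 ≤ B := (abs_nonneg _).trans (hB 0)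
  refine (hasDerivAt_integral_of_dominated_loc_of_deriv_le (s := Ioo (θ / 2) (2 * θ))
    (bound := fun ξ => domG (θ / 2) (2 * θ) (y - ξ) * B)
    (F' := fun θ ξ => GK (j + 2) θ (y - ξ) * φ ξ)
    (Ioo_mem_nhds (by linarith) (by linarith)) ?_ ?_ ?_ ?_ ?_ ?_).2
  · filter_upwards [lt_mem_nhds hθ] with z hz
    exact (cv_integrable (by omega) hz hm hB y).1
  · exact cv_integrable (by omega) hθ hm hB y
  · exact (cv_integrable (by omega) hθ hm hB y).1
  · refine Eventually.of_forall fun ξ z hz => ?_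
    rw [Real.norm_eq_abs, abs_mul]
    have : |GK (j + 2) z (y - ξ)| ≤ domG (θ / 2) (2 * θ) (y - ξ) := by
      apply GK_dom (by omega) (by linarith) hz.1.le hz.2.le
      simp
    exact mul_le_mul this (hB ξ) (abs_nonneg _) ((abs_nonneg _).trans this)
  · exact ((domG_integrable (by linarith)).comp_sub_left y).mul_const B
  · refine Eventually.of_forall fun ξ z hz => ?_
    have h1 := (GK_hasDerivAt_t hj (by linarith [hz.1] : 0 < z) (y - ξ))
    exact h1.mul_const (φ ξ)

lemma cv1_sub_t {φ : ℝ → ℝ} (hm : Measurable φ) {B : ℝ} (hB : ∀ ξ, |φ ξ| ≤ B) (y : ℝ)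
    {a b c : ℝ} (hc : 0 < c) (ha : c ≤ a) (hb : c ≤ b) :
    |cv 1 a φ y - cv 1 b φ y| ≤ 400 * B * c ^ (-(3:ℝ) / 2) * |a - b| := by
  have hB0 : 0 ≤ B := (abs_nonneg _).trans (hB 0)
  have := (convex_Ici c).norm_image_sub_le_of_norm_hasDerivWithin_le (f := fun θ => cv 1 θ φ y)
    (f' := fun θ => cv 3 θ φ y) (C := 400 * B * c ^ (-(3:ℝ) / 2))
    (fun θ hθ => (cv_hasDerivAt_t (j := 1) le_rfl (hc.trans_le hθ) hm hB y).hasDerivWithinAt)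
    (fun θ hθ => by
      have h1 := cv_bound (j := 3) le_rfl (hc.trans_le hθ) hB y
      rw [Real.norm_eq_abs]
      refine h1.trans ?_
      have : θ ^ (-((3:ℕ):ℝ) / 2) ≤ c ^ (-(3:ℝ) / 2) :=
        Real.rpow_le_rpow_of_nonpos hc hθ (by norm_num)
      gcongr) (mem_Ici.2 hb) (mem_Ici.2 ha)
  simpa [Real.norm_eq_abs] using this

lemma cv_sub_y {j : ℕ} (hj : j ≤ 2) {θ : ℝ} (hθ : 0 < θ) {φ : ℝ → ℝ} (hm : Measurable φ) {B : ℝ}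
    (hB : ∀ ξ, |φ ξ| ≤ B) (y y' : ℝ) :
    |cv j θ φ y - cv j θ φ y'| ≤ 400 * B * θ ^ (-((j + 1 : ℕ):ℝ) / 2) * |y - y'| := by
  have := (convex_univ).norm_image_sub_le_of_norm_hasDerivWithin_le (f := cv j θ φ)
    (f' := fun y => cv (j + 1) θ φ y) (C := 400 * B * θ ^ (-((j + 1 : ℕ):ℝ) / 2))
    (fun y _ => (cv_hasDerivAt_y hj hθ hm hB y).hasDerivWithinAt)
    (fun y _ => cv_bound (j := j + 1) (by omega) hθ hB y) (mem_univ y') (mem_univ y)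
  simpa [Real.norm_eq_abs] using this

lemma cv1_holder {θ : ℝ} (hθ : 0 < θ) {φ : ℝ → ℝ} (hm : Measurable φ) {B : ℝ}
    (hB : ∀ ξ, |φ ξ| ≤ B) (y y' : ℝ) :
    |cv 1 θ φ y - cv 1 θ φ y'| ≤ 800 * B * θ ^ (-(3:ℝ) / 4) * |y - y'| ^ ((1:ℝ) / 2) := by
  have hB0 : 0 ≤ B := (abs_nonneg _).trans (hB 0)
  have h1 := cv_sub_y (j := 1) (by norm_num) hθ hm hB y y'
  have h2 : |cv 1 θ φ y - cv 1 θ φ y'| ≤ 800 * B * θ ^ (-(1:ℝ) / 2) := by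
    have := cv_bound (j := 1) (by norm_num) hθ hB y
    have := cv_bound (j := 1) (by norm_num) hθ hB y'
    have := abs_sub (cv 1 θ φ y) (cv 1 θ φ y')
    push_cast at *
    linarith
  set X := |cv 1 θ φ y - cv 1 θ φ y'| with hX
  have hX0 : 0 ≤ X := abs_nonneg _
  have e1 : θ ^ (-((1 + 1 : ℕ):ℝ) / 2) * θ ^ (-(1:ℝ) / 2) = (θ ^ (-(3:ℝ) / 4)) ^ 2 := by
    rw [← Real.rpow_add hθ, ← Real.rpow_natCast (θ ^ (-(3:ℝ) / 4)) 2, ← Real.rpow_mul hθ.le]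
    norm_num
  have e2 : |y - y'| = (|y - y'| ^ ((1:ℝ) / 2)) ^ 2 := by
    rw [← Real.rpow_natCast _ 2, ← Real.rpow_mul (abs_nonneg _)]; norm_num
  have p1 : 0 ≤ θ ^ (-(3:ℝ) / 4) := Real.rpow_nonneg hθ.le _
  have p2 : 0 ≤ |y - y'| ^ ((1:ℝ) / 2) := Real.rpow_nonneg (abs_nonneg _) _
  have p3 : 0 ≤ θ ^ (-(1:ℝ) / 2) := Real.rpow_nonneg hθ.le _
  have p4 : 0 ≤ θ ^ (-((1 + 1 : ℕ):ℝ) / 2) := Real.rpow_nonneg hθ.le _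
  refine abs_le_of_sq_le_sq' (?_ : X ^ 2 ≤ _) (by positivity) |>.2
  calc X ^ 2 = X * X := sq X
    _ ≤ (400 * B * θ ^ (-((1 + 1 : ℕ):ℝ) / 2) * |y - y'|) * (800 * B * θ ^ (-(1:ℝ) / 2)) :=
        mul_le_mul h1 h2 hX0 (hX0.trans h1)
    _ = 400 * 800 * B ^ 2 * (θ ^ (-((1 + 1 : ℕ):ℝ) / 2) * θ ^ (-(1:ℝ) / 2)) * |y - y'| := by ring
    _ = 400 * 800 * (B * θ ^ (-(3:ℝ) / 4) * |y - y'| ^ ((1:ℝ) / 2)) ^ 2 := by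
        rw [e1]; nth_rw 1 [e2]; ring
    _ ≤ 800 * 800 * (B * θ ^ (-(3:ℝ) / 4) * |y - y'| ^ ((1:ℝ) / 2)) ^ 2 := by
        gcongr; norm_num
    _ = _ := by ring

lemma cv_const0 {θ : ℝ} (hθ : 0 < θ) (c y : ℝ) : cv 0 θ (fun _ => c) y = c := by
  unfold cv
  rw [integral_mul_const, integral_sub_left_eq_self (fun x => GK 0 θ x) volume y, GK0_integral hθ,
    one_mul]

lemma cv_const {j : ℕ} (hj1 : 1 ≤ j) (hj : j ≤ 2) {θ : ℝ} (hθ : 0 < θ) (c y : ℝ) :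
    cv j θ (fun _ => c) y = 0 := by
  have h1 : ∀ y, cv 1 θ (fun _ => c) y = 0 := fun y => by
    have := cv_hasDerivAt_y (j := 0) (by norm_num) hθ (φ := fun _ => c) measurable_const
      (B := |c|) (fun _ => le_rfl) y
    have h2 : cv 0 θ (fun _ => c) = fun _ => c := by funext y; exact cv_const0 hθ c y
    rw [h2] at this
    exact this.unique (hasDerivAt_const y c)
  have h2 : cv 2 θ (fun _ => c) y = 0 := by
    have := cv_hasDerivAt_y (j := 1) (by norm_num) hθ (φ := fun _ => c) measurable_const
      (B := |c|) (fun _ => le_rfl) y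
    have h2 : cv 1 θ (fun _ => c) = fun _ => 0 := by funext y; exact h1 y
    rw [h2] at this
    exact this.unique (hasDerivAt_const y 0)
  interval_cases j
  · exact h1 y
  · exact h2

lemma cv_sub {j : ℕ} (hj : j ≤ 3) {θ : ℝ} (hθ : 0 < θ) {φ ψ : ℝ → ℝ} (hm : Measurable φ)
    (hm' : Measurable ψ) {B B' : ℝ} (hB : ∀ ξ, |φ ξ| ≤ B) (hB' : ∀ ξ, |ψ ξ| ≤ B') (y : ℝ) :
    cv j θ (fun ξ => φ ξ - ψ ξ) y = cv j θ φ y - cv j θ ψ y := by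
  unfold cv
  rw [← integral_sub (cv_integrable hj hθ hm hB y) (cv_integrable hj hθ hm' hB' y)]
  congr 1; funext ξ; ring

lemma cv2_holder {a : ℝ} (ha0 : 0 ≤ a) (ha1 : a ≤ 1) {θ : ℝ} (hθ : 0 < θ)
    {φ : ℝ → ℝ} (hm : Measurable φ) {B : ℝ} (hB : ∀ ξ, |φ ξ| ≤ B) {H : ℝ} {y : ℝ}
    (hH : ∀ ξ, |φ ξ - φ y| ≤ H * |ξ - y| ^ a) :
    |cv 2 θ φ y| ≤ 400 * H * θ ^ ((a - 2) / 2) := by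
  have h1 := cv_weighted (j := 2) (by norm_num) ha0 ha1 hθ (φ := fun ξ => φ ξ - φ y) hH
  rw [cv_sub (by norm_num) hθ hm measurable_const hB (fun _ => le_rfl),
    cv_const (by norm_num) le_rfl hθ, sub_zero] at h1
  exact_mod_cast h1

lemma cv0_approx {a : ℝ} (ha0 : 0 ≤ a) (ha1 : a ≤ 1) {θ : ℝ} (hθ : 0 < θ)
    {φ : ℝ → ℝ} (hm : Measurable φ) {B : ℝ} (hB : ∀ ξ, |φ ξ| ≤ B) {H : ℝ} {y : ℝ}
    (hH : ∀ ξ, |φ ξ - φ y| ≤ H * |ξ - y| ^ a) :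
    |cv 0 θ φ y - φ y| ≤ 400 * H * θ ^ (a / 2) := by
  have h1 := cv_weighted (j := 0) (by norm_num) ha0 ha1 hθ (φ := fun ξ => φ ξ - φ y) hH
  rw [cv_sub (by norm_num) hθ hm measurable_const hB (fun _ => le_rfl), cv_const0 hθ] at h1
  simpa using h1

lemma cv_eq_shift (j : ℕ) (θ : ℝ) (φ : ℝ → ℝ) (y : ℝ) :
    cv j θ φ y = ∫ η, GK j θ η * φ (y - η) := by
  unfold cv
  rw [← integral_sub_left_eq_self (fun η => GK j θ η * φ (y - η)) volume y]
  simp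

/-- Continuity of convolutions with respect to parameters. -/
lemma cv_continuousAt {X : Type*} [TopologicalSpace X] [FirstCountableTopology X]
    {j : ℕ} (hj : j ≤ 3) {x₀ : X} {θ y : X → ℝ} {φ : X → ℝ → ℝ} {B : ℝ}
    (hθ : ContinuousAt θ x₀) (hθ0 : 0 < θ x₀) (hm : ∀ x, Measurable (φ x))
    (hB : ∀ᶠ x in 𝓝 x₀, ∀ ξ, |φ x ξ| ≤ B)
    (hc : ∀ᵐ η, ContinuousAt (fun x => φ x (y x - η)) x₀) :
    ContinuousAt (fun x => cv j (θ x) (φ x) (y x)) x₀ := by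
  simp_rw [cv_eq_shift]
  have hev : ∀ᶠ x in 𝓝 x₀, θ x ∈ Ioo (θ x₀ / 2) (2 * θ x₀) :=
    hθ.eventually (Ioo_mem_nhds (by linarith) (by linarith))
  refine continuousAt_of_dominated (bound := fun η => domG (θ x₀ / 2) (2 * θ x₀) η * B) ?_ ?_ ?_ ?_
  · exact Eventually.of_forall fun x => ((GK_measurable2 j (θ x)).mul
      ((hm x).comp (measurable_const.sub measurable_id))).aestronglyMeasurable
  · filter_upwards [hev, hB] with x hx hBx
    refine Eventually.of_forall fun η => ?_
    rw [Real.norm_eq_abs, abs_mul]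
    have : |GK j (θ x) η| ≤ domG (θ x₀ / 2) (2 * θ x₀) η :=
      GK_dom hj (by linarith) hx.1.le hx.2.le (by simp)
    exact mul_le_mul this (hBx _) (abs_nonneg _) ((abs_nonneg _).trans this)
  · exact (domG_integrable (by linarith)).mul_const B
  · filter_upwards [hc] with η hη
    refine ContinuousAt.mul ?_ hη
    exact ContinuousAt.comp (f := fun x => (θ x, η)) (g := fun q : ℝ × ℝ => GK j q.1 q.2)
      (GK_continuousAt j hj hθ0) (hθ.prodMk continuousAt_const)

/-- Integration by parts: if `Ψ` has right derivative `φ`. -/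
lemma cv_parts {θ : ℝ} (hθ : 0 < θ) {φ Ψ : ℝ → ℝ} (hm : Measurable φ) {B B' : ℝ}
    (hB : ∀ ξ, |φ ξ| ≤ B) (hΨ : Continuous Ψ) (hB' : ∀ ξ, |Ψ ξ| ≤ B')
    (hd : ∀ ξ, HasDerivWithinAt Ψ (φ ξ) (Ioi ξ) ξ) (y : ℝ) : cv 1 θ φ y = cv 2 θ Ψ y := by
  have hB0 : 0 ≤ B' := (abs_nonneg _).trans (hB' 0)
  have hI1 := cv_integrable (j := 1) (by norm_num) hθ hm hB y
  have hI2 := cv_integrable (j := 2) (by norm_num) hθ hΨ.measurable hB' y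
  set f : ℝ → ℝ := fun ξ => GK 1 θ (y - ξ) * Ψ ξ with hf
  set f' : ℝ → ℝ := fun ξ => GK 1 θ (y - ξ) * φ ξ - GK 2 θ (y - ξ) * Ψ ξ with hf'
  have hIf' : Integrable f' := hI1.sub hI2
  have hGc : Continuous (GK 1 θ) := by
    rw [continuous_iff_continuousAt]; intro x
    exact (GK_hasDerivAt_x (j := 1) (by norm_num) hθ x).continuousAt
  have hder : ∀ ξ, HasDerivWithinAt f (f' ξ) (Ioi ξ) ξ := fun ξ => by
    have h1 : HasDerivAt (fun ξ => GK 1 θ (y - ξ)) (-(GK 2 θ (y - ξ))) ξ := by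
      exact (GK_hasDerivAt_x (j := 1) (by norm_num) hθ (y - ξ)).comp_const_sub y ξ
    have := h1.hasDerivWithinAt.mul (hd ξ)
    refine this.congr_deriv ?_
    simp only [hf']; ring
  have hfc : Continuous f := (hGc.comp (continuous_const.sub continuous_id)).mul hΨ
  have hFTC : ∀ R : ℝ, 0 ≤ R → ∫ ξ in (-R)..R, f' ξ = f R - f (-R) := fun R hR =>
    intervalIntegral.integral_eq_sub_of_hasDeriv_right_of_le (by linarith) hfc.continuousOn
      (fun ξ _ => hder ξ) hIf'.intervalIntegrable
  have hlim1 : Tendsto (fun R : ℝ => ∫ ξ in (-R)..R, f' ξ) atTop (𝓝 (∫ ξ, f' ξ)) :=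
    intervalIntegral_tendsto_integral hIf' tendsto_neg_atTop_atBot tendsto_id
  have hG0 : ∀ x, |GK 1 θ x| * |x| ≤ 400 * θ ^ ((1 - ((1:ℕ):ℝ)) / 2) * (√(4 * Real.pi * (2 * θ)))⁻¹ := fun x => by
    have h1 := GK_bound (j := 1) (by norm_num) (a := 1) zero_le_one le_rfl hθ x
    rw [Real.rpow_one] at h1
    refine h1.trans ?_
    gcongr
    rw [GK0_eq]
    have : Real.exp (-(1 / (4 * (2 * θ))) * x ^ 2) ≤ 1 := by
      rw [Real.exp_le_one_iff]
      have : 0 ≤ 1 / (4 * (2 * θ)) * x ^ 2 := by positivity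
      linarith
    have h3 : 0 ≤ (√(4 * Real.pi * (2 * θ)))⁻¹ := by positivity
    nlinarith
  set C := 400 * θ ^ ((1 - ((1:ℕ):ℝ)) / 2) * (√(4 * Real.pi * (2 * θ)))⁻¹ * B' with hC
  have hC0 : 0 ≤ C := by positivity
  have hfb : ∀ ξ, |y - ξ| * |f ξ| ≤ C := fun ξ => by
    simp only [hf, abs_mul, hC]
    calc |y - ξ| * (|GK 1 θ (y - ξ)| * |Ψ ξ|) = (|GK 1 θ (y - ξ)| * |y - ξ|) * |Ψ ξ| := by ring
      _ ≤ _ := mul_le_mul (hG0 _) (hB' ξ) (abs_nonneg _) (by positivity)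
  have hlim2 : Tendsto (fun R : ℝ => f R - f (-R)) atTop (𝓝 0) := by
    have hz : Tendsto (fun R : ℝ => 2 * C / (R - |y|)) atTop (𝓝 0) :=
      Tendsto.div_atTop tendsto_const_nhds (tendsto_atTop_add_const_right _ _ tendsto_id)
    refine squeeze_zero_norm' ?_ hz
    filter_upwards [eventually_gt_atTop |y|] with R hR
    have hp : 0 < R - |y| := by linarith
    rw [Real.norm_eq_abs, le_div_iff₀ hp]
    have hy := abs_le.1 (le_refl |y|)
    have k1 : R - |y| ≤ |y - R| := by rw [abs_sub_comm]; refine le_trans ?_ (le_abs_self _); linarith [hy.2]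
    have k2 : R - |y| ≤ |y - (-R)| := by refine le_trans ?_ (le_abs_self _); linarith [hy.1]
    have m1 : |f R| * (R - |y|) ≤ C := by
      refine le_trans ?_ (hfb R); rw [mul_comm]; gcongr
    have m2 : |f (-R)| * (R - |y|) ≤ C := by
      refine le_trans ?_ (hfb (-R)); rw [mul_comm]; gcongr
    have := abs_sub (f R) (f (-R))
    nlinarith
  have h0 : ∫ ξ, f' ξ = 0 := by
    refine tendsto_nhds_unique hlim1 (hlim2.congr' ?_)
    filter_upwards [eventually_ge_atTop 0] with R hR
    exact (hFTC R hR).symm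
  rw [hf', integral_sub hI1 hI2, sub_eq_zero] at h0
  exact h0

end FBP

namespace FBP
open MeasureTheory Topology

/-- Index of the nearest even integer. -/
noncomputable def kk (ξ : ℝ) : ℤ := ⌊(ξ + 1) / 2⌋
/-- The fold of the line onto `[0,1]`. -/
noncomputable def tri (ξ : ℝ) : ℝ := |ξ - 2 * kk ξ|
/-- The sign attached to the fold. -/
noncomputable def sg (ξ : ℝ) : ℝ := if 2 * (kk ξ : ℝ) ≤ ξ then 1 else -1

lemma kk_le (ξ : ℝ) : 2 * (kk ξ : ℝ) - 1 ≤ ξ := by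
  have := Int.floor_le ((ξ + 1) / 2); unfold kk; linarith
lemma lt_kk (ξ : ℝ) : ξ < 2 * (kk ξ : ℝ) + 1 := by
  have := Int.lt_floor_add_one ((ξ + 1) / 2); unfold kk; linarith
lemma kk_eq {ξ : ℝ} {k : ℤ} (h1 : 2 * (k : ℝ) - 1 ≤ ξ) (h2 : ξ < 2 * (k : ℝ) + 1) : kk ξ = k := by
  unfold kk; rw [Int.floor_eq_iff]; constructor <;> linarith
lemma tri_nonneg (ξ : ℝ) : 0 ≤ tri ξ := abs_nonneg _
lemma tri_le_one (ξ : ℝ) : tri ξ ≤ 1 := by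
  unfold tri; rw [abs_le]; constructor <;> linarith [kk_le ξ, lt_kk ξ]
lemma tri_mem (ξ : ℝ) : tri ξ ∈ Icc (0:ℝ) 1 := ⟨tri_nonneg ξ, tri_le_one ξ⟩
lemma tri_le (ξ : ℝ) (k : ℤ) : tri ξ ≤ |ξ - 2 * k| := by
  by_cases h : k = kk ξ
  · rw [h, tri]
  · refine (tri_le_one ξ).trans ?_
    rcases lt_or_gt_of_ne h with h | h
    · have : (k:ℝ) + 1 ≤ kk ξ := by exact_mod_cast h
      refine le_trans ?_ (le_abs_self _); linarith [kk_le ξ]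
    · have : (kk ξ:ℝ) + 1 ≤ k := by exact_mod_cast h
      refine le_trans ?_ (neg_le_abs _); linarith [lt_kk ξ]
lemma tri_lip (ξ η : ℝ) : |tri ξ - tri η| ≤ |ξ - η| := by
  have h1 := (tri_le ξ (kk η)).trans (abs_sub_le ξ η (2 * kk η))
  have h2 := (tri_le η (kk ξ)).trans (abs_sub_le η ξ (2 * kk ξ))
  rw [abs_sub_comm η ξ] at h2
  rw [abs_le]; unfold tri at *; constructor <;> linarith
lemma tri_continuous : Continuous tri := by
  refine (LipschitzWith.of_dist_le_mul (K := 1) fun x y => ?_).continuous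
  simpa [Real.dist_eq] using tri_lip x y
lemma tri_of_mem {ξ : ℝ} (h : ξ ∈ Icc (0:ℝ) 1) : tri ξ = ξ := by
  have hle : tri ξ ≤ ξ := by have := tri_le ξ 0; simpa [abs_of_nonneg h.1] using this
  rcases h.2.eq_or_lt with h1 | h1
  · subst h1
    have : kk (1:ℝ) = 1 := kk_eq (by norm_num) (by norm_num)
    rw [tri, this]; norm_num
  · have : kk ξ = 0 := kk_eq (by simp; linarith [h.1]) (by simpa using h1)
    rw [tri, this]; simp [abs_of_nonneg h.1]
lemma tri_sym0 (ξ : ℝ) : tri (-ξ) = tri ξ := by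
  refine le_antisymm ?_ ?_
  · have := tri_le (-ξ) (-(kk ξ)); rw [tri.eq_1 ξ]; refine this.trans_eq ?_; rw [← abs_neg]; push_cast; ring_nf
  · have := tri_le ξ (-(kk (-ξ))); rw [tri.eq_1 (-ξ)]; refine this.trans_eq ?_; rw [← abs_neg]; push_cast; ring_nf
lemma tri_sym1 (ξ : ℝ) : tri (2 - ξ) = tri ξ := by
  refine le_antisymm ?_ ?_
  · have := tri_le (2 - ξ) (1 - (kk ξ)); rw [tri.eq_1 ξ]; refine this.trans_eq ?_; rw [← abs_neg]; push_cast; ring_nf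
  · have := tri_le ξ (1 - (kk (2 - ξ))); rw [tri.eq_1 (2 - ξ)]; refine this.trans_eq ?_; rw [← abs_neg]; push_cast; ring_nf

lemma kk_measurable : Measurable (fun ξ => (kk ξ : ℝ)) := by
  have : Measurable (fun ξ : ℝ => ⌊(ξ + 1) / 2⌋) := (by fun_prop : Measurable fun ξ : ℝ => (ξ + 1) / 2).floor
  exact (measurable_from_top (f := fun k : ℤ => (k : ℝ))).comp this
lemma sg_measurable : Measurable sg := by
  unfold sg
  exact Measurable.ite (measurableSet_le (kk_measurable.const_mul 2) measurable_id)
    measurable_const measurable_const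
lemma sg_abs (ξ : ℝ) : |sg ξ| = 1 := by unfold sg; split_ifs <;> simp
lemma sg_pos {ξ : ℝ} (k : ℤ) (h1 : 2 * (k:ℝ) ≤ ξ) (h2 : ξ < 2 * k + 1) : sg ξ = 1 := by
  have : kk ξ = k := kk_eq (by linarith) h2
  unfold sg; rw [this, if_pos h1]
lemma sg_neg {ξ : ℝ} (k : ℤ) (h1 : 2 * (k:ℝ) - 1 ≤ ξ) (h2 : ξ < 2 * k) : sg ξ = -1 := by
  have : kk ξ = k := kk_eq h1 (by linarith)
  unfold sg; rw [this, if_neg (by linarith)]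
lemma sg_of_mem {ξ : ℝ} (h : ξ ∈ Ico (0:ℝ) 1) : sg ξ = 1 :=
  sg_pos 0 (by simpa using h.1) (by simpa using h.2)

/-- Cases: the fold is affine to the right of each point. -/
lemma fold_cases (ξ : ℝ) : (∃ k : ℤ, 2 * (k:ℝ) ≤ ξ ∧ ξ < 2 * k + 1 ∧ sg ξ = 1 ∧ tri ξ = ξ - 2 * k) ∨
    (∃ k : ℤ, 2 * (k:ℝ) - 1 ≤ ξ ∧ ξ < 2 * k ∧ sg ξ = -1 ∧ tri ξ = 2 * k - ξ) := by
  by_cases h : 2 * (kk ξ : ℝ) ≤ ξ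
  · left
    refine ⟨kk ξ, h, lt_kk ξ, sg_pos _ h (lt_kk ξ), ?_⟩
    rw [tri, abs_of_nonneg (by linarith)]
  · right
    push Not at h
    refine ⟨kk ξ, kk_le ξ, h, sg_neg _ (kk_le ξ) h, ?_⟩
    rw [tri, abs_of_neg (by linarith)]; ring

lemma tri_affine_right (ξ : ℝ) : ∀ᶠ η in 𝓝[>] ξ, tri η = tri ξ + sg ξ * (η - ξ) := by
  rcases fold_cases ξ with ⟨k, h1, h2, h3, h4⟩ | ⟨k, h1, h2, h3, h4⟩
  · filter_upwards [Ioo_mem_nhdsGT h2] with η hη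
    have : kk η = k := kk_eq (by linarith [hη.1]) hη.2
    rw [h3, h4, tri, this, abs_of_nonneg (by linarith [hη.1])]; ring
  · filter_upwards [Ioo_mem_nhdsGT h2] with η hη
    have : kk η = k := kk_eq (by linarith [hη.1]) (by linarith [hη.2])
    rw [h3, h4, tri, this, abs_of_neg (by linarith [hη.2])]; ring

lemma tri_hasDeriv (ξ : ℝ) : HasDerivWithinAt tri (sg ξ) (Ioi ξ) ξ := by
  have h : HasDerivWithinAt (fun η => tri ξ + sg ξ * (η - ξ)) (sg ξ) (Ioi ξ) ξ := by
    have := (((hasDerivAt_id ξ).sub_const ξ).const_mul (sg ξ)).const_add (tri ξ)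
    simpa using this.hasDerivWithinAt
  exact h.congr_of_eventuallyEq (tri_affine_right ξ) (by simp)

lemma comp_tri_hasDeriv {R Q : ℝ → ℝ} (h : ∀ y ∈ Icc (0:ℝ) 1, HasDerivAt R (Q y) y) (ξ : ℝ) :
    HasDerivWithinAt (fun ξ => R (tri ξ)) (sg ξ * Q (tri ξ)) (Ioi ξ) ξ := by
  have := (h _ (tri_mem ξ)).comp_hasDerivWithinAt ξ (tri_hasDeriv ξ)
  rw [mul_comm]; exact this

lemma sg_sym0 {ξ : ℝ} (h : ∀ n : ℤ, ξ ≠ n) : sg (-ξ) = - sg ξ := by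
  rcases fold_cases ξ with ⟨k, h1, h2, h3, -⟩ | ⟨k, h1, h2, h3, -⟩
  · have : 2 * (k:ℝ) < ξ := lt_of_le_of_ne h1 (fun e => h (2 * k) (by push_cast; exact e.symm))
    rw [h3, sg_neg (-k) (by push_cast; linarith) (by push_cast; linarith)]
  · have : 2 * (k:ℝ) - 1 < ξ := lt_of_le_of_ne h1 (fun e => h (2 * k - 1) (by push_cast; exact e.symm))
    rw [h3, sg_pos (-k) (by push_cast; linarith) (by push_cast; linarith)]; norm_num
lemma sg_sym1 {ξ : ℝ} (h : ∀ n : ℤ, ξ ≠ n) : sg (2 - ξ) = - sg ξ := by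
  rcases fold_cases ξ with ⟨k, h1, h2, h3, -⟩ | ⟨k, h1, h2, h3, -⟩
  · have : 2 * (k:ℝ) < ξ := lt_of_le_of_ne h1 (fun e => h (2 * k) (by push_cast; exact e.symm))
    rw [h3, sg_neg (1 - k) (by push_cast; linarith) (by push_cast; linarith)]
  · have : 2 * (k:ℝ) - 1 < ξ := lt_of_le_of_ne h1 (fun e => h (2 * k - 1) (by push_cast; exact e.symm))
    rw [h3, sg_pos (1 - k) (by push_cast; linarith) (by push_cast; linarith)]; norm_num

lemma sg_continuousAt {ξ : ℝ} (h : ∀ n : ℤ, ξ ≠ n) : ContinuousAt sg ξ := by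
  rcases fold_cases ξ with ⟨k, h1, h2, h3, -⟩ | ⟨k, h1, h2, h3, -⟩
  · have h1' : 2 * (k:ℝ) < ξ := lt_of_le_of_ne h1 (fun e => h (2 * k) (by push_cast; exact e.symm))
    have : sg =ᶠ[𝓝 ξ] fun _ => 1 := by
      filter_upwards [Ioo_mem_nhds h1' h2] with η hη using sg_pos k hη.1.le hη.2
    exact continuousAt_const.congr this.symm
  · have h1' : 2 * (k:ℝ) - 1 < ξ := lt_of_le_of_ne h1 (fun e => h (2 * k - 1) (by push_cast; exact e.symm))
    have : sg =ᶠ[𝓝 ξ] fun _ => -1 := by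
      filter_upwards [Ioo_mem_nhds h1' h2] with η hη using sg_neg k hη.1.le hη.2
    exact continuousAt_const.congr this.symm

lemma ae_not_int (y : ℝ) : ∀ᵐ η : ℝ, ∀ n : ℤ, y - η ≠ n := by
  have : (⋃ n : ℤ, {y - (n:ℝ)}).Countable := countable_iUnion fun n => countable_singleton _
  filter_upwards [this.ae_notMem volume] with η hη n hn
  exact hη (mem_iUnion.2 ⟨n, by simp [← hn]⟩)

/-- The convolution of an odd function with an even kernel vanishes at the center. -/
lemma cv_odd {j : ℕ} (hj : j = 0 ∨ j = 2) {θ : ℝ} {φ : ℝ → ℝ} {c : ℝ}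
    (ho : ∀ᵐ ξ, φ (2 * c - ξ) = - φ ξ) : cv j θ φ c = 0 := by
  have h1 : cv j θ φ c = ∫ ξ, GK j θ (c - (2 * c - ξ)) * φ (2 * c - ξ) :=
    (integral_sub_left_eq_self (fun ξ => GK j θ (c - ξ) * φ ξ) volume (2 * c)).symm
  have h2 : (∫ ξ, GK j θ (c - (2 * c - ξ)) * φ (2 * c - ξ)) = ∫ ξ, -(GK j θ (c - ξ) * φ ξ) := by
    refine integral_congr_ae ?_
    filter_upwards [ho] with ξ hξ
    have e : GK j θ (c - (2 * c - ξ)) = GK j θ (c - ξ) := by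
      rw [show c - (2 * c - ξ) = -(c - ξ) by ring]
      rcases hj with rfl | rfl <;> simp [GK, PK, -neg_sub]
    rw [e, hξ]; ring
  rw [h2, integral_neg] at h1
  change _ = - cv j θ φ c at h1
  linarith

lemma ae_not_int' : ∀ᵐ η : ℝ, ∀ n : ℤ, η ≠ n := by
  have : (range (fun n : ℤ => (n:ℝ))).Countable := countable_range _
  filter_upwards [this.ae_notMem volume] with η hη n hn
  exact hη ⟨n, hn.symm⟩

lemma cv_fold0 {j : ℕ} (hj : j = 0 ∨ j = 2) {θ : ℝ} (N : ℝ → ℝ) :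
    cv j θ (fun ξ => sg ξ * N (tri ξ)) 0 = 0 := by
  refine cv_odd hj ?_
  filter_upwards [ae_not_int'] with ξ hξ
  simp only [mul_zero, zero_sub]
  rw [sg_sym0 hξ, tri_sym0]; ring
lemma cv_fold1 {j : ℕ} (hj : j = 0 ∨ j = 2) {θ : ℝ} (N : ℝ → ℝ) :
    cv j θ (fun ξ => sg ξ * N (tri ξ)) 1 = 0 := by
  refine cv_odd hj ?_
  filter_upwards [ae_not_int'] with ξ hξ
  simp only [mul_one]
  rw [sg_sym1 hξ, tri_sym1]; ring

end FBP

namespace FBP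
open MeasureTheory Topology

/-- Kernel data: a time change and a bounded source, continuous off the integers. -/
structure KD (T c C B : ℝ) (θ : ℝ → ℝ) (N : ℝ → ℝ → ℝ) : Prop where
  hT : 0 < T
  hc : 0 < c
  hC : 0 < C
  θc : Continuous θ
  lo : ∀ s t, 0 ≤ s → s ≤ t → t ≤ T → c * (t - s) ≤ θ t - θ s
  hi : ∀ s t, 0 ≤ s → s ≤ t → t ≤ T → θ t - θ s ≤ C * (t - s)
  Nm : ∀ s, Measurable (N s)
  Nb : ∀ s ξ, |N s ξ| ≤ B
  Nc : ∀ (s ξ : ℝ), (∀ n : ℤ, ξ ≠ n) → ContinuousAt (fun q : ℝ × ℝ => N q.1 q.2) (s, ξ)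

/-- Duhamel integral. -/
noncomputable def duh (j : ℕ) (θ : ℝ → ℝ) (N : ℝ → ℝ → ℝ) (t y : ℝ) : ℝ :=
  ∫ s in (0:ℝ)..t, cv j (θ t - θ s) (N s) y

lemma rpow_int {γ : ℝ} (hγ : 0 < γ) (a t : ℝ) :
    IntervalIntegrable (fun s => (t - s) ^ (γ - 1)) volume a t := by
  have := (intervalIntegral.intervalIntegrable_rpow' (a := t - a) (b := t - t) (r := γ - 1)
    (by linarith)).comp_sub_left t
  simpa using this

lemma rpow_int_val {γ : ℝ} (hγ : 0 < γ) (a t : ℝ) :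
    ∫ s in a..t, (t - s) ^ (γ - 1) = (t - a) ^ γ / γ := by
  rw [intervalIntegral.integral_comp_sub_left (fun s => s ^ (γ - 1)) t, integral_rpow (Or.inl (by linarith))]
  simp [Real.zero_rpow hγ.ne']

namespace KD
variable {T c C B : ℝ} {θ : ℝ → ℝ} {N : ℝ → ℝ → ℝ}

lemma pos (h : KD T c C B θ N) {s t : ℝ} (hs : 0 ≤ s) (hst : s < t) (ht : t ≤ T) : 0 < θ t - θ s :=
  lt_of_lt_of_le (mul_pos h.hc (sub_pos.2 hst)) (h.lo s t hs hst.le ht)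

lemma B0 (h : KD T c C B θ N) : 0 ≤ B := (abs_nonneg _).trans (h.Nb 0 0)

lemma cont3 (h : KD T c C B θ N) {j : ℕ} (hj : j ≤ 3) {X : Type*} [TopologicalSpace X]
    [FirstCountableTopology X] {x₀ : X} {t s y : X → ℝ} (ht : ContinuousAt t x₀)
    (hs : ContinuousAt s x₀) (hy : ContinuousAt y x₀) (hp : 0 < θ (t x₀) - θ (s x₀)) :
    ContinuousAt (fun x => cv j (θ (t x) - θ (s x)) (N (s x)) (y x)) x₀ := by
  refine cv_continuousAt (θ := fun x => θ (t x) - θ (s x)) (φ := fun x => N (s x)) hj (B := B) ?_ hp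
    (fun x => h.Nm _) (Eventually.of_forall fun x ξ => h.Nb _ _) ?_
  · exact (h.θc.continuousAt.comp ht).sub (h.θc.continuousAt.comp hs)
  · filter_upwards [ae_not_int (y x₀)] with η hη
    exact ContinuousAt.comp (f := fun x => (s x, y x - η)) (g := fun q : ℝ × ℝ => N q.1 q.2)
      (h.Nc _ _ hη) (hs.prodMk (hy.sub continuousAt_const))

lemma contOn_s (h : KD T c C B θ N) {j : ℕ} (hj : j ≤ 3) {t : ℝ} (ht : t ≤ T) (y : ℝ) :
    ContinuousOn (fun s => cv j (θ t - θ s) (N s) y) (Ico 0 t) := fun s hs =>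
  (h.cont3 hj (t := fun _ => t) (s := fun s => s) (y := fun _ => y) continuousAt_const
    continuousAt_id continuousAt_const (h.pos hs.1 hs.2 ht)).continuousWithinAt

lemma meas_s (h : KD T c C B θ N) {j : ℕ} (hj : j ≤ 3) {t : ℝ} (ht0 : 0 ≤ t) (ht : t ≤ T) (y : ℝ) :
    AEStronglyMeasurable (fun s => cv j (θ t - θ s) (N s) y) (volume.restrict (uIoc 0 t)) := by
  rw [uIoc_of_le ht0]
  have := (h.contOn_s hj ht y).aestronglyMeasurable (μ := volume) measurableSet_Ico
  rw [restrict_Ico_eq_restrict_Ioc] at this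
  exact this

lemma int_s (h : KD T c C B θ N) {j : ℕ} (hj : j ≤ 3) {t : ℝ} (ht0 : 0 ≤ t) (ht : t ≤ T) {y K γ : ℝ}
    (hγ : 0 < γ) (hb : ∀ s, 0 ≤ s → s < t → |cv j (θ t - θ s) (N s) y| ≤ K * (t - s) ^ (γ - 1)) :
    IntervalIntegrable (fun s => cv j (θ t - θ s) (N s) y) volume 0 t := by
  refine ((rpow_int hγ 0 t).const_mul K).mono_fun' (h.meas_s hj ht0 ht y) ?_
  rw [uIoc_of_le ht0, ← restrict_Ioo_eq_restrict_Ioc]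
  refine (ae_restrict_iff' measurableSet_Ioo).2 (Eventually.of_forall fun s hs => ?_)
  exact hb s hs.1.le hs.2

lemma duh_bound {j : ℕ} {t : ℝ} (ht0 : 0 ≤ t) {y K γ : ℝ}
    (hγ : 0 < γ) (hb : ∀ s, 0 ≤ s → s < t → |cv j (θ t - θ s) (N s) y| ≤ K * (t - s) ^ (γ - 1)) :
    |duh j θ N t y| ≤ K * (t ^ γ / γ) := by
  have h1 : ‖∫ s in (0:ℝ)..t, cv j (θ t - θ s) (N s) y‖ ≤ ∫ s in (0:ℝ)..t, K * (t - s) ^ (γ - 1) := by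
    refine intervalIntegral.norm_integral_le_of_norm_le ht0 ?_ ((rpow_int hγ 0 t).const_mul K)
    have : ∀ᵐ s : ℝ, s ≠ t := (countable_singleton t).ae_notMem volume
    filter_upwards [this] with s hs hs'
    exact hb s hs'.1.le (lt_of_le_of_ne hs'.2 hs)
  rw [intervalIntegral.integral_const_mul, rpow_int_val hγ] at h1
  rw [duh]; simpa using h1

lemma duh_cont (h : KD T c C B θ N) {j : ℕ} (hj : j ≤ 3) {U : Set ℝ} {K γ : ℝ}
    (hγ : 0 < γ) (hb : ∀ s t y, 0 ≤ s → s < t → t ≤ T → y ∈ U →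
      |cv j (θ t - θ s) (N s) y| ≤ K * (t - s) ^ (γ - 1)) :
    ContinuousOn (fun q : ℝ × ℝ => duh j θ N q.1 q.2) (Icc 0 T ×ˢ U) := by
  rcases U.eq_empty_or_nonempty with rfl | ⟨y1, hy1⟩
  · simp
  have hK : 0 ≤ K := by
    have := hb 0 T y1 le_rfl h.hT le_rfl hy1
    have h2 : 0 < (T - 0) ^ (γ - 1) := Real.rpow_pos_of_pos (by linarith [h.hT]) _
    by_contra hK
    push Not at hK
    linarith [abs_nonneg (cv j (θ T - θ 0) (N 0) y1), mul_neg_of_neg_of_pos hK h2]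
  have hsub : ∀ t y, duh j θ N t y = ∫ σ in (0:ℝ)..1, t * cv j (θ t - θ (t * σ)) (N (t * σ)) y := by
    intro t y
    have := intervalIntegral.mul_integral_comp_mul_left (a := 0) (b := 1)
      (f := fun s => cv j (θ t - θ s) (N s) y) t
    rw [intervalIntegral.integral_const_mul, this]; simp [duh]
  simp_rw [hsub]
  rintro ⟨t0, y0⟩ ⟨ht0, hy0⟩
  simp only at ht0 hy0
  have hbb : ∀ t ∈ Icc 0 T, ∀ y ∈ U, ∀ σ, 0 < σ → σ < 1 →
      |t * cv j (θ t - θ (t * σ)) (N (t * σ)) y| ≤ K * (t ^ γ * (1 - σ) ^ (γ - 1)) := by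
    intro t ht y hy σ hσ0 hσ1
    rcases ht.1.eq_or_lt with rfl | htp
    · simp only [zero_mul, abs_zero]
      have : 0 ≤ (1 - σ) ^ (γ - 1) := Real.rpow_nonneg (by linarith) _
      have := Real.rpow_nonneg le_rfl (x := 0) γ
      positivity
    · have h1 := hb (t * σ) t y (by positivity) (by nlinarith) ht.2 hy
      rw [abs_mul, abs_of_pos htp]
      calc t * _ ≤ t * (K * (t - t * σ) ^ (γ - 1)) := by gcongr
        _ = K * (t ^ γ * (1 - σ) ^ (γ - 1)) := by
          rw [show t - t * σ = t * (1 - σ) by ring, Real.mul_rpow htp.le (by linarith),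
            Real.rpow_sub_one htp.ne']
          field_simp
  have hne : ∀ᵐ σ : ℝ, σ ≠ 1 := (countable_singleton (1:ℝ)).ae_notMem volume
  refine intervalIntegral.continuousWithinAt_of_dominated_interval
    (bound := fun σ => K * (T ^ γ * (1 - σ) ^ (γ - 1))) ?_ ?_ ?_ ?_
  · filter_upwards [self_mem_nhdsWithin] with q hq
    have h0 : ContinuousOn (fun σ => q.1 * cv j (θ q.1 - θ (q.1 * σ)) (N (q.1 * σ)) q.2) (Ico 0 1) := by
      rcases hq.1.1.eq_or_lt with h0 | htp
      · rw [← h0]; simp only [zero_mul]; exact continuousOn_const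
      · intro σ hσ
        refine ContinuousAt.continuousWithinAt (ContinuousAt.mul continuousAt_const ?_)
        refine h.cont3 hj (t := fun _ => q.1) (s := fun σ => q.1 * σ) (y := fun _ => q.2)
          continuousAt_const (by fun_prop) continuousAt_const ?_
        exact h.pos (mul_nonneg htp.le hσ.1) (by nlinarith [hσ.2]) hq.1.2
    have := h0.aestronglyMeasurable (μ := volume) measurableSet_Ico
    rw [restrict_Ico_eq_restrict_Ioc] at this
    rwa [uIoc_of_le zero_le_one]
  · filter_upwards [self_mem_nhdsWithin] with q hq
    filter_upwards [hne] with σ hσ1 hσ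
    rw [uIoc_of_le zero_le_one] at hσ
    have hσ' := lt_of_le_of_ne hσ.2 hσ1
    refine (hbb q.1 hq.1 q.2 hq.2 σ hσ.1 hσ').trans ?_
    have : 0 ≤ (1 - σ) ^ (γ - 1) := Real.rpow_nonneg (by linarith) _
    have := Real.rpow_le_rpow hq.1.1 hq.1.2 hγ.le
    gcongr
  · exact ((rpow_int hγ 0 1).const_mul _).const_mul _
  · filter_upwards [hne] with σ hσ1 hσ
    rw [uIoc_of_le zero_le_one] at hσ
    have hσ' := lt_of_le_of_ne hσ.2 hσ1
    rcases ht0.1.eq_or_lt with h0 | htp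
    · subst h0
      have hz : Tendsto (fun q : ℝ × ℝ => K * (q.1 ^ γ * (1 - σ) ^ (γ - 1)))
          (𝓝[Icc 0 T ×ˢ U] ((0:ℝ), y0)) (𝓝 0) := by
        have h1 : ContinuousAt (fun q : ℝ × ℝ => K * (q.1 ^ γ * (1 - σ) ^ (γ - 1))) ((0:ℝ), y0) := by
          refine continuousAt_const.mul (ContinuousAt.mul ?_ continuousAt_const)
          exact ContinuousAt.rpow_const continuousAt_fst (Or.inr hγ.le)
        have h2 := h1.tendsto
        simp only [Real.zero_rpow hγ.ne', zero_mul, mul_zero] at h2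
        exact h2.mono_left nhdsWithin_le_nhds
      rw [ContinuousWithinAt]
      simp only [zero_mul]
      refine squeeze_zero_norm' ?_ hz
      filter_upwards [self_mem_nhdsWithin] with q hq
      exact hbb q.1 hq.1 q.2 hq.2 σ hσ.1 hσ'
    · refine ContinuousAt.continuousWithinAt (ContinuousAt.mul continuousAt_fst ?_)
      refine h.cont3 hj (t := fun q : ℝ × ℝ => q.1) (s := fun q => q.1 * σ) (y := fun q => q.2)
        continuousAt_fst (continuousAt_fst.mul continuousAt_const) continuousAt_snd ?_
      exact h.pos (mul_nonneg htp.le hσ.1.le) (by nlinarith) ht0.2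

/-- Differentiation of the Duhamel integral in space. -/
lemma duh_hasDerivAt_y (h : KD T c C B θ N) {j : ℕ} (hj : j ≤ 2) {U : Set ℝ} (hU : IsOpen U) {K K' γ γ' : ℝ}
    (hγ : 0 < γ) (hγ' : 0 < γ') {t : ℝ} (ht0 : 0 ≤ t) (htT : t ≤ T)
    (hb : ∀ s y, 0 ≤ s → s < t → y ∈ U →
      |cv j (θ t - θ s) (N s) y| ≤ K * (t - s) ^ (γ - 1))
    (hb' : ∀ s y, 0 ≤ s → s < t → y ∈ U →
      |cv (j + 1) (θ t - θ s) (N s) y| ≤ K' * (t - s) ^ (γ' - 1)) {y : ℝ} (hy : y ∈ U) :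
    HasDerivAt (duh j θ N t) (duh (j + 1) θ N t y) y := by
  have hne : ∀ᵐ σ : ℝ, σ ≠ t := (countable_singleton t).ae_notMem volume
  refine (intervalIntegral.hasDerivAt_integral_of_dominated_loc_of_deriv_le
    (bound := fun s => K' * (t - s) ^ (γ' - 1)) (F := fun y s => cv j (θ t - θ s) (N s) y)
    (F' := fun y s => cv (j + 1) (θ t - θ s) (N s) y) (hU.mem_nhds hy) ?_ ?_ ?_ ?_ ?_ ?_).2
  · exact Eventually.of_forall fun y => h.meas_s (by lia) ht0 htT y
  · exact h.int_s (by lia) ht0 htT hγ (fun s h1 h2 => hb s y h1 h2 hy)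
  · exact h.meas_s (by lia) ht0 htT y
  · filter_upwards [hne] with s hs1 hs y hy
    rw [uIoc_of_le ht0] at hs
    exact hb' s y hs.1.le (lt_of_le_of_ne hs.2 hs1) hy
  · exact (rpow_int hγ' 0 t).const_mul _
  · filter_upwards [hne] with s hs1 hs y hy
    rw [uIoc_of_le ht0] at hs
    exact cv_hasDerivAt_y hj (h.pos hs.1.le (lt_of_le_of_ne hs.2 hs1) htT) (h.Nm s) (h.Nb s) y

lemma bd0 (h : KD T c C B θ N) {s t : ℝ} (hs : 0 ≤ s) (hst : s < t) (ht : t ≤ T) (y : ℝ) :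
    |cv 0 (θ t - θ s) (N s) y| ≤ 400 * B * (t - s) ^ ((1:ℝ) - 1) := by
  have := cv_bound (j := 0) (by norm_num) (h.pos hs hst ht) (h.Nb s) y
  simpa using this

lemma bd1 (h : KD T c C B θ N) {s t : ℝ} (hs : 0 ≤ s) (hst : s < t) (ht : t ≤ T) {b : ℝ}
    (hb : ∀ ξ, |N s ξ| ≤ b) (y : ℝ) :
    |cv 1 (θ t - θ s) (N s) y| ≤ 400 * b * c ^ (-(1:ℝ) / 2) * (t - s) ^ ((1:ℝ) / 2 - 1) := by
  have h1 := cv_bound (j := 1) (by norm_num) (h.pos hs hst ht) hb y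
  refine h1.trans ?_
  have hb0 : 0 ≤ b := (abs_nonneg _).trans (hb 0)
  rw [mul_assoc, mul_assoc, mul_assoc]
  rw [show (1:ℝ) / 2 - 1 = -(1:ℝ) / 2 by norm_num, ← Real.mul_rpow h.hc.le (by linarith)]
  have := Real.rpow_le_rpow_of_nonpos (mul_pos h.hc (sub_pos.2 hst)) (h.lo s t hs hst.le ht)
    (z := -((1:ℕ):ℝ) / 2) (by norm_num)
  simp only [Nat.cast_one] at this ⊢
  gcongr

lemma bd2 (h : KD T c C B θ N) {s t : ℝ} (hs : 0 ≤ s) (hst : s < t) (ht : t ≤ T) {a H y : ℝ}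
    (ha0 : 0 ≤ a) (ha1 : a ≤ 1) (hH : ∀ ξ, |N s ξ - N s y| ≤ H * |ξ - y| ^ a) :
    |cv 2 (θ t - θ s) (N s) y| ≤ 400 * H * c ^ (a / 2 - 1) * (t - s) ^ (a / 2 - 1) := by
  have h1 := cv2_holder ha0 ha1 (h.pos hs hst ht) (h.Nm s) (h.Nb s) hH
  refine h1.trans ?_
  have hb0 : 0 ≤ H := by
    have := hH (y + 1); simp at this; exact (abs_nonneg _).trans this
  rw [mul_assoc, mul_assoc, mul_assoc]
  rw [← Real.mul_rpow h.hc.le (by linarith)]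
  have := Real.rpow_le_rpow_of_nonpos (mul_pos h.hc (sub_pos.2 hst)) (h.lo s t hs hst.le ht)
    (z := (a - 2) / 2) (by linarith)
  rw [show a / 2 - 1 = (a - 2) / 2 by ring]
  gcongr

end KD
end FBP

namespace FBP
open MeasureTheory Topology

lemma abs_rpow_int {γ : ℝ} (hγ : 0 < γ) (s a b : ℝ) :
    IntervalIntegrable (fun r => |r - s| ^ (γ - 1)) volume a b := by
  have h1 : ∀ c, IntervalIntegrable (fun r => |r - s| ^ (γ - 1)) volume s c := by
    intro c
    rcases le_total s c with hsc | hsc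
    · have h0 := (intervalIntegral.intervalIntegrable_rpow' (a := s - s) (b := c - s) (r := γ - 1)
        (by linarith)).comp_sub_right s
      simp only [sub_add_cancel] at h0
      refine h0.congr ?_
      intro r hr
      rw [uIoc_of_le hsc] at hr
      simp only; rw [abs_of_nonneg (by linarith [hr.1])]
    · have h0 := (rpow_int hγ c s).symm
      refine h0.congr ?_
      intro r hr
      rw [uIoc_comm, uIoc_of_le hsc] at hr
      simp only; rw [abs_of_nonpos (by linarith [hr.2])]; ring_nf
  exact (h1 a).symm.trans (h1 b)

lemma abs_rpow_int_le {γ : ℝ} (hγ : 0 < γ) {s t : ℝ} (hs0 : 0 ≤ s) (hst : s ≤ t) :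
    ∫ r in (0:ℝ)..t, |r - s| ^ (γ - 1) ≤ 2 * (t ^ γ / γ) := by
  rw [← intervalIntegral.integral_add_adjacent_intervals (abs_rpow_int hγ s 0 s) (abs_rpow_int hγ s s t)]
  have e1 : ∫ r in (0:ℝ)..s, |r - s| ^ (γ - 1) = s ^ γ / γ := by
    have := rpow_int_val hγ 0 s
    rw [sub_zero] at this
    rw [← this]
    refine intervalIntegral.integral_congr fun r hr => ?_
    rw [uIcc_of_le hs0] at hr
    rw [abs_of_nonpos (by linarith [hr.2])]; ring_nf
  have e2 : ∫ r in s..t, |r - s| ^ (γ - 1) = (t - s) ^ γ / γ := by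
    have : ∫ r in s..t, |r - s| ^ (γ - 1) = ∫ r in s..t, (r - s) ^ (γ - 1) := by
      refine intervalIntegral.integral_congr fun r hr => ?_
      rw [uIcc_of_le hst] at hr
      rw [abs_of_nonneg (by linarith [hr.1])]
    rw [this, intervalIntegral.integral_comp_sub_right (fun r => r ^ (γ - 1)) s,
      integral_rpow (Or.inl (by linarith))]
    simp [Real.zero_rpow hγ.ne']
  rw [e1, e2]
  have := Real.rpow_le_rpow hs0 hst hγ.le
  have h3 := Real.rpow_le_rpow (by linarith : 0 ≤ t - s) (by linarith : t - s ≤ t) hγ.le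
  rw [← add_div, ← mul_div_assoc]
  gcongr; linarith

/-- Fubini on a triangle with a weakly singular integrand. -/
lemma triangle_swap {t γ K : ℝ} (ht : 0 ≤ t) (hγ : 0 < γ) (hK : 0 ≤ K) {g : ℝ → ℝ → ℝ}
    (hg : ContinuousOn (fun q : ℝ × ℝ => g q.1 q.2) {q | 0 < q.1 ∧ q.1 < q.2 ∧ q.2 ≤ t})
    (hb : ∀ s r, 0 < s → s < r → r ≤ t → |g s r| ≤ K * (r - s) ^ (γ - 1)) :
    ∫ s in (0:ℝ)..t, ∫ r in s..t, g s r = ∫ r in (0:ℝ)..t, ∫ s in (0:ℝ)..r, g s r := by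
  set S : Set (ℝ × ℝ) := {q | 0 < q.1 ∧ q.1 < q.2 ∧ q.2 ≤ t} with hS
  have hSm : MeasurableSet S := by
    refine (measurableSet_lt measurable_const measurable_fst).inter
      ((measurableSet_lt measurable_fst measurable_snd).inter
        (measurableSet_le measurable_snd measurable_const))
  set f : ℝ × ℝ → ℝ := S.indicator (fun q => g q.1 q.2) with hf
  set μ : Measure ℝ := volume.restrict (Ioc 0 t) with hμ
  have hμf : IsFiniteMeasure μ := by rw [hμ]; infer_instance
  have hfm : AEStronglyMeasurable f (μ.prod μ) := by
    have h1 := hg.aestronglyMeasurable (μ := (volume : Measure (ℝ × ℝ))) hSm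
    rw [← aestronglyMeasurable_indicator_iff hSm] at h1
    have : μ.prod μ = (volume : Measure (ℝ × ℝ)).restrict (Ioc 0 t ×ˢ Ioc 0 t) := by
      rw [hμ, Measure.prod_restrict]; rfl
    rw [this]; exact h1.mono_measure Measure.restrict_le_self
  have hdm : Measurable (fun q : ℝ × ℝ => K * |q.2 - q.1| ^ (γ - 1)) := by fun_prop
  have hdi : Integrable (fun q : ℝ × ℝ => K * |q.2 - q.1| ^ (γ - 1)) (μ.prod μ) := by
    rw [integrable_prod_iff hdm.aestronglyMeasurable]
    have hint : ∀ s, Integrable (fun r => K * |r - s| ^ (γ - 1)) μ := fun s => by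
      have := (abs_rpow_int hγ s 0 t).const_mul K
      rwa [intervalIntegrable_iff_integrableOn_Ioc_of_le ht] at this
    refine ⟨Eventually.of_forall fun s => hint s, ?_⟩
    refine Integrable.mono' (integrable_const (K * (2 * (t ^ γ / γ))))
      hdm.norm.stronglyMeasurable.integral_prod_right'.aestronglyMeasurable ?_
    refine (ae_restrict_iff' measurableSet_Ioc).2 (Eventually.of_forall fun s hs => ?_)
    have e : ∀ r, ‖K * |r - s| ^ (γ - 1)‖ = K * |r - s| ^ (γ - 1) := fun r =>
      Real.norm_of_nonneg (mul_nonneg hK (Real.rpow_nonneg (abs_nonneg _) _))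
    simp only [e]
    rw [integral_const_mul, ← intervalIntegral.integral_of_le ht]
    have h2 : 0 ≤ ∫ r in (0:ℝ)..t, |r - s| ^ (γ - 1) :=
      intervalIntegral.integral_nonneg ht fun r _ => Real.rpow_nonneg (abs_nonneg _) _
    rw [Real.norm_of_nonneg (mul_nonneg hK h2)]
    exact mul_le_mul_of_nonneg_left (abs_rpow_int_le hγ hs.1.le hs.2) hK
  have hfi : Integrable f (μ.prod μ) := by
    refine hdi.mono' hfm (Eventually.of_forall fun q => ?_)
    by_cases hq : q ∈ S
    · rw [hf, indicator_of_mem hq, Real.norm_eq_abs]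
      have := hb q.1 q.2 hq.1 hq.2.1 hq.2.2
      rwa [abs_of_pos (by linarith [hq.2.1] : 0 < q.2 - q.1)]
    · rw [hf, indicator_of_notMem hq, norm_zero]
      exact mul_nonneg hK (Real.rpow_nonneg (abs_nonneg _) _)
  have hsw := integral_integral_swap (f := fun s r => f (s, r)) (μ := μ) (ν := μ) hfi
  have hL : ∫ s, ∫ r, f (s, r) ∂μ ∂μ = ∫ s in (0:ℝ)..t, ∫ r in s..t, g s r := by
    rw [intervalIntegral.integral_of_le ht]
    refine setIntegral_congr_fun measurableSet_Ioc fun s hs => ?_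
    rw [intervalIntegral.integral_of_le hs.2]
    have : ∀ r ∈ Ioc 0 t, f (s, r) = (Ioc s t).indicator (g s) r := by
      intro r hr
      by_cases hr2 : s < r
      · rw [indicator_of_mem (show r ∈ Ioc s t from ⟨hr2, hr.2⟩), hf, indicator_of_mem]
        exact ⟨hs.1, hr2, hr.2⟩
      · rw [indicator_of_notMem (fun hh => hr2 hh.1), hf, indicator_of_notMem]
        exact fun hh => hr2 hh.2.1
    rw [hμ, setIntegral_congr_fun measurableSet_Ioc this, setIntegral_indicator measurableSet_Ioc]
    congr 2
    rw [inter_eq_right]; exact Ioc_subset_Ioc_left hs.1.le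
  have hR : ∫ r, ∫ s, f (s, r) ∂μ ∂μ = ∫ r in (0:ℝ)..t, ∫ s in (0:ℝ)..r, g s r := by
    rw [intervalIntegral.integral_of_le ht]
    refine setIntegral_congr_fun measurableSet_Ioc fun r hr => ?_
    rw [intervalIntegral.integral_of_le hr.1.le]
    have : ∀ s ∈ Ioc 0 t, f (s, r) = (Ioo 0 r).indicator (fun s => g s r) s := by
      intro s hs
      by_cases hr2 : s < r
      · rw [indicator_of_mem (show s ∈ Ioo 0 r from ⟨hs.1, hr2⟩), hf, indicator_of_mem]
        exact ⟨hs.1, hr2, hr.2⟩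
      · rw [indicator_of_notMem (fun hh => hr2 hh.2), hf, indicator_of_notMem]
        exact fun hh => hr2 hh.2.1
    rw [hμ, setIntegral_congr_fun measurableSet_Ioc this, setIntegral_indicator measurableSet_Ioo,
      integral_Ioc_eq_integral_Ioo (y := r)]
    congr 2
    rw [inter_eq_right]; exact fun s hs => ⟨hs.1, hs.2.le.trans hr.2⟩
  rw [← hL, ← hR]; exact hsw

namespace KD
variable {T c C B : ℝ} {θ : ℝ → ℝ} {N : ℝ → ℝ → ℝ}

lemma k_eq (h : KD T c C B θ N) {θ' : ℝ → ℝ} (hθ' : Continuous θ') (hd : ∀ t, HasDerivAt θ (θ' t) t)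
    {y a H : ℝ} (ha0 : 0 < a) (ha1 : a ≤ 1) {s t : ℝ} (hs : 0 ≤ s) (hst : s < t) (htT : t ≤ T)
    (hH : ∀ ξ, |N s ξ - N s y| ≤ H * |ξ - y| ^ a) :
    cv 0 (θ t - θ s) (N s) y = N s y + ∫ r in s..t, θ' r * cv 2 (θ r - θ s) (N s) y := by
  have hH0 : 0 ≤ H := by
    have := hH (y + 1); simp at this; exact (abs_nonneg _).trans this
  have hcd : ∀ r, s < r → r ≤ T → HasDerivAt (fun r => cv 0 (θ r - θ s) (N s) y)
      (θ' r * cv 2 (θ r - θ s) (N s) y) r := fun r hr hrT => by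
    have h1 := (cv_hasDerivAt_t (j := 0) (by norm_num) (h.pos hs hr hrT) (h.Nm s) (h.Nb s) y).comp r
      ((hd r).sub_const (θ s))
    rw [mul_comm]; exact h1
  obtain ⟨M, hM⟩ := (isCompact_Icc (a := s) (b := t)).exists_bound_of_continuousOn hθ'.continuousOn
  have hM0 : 0 ≤ M := (norm_nonneg _).trans (hM s ⟨le_rfl, hst.le⟩)
  have hint : IntervalIntegrable (fun r => θ' r * cv 2 (θ r - θ s) (N s) y) volume s t := by
    have hcont : ContinuousOn (fun r => θ' r * cv 2 (θ r - θ s) (N s) y) (Ioc s t) := fun r hr => by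
      refine (hθ'.continuousAt.mul ?_).continuousWithinAt
      exact h.cont3 (by norm_num) (t := fun r => r) (s := fun _ => s) (y := fun _ => y) continuousAt_id
        continuousAt_const continuousAt_const (h.pos hs hr.1 (hr.2.trans htT))
    have hdom := (abs_rpow_int (γ := a / 2) (by linarith) s s t).const_mul
      (M * (400 * H * c ^ (a / 2 - 1)))
    refine hdom.mono_fun' ?_ ?_
    · rw [uIoc_of_le hst.le]; exact hcont.aestronglyMeasurable measurableSet_Ioc
    · rw [uIoc_of_le hst.le]
      refine (ae_restrict_iff' measurableSet_Ioc).2 (Eventually.of_forall fun r hr => ?_)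
      simp only [norm_mul, Real.norm_eq_abs]
      have h1 := h.bd2 hs hr.1 (hr.2.trans htT) ha0.le ha1 hH
      have h2 := hM r ⟨hr.1.le, hr.2⟩
      rw [mul_assoc]
      rw [abs_of_pos (by linarith [hr.1] : 0 < r - s)]
      exact mul_le_mul h2 h1 (abs_nonneg _) hM0
  have := intervalIntegral.integral_eq_sub_of_hasDerivAt_of_tendsto hst
    (fun r hr => hcd r hr.1 (hr.2.le.trans htT)) hint (fa := N s y) (fb := cv 0 (θ t - θ s) (N s) y) ?_ ?_
  · rw [this]; ring
  · rw [tendsto_iff_norm_sub_tendsto_zero]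
    have hz : Tendsto (fun r => 400 * H * (θ r - θ s) ^ (a / 2)) (𝓝[>] s) (𝓝 0) := by
      have h1 : ContinuousAt (fun r => 400 * H * (θ r - θ s) ^ (a / 2)) s := by
        refine continuousAt_const.mul (ContinuousAt.rpow_const ?_ (Or.inr (by linarith)))
        exact (h.θc.sub continuous_const).continuousAt
      have h2 := h1.tendsto
      simp only [sub_self] at h2
      rw [Real.zero_rpow (by linarith), mul_zero] at h2
      exact h2.mono_left nhdsWithin_le_nhds
    refine squeeze_zero' (Eventually.of_forall fun r => norm_nonneg _) ?_ hz
    filter_upwards [Ioc_mem_nhdsGT hst] with r hr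
    exact cv0_approx ha0.le ha1 (h.pos hs hr.1 (hr.2.trans htT)) (h.Nm s) (h.Nb s) hH
  · exact (hcd t hst htT).continuousAt.tendsto.mono_left nhdsWithin_le_nhds

lemma duh0_eq (h : KD T c C B θ N) {θ' : ℝ → ℝ} (hθ' : Continuous θ') (hd : ∀ t, HasDerivAt θ (θ' t) t)
    {y a H : ℝ} (ha0 : 0 < a) (ha1 : a ≤ 1) (hy : ∀ n : ℤ, y ≠ n)
    (hH : ∀ s ∈ Icc 0 T, ∀ ξ, |N s ξ - N s y| ≤ H * |ξ - y| ^ a) {t : ℝ} (ht : t ∈ Icc 0 T) :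
    duh 0 θ N t y = ∫ r in (0:ℝ)..t, (N r y + θ' r * duh 2 θ N r y) := by
  have hH0 : 0 ≤ H := by
    have := hH 0 ⟨le_rfl, h.hT.le⟩ (y + 1); simp at this; exact (abs_nonneg _).trans this
  have hNy : Continuous fun s => N s y := by
    rw [continuous_iff_continuousAt]; intro s
    exact ContinuousAt.comp (f := fun s => (s, y)) (g := fun q : ℝ × ℝ => N q.1 q.2) (h.Nc s y hy)
      (continuousAt_id.prodMk continuousAt_const)
  have hγ : 0 < a / 2 := by linarith
  have hD2 : ContinuousOn (fun r => duh 2 θ N r y) (Icc 0 T) := by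
    have := h.duh_cont (j := 2) (by norm_num) (U := {y}) hγ (K := 400 * H * c ^ (a / 2 - 1))
      (fun s t y' hs hst htT hy' => by
        rw [mem_singleton_iff.1 hy']
        exact h.bd2 hs hst htT ha0.le ha1 (hH s ⟨hs, (hst.le.trans htT)⟩))
    exact this.comp (f := fun r => (r, y)) (by fun_prop) (fun r hr => ⟨hr, rfl⟩)
  obtain ⟨M, hM⟩ := (isCompact_Icc (a := 0) (b := T)).exists_bound_of_continuousOn hθ'.continuousOn
  have hM0 : 0 ≤ M := (norm_nonneg _).trans (hM 0 ⟨le_rfl, h.hT.le⟩)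
  have hI0 := h.int_s (j := 0) (by norm_num) ht.1 ht.2 one_pos (fun s hs hst => h.bd0 hs hst ht.2 y)
  have hsw := triangle_swap (t := t) (γ := a / 2) (K := M * (400 * H * c ^ (a / 2 - 1))) ht.1 hγ
    (by have := Real.rpow_nonneg h.hc.le (a / 2 - 1); positivity)
    (g := fun s r => θ' r * cv 2 (θ r - θ s) (N s) y) ?_ ?_
  · have e1 : duh 0 θ N t y = ∫ s in (0:ℝ)..t, (N s y + ∫ r in s..t, θ' r * cv 2 (θ r - θ s) (N s) y) := by
      rw [duh]
      refine intervalIntegral.integral_congr_ae ?_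
      have hne : ∀ᵐ σ : ℝ, σ ≠ t := (countable_singleton t).ae_notMem volume
      filter_upwards [hne] with s hs1 hs
      rw [uIoc_of_le ht.1] at hs
      exact h.k_eq hθ' hd ha0 ha1 hs.1.le (lt_of_le_of_ne hs.2 hs1) ht.2
        (hH s ⟨hs.1.le, hs.2.trans ht.2⟩)
    have hI1 : IntervalIntegrable (fun s => ∫ r in s..t, θ' r * cv 2 (θ r - θ s) (N s) y) volume 0 t := by
      refine (hI0.sub (hNy.intervalIntegrable 0 t)).congr_ae ?_
      rw [uIoc_of_le ht.1, ← restrict_Ioo_eq_restrict_Ioc]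
      refine (ae_restrict_iff' measurableSet_Ioo).2 (Eventually.of_forall fun s hs => ?_)
      simp only
      rw [h.k_eq hθ' hd ha0 ha1 hs.1.le hs.2 ht.2 (hH s ⟨hs.1.le, hs.2.le.trans ht.2⟩)]; ring
    rw [e1, intervalIntegral.integral_add (hNy.intervalIntegrable 0 t) hI1, hsw]
    rw [intervalIntegral.integral_add (hNy.intervalIntegrable 0 t)]
    · congr 1
      refine intervalIntegral.integral_congr fun r _ => ?_
      simp only [duh, intervalIntegral.integral_const_mul]
    · refine ContinuousOn.intervalIntegrable ?_
      rw [uIcc_of_le ht.1]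
      exact hθ'.continuousOn.mul (hD2.mono (Icc_subset_Icc_right ht.2))
  · rintro ⟨s, r⟩ ⟨h1, h2, h3⟩
    simp only at h1 h2 h3
    refine ContinuousAt.continuousWithinAt (ContinuousAt.mul ?_ ?_)
    · exact hθ'.continuousAt.comp continuousAt_snd
    · exact h.cont3 (by norm_num) (t := fun q : ℝ × ℝ => q.2) (s := fun q => q.1) (y := fun _ => y)
        continuousAt_snd continuousAt_fst continuousAt_const (h.pos h1.le h2 (h3.trans ht.2))
  · intro s r h1 h2 h3
    rw [abs_mul, mul_assoc]
    exact mul_le_mul (hM r ⟨by linarith, h3.trans ht.2⟩)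
      (h.bd2 h1.le h2 (h3.trans ht.2) ha0.le ha1 (hH s ⟨h1.le, by linarith [ht.2]⟩)) (abs_nonneg _) hM0

lemma duh0_hasDerivAt_t (h : KD T c C B θ N) {θ' : ℝ → ℝ} (hθ' : Continuous θ')
    (hd : ∀ t, HasDerivAt θ (θ' t) t)
    {y a H : ℝ} (ha0 : 0 < a) (ha1 : a ≤ 1) (hy : ∀ n : ℤ, y ≠ n)
    (hH : ∀ s ∈ Icc 0 T, ∀ ξ, |N s ξ - N s y| ≤ H * |ξ - y| ^ a) {t : ℝ} (ht : t ∈ Ioo 0 T) :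
    HasDerivAt (fun t => duh 0 θ N t y) (N t y + θ' t * duh 2 θ N t y) t := by
  have hNy : Continuous fun s => N s y := by
    rw [continuous_iff_continuousAt]; intro s
    exact ContinuousAt.comp (f := fun s => (s, y)) (g := fun q : ℝ × ℝ => N q.1 q.2) (h.Nc s y hy)
      (continuousAt_id.prodMk continuousAt_const)
  have hγ : 0 < a / 2 := by linarith
  have hD2 : ContinuousOn (fun r => duh 2 θ N r y) (Icc 0 T) := by
    have := h.duh_cont (j := 2) (by norm_num) (U := {y}) hγ (K := 400 * H * c ^ (a / 2 - 1))
      (fun s t y' hs hst htT hy' => by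
        rw [mem_singleton_iff.1 hy']
        exact h.bd2 hs hst htT ha0.le ha1 (hH s ⟨hs, (hst.le.trans htT)⟩))
    exact this.comp (f := fun r => (r, y)) (by fun_prop) (fun r hr => ⟨hr, rfl⟩)
  have hcont : ContinuousOn (fun r => N r y + θ' r * duh 2 θ N r y) (Icc 0 T) :=
    hNy.continuousOn.add (hθ'.continuousOn.mul hD2)
  have hder : HasDerivAt (fun t => ∫ r in (0:ℝ)..t, (N r y + θ' r * duh 2 θ N r y))
      (N t y + θ' t * duh 2 θ N t y) t := by
    refine intervalIntegral.integral_hasDerivAt_right ?_ ?_ ?_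
    · refine ContinuousOn.intervalIntegrable ?_
      rw [uIcc_of_le ht.1.le]; exact hcont.mono (Icc_subset_Icc_right ht.2.le)
    · exact (hcont.mono Ioo_subset_Icc_self).stronglyMeasurableAtFilter isOpen_Ioo t ht
    · exact hcont.continuousAt (Icc_mem_nhds ht.1 ht.2)
  refine hder.congr_of_eventuallyEq ?_
  filter_upwards [Icc_mem_nhds ht.1 ht.2] with r hr using h.duh0_eq hθ' hd ha0 ha1 hy hH hr

end KD
end FBP

namespace FBP
open MeasureTheory Topology

lemma hol_cont {P : ℝ → ℝ} {HP α : ℝ} (hα : 0 < α)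
    (h : ∀ x x', |P x - P x'| ≤ HP * |x - x'| ^ α) : Continuous P := by
  rw [continuous_iff_continuousAt]; intro x
  have h1 : Tendsto (fun x' => HP * |x' - x| ^ α) (𝓝 x) (𝓝 0) := by
    have : ContinuousAt (fun x' => HP * |x' - x| ^ α) x :=
      continuousAt_const.mul (ContinuousAt.rpow_const (by fun_prop) (Or.inr hα.le))
    have := this.tendsto
    simpa [Real.zero_rpow hα.ne'] using this
  exact tendsto_iff_norm_sub_tendsto_zero.2 (squeeze_zero (fun _ => norm_nonneg _) (fun x' => h x' x) h1)

lemma avg_eq (P : ℝ → ℝ) (a Δ : ℝ) : ∫ x in a..(a + Δ), P x = Δ * ∫ r in (0:ℝ)..1, P (a + Δ * r) := by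
  have := intervalIntegral.mul_integral_comp_add_mul (a := 0) (b := 1) (f := P) Δ a
  rw [this]; simp

lemma shift_prim {P : ℝ → ℝ} {C0 HP α : ℝ} (hα : 0 < α) (hα1 : α ≤ 1) (hb : ∀ x, |P x| ≤ C0)
    (hh : ∀ x x', |P x - P x'| ≤ HP * |x - x'| ^ α) {g1 g2 l1 l2 lm LM H : ℝ} (hm : 0 < lm)
    (h1 : lm ≤ l1) (h2 : lm ≤ l2) (h1' : l1 ≤ LM) (h2' : l2 ≤ LM) (hg : |g1 - g2| ≤ H) (hl : |l1 - l2| ≤ H)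
    {ξ η : ℝ} (hξ : ξ ∈ Icc (0:ℝ) 1) (hη : η ∈ Icc (0:ℝ) 1) :
    |∫ r in η..ξ, (P (g1 + l1 * r) - P (g2 + l2 * r))| ≤
      (2 * C0 + 2 * HP * LM ^ α) / lm * H * |ξ - η| ^ α := by
  have hc := hol_cont hα hh
  have hC0 : 0 ≤ C0 := (abs_nonneg _).trans (hb 0)
  have hHP : 0 ≤ HP := by have := hh 1 0; simp at this; exact (abs_nonneg _).trans this
  have hH : 0 ≤ H := (abs_nonneg _).trans hg
  have hi : ∀ f : ℝ → ℝ, Continuous f → ∀ a b, IntervalIntegrable f volume a b :=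
    fun f hf a b => hf.intervalIntegrable a b
  rw [intervalIntegral.integral_sub (hi _ (by fun_prop) _ _) (hi _ (by fun_prop) _ _)]
  set X1 := ∫ r in η..ξ, P (g1 + l1 * r) with hX1
  set X2 := ∫ r in η..ξ, P (g2 + l2 * r) with hX2
  have e1 : l1 * X1 = ∫ x in (g1 + l1 * η)..(g1 + l1 * ξ), P x :=
    intervalIntegral.mul_integral_comp_add_mul (f := P) l1 g1
  have e2 : l2 * X2 = ∫ x in (g2 + l2 * η)..(g2 + l2 * ξ), P x :=
    intervalIntegral.mul_integral_comp_add_mul (f := P) l2 g2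
  have hX1b : |X1| ≤ C0 * |ξ - η| := by
    have := intervalIntegral.norm_integral_le_of_norm_le_const (a := η) (b := ξ) (C := C0)
      (f := fun r => P (g1 + l1 * r)) (fun x _ => hb _)
    exact this
  set Δ : ℝ → ℝ := fun ξ => (g1 - g2) + (l1 - l2) * ξ with hΔ
  have hΔb : ∀ ξ ∈ Icc (0:ℝ) 1, |Δ ξ| ≤ 2 * H := fun ξ hξ => by
    have := abs_add_le (g1 - g2) ((l1 - l2) * ξ)
    rw [abs_mul, abs_of_nonneg hξ.1] at this
    have h3 : |l1 - l2| * ξ ≤ H * 1 := mul_le_mul hl hξ.2 hξ.1 hH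
    simp only [hΔ]; linarith
  have e3 : l1 * X1 - l2 * X2 = (Δ ξ * ∫ r in (0:ℝ)..1, P (g2 + l2 * ξ + Δ ξ * r))
      - Δ η * ∫ r in (0:ℝ)..1, P (g2 + l2 * η + Δ η * r) := by
    rw [← avg_eq, ← avg_eq, e1, e2]
    rw [show g2 + l2 * ξ + Δ ξ = g1 + l1 * ξ by simp only [hΔ]; ring,
      show g2 + l2 * η + Δ η = g1 + l1 * η by simp only [hΔ]; ring]
    have k1 := intervalIntegral.integral_add_adjacent_intervals (hi P hc (g1 + l1 * η) (g1 + l1 * ξ))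
      (hi P hc (g1 + l1 * ξ) (g2 + l2 * ξ))
    have k2 := intervalIntegral.integral_add_adjacent_intervals (hi P hc (g1 + l1 * η) (g2 + l2 * η))
      (hi P hc (g2 + l2 * η) (g2 + l2 * ξ))
    rw [intervalIntegral.integral_symm (g2 + l2 * ξ) (g1 + l1 * ξ)] at k1
    rw [intervalIntegral.integral_symm (g2 + l2 * η) (g1 + l1 * η)] at k2
    linarith
  set Y1 := ∫ r in (0:ℝ)..1, P (g2 + l2 * ξ + Δ ξ * r) with hY1
  set Y2 := ∫ r in (0:ℝ)..1, P (g2 + l2 * η + Δ η * r) with hY2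
  have hY1b : |Y1| ≤ C0 := by
    have := intervalIntegral.norm_integral_le_of_norm_le_const (a := 0) (b := 1) (C := C0)
      (f := fun r => P (g2 + l2 * ξ + Δ ξ * r)) (fun x _ => hb _)
    simpa using this
  have hY : |Y1 - Y2| ≤ HP * LM ^ α * |ξ - η| ^ α := by
    rw [hY1, hY2, ← intervalIntegral.integral_sub (hi _ (by fun_prop) _ _) (hi _ (by fun_prop) _ _)]
    have := intervalIntegral.norm_integral_le_of_norm_le_const (a := 0) (b := 1)
      (C := HP * LM ^ α * |ξ - η| ^ α)
      (f := fun r => P (g2 + l2 * ξ + Δ ξ * r) - P (g2 + l2 * η + Δ η * r)) (fun r hr => ?_)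
    · simpa using this
    · rw [uIoc_of_le zero_le_one] at hr
      refine (hh _ _).trans ?_
      rw [mul_assoc, ← Real.mul_rpow (by linarith) (abs_nonneg _)]
      have : g2 + l2 * ξ + Δ ξ * r - (g2 + l2 * η + Δ η * r) = ((1 - r) * l2 + r * l1) * (ξ - η) := by
        simp only [hΔ]; ring
      rw [this, abs_mul]
      have h5 : |(1 - r) * l2 + r * l1| ≤ LM := by
        rw [abs_of_nonneg (by nlinarith [hr.1, hr.2])]
        nlinarith [hr.1, hr.2]
      gcongr
  have hle : |ξ - η| ≤ |ξ - η| ^ α := by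
    have h01 : |ξ - η| ≤ 1 := by rw [abs_le]; constructor <;> linarith [hξ.1, hξ.2, hη.1, hη.2]
    calc |ξ - η| = |ξ - η| ^ (1:ℝ) := (Real.rpow_one _).symm
      _ ≤ _ := Real.rpow_le_rpow_of_exponent_ge' (abs_nonneg _) h01 hα.le hα1
  have key : |l2 * (X1 - X2)| ≤ (2 * C0 + 2 * HP * LM ^ α) * H * |ξ - η| ^ α := by
    have : l2 * (X1 - X2) = (l2 - l1) * X1 + (Δ ξ - Δ η) * Y1 + Δ η * (Y1 - Y2) := by
      have : l2 * (X1 - X2) = (l2 - l1) * X1 + (l1 * X1 - l2 * X2) := by ring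
      rw [this, e3]; ring
    rw [this]
    have hLα : 0 ≤ LM ^ α := Real.rpow_nonneg (by linarith) _
    have n1 : |(l2 - l1) * X1| ≤ H * (C0 * |ξ - η| ^ α) := by
      rw [abs_mul, abs_sub_comm]
      exact mul_le_mul hl (hX1b.trans (by gcongr)) (abs_nonneg _) hH
    have n2 : |(Δ ξ - Δ η) * Y1| ≤ (H * |ξ - η| ^ α) * C0 := by
      rw [abs_mul]
      refine mul_le_mul ?_ hY1b (abs_nonneg _) (by positivity)
      rw [show Δ ξ - Δ η = (l1 - l2) * (ξ - η) by simp only [hΔ]; ring, abs_mul]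
      exact mul_le_mul hl hle (abs_nonneg _) hH
    have n3 : |Δ η * (Y1 - Y2)| ≤ (2 * H) * (HP * LM ^ α * |ξ - η| ^ α) := by
      rw [abs_mul]
      exact mul_le_mul (hΔb η hη) hY (abs_nonneg _) (by positivity)
    calc _ ≤ |(l2 - l1) * X1| + |(Δ ξ - Δ η) * Y1| + |Δ η * (Y1 - Y2)| := abs_add_three _ _ _
      _ ≤ _ := by linarith
  rw [abs_mul, abs_of_pos (by linarith)] at key
  rw [div_mul_eq_mul_div, div_mul_eq_mul_div, le_div_iff₀ hm]
  calc |X1 - X2| * lm ≤ l2 * |X1 - X2| := by rw [mul_comm]; gcongr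
    _ ≤ _ := key

/-- The difference of a Hoelder function along two nearby affine maps is small in a negative norm. -/
lemma cv1_shift {P : ℝ → ℝ} {C0 HP α : ℝ} (hα : 0 < α) (hα1 : α ≤ 1) (hb : ∀ x, |P x| ≤ C0)
    (hh : ∀ x x', |P x - P x'| ≤ HP * |x - x'| ^ α) {g1 g2 l1 l2 lm LM H : ℝ} (hm : 0 < lm)
    (h1 : lm ≤ l1) (h2 : lm ≤ l2) (h1' : l1 ≤ LM) (h2' : l2 ≤ LM) (hg : |g1 - g2| ≤ H) (hl : |l1 - l2| ≤ H)
    {θ : ℝ} (hθ : 0 < θ) (y : ℝ) :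
    |cv 1 θ (fun ξ => sg ξ * (P (g1 + l1 * tri ξ) - P (g2 + l2 * tri ξ))) y| ≤
      400 * ((2 * C0 + 2 * HP * LM ^ α) / lm * H) * θ ^ ((α - 2) / 2) := by
  have hc := hol_cont hα hh
  set Q : ℝ → ℝ := fun r => P (g1 + l1 * r) - P (g2 + l2 * r) with hQ
  have hQc : Continuous Q := by fun_prop
  have hQb : ∀ r, |Q r| ≤ 2 * C0 := fun r => by
    have := abs_sub (P (g1 + l1 * r)) (P (g2 + l2 * r))
    simp only [hQ]; linarith [hb (g1 + l1 * r), hb (g2 + l2 * r)]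
  set Rf : ℝ → ℝ := fun x => ∫ r in (0:ℝ)..x, Q r with hR
  have hRd : ∀ x, HasDerivAt Rf (Q x) x := fun x => (hQc.integral_hasStrictDerivAt 0 x).hasDerivAt
  have hRc : Continuous Rf := continuous_iff_continuousAt.2 fun x => (hRd x).continuousAt
  have hRsub : ∀ x ∈ Icc (0:ℝ) 1, ∀ x' ∈ Icc (0:ℝ) 1, |Rf x - Rf x'| ≤
      (2 * C0 + 2 * HP * LM ^ α) / lm * H * |x - x'| ^ α := fun x hx x' hx' => by
    have : Rf x - Rf x' = ∫ r in x'..x, Q r := by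
      simp only [hR]
      rw [intervalIntegral.integral_interval_sub_left (hQc.intervalIntegrable _ _) (hQc.intervalIntegrable _ _)]
    rw [this]
    exact shift_prim hα hα1 hb hh hm h1 h2 h1' h2' hg hl hx hx'
  have hK : 0 ≤ (2 * C0 + 2 * HP * LM ^ α) / lm * H := by
    have hC0 : 0 ≤ C0 := (abs_nonneg _).trans (hb 0)
    have hHP : 0 ≤ HP := by have := hh 1 0; simp at this; exact (abs_nonneg _).trans this
    have hH : 0 ≤ H := (abs_nonneg _).trans hg
    have hLα : 0 ≤ LM ^ α := Real.rpow_nonneg (by linarith) _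
    positivity
  have hRb : ∀ ξ, |Rf (tri ξ)| ≤ (2 * C0 + 2 * HP * LM ^ α) / lm * H := fun ξ => by
    have := hRsub _ (tri_mem ξ) 0 ⟨le_rfl, zero_le_one⟩
    have h0 : Rf 0 = 0 := by simp [hR]
    rw [h0, sub_zero, sub_zero] at this
    refine this.trans (mul_le_of_le_one_right hK ?_)
    rw [abs_of_nonneg (tri_nonneg ξ)]
    exact Real.rpow_le_one (tri_nonneg ξ) (tri_le_one ξ) hα.le
  have hp := cv_parts hθ (φ := fun ξ => sg ξ * Q (tri ξ)) (Ψ := fun ξ => Rf (tri ξ))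
    (sg_measurable.mul (hQc.comp tri_continuous).measurable) (B := 2 * C0)
    (fun ξ => by rw [abs_mul, sg_abs, one_mul]; exact hQb _) (hRc.comp tri_continuous) hRb
    (fun ξ => comp_tri_hasDeriv (fun y _ => hRd y) ξ) y
  rw [hp]
  refine cv2_holder hα.le hα1 hθ (hRc.comp tri_continuous).measurable hRb (fun ξ => ?_)
  refine (hRsub _ (tri_mem ξ) _ (tri_mem y)).trans ?_
  have := tri_lip ξ y
  gcongr

/-- Weighted singular integral bound. -/
lemma exp_weight {γ l t : ℝ} (hγ : 0 < γ) (hl : 0 < l) (ht : 0 ≤ t) :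
    ∫ s in (0:ℝ)..t, (t - s) ^ (γ - 1) * Real.exp (l * s) ≤
      Real.exp (l * t) * ((1 / l) ^ γ * Real.Gamma γ) := by
  have e1 : ∫ s in (0:ℝ)..t, (t - s) ^ (γ - 1) * Real.exp (l * s) =
      Real.exp (l * t) * ∫ s in (0:ℝ)..t, s ^ (γ - 1) * Real.exp (-(l * s)) := by
    have := intervalIntegral.integral_comp_sub_left (a := 0) (b := t)
      (fun s => Real.exp (l * t) * (s ^ (γ - 1) * Real.exp (-(l * s)))) t
    rw [sub_self, sub_zero] at this
    rw [← intervalIntegral.integral_const_mul, ← this]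
    refine intervalIntegral.integral_congr fun s _ => ?_
    rw [show l * s = l * t + -(l * (t - s)) by ring, Real.exp_add]; ring
  rw [e1]
  refine mul_le_mul_of_nonneg_left ?_ (Real.exp_pos _).le
  rw [← Real.integral_rpow_mul_exp_neg_mul_Ioi hγ hl, intervalIntegral.integral_of_le ht]
  refine setIntegral_mono_set ?_ ?_ (Ioc_subset_Ioi_self.eventuallyLE)
  · have h0 := Real.integral_rpow_mul_exp_neg_mul_Ioi hγ hl
    by_contra hn
    rw [integral_undef hn] at h0
    have : 0 < (1 / l) ^ γ * Real.Gamma γ := mul_pos (Real.rpow_pos_of_pos (by positivity) _) (Real.Gamma_pos_of_pos hγ)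
    linarith
  · refine (ae_restrict_iff' measurableSet_Ioi).2 (Eventually.of_forall fun s hs => ?_)
    exact mul_nonneg (Real.rpow_nonneg (le_of_lt hs) _) (Real.exp_pos _).le

lemma exp_weight_bound {γ l t K : ℝ} (hγ : 0 < γ) (hl : 0 < l) (ht : 0 ≤ t) (hK : 0 ≤ K) {f : ℝ → ℝ}
    (hf : ∀ s, 0 ≤ s → s < t → |f s| ≤ K * (t - s) ^ (γ - 1) * Real.exp (l * s)) :
    |∫ s in (0:ℝ)..t, f s| ≤ K * ((1 / l) ^ γ * Real.Gamma γ) * Real.exp (l * t) := by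
  have hne : ∀ᵐ σ : ℝ, σ ≠ t := (countable_singleton t).ae_notMem volume
  have h1 : ‖∫ s in (0:ℝ)..t, f s‖ ≤ ∫ s in (0:ℝ)..t, K * ((t - s) ^ (γ - 1) * Real.exp (l * s)) := by
    refine intervalIntegral.norm_integral_le_of_norm_le ht ?_ ?_
    · filter_upwards [hne] with s hs hs'
      rw [← mul_assoc]
      exact hf s hs'.1.le (lt_of_le_of_ne hs'.2 hs)
    · refine IntervalIntegrable.const_mul ?_ K
      exact (rpow_int hγ 0 t).mul_continuousOn (by fun_prop)
  refine h1.trans ?_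
  rw [intervalIntegral.integral_const_mul]
  have := mul_le_mul_of_nonneg_left (exp_weight hγ hl ht) hK
  linarith

lemma exp_int_le {l a t : ℝ} (hl : 0 < l) : ∫ s in a..t, Real.exp (l * s) ≤ Real.exp (l * t) / l := by
  rw [intervalIntegral.integral_comp_mul_left (fun s => Real.exp s) hl.ne', integral_exp, smul_eq_mul]
  have := Real.exp_pos (l * a)
  rw [inv_mul_eq_div]; gcongr; linarith

end FBP

namespace FBP
open MeasureTheory Topology

lemma int_le_const {f : ℝ → ℝ} {C : ℝ} (a b : ℝ) (h : ∀ x, |f x| ≤ C) :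
    |∫ x in a..b, f x| ≤ C * |b - a| := by
  have := intervalIntegral.norm_integral_le_of_norm_le_const (f := f) (C := C) (a := a) (b := b)
    fun x _ => (Real.norm_eq_abs _).trans_le (h x)
  rwa [Real.norm_eq_abs] at this

/-- Abstract data for the straightened free boundary problem. -/
structure Dat where
  (d δ l1 T h0 Cv Lv CF LF HF α Lq Bq : ℝ)
  (cg ch : ℝ → ℝ → ℝ)
  (F : ℝ → ℝ → ℝ → ℝ)
  (q0 : ℝ → ℝ)
  hd : 0 < d
  hl1 : 0 < l1
  hT : 0 < T
  hh0 : 0 < h0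
  hα0 : 0 < α
  hα1 : α ≤ 1 / 2
  cgc : Continuous (fun z : ℝ × ℝ => cg z.1 z.2)
  chc : Continuous (fun z : ℝ × ℝ => ch z.1 z.2)
  cgb : ∀ t p, |cg t p| ≤ Cv
  chb : ∀ t p, |ch t p| ≤ Cv
  cgl : ∀ t p p', |cg t p - cg t p'| ≤ Lv * |p - p'|
  chl : ∀ t p p', |ch t p - ch t p'| ≤ Lv * |p - p'|
  Fc : Continuous (fun z : ℝ × ℝ × ℝ => F z.1 z.2.1 z.2.2)
  Fb : ∀ t x v, |F t x v| ≤ CF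
  Fl : ∀ t x v v', |F t x v - F t x v'| ≤ LF * |v - v'|
  Fh : ∀ t x x' v, |F t x v - F t x' v| ≤ HF * |x - x'| ^ α
  ql : ∀ y y', |q0 y - q0 y'| ≤ Lq * |y - y'|
  qb : ∀ y, |q0 y| ≤ Bq
  q_sym0 : ∀ y, q0 (-y) = q0 y
  q_sym1 : ∀ y, q0 (2 - y) = q0 y
  q_int : ∫ y in (0:ℝ)..1, q0 y = 0

namespace Dat
variable (D : Dat)

noncomputable def vg (p : ℝ → ℝ → ℝ) (t : ℝ) : ℝ := D.cg t (p t 0)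
noncomputable def vh (p : ℝ → ℝ → ℝ) (t : ℝ) : ℝ := D.ch t (p t 1)
noncomputable def gg (p : ℝ → ℝ → ℝ) (t : ℝ) : ℝ := -D.h0 + ∫ s in (0:ℝ)..t, D.vg p s
noncomputable def hh (p : ℝ → ℝ → ℝ) (t : ℝ) : ℝ := D.h0 + ∫ s in (0:ℝ)..t, D.vh p s
noncomputable def ll (p : ℝ → ℝ → ℝ) (t : ℝ) : ℝ := max (D.hh p t - D.gg p t) D.l1
noncomputable def th (p : ℝ → ℝ → ℝ) (t : ℝ) : ℝ := ∫ s in (0:ℝ)..t, D.d / (D.ll p s) ^ 2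
noncomputable def pr (p : ℝ → ℝ → ℝ) (s y : ℝ) : ℝ := ∫ r in (0:ℝ)..y, p s r
noncomputable def VV (p : ℝ → ℝ → ℝ) (s y : ℝ) : ℝ := D.vg p s * (1 - y) + D.vh p s * y
noncomputable def ww (p : ℝ → ℝ → ℝ) (s y : ℝ) : ℝ := D.δ + D.ll p s * pr p s y
noncomputable def NN (p : ℝ → ℝ → ℝ) (s y : ℝ) : ℝ :=
  p s y * D.VV p s y + D.F s (D.gg p s + D.ll p s * y) (D.ww p s y)
noncomputable def Nt (p : ℝ → ℝ → ℝ) (s ξ : ℝ) : ℝ := sg ξ * D.NN p s (tri ξ)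
noncomputable def I0 (θ y : ℝ) : ℝ := ∫ η, GK 0 1 η * D.q0 (y - Real.sqrt θ * η)
noncomputable def Phi (p : ℝ → ℝ → ℝ) (t y : ℝ) : ℝ :=
  (D.I0 (D.th p t) y + duh 1 (D.th p) (D.Nt p) t y) / D.ll p t
noncomputable def LM : ℝ := 2 * D.h0 + 2 * D.Cv * D.T + D.l1

/-- Admissible slopes. -/
structure Adm (p : ℝ → ℝ → ℝ) (R : ℝ) : Prop where
  c : Continuous (fun z : ℝ × ℝ => p z.1 z.2)
  b : ∀ t y, |p t y| ≤ R

lemma Cv0 : 0 ≤ D.Cv := (abs_nonneg _).trans (D.cgb 0 0)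
lemma CF0 : 0 ≤ D.CF := (abs_nonneg _).trans (D.Fb 0 0 0)
lemma Bq0 : 0 ≤ D.Bq := (abs_nonneg _).trans (D.qb 0)
lemma Lv0 : 0 ≤ D.Lv := by
  have := (abs_nonneg _).trans (D.cgl 0 1 0); simpa using this
lemma LF0 : 0 ≤ D.LF := by
  have := (abs_nonneg _).trans (D.Fl 0 0 1 0); simpa using this
lemma HF0 : 0 ≤ D.HF := by
  have := (abs_nonneg _).trans (D.Fh 0 1 0 0); simpa using this
lemma Lq0 : 0 ≤ D.Lq := by
  have := (abs_nonneg _).trans (D.ql 1 0); simpa using this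
lemma qc : Continuous D.q0 := by
  refine hol_cont (HP := D.Lq) one_pos fun x x' => ?_
  rw [Real.rpow_one]; exact D.ql x x'
lemma LM0 : 0 < D.LM := by
  have h1 := D.hh0; have h2 := D.hl1; have h3 := mul_nonneg D.Cv0 D.hT.le
  unfold LM; nlinarith
lemma l1_le_LM : D.l1 ≤ D.LM := by
  have h1 := D.hh0; have h3 := mul_nonneg D.Cv0 D.hT.le
  unfold LM; nlinarith

variable {D} {p : ℝ → ℝ → ℝ}

lemma vg_cont (hp : Continuous (fun z : ℝ × ℝ => p z.1 z.2)) : Continuous (D.vg p) :=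
  D.cgc.comp (continuous_id.prodMk (hp.comp (continuous_id.prodMk continuous_const)))
lemma vh_cont (hp : Continuous (fun z : ℝ × ℝ => p z.1 z.2)) : Continuous (D.vh p) :=
  D.chc.comp (continuous_id.prodMk (hp.comp (continuous_id.prodMk continuous_const)))

lemma gg_deriv (hp : Continuous (fun z : ℝ × ℝ => p z.1 z.2)) (t : ℝ) :
    HasDerivAt (D.gg p) (D.vg p t) t :=
  ((vg_cont hp).integral_hasStrictDerivAt 0 t).hasDerivAt.const_add _
lemma hh_deriv (hp : Continuous (fun z : ℝ × ℝ => p z.1 z.2)) (t : ℝ) :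
    HasDerivAt (D.hh p) (D.vh p t) t :=
  ((vh_cont hp).integral_hasStrictDerivAt 0 t).hasDerivAt.const_add _
lemma gg_cont (hp : Continuous (fun z : ℝ × ℝ => p z.1 z.2)) : Continuous (D.gg p) :=
  continuous_iff_continuousAt.2 fun t => (gg_deriv hp t).continuousAt
lemma hh_cont (hp : Continuous (fun z : ℝ × ℝ => p z.1 z.2)) : Continuous (D.hh p) :=
  continuous_iff_continuousAt.2 fun t => (hh_deriv hp t).continuousAt
lemma ll_cont (hp : Continuous (fun z : ℝ × ℝ => p z.1 z.2)) : Continuous (D.ll p) :=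
  ((hh_cont hp).sub (gg_cont hp)).max continuous_const
lemma ll_ge (t : ℝ) : D.l1 ≤ D.ll p t := le_max_right _ _
lemma ll_pos (t : ℝ) : 0 < D.ll p t := D.hl1.trans_le (ll_ge t)

lemma ll_le {t : ℝ} (ht : t ∈ Icc 0 D.T) : D.ll p t ≤ D.LM := by
  have e1 : |∫ s in (0:ℝ)..t, D.vg p s| ≤ D.Cv * |t - 0| :=
    int_le_const _ _ fun s => D.cgb s _
  have e2 : |∫ s in (0:ℝ)..t, D.vh p s| ≤ D.Cv * |t - 0| :=
    int_le_const _ _ fun s => D.chb s _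
  rw [sub_zero, abs_of_nonneg ht.1] at e1 e2
  have h3 := mul_le_mul_of_nonneg_left ht.2 D.Cv0
  have h4 := mul_nonneg D.Cv0 D.hT.le
  have := abs_le.1 e1; have := abs_le.1 e2
  have := D.hl1; have := D.hh0
  unfold ll LM gg hh
  refine max_le ?_ ?_ <;> nlinarith

lemma th_deriv (hp : Continuous (fun z : ℝ × ℝ => p z.1 z.2)) (t : ℝ) :
    HasDerivAt (D.th p) (D.d / (D.ll p t) ^ 2) t := by
  have : Continuous fun s => D.d / (D.ll p s) ^ 2 :=
    continuous_const.div ((ll_cont hp).pow 2) fun s => (pow_pos (ll_pos s) 2).ne'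
  exact (this.integral_hasStrictDerivAt 0 t).hasDerivAt

lemma thd_cont (hp : Continuous (fun z : ℝ × ℝ => p z.1 z.2)) :
    Continuous fun s => D.d / (D.ll p s) ^ 2 :=
    continuous_const.div ((ll_cont hp).pow 2) fun s => (pow_pos (ll_pos s) 2).ne'

lemma th_cont (hp : Continuous (fun z : ℝ × ℝ => p z.1 z.2)) : Continuous (D.th p) :=
  continuous_iff_continuousAt.2 fun t => (th_deriv hp t).continuousAt

lemma th_sub (hp : Continuous (fun z : ℝ × ℝ => p z.1 z.2)) (s t : ℝ) :
    D.th p t - D.th p s = ∫ r in s..t, D.d / (D.ll p r) ^ 2 := by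
  unfold th
  exact intervalIntegral.integral_interval_sub_left ((thd_cont hp).intervalIntegrable _ _)
    ((thd_cont hp).intervalIntegrable _ _)

lemma pr_cont (hp : Continuous (fun z : ℝ × ℝ => p z.1 z.2)) :
    Continuous (fun z : ℝ × ℝ => pr p z.1 z.2) := by
  refine intervalIntegral.continuous_parametric_intervalIntegral_of_continuous
    (f := fun (z : ℝ × ℝ) r => p z.1 r) ?_ continuous_snd
  exact hp.comp ((continuous_fst.comp continuous_fst).prodMk continuous_snd)

lemma slice_cont (hp : Continuous (fun z : ℝ × ℝ => p z.1 z.2)) (s : ℝ) : Continuous (p s) :=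
  hp.comp (continuous_const.prodMk continuous_id)

lemma pr_deriv (hp : Continuous (fun z : ℝ × ℝ => p z.1 z.2)) (s y : ℝ) :
    HasDerivAt (pr p s) (p s y) y :=
  ((slice_cont hp s).integral_hasStrictDerivAt 0 y).hasDerivAt

lemma pr_sub {R : ℝ} (hp : Adm p R) (s y y' : ℝ) : |pr p s y - pr p s y'| ≤ R * |y - y'| := by
  unfold pr
  rw [intervalIntegral.integral_interval_sub_left ((slice_cont hp.c s).intervalIntegrable _ _)
    ((slice_cont hp.c s).intervalIntegrable _ _)]
  exact int_le_const _ _ fun r => hp.b s r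

lemma VV_bound (s : ℝ) {y : ℝ} (hy : y ∈ Icc (0:ℝ) 1) : |D.VV p s y| ≤ D.Cv := by
  unfold VV
  have h1 := abs_le.1 (D.cgb s (p s 0)); have h2 := abs_le.1 (D.chb s (p s 1))
  have := hy.1; have := hy.2
  rw [abs_le]; unfold vg vh; constructor <;> nlinarith

lemma NN_bound {R : ℝ} (hp : Adm p R) (s : ℝ) {y : ℝ} (hy : y ∈ Icc (0:ℝ) 1) :
    |D.NN p s y| ≤ R * D.Cv + D.CF := by
  unfold NN
  refine (abs_add_le _ _).trans (add_le_add ?_ (D.Fb _ _ _))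
  rw [abs_mul]
  exact mul_le_mul (hp.b s y) (VV_bound s hy) (abs_nonneg _) ((abs_nonneg _).trans (hp.b 0 0))

lemma VV_cont (hp : Continuous (fun z : ℝ × ℝ => p z.1 z.2)) :
    Continuous (fun z : ℝ × ℝ => D.VV p z.1 z.2) :=
  (((vg_cont hp).comp continuous_fst).mul (continuous_const.sub continuous_snd)).add
    (((vh_cont hp).comp continuous_fst).mul continuous_snd)

lemma ww_cont (hp : Continuous (fun z : ℝ × ℝ => p z.1 z.2)) :
    Continuous (fun z : ℝ × ℝ => D.ww p z.1 z.2) :=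
  continuous_const.add (((ll_cont hp).comp continuous_fst).mul (pr_cont hp))

lemma NN_cont (hp : Continuous (fun z : ℝ × ℝ => p z.1 z.2)) :
    Continuous (fun z : ℝ × ℝ => D.NN p z.1 z.2) := by
  refine (hp.mul (VV_cont hp)).add (D.Fc.comp (continuous_fst.prodMk (Continuous.prodMk ?_ (ww_cont hp))))
  exact ((gg_cont hp).comp continuous_fst).add (((ll_cont hp).comp continuous_fst).mul continuous_snd)

lemma kd2 {q : ℝ → ℝ → ℝ} {R : ℝ} (hp : Adm p R) (hq : Adm q R) :
    KD D.T (D.d / D.LM ^ 2) (D.d / D.l1 ^ 2) (R * D.Cv + D.CF) (D.th p) (D.Nt q) where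
  hT := D.hT
  hc := div_pos D.hd (pow_pos D.LM0 2)
  hC := div_pos D.hd (pow_pos D.hl1 2)
  θc := th_cont hp.c
  lo s t hs hst ht := by
    rw [th_sub hp.c]
    have := intervalIntegral.integral_mono_on (μ := volume) (a := s) (b := t) (f := fun _ => D.d / D.LM ^ 2)
      (g := fun r => D.d / (D.ll p r) ^ 2) hst (continuous_const.intervalIntegrable _ _)
      ((thd_cont hp.c).intervalIntegrable _ _) (fun r hr => by
        have h1 := ll_le (D := D) (p := p) (t := r) ⟨hs.trans hr.1, hr.2.trans ht⟩
        have h2 := ll_pos (D := D) (p := p) r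
        have h3 := D.hd
        gcongr)
    rwa [intervalIntegral.integral_const, smul_eq_mul, mul_comm] at this
  hi s t hs hst ht := by
    rw [th_sub hp.c]
    have := intervalIntegral.integral_mono_on (μ := volume) (a := s) (b := t) (g := fun _ => D.d / D.l1 ^ 2)
      (f := fun r => D.d / (D.ll p r) ^ 2) hst ((thd_cont hp.c).intervalIntegrable _ _)
      (continuous_const.intervalIntegrable _ _)
      (fun r hr => by
        have h1 := ll_ge (D := D) (p := p) r
        have h2 := D.hl1
        have h3 := D.hd
        gcongr)
    rwa [intervalIntegral.integral_const, smul_eq_mul, mul_comm] at this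
  Nm s := sg_measurable.mul
    (((NN_cont hq.c).comp (continuous_const.prodMk continuous_id)).comp tri_continuous).measurable
  Nb s ξ := by
    unfold Nt; rw [abs_mul, sg_abs, one_mul]; exact NN_bound hq s (tri_mem ξ)
  Nc s ξ h := by
    unfold Nt
    refine ContinuousAt.mul ?_ ?_
    · exact ContinuousAt.comp' (x := (s, ξ)) (f := Prod.snd) (g := sg) (sg_continuousAt h) continuousAt_snd
    · exact ((NN_cont hq.c).comp (continuous_fst.prodMk (tri_continuous.comp continuous_snd))).continuousAt

lemma kd {R : ℝ} (hp : Adm p R) :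
    KD D.T (D.d / D.LM ^ 2) (D.d / D.l1 ^ 2) (R * D.Cv + D.CF) (D.th p) (D.Nt p) := kd2 hp hp

lemma th_pos {R : ℝ} (hp : Adm p R) {t : ℝ} (h0 : 0 < t) (ht : t ≤ D.T) : 0 < D.th p t := by
  have := (kd (D := D) hp).pos le_rfl h0 ht
  simpa [th] using this

lemma I0_cont : Continuous (fun z : ℝ × ℝ => D.I0 z.1 z.2) := by
  unfold I0
  refine continuous_of_dominated (bound := fun η => GK 0 1 η * D.Bq) (fun z => ?_) (fun z => ?_) ?_ ?_
  · have := D.qc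
    exact ((GK_measurable2 0 1).mul ((this.comp (by fun_prop : Continuous fun η : ℝ => z.2 - Real.sqrt z.1 * η)).measurable)).aestronglyMeasurable
  · refine Eventually.of_forall fun η => ?_
    rw [Real.norm_eq_abs, abs_mul, abs_of_pos (GK0_pos one_pos η)]
    exact mul_le_mul_of_nonneg_left (D.qb _) (GK0_pos one_pos η).le
  · exact (GK0_integrable one_pos).mul_const _
  · refine Eventually.of_forall fun η => continuous_const.mul (D.qc.comp ?_)
    fun_prop

lemma I0_bound (θ y : ℝ) : |D.I0 θ y| ≤ D.Bq := by
  unfold I0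
  have := norm_integral_le_of_norm_le (μ := volume) (f := fun η => GK 0 1 η * D.q0 (y - Real.sqrt θ * η))
    (g := fun η => GK 0 1 η * D.Bq) ((GK0_integrable one_pos).mul_const _) (Eventually.of_forall fun η => by
    rw [Real.norm_eq_abs, abs_mul, abs_of_pos (GK0_pos one_pos η)]
    exact mul_le_mul_of_nonneg_left (D.qb _) (GK0_pos one_pos η).le)
  rwa [integral_mul_const, GK0_integral one_pos, one_mul] at this

lemma I0_sub (θ θ' y y' : ℝ) :
    |D.I0 θ y - D.I0 θ' y'| ≤ D.Lq * |y - y'| + 400 * (D.Lq * |Real.sqrt θ - Real.sqrt θ'|) := by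
  have hi : ∀ θ y, Integrable (fun η => GK 0 1 η * D.q0 (y - Real.sqrt θ * η)) := fun θ y => by
    refine Integrable.mono' ((GK0_integrable one_pos).mul_const D.Bq) ?_ (Eventually.of_forall fun η => ?_)
    · have := D.qc
      exact ((GK_measurable2 0 1).mul ((this.comp (by fun_prop : Continuous fun η : ℝ => y - Real.sqrt θ * η)).measurable)).aestronglyMeasurable
    · rw [Real.norm_eq_abs, abs_mul, abs_of_pos (GK0_pos one_pos η)]
      exact mul_le_mul_of_nonneg_left (D.qb _) (GK0_pos one_pos η).le
  unfold I0
  rw [← integral_sub (hi θ y) (hi θ' y')]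
  have hb := norm_integral_le_of_norm_le (μ := volume)
    (f := fun η => GK 0 1 η * D.q0 (y - Real.sqrt θ * η) - GK 0 1 η * D.q0 (y' - Real.sqrt θ' * η))
    (g := fun η => GK 0 1 η * (D.Lq * |y - y'|) + GK 0 (2 * 1) η * (400 * (D.Lq * |Real.sqrt θ - Real.sqrt θ'|)))
    (((GK0_integrable one_pos).mul_const _).add ((GK0_integrable (by norm_num)).mul_const _))
    (Eventually.of_forall fun η => by
      have h0 := GK0_pos one_pos η
      have h1 := GK_bound (j := 0) (by norm_num) zero_le_one le_rfl one_pos η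
      rw [Real.one_rpow, Real.rpow_one, mul_one, abs_of_pos h0] at h1
      rw [Real.norm_eq_abs, ← mul_sub, abs_mul, abs_of_pos h0]
      have h2 := D.ql (y - Real.sqrt θ * η) (y' - Real.sqrt θ' * η)
      have h3 : |y - Real.sqrt θ * η - (y' - Real.sqrt θ' * η)| ≤ |y - y'| + |Real.sqrt θ - Real.sqrt θ'| * |η| := by
        rw [← abs_mul, show y - Real.sqrt θ * η - (y' - Real.sqrt θ' * η) = (y - y') - (Real.sqrt θ - Real.sqrt θ') * η by ring]
        exact abs_sub _ _
      have h4 := h2.trans (mul_le_mul_of_nonneg_left h3 D.Lq0)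
      have h5 := mul_le_mul_of_nonneg_left h4 h0.le
      have h6 := mul_le_mul_of_nonneg_left h1 (mul_nonneg D.Lq0 (abs_nonneg (Real.sqrt θ - Real.sqrt θ')))
      nlinarith)
  rw [integral_add ((GK0_integrable one_pos).mul_const _) ((GK0_integrable (by norm_num)).mul_const _),
    integral_mul_const, integral_mul_const, GK0_integral one_pos, GK0_integral (by norm_num), one_mul, one_mul] at hb
  exact hb

lemma Phi_contOn {R : ℝ} (hp : Adm p R) :
    ContinuousOn (fun z : ℝ × ℝ => D.Phi p z.1 z.2) (Icc 0 D.T ×ˢ univ) := by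
  unfold Phi
  refine ContinuousOn.div (ContinuousOn.add ?_ ?_) ?_ fun z _ => (ll_pos z.1).ne'
  · exact (I0_cont.comp (((th_cont hp.c).comp continuous_fst).prodMk continuous_snd)).continuousOn
  · exact (kd hp).duh_cont (by norm_num) (by norm_num : (0:ℝ) < 1 / 2)
      fun s t y hs hst ht _ => (kd hp).bd1 hs hst ht ((kd hp).Nb s) y
  · exact ((ll_cont hp.c).comp continuous_fst).continuousOn

end Dat
end FBP

namespace FBP
open MeasureTheory Topology
namespace Dat

/-- Two admissible slopes at weighted distance `e`. -/
structure Cmp (D : Dat) (p q : ℝ → ℝ → ℝ) (R lam e : ℝ) : Prop where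
  hp : Adm p R
  hq : Adm q R
  hl : 1 ≤ lam
  he : 0 ≤ e
  hb : ∀ s ∈ Icc 0 D.T, ∀ y ∈ Icc (0:ℝ) 1, |p s y - q s y| ≤ e * Real.exp (lam * s)

variable {D : Dat} {p q : ℝ → ℝ → ℝ} {R lam e : ℝ}

lemma Adm.R0 (h : Adm p R) : 0 ≤ R := (abs_nonneg _).trans (h.b 0 0)

lemma int_exp_bound {f : ℝ → ℝ} {l K s t : ℝ} (hl : 0 < l) (hst : s ≤ t) (hK : 0 ≤ K)
    (hf : ∀ r, s ≤ r → r ≤ t → |f r| ≤ K * Real.exp (l * r)) :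
    |∫ r in s..t, f r| ≤ K * (Real.exp (l * t) / l) := by
  have := intervalIntegral.norm_integral_le_of_norm_le (μ := volume) (f := f) (g := fun r => K * Real.exp (l * r))
    hst (Eventually.of_forall fun r hr => hf r hr.1.le hr.2) ((by fun_prop : Continuous fun r => K * Real.exp (l * r)).intervalIntegrable _ _)
  rw [intervalIntegral.integral_const_mul] at this
  exact this.trans (mul_le_mul_of_nonneg_left (exp_int_le hl) hK)

namespace Cmp

lemma l0 (h : Cmp D p q R lam e) : 0 < lam := lt_of_lt_of_le one_pos h.hl

lemma dvg (h : Cmp D p q R lam e) {s : ℝ} (hs : s ∈ Icc 0 D.T) :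
    |D.vg p s - D.vg q s| ≤ D.Lv * e * Real.exp (lam * s) := by
  refine (D.cgl _ _ _).trans ?_
  rw [mul_assoc]
  exact mul_le_mul_of_nonneg_left (h.hb s hs 0 (by simp)) D.Lv0
lemma dvh (h : Cmp D p q R lam e) {s : ℝ} (hs : s ∈ Icc 0 D.T) :
    |D.vh p s - D.vh q s| ≤ D.Lv * e * Real.exp (lam * s) := by
  refine (D.chl _ _ _).trans ?_
  rw [mul_assoc]
  exact mul_le_mul_of_nonneg_left (h.hb s hs 1 (by simp)) D.Lv0

lemma dgg (h : Cmp D p q R lam e) {t : ℝ} (ht : t ∈ Icc 0 D.T) :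
    |D.gg p t - D.gg q t| ≤ D.Lv * e * (Real.exp (lam * t) / lam) := by
  unfold gg
  rw [add_sub_add_left_eq_sub, ← intervalIntegral.integral_sub ((vg_cont h.hp.c).intervalIntegrable _ _)
    ((vg_cont h.hq.c).intervalIntegrable _ _)]
  exact int_exp_bound h.l0 ht.1 (mul_nonneg D.Lv0 h.he) fun r h1 h2 => h.dvg ⟨h1, h2.trans ht.2⟩
lemma dhh (h : Cmp D p q R lam e) {t : ℝ} (ht : t ∈ Icc 0 D.T) :
    |D.hh p t - D.hh q t| ≤ D.Lv * e * (Real.exp (lam * t) / lam) := by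
  unfold hh
  rw [add_sub_add_left_eq_sub, ← intervalIntegral.integral_sub ((vh_cont h.hp.c).intervalIntegrable _ _)
    ((vh_cont h.hq.c).intervalIntegrable _ _)]
  exact int_exp_bound h.l0 ht.1 (mul_nonneg D.Lv0 h.he) fun r h1 h2 => h.dvh ⟨h1, h2.trans ht.2⟩

lemma dll (h : Cmp D p q R lam e) {t : ℝ} (ht : t ∈ Icc 0 D.T) :
    |D.ll p t - D.ll q t| ≤ 2 * D.Lv * e * (Real.exp (lam * t) / lam) := by
  unfold ll
  refine (abs_max_sub_max_le_abs _ _ _).trans ?_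
  have h1 := abs_le.1 (h.dgg ht); have h2 := abs_le.1 (h.dhh ht)
  rw [abs_le]; constructor <;> linarith

lemma expl (h : Cmp D p q R lam e) (t : ℝ) : Real.exp (lam * t) / lam ≤ Real.exp (lam * t) :=
  div_le_self (Real.exp_pos _).le h.hl

lemma dthd (h : Cmp D p q R lam e) {t : ℝ} (ht : t ∈ Icc 0 D.T) :
    |D.d / D.ll p t ^ 2 - D.d / D.ll q t ^ 2| ≤
      D.d * (2 * D.LM) / D.l1 ^ 4 * (2 * D.Lv * e) * (Real.exp (lam * t) / lam) := by
  have h1 := ll_ge (D := D) (p := p) t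
  have h2 := ll_ge (D := D) (p := q) t
  have h3 := ll_le (D := D) (p := p) ht
  have h4 := ll_le (D := D) (p := q) ht
  have h0 := D.hl1
  have hdl := h.dll ht
  have hd := D.hd
  have hp : 0 < D.ll p t := ll_pos t
  have hq : 0 < D.ll q t := ll_pos t
  have e1 : D.d / D.ll p t ^ 2 - D.d / D.ll q t ^ 2 =
    D.d * (D.ll q t + D.ll p t) / (D.ll p t ^ 2 * D.ll q t ^ 2) * (D.ll q t - D.ll p t) := by
    field_simp
    ring
  rw [e1, abs_mul, abs_sub_comm, abs_of_nonneg (by positivity), mul_assoc]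
  rw [mul_assoc (2 * D.Lv) e, ← mul_assoc (2 * D.Lv) e]
  have hLM := D.LM0
  refine mul_le_mul ?_ (by simpa [mul_assoc] using hdl) (abs_nonneg _) (by positivity)
  refine div_le_div₀ (by positivity) (by gcongr; linarith) (by positivity) ?_
  rw [show D.l1 ^ 4 = D.l1 ^ 2 * D.l1 ^ 2 by ring]
  gcongr

/-- Lipschitz constant of the clock. -/
noncomputable def Kth (D : Dat) : ℝ := D.d * (2 * D.LM) / D.l1 ^ 4 * (2 * D.Lv)
lemma Kth0 : 0 ≤ Kth D := by
  have := D.hd; have := D.LM0; have := D.hl1; have := D.Lv0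
  unfold Kth; positivity

lemma dth (h : Cmp D p q R lam e) {s t : ℝ} (hs : 0 ≤ s) (hst : s ≤ t) (ht : t ≤ D.T) :
    |(D.th p t - D.th p s) - (D.th q t - D.th q s)| ≤ Kth D * (e * Real.exp (lam * t) / lam) * (t - s) := by
  rw [th_sub h.hp.c, th_sub h.hq.c, ← intervalIntegral.integral_sub ((thd_cont h.hp.c).intervalIntegrable _ _)
    ((thd_cont h.hq.c).intervalIntegrable _ _)]
  have := intervalIntegral.norm_integral_le_of_norm_le_const (a := s) (b := t)
    (f := fun r => D.d / D.ll p r ^ 2 - D.d / D.ll q r ^ 2) (C := Kth D * (e * Real.exp (lam * t) / lam)) (fun r hr => by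
    rw [uIoc_of_le hst] at hr
    rw [Real.norm_eq_abs]
    refine (h.dthd ⟨hs.trans hr.1.le, hr.2.trans ht⟩).trans ?_
    have h1 : Real.exp (lam * r) ≤ Real.exp (lam * t) := Real.exp_le_exp.2 (mul_le_mul_of_nonneg_left hr.2 h.l0.le)
    have h2 := h.l0; have := h.he
    have h3 : Real.exp (lam * r) / lam ≤ Real.exp (lam * t) / lam := by gcongr
    have h4 := mul_le_mul_of_nonneg_left h3 (mul_nonneg (Kth0 (D := D)) h.he)
    unfold Kth at *
    calc _ = _ := by ring
      _ ≤ _ := h4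
      _ = _ := by ring)
  rwa [Real.norm_eq_abs, abs_of_nonneg (sub_nonneg.2 hst)] at this

lemma sqrt_sub {a b c : ℝ} (hc : 0 ≤ c) (ha : c ≤ a) (hb : c ≤ b) : |Real.sqrt a - Real.sqrt b| * Real.sqrt c ≤ |a - b| := by
  have h1 : a - b = (Real.sqrt a - Real.sqrt b) * (Real.sqrt a + Real.sqrt b) := by
    have := Real.mul_self_sqrt (hc.trans ha); have := Real.mul_self_sqrt (hc.trans hb)
    nlinarith
  rw [h1, abs_mul]
  refine mul_le_mul_of_nonneg_left ?_ (abs_nonneg _)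
  have := Real.sqrt_le_sqrt ha; have := Real.sqrt_nonneg b; have := Real.sqrt_nonneg a
  rw [abs_of_nonneg (by linarith)]; linarith

lemma dI0 (h : Cmp D p q R lam e) {t : ℝ} (ht : t ∈ Icc 0 D.T) (y : ℝ) :
    |D.I0 (D.th p t) y - D.I0 (D.th q t) y| ≤
      400 * D.Lq * (Kth D * Real.sqrt D.T / Real.sqrt (D.d / D.LM ^ 2)) * (e * Real.exp (lam * t) / lam) := by
  refine (I0_sub _ _ _ _).trans ?_
  rw [sub_self, abs_zero, mul_zero, zero_add, mul_assoc (400:ℝ), mul_assoc (400:ℝ), mul_assoc D.Lq]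
  refine mul_le_mul_of_nonneg_left (mul_le_mul_of_nonneg_left ?_ D.Lq0) (by norm_num)
  have hE : 0 ≤ e * Real.exp (lam * t) / lam := div_nonneg (mul_nonneg h.he (Real.exp_pos _).le) h.l0.le
  have hc : 0 < D.d / D.LM ^ 2 := div_pos D.hd (pow_pos D.LM0 2)
  rcases ht.1.eq_or_lt with h0 | h0
  · rw [← h0]; simp only [th, intervalIntegral.integral_same, sub_self, abs_zero]
    rw [← h0] at hE
    have := Kth0 (D := D); positivity
  have h1 := (kd (D := D) h.hp).lo 0 t le_rfl ht.1 ht.2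
  have h2 := (kd (D := D) h.hq).lo 0 t le_rfl ht.1 ht.2
  have h3 := h.dth le_rfl ht.1 ht.2
  have z1 : D.th p 0 = 0 := by simp [th]
  have z2 : D.th q 0 = 0 := by simp [th]
  rw [z1, sub_zero, sub_zero] at h1
  rw [z2, sub_zero, sub_zero] at h2
  rw [z1, z2, sub_zero, sub_zero, sub_zero] at h3
  have h4 := (sqrt_sub (mul_nonneg hc.le ht.1) h1 h2).trans h3
  rw [Real.sqrt_mul hc.le] at h4
  have hs := Real.sqrt_pos.2 h0
  have hs2 := Real.sqrt_pos.2 hc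
  have h5 : Real.sqrt t ≤ Real.sqrt D.T := Real.sqrt_le_sqrt ht.2
  have h6 : |√(D.th p t) - √(D.th q t)| ≤ Kth D * (e * Real.exp (lam * t) / lam) * √t / √(D.d / D.LM ^ 2) := by
    rw [le_div_iff₀ hs2]
    refine le_of_mul_le_mul_right ?_ hs
    have := Real.mul_self_sqrt ht.1
    calc _ = _ := by ring
      _ ≤ _ := h4
      _ = Kth D * (e * Real.exp (lam * t) / lam) * (√t * √t) := by rw [this]
      _ = _ := by ring
  refine h6.trans ?_
  have := Kth0 (D := D)
  calc _ = Kth D * √t / √(D.d / D.LM ^ 2) * (e * Real.exp (lam * t) / lam) := by ring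
    _ ≤ _ := by gcongr

end Cmp
end Dat
end FBP

namespace FBP
open MeasureTheory Topology

lemma int_rpow_bound {f : ℝ → ℝ} {K γ t : ℝ} (hγ : 0 < γ) (ht : 0 ≤ t)
    (hf : ∀ s, 0 ≤ s → s < t → |f s| ≤ K * (t - s) ^ (γ - 1)) :
    |∫ s in (0:ℝ)..t, f s| ≤ K * (t ^ γ / γ) := by
  have h1 := intervalIntegral.norm_integral_le_of_norm_le (μ := volume) (f := f)
    (g := fun s => K * (t - s) ^ (γ - 1)) (a := 0) (b := t) ht ?_ ((rpow_int hγ 0 t).const_mul K)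
  · rw [intervalIntegral.integral_const_mul, rpow_int_val hγ, sub_zero] at h1
    exact h1
  · have : ∀ᵐ s : ℝ, s ≠ t := by simp [ae_iff]
    filter_upwards [this] with s hs hs2
    exact hf s hs2.1.le (lt_of_le_of_ne hs2.2 hs)

namespace Dat
variable {D : Dat} {p q : ℝ → ℝ → ℝ} {R lam e : ℝ}
namespace Cmp

noncomputable def cc (D : Dat) : ℝ := D.d / D.LM ^ 2
lemma cc0 : 0 < cc D := div_pos D.hd (pow_pos D.LM0 2)

noncomputable def BB (D : Dat) (R : ℝ) : ℝ := R * D.Cv + D.CF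

lemma BB0 (hR : 0 ≤ R) : 0 ≤ BB D R := add_nonneg (mul_nonneg hR D.Cv0) D.CF0

lemma ddA (h : Cmp D p q R lam e) {t : ℝ} (ht : t ∈ Icc 0 D.T) (y : ℝ) :
    |duh 1 (D.th p) (D.Nt p) t y - duh 1 (D.th q) (D.Nt p) t y| ≤
      400 * BB D R * (cc D) ^ (-(3:ℝ) / 2) * Kth D * (D.T ^ ((1:ℝ) / 2) / (1 / 2)) * (e * Real.exp (lam * t) / lam) := by
  have k1 := kd2 (D := D) h.hp h.hp
  have k2 := kd2 (D := D) h.hq h.hp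
  have half : (0:ℝ) < 1 / 2 := by norm_num
  unfold duh
  rw [← intervalIntegral.integral_sub
    (k1.int_s (by norm_num) ht.1 ht.2 half fun s hs hst => k1.bd1 hs hst ht.2 (k1.Nb s) y)
    (k2.int_s (by norm_num) ht.1 ht.2 half fun s hs hst => k2.bd1 hs hst ht.2 (k2.Nb s) y)]
  have hE : 0 ≤ e * Real.exp (lam * t) / lam := div_nonneg (mul_nonneg h.he (Real.exp_pos _).le) h.l0.le
  have hB := BB0 (D := D) h.hp.R0
  have hc := cc0 (D := D)
  have hK := Kth0 (D := D)
  have key := int_rpow_bound (f := fun s => cv 1 (D.th p t - D.th p s) (D.Nt p s) y - cv 1 (D.th q t - D.th q s) (D.Nt p s) y)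
    (K := 400 * BB D R * (cc D) ^ (-(3:ℝ) / 2) * Kth D * (e * Real.exp (lam * t) / lam)) half ht.1 (fun s hs hst => by
      have hts : 0 < t - s := sub_pos.2 hst
      have h1 := cv1_sub_t (k1.Nm s) (k1.Nb s) y (mul_pos hc hts) (k1.lo s t hs hst.le ht.2) (k2.lo s t hs hst.le ht.2)
      have h2 := h.dth hs hst.le ht.2
      refine h1.trans ?_
      have e1 : (cc D * (t - s)) ^ (-(3:ℝ) / 2) * (t - s) = cc D ^ (-(3:ℝ) / 2) * (t - s) ^ ((1:ℝ) / 2 - 1) := by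
        rw [Real.mul_rpow hc.le hts.le, mul_assoc, ← Real.rpow_add_one hts.ne']
        norm_num
      have h3 : 0 ≤ 400 * (R * D.Cv + D.CF) * (cc D * (t - s)) ^ (-(3:ℝ) / 2) := by
        have := Real.rpow_nonneg (mul_pos hc hts).le (-(3:ℝ) / 2)
        unfold BB at hB; positivity
      refine (mul_le_mul_of_nonneg_left h2 h3).trans_eq ?_
      unfold BB
      calc _ = 400 * (R * D.Cv + D.CF) * Kth D * (e * Real.exp (lam * t) / lam) * ((cc D * (t - s)) ^ (-(3:ℝ) / 2) * (t - s)) := by ring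
        _ = _ := by rw [e1]; ring)
  refine key.trans ?_
  have hm : t ^ ((1:ℝ) / 2) ≤ D.T ^ ((1:ℝ) / 2) := Real.rpow_le_rpow ht.1 ht.2 half.le
  have : 0 ≤ 400 * BB D R * (cc D) ^ (-(3:ℝ) / 2) * Kth D * (e * Real.exp (lam * t) / lam) := by
    have := Real.rpow_nonneg hc.le (-(3:ℝ) / 2)
    positivity
  calc _ ≤ 400 * BB D R * (cc D) ^ (-(3:ℝ) / 2) * Kth D * (e * Real.exp (lam * t) / lam) * (D.T ^ ((1:ℝ) / 2) / (1 / 2)) := by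
        gcongr
    _ = _ := by ring

/-- The frozen profile used in the shift decomposition. -/
noncomputable def om (D : Dat) (q : ℝ → ℝ → ℝ) (s x : ℝ) : ℝ := D.ww q s ((x - D.gg q s) / D.ll q s)

lemma om_lip (hq : Adm q R) (s x x' : ℝ) : |om D q s x - om D q s x'| ≤ R * |x - x'| := by
  unfold om ww
  have hl : 0 < D.ll q s := ll_pos s
  rw [add_sub_add_left_eq_sub, ← mul_sub, abs_mul, abs_of_pos hl]
  refine (mul_le_mul_of_nonneg_left (pr_sub hq s _ _) hl.le).trans_eq ?_
  rw [div_sub_div_same, sub_sub_sub_cancel_right, abs_div, abs_of_pos hl]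
  field_simp

lemma om_at (s y : ℝ) : om D q s (D.gg q s + D.ll q s * y) = D.ww q s y := by
  have hl : 0 < D.ll q s := ll_pos s
  unfold om; congr 1; field_simp; ring

noncomputable def PP (D : Dat) (q : ℝ → ℝ → ℝ) (s x : ℝ) : ℝ := D.F s x (om D q s x)

noncomputable def HP (D : Dat) (R : ℝ) : ℝ := D.HF + D.LF * R + 2 * D.CF

lemma PP_hol (hq : Adm q R) (s x x' : ℝ) : |PP D q s x - PP D q s x'| ≤ HP D R * |x - x'| ^ D.α := by
  have hR := hq.R0
  have h1 := D.HF0; have h2 := D.LF0; have h3 := D.CF0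
  have hα := D.hα0
  unfold HP
  rcases le_or_gt |x - x'| 1 with hx | hx
  · have : |x - x'| ≤ |x - x'| ^ D.α := by
      rcases (abs_nonneg (x - x')).eq_or_lt with h0 | h0
      · rw [← h0]; exact Real.rpow_nonneg le_rfl _
      · have := Real.rpow_le_rpow_of_exponent_ge h0 hx (by linarith [D.hα1] : D.α ≤ 1)
        rwa [Real.rpow_one] at this
    have e1 : PP D q s x - PP D q s x' = (D.F s x (om D q s x) - D.F s x' (om D q s x)) +
        (D.F s x' (om D q s x) - D.F s x' (om D q s x')) := by unfold PP; ring
    rw [e1]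
    refine (abs_add_le _ _).trans ((add_le_add (D.Fh _ _ _ _) ((D.Fl _ _ _ _).trans
      (mul_le_mul_of_nonneg_left (om_lip hq s x x') h2))).trans ?_)
    have h4 := Real.rpow_nonneg (abs_nonneg (x - x')) D.α
    have h5 := mul_le_mul_of_nonneg_left this (mul_nonneg h2 hR)
    nlinarith [mul_nonneg h3 h4]
  · have h4 : 1 ≤ |x - x'| ^ D.α := Real.one_le_rpow hx.le hα.le
    have h5 : |PP D q s x - PP D q s x'| ≤ 2 * D.CF := by
      refine (abs_sub _ _).trans ?_
      have := D.Fb s x (om D q s x); have := D.Fb s x' (om D q s x'); unfold PP; linarith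
    refine h5.trans ?_
    have h6 := mul_nonneg h2 hR
    nlinarith

noncomputable def shf (D : Dat) (p q : ℝ → ℝ → ℝ) (s ξ : ℝ) : ℝ :=
  sg ξ * (PP D q s (D.gg p s + D.ll p s * tri ξ) - PP D q s (D.gg q s + D.ll q s * tri ξ))

noncomputable def KA (D : Dat) (R : ℝ) : ℝ :=
  D.Cv + R * D.Lv + D.LF * (2 * D.Lv * R + D.LM) + D.LF * (R * (3 * D.Lv))

lemma KA0 (hR : 0 ≤ R) : 0 ≤ KA D R := by
  have := D.Cv0; have := D.Lv0; have := D.LF0; have := D.LM0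
  unfold KA; positivity

lemma dNN (h : Cmp D p q R lam e) {s : ℝ} (hs : s ∈ Icc 0 D.T) {y : ℝ} (hy : y ∈ Icc (0:ℝ) 1) :
    |D.NN p s y - D.NN q s y - (PP D q s (D.gg p s + D.ll p s * y) - PP D q s (D.gg q s + D.ll q s * y))| ≤
      KA D R * (e * Real.exp (lam * s)) := by
  have hR := h.hp.R0
  set E := e * Real.exp (lam * s) with hE
  have hE0 : 0 ≤ E := mul_nonneg h.he (Real.exp_pos _).le
  have hLv := D.Lv0; have hLF := D.LF0
  have hel := h.expl s
  have hg : |D.gg p s - D.gg q s| ≤ D.Lv * E := by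
    refine (h.dgg hs).trans ?_
    rw [hE, ← mul_assoc]
    exact mul_le_mul_of_nonneg_left hel (mul_nonneg hLv h.he)
  have hl : |D.ll p s - D.ll q s| ≤ 2 * D.Lv * E := by
    refine (h.dll hs).trans ?_
    rw [hE, ← mul_assoc]
    exact mul_le_mul_of_nonneg_left hel (mul_nonneg (mul_nonneg zero_le_two hLv) h.he)
  have hvg : |D.vg p s - D.vg q s| ≤ D.Lv * E := (h.dvg hs).trans_eq (by rw [hE]; ring)
  have hvh : |D.vh p s - D.vh q s| ≤ D.Lv * E := (h.dvh hs).trans_eq (by rw [hE]; ring)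
  have hV : |D.VV p s y - D.VV q s y| ≤ D.Lv * E := by
    unfold VV
    have := abs_le.1 hvg; have := abs_le.1 hvh; have := hy.1; have := hy.2
    rw [abs_le]; constructor <;> nlinarith
  have hpV : |p s y * D.VV p s y - q s y * D.VV q s y| ≤ E * D.Cv + R * (D.Lv * E) := by
    rw [show p s y * D.VV p s y - q s y * D.VV q s y = (p s y - q s y) * D.VV p s y + q s y * (D.VV p s y - D.VV q s y) by ring]
    refine (abs_add_le _ _).trans (add_le_add ?_ ?_)
    · rw [abs_mul]; exact mul_le_mul (h.hb s hs y hy) (VV_bound s hy) (abs_nonneg _) hE0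
    · rw [abs_mul]; exact mul_le_mul (h.hq.b s y) hV (abs_nonneg _) hR
  have hprp : |pr p s y| ≤ R := by
    have := pr_sub h.hp s y 0
    rw [show pr p s 0 = 0 by simp [pr], sub_zero, sub_zero, abs_of_nonneg hy.1] at this
    exact this.trans (mul_le_of_le_one_right hR hy.2)
  have hdpr : |pr p s y - pr q s y| ≤ E := by
    unfold pr
    rw [← intervalIntegral.integral_sub ((slice_cont h.hp.c s).intervalIntegrable _ _)
      ((slice_cont h.hq.c s).intervalIntegrable _ _)]
    have := intervalIntegral.norm_integral_le_of_norm_le_const (f := fun r => p s r - q s r) (C := E) (a := 0) (b := y)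
      (fun r hr => by
        rw [uIoc_of_le hy.1] at hr
        exact h.hb s hs r ⟨hr.1.le, hr.2.trans hy.2⟩)
    rw [sub_zero, abs_of_nonneg hy.1] at this
    exact this.trans (mul_le_of_le_one_right hE0 hy.2)
  have hw : |D.ww p s y - D.ww q s y| ≤ (2 * D.Lv * R + D.LM) * E := by
    unfold ww
    rw [show D.δ + D.ll p s * pr p s y - (D.δ + D.ll q s * pr q s y) =
      (D.ll p s - D.ll q s) * pr p s y + D.ll q s * (pr p s y - pr q s y) by ring]
    refine (abs_add_le _ _).trans ?_
    rw [abs_mul, abs_mul, abs_of_pos (ll_pos (D := D) (p := q) s)]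
    have h1 := mul_le_mul hl hprp (abs_nonneg _) (by positivity)
    have h2 := mul_le_mul (ll_le (D := D) (p := q) hs) hdpr (abs_nonneg _) D.LM0.le
    nlinarith
  have hx : |D.gg p s + D.ll p s * y - (D.gg q s + D.ll q s * y)| ≤ 3 * D.Lv * E := by
    have := abs_le.1 hg; have := abs_le.1 hl; have := hy.1; have := hy.2
    have : 0 ≤ D.Lv * E := by positivity
    rw [abs_le]; constructor <;> nlinarith
  set x1 := D.gg p s + D.ll p s * y
  have e1 : D.NN p s y - D.NN q s y - (PP D q s x1 - PP D q s (D.gg q s + D.ll q s * y)) =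
      (p s y * D.VV p s y - q s y * D.VV q s y) + (D.F s x1 (D.ww p s y) - D.F s x1 (D.ww q s y)) +
      (D.F s x1 (om D q s (D.gg q s + D.ll q s * y)) - D.F s x1 (om D q s x1)) := by
    unfold NN PP; rw [om_at]; ring
  rw [e1]
  refine (abs_add_le _ _).trans (le_trans (add_le_add ((abs_add_le _ _).trans (add_le_add hpV ((D.Fl _ _ _ _).trans
    (mul_le_mul_of_nonneg_left hw hLF)))) ((D.Fl _ _ _ _).trans (mul_le_mul_of_nonneg_left
      ((om_lip h.hq s _ _).trans (mul_le_mul_of_nonneg_left ((abs_sub_comm _ _).trans_le hx) hR)) hLF))) ?_)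
  unfold KA
  refine le_of_eq ?_
  ring

noncomputable def KS (D : Dat) (R : ℝ) : ℝ :=
  (2 * D.CF + 2 * HP D R * D.LM ^ D.α) / D.l1 * (2 * D.Lv)

lemma HP0 (hR : 0 ≤ R) : 0 ≤ HP D R := by
  have := D.HF0; have := D.LF0; have := D.CF0; unfold HP; positivity
lemma KS0 (hR : 0 ≤ R) : 0 ≤ KS D R := by
  have := D.CF0; have := HP0 (D := D) hR; have := D.hl1; have := D.Lv0
  have := Real.rpow_nonneg D.LM0.le D.α
  unfold KS; positivity

lemma shf_meas (hq : Adm q R) (s : ℝ) : Measurable (shf D p q s) := by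
  have hP : Continuous (PP D q s) := hol_cont D.hα0 fun x x' => PP_hol hq s x x'
  refine sg_measurable.mul (Continuous.measurable ?_)
  have := tri_continuous
  exact (hP.comp (by fun_prop)).sub (hP.comp (by fun_prop))

lemma shf_bound (s ξ : ℝ) : |shf D p q s ξ| ≤ 2 * D.CF := by
  unfold shf
  rw [abs_mul, sg_abs, one_mul]
  refine (abs_sub _ _).trans ?_
  unfold PP
  linarith [D.Fb s (D.gg p s + D.ll p s * tri ξ) (om D q s (D.gg p s + D.ll p s * tri ξ)),
    D.Fb s (D.gg q s + D.ll q s * tri ξ) (om D q s (D.gg q s + D.ll q s * tri ξ))]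

noncomputable def KN (D : Dat) (R : ℝ) : ℝ :=
  400 * KA D R * cc D ^ (-(1:ℝ) / 2) * D.T ^ ((1 - D.α) / 2) + 400 * KS D R * cc D ^ ((D.α - 2) / 2)

lemma KN0 (hR : 0 ≤ R) : 0 ≤ KN D R := by
  have := KA0 (D := D) hR; have := KS0 (D := D) hR
  have := Real.rpow_nonneg (cc0 (D := D)).le (-(1:ℝ) / 2)
  have := Real.rpow_nonneg (cc0 (D := D)).le ((D.α - 2) / 2)
  have := Real.rpow_nonneg D.hT.le ((1 - D.α) / 2)
  unfold KN; positivity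

lemma ddN_pt (h : Cmp D p q R lam e) {s t : ℝ} (hs : 0 ≤ s) (hst : s < t) (ht : t ≤ D.T) (y : ℝ) :
    |cv 1 (D.th q t - D.th q s) (D.Nt p s) y - cv 1 (D.th q t - D.th q s) (D.Nt q s) y| ≤
      KN D R * e * (t - s) ^ (D.α / 2 - 1) * Real.exp (lam * s) := by
  have k1 := kd2 (D := D) h.hq h.hp
  have k2 := kd2 (D := D) h.hq h.hq
  have hR := h.hp.R0
  have hsT : s ∈ Icc 0 D.T := ⟨hs, hst.le.trans ht⟩
  have hθ := k1.pos hs hst ht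
  have hlo := k1.lo s t hs hst.le ht
  have hts : 0 < t - s := sub_pos.2 hst
  have hE0 : 0 ≤ e * Real.exp (lam * s) := mul_nonneg h.he (Real.exp_pos _).le
  set E := e * Real.exp (lam * s) with hE
  set θ := D.th q t - D.th q s
  have hc := cc0 (D := D)
  rw [← cv_sub (by norm_num) hθ (k1.Nm s) (k2.Nm s) (k1.Nb s) (k2.Nb s)]
  have hm : Measurable fun ξ => D.Nt p s ξ - D.Nt q s ξ := (k1.Nm s).sub (k2.Nm s)
  have hb : ∀ ξ, |D.Nt p s ξ - D.Nt q s ξ| ≤ BB D R + BB D R := fun ξ =>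
    (abs_sub _ _).trans (add_le_add (k1.Nb s ξ) (k2.Nb s ξ))
  have e1 := cv_sub (j := 1) (by norm_num) hθ hm (shf_meas (D := D) (p := p) h.hq s) hb (shf_bound s) y
  have h1 := cv_bound (j := 1) (by norm_num) hθ (φ := fun ξ => D.Nt p s ξ - D.Nt q s ξ - shf D p q s ξ)
    (B := KA D R * E) (fun ξ => by
      have := h.dNN hsT (tri_mem ξ)
      rw [show D.Nt p s ξ - D.Nt q s ξ - shf D p q s ξ = sg ξ * (D.NN p s (tri ξ) - D.NN q s (tri ξ) -
        (PP D q s (D.gg p s + D.ll p s * tri ξ) - PP D q s (D.gg q s + D.ll q s * tri ξ))) by unfold Nt shf; ring,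
        abs_mul, sg_abs, one_mul]
      exact this) y
  have hel := h.expl s
  have hLv := D.Lv0
  have hgl : ∀ x, |x| ≤ 2 * D.Lv * e * (Real.exp (lam * s) / lam) → |x| ≤ 2 * D.Lv * E := fun x hx => by
    refine hx.trans ?_
    rw [hE, ← mul_assoc]
    exact mul_le_mul_of_nonneg_left hel (mul_nonneg (mul_nonneg zero_le_two hLv) h.he)
  have hg : |D.gg p s - D.gg q s| ≤ 2 * D.Lv * E := hgl _ ((h.dgg hsT).trans (by
    have h3 : 0 ≤ D.Lv * e * (Real.exp (lam * s) / lam) :=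
      mul_nonneg (mul_nonneg hLv h.he) (div_nonneg (Real.exp_pos _).le h.l0.le)
    linarith))
  have h2 := cv1_shift D.hα0 (by linarith [D.hα1]) (P := PP D q s) (C0 := D.CF) (fun x => D.Fb _ _ _)
    (PP_hol h.hq s) D.hl1 (ll_ge (D := D) (p := p) s) (ll_ge (D := D) (p := q) s) (ll_le hsT) (ll_le hsT)
    hg (hgl _ (h.dll hsT)) hθ y
  have h2' : |cv 1 θ (shf D p q s) y| ≤ 400 * ((2 * D.CF + 2 * HP D R * D.LM ^ D.α) / D.l1 * (2 * D.Lv * E)) * θ ^ ((D.α - 2) / 2) := h2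
  have h3 : cv 1 θ (fun ξ => D.Nt p s ξ - D.Nt q s ξ) y =
    cv 1 θ (fun ξ => D.Nt p s ξ - D.Nt q s ξ - shf D p q s ξ) y + cv 1 θ (shf D p q s) y := by rw [e1]; ring
  rw [h3]
  refine (abs_add_le _ _).trans ((add_le_add h1 h2').trans ?_)
  have p1 : θ ^ (-((1:ℕ):ℝ) / 2) ≤ cc D ^ (-(1:ℝ) / 2) * (D.T ^ ((1 - D.α) / 2) * (t - s) ^ (D.α / 2 - 1)) := by
    rw [Nat.cast_one]
    refine (Real.rpow_le_rpow_of_nonpos (mul_pos hc hts) hlo (by norm_num)).trans ?_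
    rw [Real.mul_rpow hc.le hts.le]
    refine mul_le_mul_of_nonneg_left ?_ (Real.rpow_nonneg hc.le _)
    rw [show -(1:ℝ) / 2 = (1 - D.α) / 2 + (D.α / 2 - 1) by ring, Real.rpow_add hts]
    refine mul_le_mul_of_nonneg_right ?_ (Real.rpow_nonneg hts.le _)
    exact Real.rpow_le_rpow hts.le (by linarith) (by linarith [D.hα1])
  have p2 : θ ^ ((D.α - 2) / 2) ≤ cc D ^ ((D.α - 2) / 2) * (t - s) ^ (D.α / 2 - 1) := by
    refine (Real.rpow_le_rpow_of_nonpos (mul_pos hc hts) hlo (by linarith [D.hα1])).trans_eq ?_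
    rw [Real.mul_rpow hc.le hts.le]; congr 2; ring
  have hKA := KA0 (D := D) hR
  have q1 := mul_le_mul_of_nonneg_left p1 (by positivity : 0 ≤ 400 * (KA D R * E))
  have q2 := mul_le_mul_of_nonneg_left p2 (by
    have := mul_nonneg (KS0 (D := D) hR) hE0
    unfold KS at this; nlinarith : 0 ≤ 400 * ((2 * D.CF + 2 * HP D R * D.LM ^ D.α) / D.l1 * (2 * D.Lv * E)))
  refine (add_le_add q1 q2).trans_eq ?_
  rw [hE]; unfold KN KS; ring

lemma ddN (h : Cmp D p q R lam e) {t : ℝ} (ht : t ∈ Icc 0 D.T) (y : ℝ) :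
    |duh 1 (D.th q) (D.Nt p) t y - duh 1 (D.th q) (D.Nt q) t y| ≤
      KN D R * Real.Gamma (D.α / 2) * ((1 / lam) ^ (D.α / 2) * (e * Real.exp (lam * t))) := by
  have k1 := kd2 (D := D) h.hq h.hp
  have k2 := kd2 (D := D) h.hq h.hq
  have half : (0:ℝ) < 1 / 2 := by norm_num
  unfold duh
  rw [← intervalIntegral.integral_sub
    (k1.int_s (by norm_num) ht.1 ht.2 half fun s hs hst => k1.bd1 hs hst ht.2 (k1.Nb s) y)
    (k2.int_s (by norm_num) ht.1 ht.2 half fun s hs hst => k2.bd1 hs hst ht.2 (k2.Nb s) y)]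
  refine (exp_weight_bound (by linarith [D.hα0]) h.l0 ht.1 (mul_nonneg (KN0 h.hp.R0) h.he)
    fun s hs hst => h.ddN_pt hs hst ht.2 y).trans_eq ?_
  ring

lemma duh_bd (hp : Adm p R) {t : ℝ} (ht : t ∈ Icc 0 D.T) (y : ℝ) :
    |duh 1 (D.th p) (D.Nt p) t y| ≤ 400 * BB D R * cc D ^ (-(1:ℝ) / 2) * (D.T ^ ((1:ℝ) / 2) / (1 / 2)) := by
  have k := kd (D := D) hp
  have half : (0:ℝ) < 1 / 2 := by norm_num
  refine (KD.duh_bound ht.1 half fun s hs hst => k.bd1 hs hst ht.2 (k.Nb s) y).trans ?_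
  have := BB0 (D := D) hp.R0
  have := Real.rpow_nonneg (cc0 (D := D)).le (-(1:ℝ) / 2)
  have : t ^ ((1:ℝ) / 2) ≤ D.T ^ ((1:ℝ) / 2) := Real.rpow_le_rpow ht.1 ht.2 half.le
  unfold BB cc at *
  gcongr

/-- Weighted contraction estimate. -/
lemma contr (D : Dat) (hR : 0 ≤ R) : ∃ K, 0 ≤ K ∧ ∀ p q lam e, Cmp D p q R lam e →
    ∀ t ∈ Icc 0 D.T, ∀ y, |D.Phi p t y - D.Phi q t y| ≤ K * (1 / lam) ^ (D.α / 2) * (e * Real.exp (lam * t)) := by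
  set k1 := 400 * D.Lq * (Kth D * Real.sqrt D.T / Real.sqrt (D.d / D.LM ^ 2)) with hk1
  set k2 := 400 * BB D R * (cc D) ^ (-(3:ℝ) / 2) * Kth D * (D.T ^ ((1:ℝ) / 2) / (1 / 2)) with hk2
  set k3 := KN D R * Real.Gamma (D.α / 2) with hk3
  set k4 := D.Bq + 400 * BB D R * cc D ^ (-(1:ℝ) / 2) * (D.T ^ ((1:ℝ) / 2) / (1 / 2)) with hk4
  have hB := BB0 (D := D) hR
  have hc := cc0 (D := D)
  have hT := Real.rpow_nonneg D.hT.le ((1:ℝ) / 2)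
  have hLv := D.Lv0
  have hl1 := D.hl1
  have z1 : 0 ≤ k1 := by have := D.Lq0; have := Kth0 (D := D); positivity
  have z2 : 0 ≤ k2 := by
    have := Kth0 (D := D); have := Real.rpow_nonneg hc.le (-(3:ℝ) / 2); positivity
  have z3 : 0 ≤ k3 := mul_nonneg (KN0 hR) (Real.Gamma_pos_of_pos (by linarith [D.hα0])).le
  have z4 : 0 ≤ k4 := by
    have := D.Bq0; have := Real.rpow_nonneg hc.le (-(1:ℝ) / 2); positivity
  refine ⟨(k1 + k2 + k3) / D.l1 + k4 * (2 * D.Lv) / D.l1 ^ 2, by positivity, fun p q lam e h t ht y => ?_⟩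
  have hlam : 1 / lam ≤ (1 / lam) ^ (D.α / 2) := by
    have h0 : 0 < 1 / lam := one_div_pos.2 h.l0
    have := Real.rpow_le_rpow_of_exponent_ge h0 (by rw [div_le_one h.l0]; exact h.hl) (by linarith [D.hα1] : D.α / 2 ≤ 1)
    rwa [Real.rpow_one] at this
  set E := e * Real.exp (lam * t) with hE
  have hE0 : 0 ≤ E := mul_nonneg h.he (Real.exp_pos _).le
  set X := (1 / lam) ^ (D.α / 2) * E with hX
  have hEX : E / lam ≤ X := by
    rw [div_eq_mul_one_div, mul_comm]; exact mul_le_mul_of_nonneg_right hlam hE0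
  have a1 := (h.dI0 ht y).trans (mul_le_mul_of_nonneg_left hEX z1)
  have a2 := (h.ddA ht y).trans (mul_le_mul_of_nonneg_left hEX z2)
  have a3 := h.ddN ht y
  rw [← hk3, ← hE, ← hX] at a3
  rw [← hk1] at a1
  rw [← hk2] at a2
  have a4 : |D.ll p t - D.ll q t| ≤ 2 * D.Lv * X := by
    refine (h.dll ht).trans ?_
    have := mul_le_mul_of_nonneg_left hEX (mul_nonneg zero_le_two hLv)
    calc _ = 2 * D.Lv * (E / lam) := by rw [hE]; ring
      _ ≤ _ := this
  have hlp := ll_pos (D := D) (p := p) t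
  have hlq := ll_pos (D := D) (p := q) t
  have hlp' := ll_ge (D := D) (p := p) t
  have hlq' := ll_ge (D := D) (p := q) t
  set Ap := D.I0 (D.th p t) y + duh 1 (D.th p) (D.Nt p) t y with hAp
  set Aq := D.I0 (D.th q t) y + duh 1 (D.th q) (D.Nt q) t y with hAq
  have b1 : |Ap - Aq| ≤ (k1 + k2 + k3) * X := by
    rw [show Ap - Aq = (D.I0 (D.th p t) y - D.I0 (D.th q t) y) + (duh 1 (D.th p) (D.Nt p) t y - duh 1 (D.th q) (D.Nt p) t y)
      + (duh 1 (D.th q) (D.Nt p) t y - duh 1 (D.th q) (D.Nt q) t y) by rw [hAp, hAq]; ring]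
    refine (abs_add_three _ _ _).trans ?_
    linarith
  have b2 : |Aq| ≤ k4 := (abs_add_le _ _).trans (add_le_add (I0_bound _ _) (duh_bd h.hq ht y))
  have hX0 : 0 ≤ X := mul_nonneg (Real.rpow_nonneg (one_div_pos.2 h.l0).le _) hE0
  have e1 : D.Phi p t y - D.Phi q t y = (Ap - Aq) / D.ll p t + Aq * (D.ll q t - D.ll p t) / (D.ll p t * D.ll q t) := by
    unfold Phi; rw [← hAp, ← hAq]; field_simp; ring
  rw [e1]
  refine (abs_add_le _ _).trans ?_
  have c1 : |(Ap - Aq) / D.ll p t| ≤ (k1 + k2 + k3) * X / D.l1 := by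
    rw [abs_div, abs_of_pos hlp]
    exact div_le_div₀ (by positivity) b1 hl1 hlp'
  have c2 : |Aq * (D.ll q t - D.ll p t) / (D.ll p t * D.ll q t)| ≤ k4 * (2 * D.Lv * X) / D.l1 ^ 2 := by
    rw [abs_div, abs_of_pos (mul_pos hlp hlq), abs_mul, abs_sub_comm, pow_two]
    exact div_le_div₀ (by positivity) (mul_le_mul b2 a4 (abs_nonneg _) z4) (by positivity)
      (mul_le_mul hlp' hlq' hl1.le hlp.le)
  refine (add_le_add c1 c2).trans_eq ?_
  rw [hX]; ring

end Cmp
end Dat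
end FBP

namespace FBP
open MeasureTheory Topology

lemma small_pow {γ ε : ℝ} (hγ : 0 < γ) (hε : 0 < ε) : ∃ lam : ℝ, 1 ≤ lam ∧ (1 / lam) ^ γ ≤ ε := by
  have h := tendsto_rpow_neg_atTop hγ
  obtain ⟨lam, h1, h2⟩ := ((h.eventually (gt_mem_nhds hε)).and (eventually_ge_atTop 1)).exists
  refine ⟨lam, h2, ?_⟩
  rw [one_div, Real.inv_rpow (by linarith), ← Real.rpow_neg (by linarith)]
  exact h1.le

namespace Dat
variable {D : Dat} {p q : ℝ → ℝ → ℝ} {R lam e : ℝ}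

/-- Clamp onto the time interval. -/
noncomputable def cl (D : Dat) (t : ℝ) : ℝ := max 0 (min t D.T)
lemma cl_mem (t : ℝ) : D.cl t ∈ Icc 0 D.T := ⟨le_max_left _ _, max_le D.hT.le (min_le_right _ _)⟩
lemma cl_of_mem {t : ℝ} (h : t ∈ Icc 0 D.T) : D.cl t = t := by
  unfold cl; rw [min_eq_left h.2, max_eq_right h.1]
lemma cl_cont : Continuous D.cl := by unfold cl; fun_prop

noncomputable def PhiT (D : Dat) (p : ℝ → ℝ → ℝ) (t y : ℝ) : ℝ := D.Phi p (D.cl t) y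

lemma PhiT_cont (hp : Adm p R) : Continuous (fun z : ℝ × ℝ => D.PhiT p z.1 z.2) := by
  unfold PhiT
  exact (Phi_contOn hp).comp_continuous (f := fun z : ℝ × ℝ => (D.cl z.1, z.2))
    ((cl_cont.comp continuous_fst).prodMk continuous_snd) fun z => ⟨cl_mem _, mem_univ _⟩

open Cmp in
lemma inv (hp : Adm p R) {R0 : ℝ} (hl : 0 < lam) (hR0 : 0 ≤ R0)
    (hb : ∀ s ∈ Icc 0 D.T, ∀ y ∈ Icc (0:ℝ) 1, |p s y| ≤ R0 * Real.exp (lam * s)) {t : ℝ} (ht : t ∈ Icc 0 D.T) (y : ℝ) :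
    |D.Phi p t y| ≤ (D.Bq + 400 * cc D ^ (-(1:ℝ) / 2) * Real.Gamma (1 / 2) * (1 / lam) ^ ((1:ℝ) / 2) * (R0 * D.Cv + D.CF) * Real.exp (lam * t)) / D.l1 := by
  have k := kd (D := D) hp
  have half : (0:ℝ) < 1 / 2 := by norm_num
  have hC := D.Cv0; have hF := D.CF0
  have hcc := Real.rpow_nonneg (cc0 (D := D)).le (-(1:ℝ) / 2)
  have h1 : |duh 1 (D.th p) (D.Nt p) t y| ≤ 400 * (R0 * D.Cv + D.CF) * cc D ^ (-(1:ℝ) / 2) * ((1 / lam) ^ ((1:ℝ) / 2) * Real.Gamma (1 / 2)) * Real.exp (lam * t) := by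
    refine exp_weight_bound half hl ht.1 (by positivity) fun s hs hst => ?_
    refine (k.bd1 hs hst ht.2 (b := (R0 * D.Cv + D.CF) * Real.exp (lam * s)) (fun ξ => ?_) y).trans_eq ?_
    · unfold Nt
      rw [abs_mul, sg_abs, one_mul]
      unfold NN
      refine (abs_add_le _ _).trans ?_
      have e1 := mul_le_mul (hb s ⟨hs, hst.le.trans ht.2⟩ _ (tri_mem ξ)) (VV_bound (D := D) (p := p) s (tri_mem ξ)) (abs_nonneg _) (by positivity)
      rw [← abs_mul] at e1
      have e2 := D.Fb s (D.gg p s + D.ll p s * tri ξ) (D.ww p s (tri ξ))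
      have e3 : D.CF ≤ D.CF * Real.exp (lam * s) := le_mul_of_one_le_right hF (Real.one_le_exp (by positivity))
      linarith
    · unfold cc; ring
  unfold Phi
  rw [abs_div, abs_of_pos (ll_pos t)]
  refine div_le_div₀ ?_ ?_ D.hl1 (ll_ge t)
  · have := D.Bq0; have := (Real.Gamma_pos_of_pos half).le
    have := Real.rpow_nonneg (one_div_pos.2 hl).le ((1:ℝ) / 2)
    positivity
  · refine (abs_add_le _ _).trans (add_le_add (I0_bound _ _) (h1.trans_eq ?_))
    ring

open Cmp in
lemma exists_inv (D : Dat) : ∃ lam R0, 1 ≤ lam ∧ 0 ≤ R0 ∧ ∀ p R, Adm p R →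
    (∀ s ∈ Icc 0 D.T, ∀ y ∈ Icc (0:ℝ) 1, |p s y| ≤ R0 * Real.exp (lam * s)) → ∀ t ∈ Icc 0 D.T, ∀ y,
    |D.Phi p t y| ≤ R0 * Real.exp (lam * t) := by
  set K := 400 * cc D ^ (-(1:ℝ) / 2) * Real.Gamma (1 / 2) with hK
  have hC := D.Cv0; have hF := D.CF0; have hl := D.hl1
  have hcc := Real.rpow_nonneg (cc0 (D := D)).le (-(1:ℝ) / 2)
  have hK0 : 0 ≤ K := by have := (Real.Gamma_pos_of_pos (by norm_num : (0:ℝ) < 1 / 2)).le; positivity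
  obtain ⟨lam, h1, h2⟩ := small_pow (γ := 1 / 2) (ε := D.l1 / (2 * (K * D.Cv + K * D.CF + 1))) (by norm_num) (by positivity)
  have hB := D.Bq0
  refine ⟨lam, 2 * (D.Bq / D.l1 + 1), h1, by positivity, fun p R hp hb t ht y => ?_⟩
  refine (inv hp (by linarith) (by positivity) hb ht y).trans ?_
  set X := (1 / lam) ^ ((1:ℝ) / 2)
  have hX0 : 0 ≤ X := Real.rpow_nonneg (by positivity) _
  rw [le_div_iff₀ (by positivity)] at h2
  have a1 : K * X * D.Cv ≤ D.l1 / 2 := by nlinarith [mul_nonneg (mul_nonneg hK0 hX0) hF]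
  have a2 : K * X * D.CF ≤ D.l1 := by nlinarith [mul_nonneg (mul_nonneg hK0 hX0) hC]
  set Q := Real.exp (lam * t)
  have hQ : 1 ≤ Q := Real.one_le_exp (mul_nonneg (by linarith) ht.1)
  set R0 := 2 * (D.Bq / D.l1 + 1) with hR0
  have hR00 : 0 ≤ R0 := by positivity
  rw [div_le_iff₀ hl]
  have e1 : D.Bq = D.Bq / D.l1 * D.l1 := by field_simp
  have e2 : D.Bq / D.l1 = R0 / 2 - 1 := by rw [hR0]; ring
  have a3 : K * X * (R0 * D.Cv + D.CF) ≤ R0 * (D.l1 / 2) + D.l1 := by nlinarith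
  have a4 := mul_le_mul_of_nonneg_right a3 (by linarith : 0 ≤ Q)
  have a5 : D.Bq ≤ D.Bq * Q := le_mul_of_one_le_right hB hQ
  have e3 : D.Bq = (R0 / 2 - 1) * D.l1 := by rw [← e2]; exact e1
  have e4 : D.Bq * Q = (R0 / 2 - 1) * D.l1 * Q := by rw [e3]
  change D.Bq + K * X * (R0 * D.Cv + D.CF) * Q ≤ R0 * Q * D.l1
  linarith

theorem fix_unique (hp : Adm p R) (hq : Adm q R)
    (hfp : ∀ t ∈ Icc 0 D.T, ∀ y ∈ Icc (0:ℝ) 1, p t y = D.Phi p t y)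
    (hfq : ∀ t ∈ Icc 0 D.T, ∀ y ∈ Icc (0:ℝ) 1, q t y = D.Phi q t y) :
    ∀ t ∈ Icc 0 D.T, ∀ y ∈ Icc (0:ℝ) 1, p t y = q t y := by
  obtain ⟨K, hK0, hK⟩ := Cmp.contr D hp.R0
  obtain ⟨lam, h1, h2⟩ := small_pow (γ := D.α / 2) (ε := 1 / (2 * (K + 1))) (by linarith [D.hα0]) (by positivity)
  have hlam : K * (1 / lam) ^ (D.α / 2) ≤ 1 / 2 := by
    have := mul_le_mul_of_nonneg_left h2 hK0
    refine this.trans ?_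
    rw [mul_one_div, div_le_div_iff₀ (by positivity) (by norm_num)]; linarith
  have key : ∀ n : ℕ, Cmp D p q R lam (2 * R * (1 / 2) ^ n) := by
    have hR := hp.R0
    intro n
    induction n with
    | zero =>
      refine ⟨hp, hq, h1, by positivity, fun s hs y hy => ?_⟩
      have h3 : |p s y - q s y| ≤ 2 * R := (abs_sub _ _).trans (by linarith [hp.b s y, hq.b s y])
      rw [pow_zero, mul_one]
      exact h3.trans (le_mul_of_one_le_right (by positivity) (Real.one_le_exp (mul_nonneg (by linarith) hs.1)))
    | succ n ih =>
      refine ⟨hp, hq, h1, by positivity, fun s hs y hy => ?_⟩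
      rw [hfp s hs y hy, hfq s hs y hy]
      refine (hK p q lam _ ih s hs y).trans ?_
      refine (mul_le_mul_of_nonneg_right hlam (by positivity)).trans_eq ?_
      rw [pow_succ]; ring
  intro t ht y hy
  have hlim : Tendsto (fun n : ℕ => 2 * R * (1 / 2 : ℝ) ^ n * Real.exp (lam * t)) atTop (𝓝 0) := by
    have := ((tendsto_pow_atTop_nhds_zero_of_lt_one (by norm_num : (0:ℝ) ≤ 1 / 2) (by norm_num)).const_mul (2 * R)).mul_const (Real.exp (lam * t))
    simpa using this
  have := ge_of_tendsto' hlim fun n => (key n).hb t ht y hy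
  have := abs_nonpos_iff.1 this
  linarith

theorem fix_exists (D : Dat) : ∃ p R, Adm p R ∧ ∀ t y, p t y = D.PhiT p t y := by
  obtain ⟨lam0, R0, hl0, hR0, hinv⟩ := exists_inv D
  set R := R0 * Real.exp (lam0 * D.T) with hR
  have hRn : 0 ≤ R := by positivity
  obtain ⟨K, hK0, hK⟩ := Cmp.contr D hRn
  obtain ⟨lam, h1, h2⟩ := small_pow (γ := D.α / 2) (ε := 1 / (2 * (K + 1))) (by linarith [D.hα0]) (by positivity)
  have hlam : K * (1 / lam) ^ (D.α / 2) ≤ 1 / 2 := by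
    have := mul_le_mul_of_nonneg_left h2 hK0
    refine this.trans ?_
    rw [mul_one_div, div_le_div_iff₀ (by positivity) (by norm_num)]; linarith
  let P : ℕ → ℝ → ℝ → ℝ := fun n => (D.PhiT)^[n] (fun _ _ => 0)
  have hPs : ∀ n, P (n + 1) = D.PhiT (P n) := fun n => Function.iterate_succ_apply' _ _ _
  have hexp : ∀ t, R0 * Real.exp (lam0 * D.cl t) ≤ R := fun t => by
    rw [hR]; gcongr; exact (cl_mem t).2
  have hP : ∀ n, Adm (P n) R ∧ ∀ s y, |P n s y| ≤ R0 * Real.exp (lam0 * D.cl s) := by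
    intro n
    induction n with
    | zero =>
      refine ⟨⟨continuous_const, fun t y => ?_⟩, fun s y => ?_⟩
      · simp only [P, Function.iterate_zero, id, abs_zero]; exact hRn
      · simp only [P, Function.iterate_zero, id, abs_zero]; positivity
    | succ n ih =>
      rw [hPs]
      have hb : ∀ s y, |D.PhiT (P n) s y| ≤ R0 * Real.exp (lam0 * D.cl s) := fun s y =>
        hinv (P n) R ih.1 (fun s hs y _ => by have := ih.2 s y; rwa [cl_of_mem hs] at this) _ (cl_mem s) y
      exact ⟨⟨PhiT_cont ih.1, fun t y => (hb t y).trans (hexp t)⟩, hb⟩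
  have hcmp : ∀ n : ℕ, (∀ t y, |P (n + 1) t y - P n t y| ≤ 2 * R * (1 / 2) ^ n * Real.exp (lam * D.cl t)) := by
    intro n
    induction n with
    | zero =>
      intro t y
      have h3 : |P 1 t y - P 0 t y| ≤ 2 * R := (abs_sub _ _).trans (by linarith [(hP 1).1.b t y, (hP 0).1.b t y])
      rw [pow_zero, mul_one]
      exact h3.trans (le_mul_of_one_le_right (by positivity) (Real.one_le_exp (mul_nonneg (by linarith) (cl_mem t).1)))
    | succ n ih =>
      intro t y
      rw [hPs (n + 1), hPs n, ← hPs n]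
      have hc : Cmp D (P (n + 1)) (P n) R lam (2 * R * (1 / 2) ^ n) :=
        ⟨(hP _).1, (hP _).1, h1, by positivity, fun s hs y _ => by have := ih s y; rwa [cl_of_mem hs] at this⟩
      have := hK _ _ _ _ hc (D.cl t) (cl_mem t) y
      rw [hPs n] at this ⊢
      refine this.trans ((mul_le_mul_of_nonneg_right hlam (by positivity)).trans_eq ?_)
      rw [pow_succ]; ring
  set W := Real.exp (lam * D.T) with hW
  have hWb : ∀ t, Real.exp (lam * D.cl t) ≤ W := fun t => by
    rw [hW]; gcongr; exact (cl_mem t).2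
  have hdist : ∀ t y n, dist (P n t y) (P (n + 1) t y) ≤ 4 * R * W / 2 / 2 ^ n := fun t y n => by
    rw [dist_comm, Real.dist_eq]
    refine (hcmp n t y).trans ((mul_le_mul_of_nonneg_left (hWb t) (by positivity)).trans_eq ?_)
    rw [one_div_pow]; ring
  have hlim : ∀ t y, ∃ a, Tendsto (fun n => P n t y) atTop (𝓝 a) := fun t y =>
    cauchySeq_tendsto_of_complete (cauchySeq_of_le_geometric_two (hdist t y))
  choose p hp using hlim
  have hpd : ∀ n t y, |P n t y - p t y| ≤ 4 * R * W / 2 ^ n := fun n t y =>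
    dist_le_of_le_geometric_two_of_tendsto (hdist t y) (hp t y) n
  have h0 : Tendsto (fun n : ℕ => 4 * R * W / 2 ^ n) atTop (𝓝 0) := by
    have := (tendsto_pow_atTop_nhds_zero_of_lt_one (by norm_num : (0:ℝ) ≤ 1 / 2) (by norm_num)).const_mul (4 * R * W)
    simpa [div_eq_mul_inv] using this
  have hpc : Continuous (fun z : ℝ × ℝ => p z.1 z.2) := by
    have hu : TendstoUniformly (fun (n : ℕ) (z : ℝ × ℝ) => P n z.1 z.2) (fun z => p z.1 z.2) atTop := by
      rw [Metric.tendstoUniformly_iff]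
      intro ε hε
      filter_upwards [h0.eventually (gt_mem_nhds hε)] with n hn z
      rw [dist_comm]
      exact lt_of_le_of_lt (hpd n z.1 z.2) hn
    exact hu.continuous (Frequently.of_forall fun n => (hP n).1.c)
  have hpa : Adm p R := ⟨hpc, fun t y => le_of_tendsto' ((hp t y).abs) fun n => (hP n).1.b t y⟩
  refine ⟨p, R, hpa, fun t y => ?_⟩
  have hl2 : Tendsto (fun n => P (n + 1) t y) atTop (𝓝 (D.PhiT p t y)) := by
    rw [tendsto_iff_dist_tendsto_zero]
    have h3 : Tendsto (fun n : ℕ => 1 / 2 * (4 * R * W / 2 ^ n * W)) atTop (𝓝 0) := by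
      have := (h0.mul_const W).const_mul (1 / 2 : ℝ); rwa [zero_mul, mul_zero] at this
    refine squeeze_zero (fun _ => dist_nonneg) (fun n => ?_) h3
    have hc : Cmp D (P n) p R lam (4 * R * W / 2 ^ n) :=
      ⟨(hP _).1, hpa, h1, by positivity, fun s hs y _ => (hpd n s y).trans
        (le_mul_of_one_le_right (by positivity) (Real.one_le_exp (mul_nonneg (by linarith) hs.1)))⟩
    rw [hPs n, Real.dist_eq]
    refine (hK _ _ _ _ hc (D.cl t) (cl_mem t) y).trans ?_
    refine mul_le_mul hlam (mul_le_mul_of_nonneg_left (hWb t) (by positivity)) (by positivity) (by norm_num)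
  exact tendsto_nhds_unique ((hp t y).comp (tendsto_add_atTop_nat 1)) hl2

end Dat
end FBP

namespace FBP
open MeasureTheory Topology
namespace Dat
variable {D : Dat} {p : ℝ → ℝ → ℝ} {R : ℝ}

noncomputable def z0 (D : Dat) (y : ℝ) : ℝ := ∫ r in (0:ℝ)..y, D.q0 r

lemma z0_deriv (y : ℝ) : HasDerivAt D.z0 (D.q0 y) y :=
  intervalIntegral.integral_hasDerivAt_right (D.qc.intervalIntegrable _ _)
    (D.qc.stronglyMeasurableAtFilter _ _) D.qc.continuousAt

lemma z0_cont : Continuous D.z0 := continuous_iff_continuousAt.2 fun y => (z0_deriv y).continuousAt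

lemma z0_odd (y : ℝ) : D.z0 (-y) = - D.z0 y := by
  unfold z0
  have h := intervalIntegral.integral_comp_neg (f := D.q0) (a := 0) (b := y)
  simp only [neg_zero, D.q_sym0] at h
  rw [h, intervalIntegral.integral_symm]

lemma z0_one : D.z0 1 = 0 := D.q_int

lemma z0_odd1 (y : ℝ) : D.z0 (2 - y) = - D.z0 y := by
  have h : ∀ x, HasDerivAt (fun x => D.z0 (2 - x) + D.z0 x) 0 x := fun x => by
    have h1 := (z0_deriv (D := D) (2 - x)).comp x ((hasDerivAt_id x).const_sub 2)
    have h2 := h1.add (z0_deriv (D := D) x)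
    rw [D.q_sym1] at h2
    exact h2.congr_deriv (by ring)
  have h2 := is_const_of_deriv_eq_zero (fun x => (h x).differentiableAt) (fun x => (h x).deriv) y 1
  simp only [show (2:ℝ) - 1 = 1 by norm_num, z0_one] at h2
  linarith

lemma z0_bound (y : ℝ) : |D.z0 y| ≤ D.Bq := by
  have hper : Function.Periodic D.z0 2 := fun x => by
    have h1 := z0_odd1 (D := D) (-x)
    rw [z0_odd] at h1
    rw [add_comm, ← sub_neg_eq_add, h1, neg_neg]
  have h1 : D.z0 y = D.z0 (y - kk y * 2) := (hper.sub_int_mul_eq (kk y)).symm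
  rw [h1]
  have h2 := int_le_const 0 (y - kk y * 2) D.qb
  unfold z0
  refine h2.trans (mul_le_of_le_one_right D.Bq0 ?_)
  rw [abs_le]; constructor <;> linarith [kk_le y, lt_kk y]

lemma I0_eq_cv {θ : ℝ} (hθ : 0 < θ) (y : ℝ) : D.I0 θ y = ∫ η, GK 0 θ η * D.q0 (y - η) := by
  have hs := Real.sqrt_pos.2 hθ
  have h := MeasureTheory.Measure.integral_comp_mul_left (fun η => GK 0 θ η * D.q0 (y - η)) (√θ)
  rw [abs_of_pos (inv_pos.2 hs), smul_eq_mul, eq_inv_mul_iff_mul_eq₀ hs.ne', ← integral_const_mul] at h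
  rw [← h]; unfold I0
  congr 1; ext η
  rw [← mul_assoc]; congr 1
  rw [GK0_eq, GK0_eq, ← mul_assoc]
  congr 1
  · rw [Real.sqrt_mul (by positivity : 0 ≤ 4 * Real.pi) 1, Real.sqrt_mul (by positivity : 0 ≤ 4 * Real.pi) θ, Real.sqrt_one]
    have : √(4 * Real.pi) ≠ 0 := (Real.sqrt_pos.2 (by positivity)).ne'
    field_simp
  · congr 1; rw [mul_pow, Real.sq_sqrt hθ.le]; field_simp

lemma cv0_z0_deriv {θ : ℝ} (hθ : 0 < θ) (y : ℝ) : HasDerivAt (cv 0 θ D.z0) (D.I0 θ y) y := by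
  have hi : ∀ φ : ℝ → ℝ, Continuous φ → (∀ x, |φ x| ≤ D.Bq) → ∀ x, Integrable fun η => GK 0 θ η * φ (x - η) := by
    intro φ hc hb x
    refine (GK0_integrable hθ).mul_bdd (c := D.Bq) ?_ (ae_of_all _ fun η => by simpa using hb _)
    exact (hc.comp (continuous_const.sub continuous_id)).aestronglyMeasurable
  have h := (hasDerivAt_integral_of_dominated_loc_of_deriv_le (μ := volume)
    (F := fun x η => GK 0 θ η * D.z0 (x - η)) (F' := fun x η => GK 0 θ η * D.q0 (x - η)) (x₀ := y)
    (s := univ) (bound := fun η => GK 0 θ η * D.Bq) univ_mem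
    (Eventually.of_forall fun x => (hi _ z0_cont z0_bound x).aestronglyMeasurable)
    (hi _ z0_cont z0_bound y) (hi _ D.qc D.qb y).aestronglyMeasurable
    (ae_of_all _ fun η x _ => by
      rw [norm_mul, Real.norm_of_nonneg (GK0_pos hθ η).le]
      exact mul_le_mul_of_nonneg_left (D.qb _) (GK0_pos hθ η).le)
    ((GK0_integrable hθ).mul_const _)
    (ae_of_all _ fun η x _ => by
      have := (z0_deriv (D := D) (x - η)).comp_sub_const x η
      exact this.const_mul _)).2
  rw [I0_eq_cv hθ]
  refine h.congr_of_eventuallyEq (Eventually.of_forall fun x => ?_)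
  exact cv_eq_shift 0 θ D.z0 x

lemma cv1_z0 {θ : ℝ} (hθ : 0 < θ) (y : ℝ) : cv 1 θ D.z0 y = D.I0 θ y :=
  (cv_hasDerivAt_y (j := 0) (by norm_num) hθ z0_cont.measurable z0_bound y).unique (cv0_z0_deriv hθ y)

lemma I0_deriv {θ : ℝ} (hθ : 0 < θ) (y : ℝ) : HasDerivAt (D.I0 θ) (cv 2 θ D.z0 y) y := by
  have := cv_hasDerivAt_y (j := 1) (by norm_num) hθ z0_cont.measurable (z0_bound (D := D)) y
  rwa [show cv 1 θ D.z0 = D.I0 θ from funext fun y => cv1_z0 hθ y] at this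

structure Fx (D : Dat) (p : ℝ → ℝ → ℝ) (R : ℝ) : Prop where
  a : Adm p R
  f : ∀ t ∈ Icc 0 D.T, ∀ y, p t y = D.Phi p t y

theorem fx_exists (D : Dat) : ∃ p R, Fx D p R := by
  obtain ⟨p, R, h1, h2⟩ := fix_exists D
  exact ⟨p, R, h1, fun t ht y => by rw [h2]; unfold PhiT; rw [cl_of_mem ht]⟩

noncomputable def Z (D : Dat) (p : ℝ → ℝ → ℝ) (t y : ℝ) : ℝ := D.ll p t * pr p t y

lemma Z_cont (hp : Adm p R) : Continuous fun z : ℝ × ℝ => D.Z p z.1 z.2 :=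
  ((ll_cont hp.c).comp continuous_fst).mul (pr_cont hp.c)

lemma Z_deriv (hp : Adm p R) (t y : ℝ) : HasDerivAt (D.Z p t) (D.ll p t * p t y) y :=
  (pr_deriv hp.c t y).const_mul _

lemma Z_zero (t : ℝ) : D.Z p t 0 = 0 := by simp [Z, pr]

lemma duh0_deriv (hp : Adm p R) {t : ℝ} (ht0 : 0 ≤ t) (ht : t ≤ D.T) (y : ℝ) :
    HasDerivAt (duh 0 (D.th p) (D.Nt p) t) (duh 1 (D.th p) (D.Nt p) t y) y := by
  have k := kd (D := D) hp
  exact k.duh_hasDerivAt_y (j := 0) (by norm_num) isOpen_univ one_pos (by norm_num : (0:ℝ) < 1 / 2) ht0 ht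
    (fun s y h0 h1 _ => k.bd0 h0 h1 ht y)
    (fun s y h0 h1 _ => k.bd1 h0 h1 ht (k.Nb s) y) (mem_univ y)

lemma Z_eq (h : Fx D p R) {t : ℝ} (ht0 : 0 < t) (ht : t ≤ D.T) (y : ℝ) :
    D.Z p t y = cv 0 (D.th p t) D.z0 y + duh 0 (D.th p) (D.Nt p) t y := by
  have hθ := th_pos (D := D) h.a ht0 ht
  have hd : ∀ x, HasDerivAt (fun x => D.Z p t x - (cv 0 (D.th p t) D.z0 x + duh 0 (D.th p) (D.Nt p) t x)) 0 x := by
    intro x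
    have h1 := (Z_deriv (D := D) h.a t x).sub ((cv0_z0_deriv (D := D) hθ x).add (duh0_deriv (D := D) h.a ht0.le ht x))
    refine h1.congr_deriv ?_
    rw [h.f t ⟨ht0.le, ht⟩ x]
    unfold Phi
    rw [mul_div_cancel₀ _ (ll_pos t).ne', sub_self]
  have h2 := is_const_of_deriv_eq_zero (fun x => (hd x).differentiableAt) (fun x => (hd x).deriv) y 0
  have e1 : cv 0 (D.th p t) D.z0 0 = 0 := cv_odd (Or.inl rfl) (ae_of_all _ fun ξ => by
    rw [mul_zero, zero_sub, z0_odd])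
  have e2 : duh 0 (D.th p) (D.Nt p) t 0 = 0 := by
    unfold duh
    have e : ∀ s, cv 0 (D.th p t - D.th p s) (D.Nt p s) 0 = 0 := fun s => cv_fold0 (Or.inl rfl) (D.NN p s)
    simp only [e, intervalIntegral.integral_zero]
  simp only [Z_zero, e1, e2, add_zero, sub_zero] at h2
  linarith

lemma Z_one' (h : Fx D p R) {t : ℝ} (ht0 : 0 < t) (ht : t ≤ D.T) : D.Z p t 1 = 0 := by
  rw [Z_eq h ht0 ht]
  have e1 : cv 0 (D.th p t) D.z0 1 = 0 := cv_odd (Or.inl rfl) (ae_of_all _ fun ξ => by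
    rw [mul_one, z0_odd1])
  have e2 : duh 0 (D.th p) (D.Nt p) t 1 = 0 := by
    unfold duh
    have e : ∀ s, cv 0 (D.th p t - D.th p s) (D.Nt p s) 1 = 0 := fun s => cv_fold1 (Or.inl rfl) (D.NN p s)
    simp only [e, intervalIntegral.integral_zero]
  rw [e1, e2, add_zero]

lemma Z_init (h : Fx D p R) (y : ℝ) : D.Z p 0 y = D.z0 y := by
  have hd : ∀ x, HasDerivAt (fun x => D.Z p 0 x - D.z0 x) 0 x := by
    intro x
    have h1 := (Z_deriv (D := D) h.a 0 x).sub (z0_deriv (D := D) x)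
    refine h1.congr_deriv ?_
    rw [h.f 0 ⟨le_rfl, D.hT.le⟩ x]
    unfold Phi duh
    rw [mul_div_cancel₀ _ (ll_pos 0).ne', intervalIntegral.integral_same]
    have : D.th p 0 = 0 := by unfold th; exact intervalIntegral.integral_same
    unfold I0
    rw [this, Real.sqrt_zero]
    simp only [zero_mul, sub_zero]
    rw [integral_mul_const, GK0_integral one_pos]; ring
  have h2 := is_const_of_deriv_eq_zero (fun x => (hd x).differentiableAt) (fun x => (hd x).deriv) y 0
  have : D.z0 0 = 0 := intervalIntegral.integral_same
  simp only [Z_zero, this] at h2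
  linarith

lemma Z_one (h : Fx D p R) {t : ℝ} (ht : t ∈ Icc 0 D.T) : D.Z p t 1 = 0 := by
  rcases ht.1.eq_or_lt with h0 | h0
  · rw [← h0, Z_init h, z0_one]
  · exact Z_one' h h0 ht.2

end Dat
end FBP

namespace FBP
open MeasureTheory Topology
namespace Dat
variable {D : Dat} {p : ℝ → ℝ → ℝ} {R : ℝ}

lemma pow_up {x a b : ℝ} (hx0 : 0 ≤ x) (hx : x ≤ 1) (ha : 0 < a) (hab : a ≤ b) : x ^ b ≤ x ^ a := by
  rcases hx0.eq_or_lt with h | h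
  · rw [← h, Real.zero_rpow ha.ne', Real.zero_rpow (by linarith)]
  · exact Real.rpow_le_rpow_of_exponent_ge h hx hab

lemma duh1_hol (hp : Adm p R) : ∃ H, 0 ≤ H ∧ ∀ t ∈ Icc 0 D.T, ∀ y y',
    |duh 1 (D.th p) (D.Nt p) t y - duh 1 (D.th p) (D.Nt p) t y'| ≤ H * |y - y'| ^ ((1:ℝ) / 2) := by
  have k := kd (D := D) hp
  have hB := k.B0
  have hT := D.hT
  have hc := k.hc
  set B := R * D.Cv + D.CF
  set c := D.d / D.LM ^ 2
  have hcp := Real.rpow_nonneg hc.le (-(3:ℝ) / 4)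
  refine ⟨800 * B * c ^ (-(3:ℝ) / 4) * (D.T ^ ((1:ℝ) / 4) / (1 / 4)), by positivity, fun t ht y y' => ?_⟩
  have hi : ∀ y, IntervalIntegrable (fun s => cv 1 (D.th p t - D.th p s) (D.Nt p s) y) volume 0 t := fun y =>
    k.int_s (by norm_num) ht.1 ht.2 (γ := 1 / 2) (by norm_num) fun s h0 h1 => k.bd1 h0 h1 ht.2 (k.Nb s) y
  unfold duh
  rw [← intervalIntegral.integral_sub (hi y) (hi y')]
  have hr := rpow_int (γ := 1 / 4) (by norm_num) 0 t
  have h1 : ∀ s ∈ Ioo 0 t, ‖cv 1 (D.th p t - D.th p s) (D.Nt p s) y - cv 1 (D.th p t - D.th p s) (D.Nt p s) y'‖ ≤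
      800 * B * c ^ (-(3:ℝ) / 4) * |y - y'| ^ ((1:ℝ) / 2) * (t - s) ^ ((1:ℝ) / 4 - 1) := by
    intro s hs
    rw [Real.norm_eq_abs]
    refine (cv1_holder (k.pos hs.1.le hs.2 ht.2) (k.Nm s) (k.Nb s) y y').trans ?_
    have h2 := k.lo s t hs.1.le hs.2.le ht.2
    have h3 : (D.th p t - D.th p s) ^ (-(3:ℝ) / 4) ≤ c ^ (-(3:ℝ) / 4) * (t - s) ^ ((1:ℝ) / 4 - 1) := by
      rw [show (1:ℝ) / 4 - 1 = -(3:ℝ) / 4 by norm_num, ← Real.mul_rpow hc.le (by linarith [hs.2])]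
      exact Real.rpow_le_rpow_of_nonpos (mul_pos hc (by linarith [hs.2])) h2 (by norm_num)
    calc _ ≤ 800 * B * (c ^ (-(3:ℝ) / 4) * (t - s) ^ ((1:ℝ) / 4 - 1)) * |y - y'| ^ ((1:ℝ) / 2) := by gcongr
      _ = _ := by ring
  have h4 := intervalIntegral.norm_integral_le_of_norm_le (μ := volume) (a := 0) (b := t) (f := fun s => cv 1 (D.th p t - D.th p s) (D.Nt p s) y - cv 1 (D.th p t - D.th p s) (D.Nt p s) y') ht.1
    (g := fun s => 800 * B * c ^ (-(3:ℝ) / 4) * |y - y'| ^ ((1:ℝ) / 2) * (t - s) ^ ((1:ℝ) / 4 - 1)) (by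
      have : ∀ᵐ s : ℝ, s ≠ t := by simp [ae_iff]
      filter_upwards [this] with s hst hs
      exact h1 s ⟨hs.1, lt_of_le_of_ne hs.2 hst⟩) (hr.const_mul _)
  rw [Real.norm_eq_abs, intervalIntegral.integral_const_mul, rpow_int_val (by norm_num), sub_zero] at h4
  refine h4.trans ?_
  have h5 : t ^ ((1:ℝ) / 4) ≤ D.T ^ ((1:ℝ) / 4) := Real.rpow_le_rpow ht.1 ht.2 (by norm_num)
  calc _ ≤ 800 * B * c ^ (-(3:ℝ) / 4) * |y - y'| ^ ((1:ℝ) / 2) * (D.T ^ ((1:ℝ) / 4) / (1 / 4)) := by gcongr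
    _ = _ := by ring

lemma p_hol (h : Fx D p R) : ∃ H, 0 ≤ H ∧ ∀ t ∈ Icc 0 D.T, ∀ y y', |y - y'| ≤ 1 →
    |p t y - p t y'| ≤ H * |y - y'| ^ ((1:ℝ) / 2) := by
  obtain ⟨H, hH0, hH⟩ := duh1_hol (D := D) h.a
  have hq := D.Lq0
  have hl1 := D.hl1
  refine ⟨(D.Lq + H) / D.l1, by positivity, fun t ht y y' hy => ?_⟩
  rw [h.f t ht, h.f t ht]; unfold Phi
  rw [← sub_div, abs_div, abs_of_pos (ll_pos t), div_mul_eq_mul_div]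
  have h1 := D.I0_sub (D.th p t) (D.th p t) y y'
  rw [sub_self, abs_zero, mul_zero, mul_zero, add_zero] at h1
  have h2 := hH t ht y y'
  have h3 : |y - y'| ≤ |y - y'| ^ ((1:ℝ) / 2) := by
    have := pow_up (abs_nonneg (y - y')) hy (by norm_num : (0:ℝ) < 1 / 2) (by norm_num : (1:ℝ) / 2 ≤ 1)
    rwa [Real.rpow_one] at this
  have h4 := mul_le_mul_of_nonneg_left h3 hq
  refine div_le_div₀ (by positivity) ?_ hl1 (ll_ge t)
  have e : D.I0 (D.th p t) y + duh 1 (D.th p) (D.Nt p) t y - (D.I0 (D.th p t) y' + duh 1 (D.th p) (D.Nt p) t y')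
    = (D.I0 (D.th p t) y - D.I0 (D.th p t) y') + (duh 1 (D.th p) (D.Nt p) t y - duh 1 (D.th p) (D.Nt p) t y') := by ring
  rw [e]
  refine (abs_add_le _ _).trans ?_
  linarith

lemma NN_hol (h : Fx D p R) : ∃ H, 0 ≤ H ∧ ∀ t ∈ Icc 0 D.T, ∀ y ∈ Icc (0:ℝ) 1, ∀ y' ∈ Icc (0:ℝ) 1,
    |D.NN p t y - D.NN p t y'| ≤ H * |y - y'| ^ D.α := by
  obtain ⟨H, hH0, hH⟩ := p_hol h
  have hC := D.Cv0
  have hR := h.a.R0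
  have hLM := D.LM0
  have hHF := D.HF0
  have hLF := D.LF0
  have hα := D.hα0
  refine ⟨H * D.Cv + R * (2 * D.Cv) + HF D * D.LM ^ D.α + D.LF * (D.LM * R), by positivity, fun t ht y hy y' hy' => ?_⟩
  have hyy : |y - y'| ≤ 1 := by rw [abs_le]; constructor <;> linarith [hy.1, hy.2, hy'.1, hy'.2]
  set X := |y - y'| ^ D.α with hX
  have hX0 : 0 ≤ X := by positivity
  have k1 : |y - y'| ^ ((1:ℝ) / 2) ≤ X := pow_up (abs_nonneg _) hyy D.hα0 D.hα1
  have k2 : |y - y'| ≤ X := by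
    have := pow_up (abs_nonneg (y - y')) hyy D.hα0 (by linarith [D.hα1] : D.α ≤ 1)
    rwa [Real.rpow_one] at this
  have hll := ll_le (p := p) ht
  have hl0 := ll_pos (D := D) (p := p) t
  have a1 : |p t y * D.VV p t y - p t y' * D.VV p t y'| ≤ H * D.Cv * X + R * (2 * D.Cv) * X := by
    have e : p t y * D.VV p t y - p t y' * D.VV p t y' = (p t y - p t y') * D.VV p t y + p t y' * ((D.vh p t - D.vg p t) * (y - y')) := by
      unfold VV; ring
    rw [e]
    refine (abs_add_le _ _).trans (add_le_add ?_ ?_)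
    · rw [abs_mul]
      calc _ ≤ (H * X) * D.Cv := mul_le_mul ((hH t ht y y' hyy).trans (by gcongr)) (VV_bound t hy) (abs_nonneg _) (by positivity)
        _ = _ := by ring
    · rw [abs_mul, abs_mul]
      have b1 : |D.vh p t - D.vg p t| ≤ 2 * D.Cv := by
        refine (abs_sub _ _).trans ?_
        linarith [D.chb t (p t 1), D.cgb t (p t 0), show D.vh p t = D.ch t (p t 1) from rfl, show |D.vh p t| ≤ D.Cv from D.chb _ _, show |D.vg p t| ≤ D.Cv from D.cgb _ _]
      calc _ ≤ R * (2 * D.Cv * X) := by gcongr; exact h.a.b t y'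
        _ = _ := by ring
  have a2 : |D.F t (D.gg p t + D.ll p t * y) (D.ww p t y) - D.F t (D.gg p t + D.ll p t * y') (D.ww p t y')| ≤ D.HF * D.LM ^ D.α * X + D.LF * (D.LM * R) * X := by
    refine (abs_sub_le _ (D.F t (D.gg p t + D.ll p t * y') (D.ww p t y)) _).trans (add_le_add ?_ ?_)
    · refine (D.Fh _ _ _ _).trans ?_
      rw [show D.gg p t + D.ll p t * y - (D.gg p t + D.ll p t * y') = D.ll p t * (y - y') by ring, abs_mul, abs_of_pos hl0,
        Real.mul_rpow hl0.le (abs_nonneg _), ← mul_assoc]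
      gcongr
    · refine (D.Fl _ _ _ _).trans ?_
      rw [mul_assoc D.LF]
      refine mul_le_mul_of_nonneg_left ?_ hLF
      unfold ww
      rw [show D.δ + D.ll p t * pr p t y - (D.δ + D.ll p t * pr p t y') = D.ll p t * (pr p t y - pr p t y') by ring, abs_mul, abs_of_pos hl0, mul_assoc]
      refine mul_le_mul hll ((pr_sub h.a t y y').trans (by gcongr)) (abs_nonneg _) hLM.le
  have e : D.NN p t y - D.NN p t y' = (p t y * D.VV p t y - p t y' * D.VV p t y') + (D.F t (D.gg p t + D.ll p t * y) (D.ww p t y) - D.F t (D.gg p t + D.ll p t * y') (D.ww p t y')) := by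
    unfold NN; ring
  rw [e]
  refine (abs_add_le _ _).trans ?_
  linarith

lemma Nt_hol (h : Fx D p R) {r : ℝ} (hr : 0 < r) : ∃ H, ∀ t ∈ Icc 0 D.T, ∀ y ∈ Icc r (1 - r), ∀ ξ,
    |D.Nt p t ξ - D.Nt p t y| ≤ H * |ξ - y| ^ D.α := by
  obtain ⟨H, hH0, hH⟩ := NN_hol h
  have k := kd (D := D) h.a
  have hB := k.B0
  set B := R * D.Cv + D.CF
  refine ⟨H + 2 * B / r ^ D.α, fun t ht y hy ξ => ?_⟩
  have hX : 0 ≤ |ξ - y| ^ D.α := by positivity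
  have hrp : 0 < r ^ D.α := Real.rpow_pos_of_pos hr _
  by_cases hξ : |ξ - y| < r
  · rw [abs_lt] at hξ
    have h1 : ξ ∈ Ico (0:ℝ) 1 := ⟨by linarith [hy.1], by linarith [hy.2]⟩
    have h2 : y ∈ Ico (0:ℝ) 1 := ⟨by linarith [hy.1], by linarith [hy.2]⟩
    unfold Nt
    rw [sg_of_mem h1, sg_of_mem h2, tri_of_mem (Ico_subset_Icc_self h1), tri_of_mem (Ico_subset_Icc_self h2), one_mul, one_mul]
    refine (hH t ht ξ (Ico_subset_Icc_self h1) y (Ico_subset_Icc_self h2)).trans ?_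
    refine mul_le_mul_of_nonneg_right ?_ hX
    have : 0 ≤ 2 * B / r ^ D.α := by positivity
    linarith
  · push Not at hξ
    have h1 : r ^ D.α ≤ |ξ - y| ^ D.α := Real.rpow_le_rpow hr.le hξ D.hα0.le
    have h2 : |D.Nt p t ξ - D.Nt p t y| ≤ 2 * B := (abs_sub _ _).trans (by linarith [k.Nb t ξ, k.Nb t y])
    refine h2.trans ?_
    have h3 : 2 * B / r ^ D.α * r ^ D.α = 2 * B := by field_simp
    have h4 : 2 * B / r ^ D.α * r ^ D.α ≤ 2 * B / r ^ D.α * |ξ - y| ^ D.α := by gcongr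
    rw [add_mul]
    have := mul_nonneg hH0 hX
    linarith

/-- second derivative of `Z` in `y`. -/
noncomputable def S (D : Dat) (p : ℝ → ℝ → ℝ) (t y : ℝ) : ℝ :=
  cv 2 (D.th p t) D.z0 y + duh 2 (D.th p) (D.Nt p) t y

lemma bd2' (h : Fx D p R) {r : ℝ} (hr : 0 < r) : ∃ K, ∀ s t y, 0 ≤ s → s < t → t ≤ D.T → y ∈ Icc r (1 - r) →
      |cv 2 (D.th p t - D.th p s) (D.Nt p s) y| ≤ K * (t - s) ^ (D.α / 2 - 1) := by
  obtain ⟨H, hH⟩ := Nt_hol h hr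
  have k := kd (D := D) h.a
  exact ⟨_, fun s t y h0 h1 h2 hy => k.bd2 h0 h1 h2 D.hα0.le (by linarith [D.hα1]) (hH s ⟨h0, by linarith⟩ y hy)⟩

lemma half_r {y : ℝ} (hy : y ∈ Ioo (0:ℝ) 1) : ∃ r, 0 < r ∧ y ∈ Ioo r (1 - r) :=
  ⟨min y (1 - y) / 2, by have := lt_min hy.1 (sub_pos.2 hy.2); linarith,
    by have := min_le_left y (1 - y); linarith [hy.1], by have := min_le_right y (1 - y); linarith [hy.2]⟩

lemma p_deriv (h : Fx D p R) {t y : ℝ} (ht0 : 0 < t) (ht : t ≤ D.T) (hy : y ∈ Ioo (0:ℝ) 1) :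
    HasDerivAt (p t) (D.S p t y / D.ll p t) y := by
  obtain ⟨r, hr, hyr⟩ := half_r hy
  obtain ⟨K, hK⟩ := bd2' h hr
  have k := kd (D := D) h.a
  have h1 := k.duh_hasDerivAt_y (j := 1) (by norm_num) (isOpen_Ioo (a := r) (b := 1 - r)) (by norm_num : (0:ℝ) < 1 / 2)
    (γ' := D.α / 2) (by linarith [D.hα0]) ht0.le ht
    (fun s y h0 h1 _ => k.bd1 h0 h1 ht (k.Nb s) y)
    (fun s y h0 h1 hy => hK s t y h0 h1 ht (Ioo_subset_Icc_self hy)) hyr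
  have h2 := ((I0_deriv (D := D) (th_pos h.a ht0 ht) y).add h1).div_const (D.ll p t)
  refine h2.congr_of_eventuallyEq (Eventually.of_forall fun x => ?_)
  exact h.f t ⟨ht0.le, ht⟩ x

lemma S_cont (h : Fx D p R) : ContinuousOn (fun z : ℝ × ℝ => D.S p z.1 z.2) (Ioo 0 D.T ×ˢ Ioo (0:ℝ) 1) := by
  rintro ⟨t, y⟩ ⟨ht, hy⟩
  obtain ⟨r, hr, hyr⟩ := half_r hy
  obtain ⟨K, hK⟩ := bd2' h hr
  have k := kd (D := D) h.a
  have h1 := k.duh_cont (j := 2) (by norm_num) (U := Icc r (1 - r)) (γ := D.α / 2) (by linarith [D.hα0])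
    (fun s t y h0 h1 h2 hy => hK s t y h0 h1 h2 hy)
  have h2 : ContinuousAt (fun q : ℝ × ℝ => duh 2 (D.th p) (D.Nt p) q.1 q.2) (t, y) :=
    h1.continuousAt (prod_mem_nhds (Icc_mem_nhds ht.1 ht.2) (Icc_mem_nhds hyr.1 hyr.2))
  have h3 : ContinuousAt (fun q : ℝ × ℝ => cv 2 (D.th p q.1) D.z0 q.2) (t, y) :=
    cv_continuousAt (j := 2) (by norm_num) (θ := fun q : ℝ × ℝ => D.th p q.1) (y := fun q : ℝ × ℝ => q.2) (φ := fun _ => D.z0)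
      (((th_cont h.a.c).comp continuous_fst).continuousAt) (th_pos h.a ht.1 ht.2.le) (fun _ => z0_cont.measurable)
      (Eventually.of_forall fun _ => z0_bound) (ae_of_all _ fun η => by
        exact (z0_cont.comp (continuous_snd.sub continuous_const)).continuousAt)
  exact (h3.add h2).continuousWithinAt

noncomputable def Zt (D : Dat) (p : ℝ → ℝ → ℝ) (t y : ℝ) : ℝ :=
  D.d / D.ll p t ^ 2 * D.S p t y + D.NN p t y

lemma Z_deriv_t (h : Fx D p R) {t y : ℝ} (ht : t ∈ Ioo 0 D.T) (hy : y ∈ Ioo (0:ℝ) 1) :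
    HasDerivAt (fun t => D.Z p t y) (D.Zt p t y) t := by
  obtain ⟨r, hr, hyr⟩ := half_r hy
  obtain ⟨H, hH⟩ := Nt_hol h hr
  have k := kd (D := D) h.a
  have hn : ∀ n : ℤ, y ≠ n := by
    rintro n rfl
    have h1 : (0:ℤ) < n := by exact_mod_cast hy.1
    have h2 : n < (1:ℤ) := by exact_mod_cast hy.2
    omega
  have h1 := k.duh0_hasDerivAt_t (thd_cont h.a.c) (th_deriv h.a.c) D.hα0 (by linarith [D.hα1]) hn
    (fun s hs ξ => hH s hs y (Ioo_subset_Icc_self hyr) ξ) ht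
  have h2 := (cv_hasDerivAt_t (j := 0) (by norm_num) (th_pos h.a ht.1 ht.2.le) z0_cont.measurable (z0_bound (D := D)) y).comp t (th_deriv h.a.c t)
  have h3 := (h2.add h1).congr_of_eventuallyEq (f₁ := fun t => D.Z p t y) (by
    filter_upwards [Ioo_mem_nhds ht.1 ht.2] with s hs
    exact Z_eq h hs.1 hs.2.le y)
  refine h3.congr_deriv ?_
  have : D.Nt p t y = D.NN p t y := by
    unfold Nt; rw [sg_of_mem ⟨hy.1.le, hy.2⟩, tri_of_mem ⟨hy.1.le, hy.2.le⟩, one_mul]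
  rw [this]; unfold Zt S
  simp only [zero_add]
  ring

lemma Zt_cont (h : Fx D p R) : ContinuousOn (fun z : ℝ × ℝ => D.Zt p z.1 z.2) (Ioo 0 D.T ×ˢ Ioo (0:ℝ) 1) := by
  have h1 : Continuous fun z : ℝ × ℝ => D.d / D.ll p z.1 ^ 2 := (thd_cont h.a.c).comp continuous_fst
  exact (h1.continuousOn.mul (S_cont h)).add (NN_cont h.a.c).continuousOn

lemma Z_strict (h : Fx D p R) {t y : ℝ} (ht : t ∈ Ioo 0 D.T) (hy : y ∈ Ioo (0:ℝ) 1) :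
    HasStrictFDerivAt (fun z : ℝ × ℝ => D.Z p z.1 z.2)
      ((ContinuousLinearMap.toSpanSingleton ℝ (D.Zt p t y)).coprod (ContinuousLinearMap.toSpanSingleton ℝ (D.ll p t * p t y))) (t, y) := by
  have hn : Ioo 0 D.T ×ˢ Ioo (0:ℝ) 1 ∈ 𝓝 (t, y) := prod_mem_nhds (Ioo_mem_nhds ht.1 ht.2) (Ioo_mem_nhds hy.1 hy.2)
  have := hasStrictFDerivAt_uncurry_coprod (𝕜 := ℝ) (u := (t, y)) (f := D.Z p)
    (f₁ := fun t y => ContinuousLinearMap.toSpanSingleton ℝ (D.Zt p t y))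
    (f₂ := fun t y => ContinuousLinearMap.toSpanSingleton ℝ (D.ll p t * p t y))
    (by filter_upwards [hn] with z hz; exact (Z_deriv_t h hz.1 hz.2).hasFDerivAt)
    (by filter_upwards with z; exact (Z_deriv h.a z.1 z.2).hasFDerivAt)
    ((ContinuousLinearMap.toSpanSingletonCLE (𝕜 := ℝ) (E := ℝ)).continuous.continuousAt.comp ((Zt_cont h).continuousAt hn))
    ((ContinuousLinearMap.toSpanSingletonCLE (𝕜 := ℝ) (E := ℝ)).continuous.continuousAt.comp
      (((ll_cont h.a.c).comp continuous_fst).mul h.a.c).continuousAt)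
  exact this

end Dat
end FBP

namespace FBP
open MeasureTheory Topology

/-- Solution of a scalar parabolic equation in a moving domain. -/
structure PS (d T : ℝ) (F : ℝ → ℝ → ℝ → ℝ) (u : ℝ → ℝ → ℝ) (g h : ℝ → ℝ) : Prop where
  gc : ContinuousOn g (Ico 0 T)
  hc : ContinuousOn h (Ico 0 T)
  uc : ContinuousOn (fun z : ℝ × ℝ => u z.1 z.2) {z | z.1 ∈ Ico 0 T ∧ z.2 ∈ Icc (g z.1) (h z.1)}
  ut : ∀ t ∈ Ioo 0 T, ∀ x ∈ Ioo (g t) (h t), DifferentiableAt ℝ (fun s => u s x) t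
  ux : ∀ t ∈ Ioo 0 T, ∀ x ∈ Ioo (g t) (h t), DifferentiableAt ℝ (u t) x
  uxx : ∀ t ∈ Ioo 0 T, ∀ x ∈ Ioo (g t) (h t), DifferentiableAt ℝ (deriv (u t)) x
  pde : ∀ t ∈ Ioo 0 T, ∀ x ∈ Ioo (g t) (h t),
    deriv (fun s => u s x) t = d * deriv (deriv (u t)) x + F t x (u t x)

lemma second_deriv_max {v : ℝ → ℝ} {x : ℝ} (hm : IsLocalMax v x) (hc : ContinuousAt v x) :
    deriv (deriv v) x ≤ 0 := by
  by_contra hcon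
  push Not at hcon
  have h1 := isLocalMin_of_deriv_deriv_pos hcon hm.deriv_eq_zero hc
  have h2 : v =ᶠ[𝓝 x] fun _ => v x := by
    filter_upwards [hm, h1] with y h3 h4
    exact le_antisymm h3 h4
  have h3 : deriv v =ᶠ[𝓝 x] fun _ => 0 := by
    have := h2.deriv
    simpa using this
  have := h3.deriv_eq
  rw [this] at hcon
  simp at hcon

lemma deriv_left_max {v : ℝ → ℝ} {t : ℝ} (hm : ∀ᶠ s in 𝓝[<] t, v s ≤ v t) : 0 ≤ deriv v t := by
  by_cases hd : DifferentiableAt ℝ v t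
  · have h1 := hd.hasDerivAt.hasDerivWithinAt (s := Iio t)
    rw [hasDerivWithinAt_iff_tendsto_slope' (by simp)] at h1
    refine ge_of_tendsto h1 ?_
    filter_upwards [hm, self_mem_nhdsWithin] with s h2 h3
    rw [slope_def_field]
    exact div_nonneg_of_nonpos (by linarith) (by linarith [show s < t from h3])
  · rw [deriv_zero_of_not_differentiableAt hd]

lemma dom_compact {T : ℝ} {g h : ℝ → ℝ} (hg : ContinuousOn g (Icc 0 T)) (hh : ContinuousOn h (Icc 0 T)) :
    IsCompact {z : ℝ × ℝ | z.1 ∈ Icc 0 T ∧ z.2 ∈ Icc (g z.1) (h z.1)} := by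
  set f : ℝ × ℝ → ℝ × ℝ := fun q => (q.1, g q.1 + q.2 * (h q.1 - g q.1))
  have h1 : {z : ℝ × ℝ | z.1 ∈ Icc 0 T ∧ z.2 ∈ Icc (g z.1) (h z.1)} = f '' {q | q ∈ Icc 0 T ×ˢ Icc (0:ℝ) 1 ∧ g q.1 ≤ h q.1} := by
    ext ⟨t, x⟩
    constructor
    · rintro ⟨h1, h2⟩
      have hle : g t ≤ h t := h2.1.trans h2.2
      rcases hle.eq_or_lt with he | hlt
      · refine ⟨(t, 0), ⟨⟨h1, by simp⟩, hle⟩, ?_⟩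
        have : x = g t := le_antisymm (by have := h2.2; simp only at this; linarith) h2.1
        simp [f, this]
      · refine ⟨(t, (x - g t) / (h t - g t)), ⟨⟨h1, ?_⟩, hle⟩, ?_⟩
        · have h3 := h2.1; have h4 := h2.2
          simp only at h3 h4
          exact ⟨div_nonneg (by linarith) (by linarith), by rw [div_le_one (by linarith)]; linarith⟩
        · simp only [f]
          rw [div_mul_cancel₀ _ (by linarith)]; simp
    · rintro ⟨⟨s, y⟩, ⟨⟨h1, h2⟩, h3⟩, h4⟩
      simp only [f, Prod.mk.injEq] at h4
      obtain ⟨rfl, rfl⟩ := h4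
      simp only at h1 h2 h3
      refine ⟨h1, ?_, ?_⟩ <;> simp only <;> nlinarith [h2.1, h2.2]
  rw [h1]
  have gc : ContinuousOn (fun q : ℝ × ℝ => g q.1) (Icc 0 T ×ˢ Icc (0:ℝ) 1) := hg.comp continuousOn_fst fun q hq => hq.1
  have hc : ContinuousOn (fun q : ℝ × ℝ => h q.1) (Icc 0 T ×ˢ Icc (0:ℝ) 1) := hh.comp continuousOn_fst fun q hq => hq.1
  have hK : IsCompact (Icc 0 T ×ˢ Icc (0:ℝ) 1) := isCompact_Icc.prod isCompact_Icc
  refine IsCompact.image_of_continuousOn (hK.of_isClosed_subset ?_ fun q hq => hq.1) ?_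
  · have := hc.sub gc |>.preimage_isClosed_of_isClosed hK.isClosed isClosed_Ici (t := Ici 0)
    convert this using 1
    ext q; simp [sub_nonneg]
  · refine ContinuousOn.mono ?_ (fun q hq => hq.1 : _ ⊆ Icc 0 T ×ˢ Icc (0:ℝ) 1)
    exact continuousOn_fst.prodMk (gc.add (continuousOn_snd.mul (hc.sub gc)))

/-- Maximum principle in a moving domain. -/
theorem max_principle {T : ℝ} {g h : ℝ → ℝ} {v : ℝ → ℝ → ℝ} (hg : ContinuousOn g (Icc 0 T))
    (hh : ContinuousOn h (Icc 0 T))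
    (hv : ContinuousOn (fun z : ℝ × ℝ => v z.1 z.2) {z | z.1 ∈ Icc 0 T ∧ z.2 ∈ Icc (g z.1) (h z.1)})
    (h0 : ∀ x ∈ Icc (g 0) (h 0), v 0 x ≤ 0)
    (hgb : ∀ t ∈ Ioc 0 T, v t (g t) ≤ 0) (hhb : ∀ t ∈ Ioc 0 T, v t (h t) ≤ 0)
    (hin : ∀ t ∈ Ioc 0 T, ∀ x ∈ Ioo (g t) (h t), 0 < v t x → 0 ≤ deriv (fun s => v s x) t →
      deriv (v t) x = 0 → deriv (deriv (v t)) x ≤ 0 → False) :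
    ∀ t ∈ Icc 0 T, ∀ x ∈ Icc (g t) (h t), v t x ≤ 0 := by
  intro t1 ht1 x1 hx1
  by_contra hcon
  push Not at hcon
  obtain ⟨⟨t, x⟩, ⟨ht, hx⟩, hmax⟩ := (dom_compact hg hh).exists_isMaxOn ⟨(t1, x1), ⟨ht1, hx1⟩⟩ hv
  simp only at ht hx
  have hpos : 0 < v t x := hcon.trans_le (hmax (a := (t1, x1)) ⟨ht1, hx1⟩)
  have ht0 : 0 < t := by
    rcases ht.1.eq_or_lt with h | h
    · subst h; exact absurd (h0 x hx) (not_le.2 hpos)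
    · exact h
  have hxg : g t < x := by
    rcases hx.1.eq_or_lt with h | h
    · rw [← h] at hpos; exact absurd (hgb t ⟨ht0, ht.2⟩) (not_le.2 hpos)
    · exact h
  have hxh : x < h t := by
    rcases hx.2.eq_or_lt with h | h
    · rw [h] at hpos; exact absurd (hhb t ⟨ht0, ht.2⟩) (not_le.2 hpos)
    · exact h
  have hlm : IsLocalMax (v t) x := by
    filter_upwards [Icc_mem_nhds hxg hxh] with y hy
    exact hmax (a := (t, y)) ⟨ht, hy⟩
  have hcx : ContinuousAt (v t) x := by
    have : ContinuousOn (v t) (Icc (g t) (h t)) :=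
      hv.comp (f := fun y => (t, y)) (Continuous.continuousOn (by fun_prop)) fun y hy => ⟨ht, hy⟩
    exact this.continuousAt (Icc_mem_nhds hxg hxh)
  refine hin t ⟨ht0, ht.2⟩ x ⟨hxg, hxh⟩ hpos ?_ hlm.deriv_eq_zero (second_deriv_max hlm hcx)
  refine deriv_left_max ?_
  have hsub : 𝓝[<] t ≤ 𝓝[Icc 0 T] t := by
    rw [nhdsWithin_le_iff]
    filter_upwards [Ioo_mem_nhdsLT ht0] with s hs
    exact ⟨hs.1.le, hs.2.le.trans ht.2⟩
  have e1 := hsub ((hg t ht).eventually (gt_mem_nhds hxg))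
  have e2 := hsub ((hh t ht).eventually (lt_mem_nhds hxh))
  have e3 : ∀ᶠ s in 𝓝[<] t, s ∈ Icc 0 T := by
    filter_upwards [Ioo_mem_nhdsLT ht0] with s hs
    exact ⟨hs.1.le, hs.2.le.trans ht.2⟩
  filter_upwards [e1, e2, e3] with s h1 h2 h3
  exact hmax (a := (s, x)) ⟨h3, h1.le, h2.le⟩

namespace PS
variable {d T : ℝ} {F : ℝ → ℝ → ℝ → ℝ} {u : ℝ → ℝ → ℝ} {g h : ℝ → ℝ}

/-- Comparison of a solution with an explicit barrier `B` (with sign `σ = ±1`) in a subdomain. -/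
theorem barrier (H : PS d T F u g h) (hd : 0 ≤ d) {T' σ : ℝ} (hT : T' < T) {g' h' : ℝ → ℝ}
    (hg' : ContinuousOn g' (Icc 0 T')) (hh' : ContinuousOn h' (Icc 0 T'))
    (hgg : ∀ t ∈ Icc 0 T', g t ≤ g' t) (hhh : ∀ t ∈ Icc 0 T', h' t ≤ h t)
    {B Bt Bx Bxx : ℝ → ℝ → ℝ}
    (hB : ContinuousOn (fun z : ℝ × ℝ => B z.1 z.2) {z | z.1 ∈ Icc 0 T' ∧ z.2 ∈ Icc (g' z.1) (h' z.1)})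
    (hBt : ∀ t ∈ Ioc 0 T', ∀ x ∈ Ioo (g' t) (h' t), HasDerivAt (fun s => B s x) (Bt t x) t)
    (hBx : ∀ t ∈ Ioc 0 T', ∀ x ∈ Ioo (g' t) (h' t), HasDerivAt (B t) (Bx t x) x)
    (hBxx : ∀ t ∈ Ioc 0 T', ∀ x ∈ Ioo (g' t) (h' t), HasDerivAt (Bx t) (Bxx t x) x)
    (h0 : ∀ x ∈ Icc (g' 0) (h' 0), σ * u 0 x ≤ σ * B 0 x)
    (hgb : ∀ t ∈ Ioc 0 T', σ * u t (g' t) ≤ σ * B t (g' t))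
    (hhb : ∀ t ∈ Ioc 0 T', σ * u t (h' t) ≤ σ * B t (h' t))
    (hin : ∀ t ∈ Ioc 0 T', ∀ x ∈ Ioo (g' t) (h' t), σ * B t x < σ * u t x →
      σ * (d * Bxx t x + F t x (u t x)) < σ * Bt t x) :
    ∀ t ∈ Icc 0 T', ∀ x ∈ Icc (g' t) (h' t), σ * u t x ≤ σ * B t x := by
  have key := max_principle (T := T') (g := g') (h := h') (v := fun t x => σ * (u t x - B t x)) hg' hh' ?_ ?_ ?_ ?_ ?_
  · intro t ht x hx
    have := key t ht x hx
    linarith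
  · refine continuousOn_const.mul ((H.uc.mono ?_).sub hB)
    rintro ⟨t, x⟩ ⟨h1, h2⟩
    exact ⟨⟨h1.1, lt_of_le_of_lt h1.2 hT⟩, (hgg t h1).trans h2.1, h2.2.trans (hhh t h1)⟩
  · intro x hx; linarith [h0 x hx]
  · intro t ht; linarith [hgb t ht]
  · intro t ht; linarith [hhb t ht]
  · intro t ht x hx hpos h1 h2 h3
    have hs : ∀ y ∈ Ioo (g' t) (h' t), y ∈ Ioo (g t) (h t) := fun y hy =>
      ⟨(hgg t ⟨ht.1.le, ht.2⟩).trans_lt hy.1, hy.2.trans_le (hhh t ⟨ht.1.le, ht.2⟩)⟩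
    have htT : t ∈ Ioo 0 T := ⟨ht.1, ht.2.trans_lt hT⟩
    have e1 : deriv (fun s => σ * (u s x - B s x)) t = σ * (deriv (fun s => u s x) t - Bt t x) :=
      (((H.ut t htT x (hs x hx)).hasDerivAt.sub (hBt t ht x hx)).const_mul σ).deriv
    have e2 : deriv (fun y => σ * (u t y - B t y)) =ᶠ[𝓝 x] fun y => σ * (deriv (u t) y - Bx t y) := by
      filter_upwards [Ioo_mem_nhds hx.1 hx.2] with y hy
      exact (((H.ux t htT y (hs y hy)).hasDerivAt.sub (hBx t ht y hy)).const_mul σ).deriv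
    have e3 : deriv (fun y => σ * (deriv (u t) y - Bx t y)) x = σ * (deriv (deriv (u t)) x - Bxx t x) :=
      (((H.uxx t htT x (hs x hx)).hasDerivAt.sub (hBxx t ht x hx)).const_mul σ).deriv
    rw [e1, H.pde t htT x (hs x hx)] at h1
    change deriv (deriv (fun y => σ * (u t y - B t y))) x ≤ 0 at h3
    rw [e2.deriv_eq, e3] at h3
    have h4 := hin t ht x hx (by linarith)
    have h5 := mul_nonneg hd (neg_nonneg.2 h3)
    nlinarith

end PS
end FBP

namespace FBP
open MeasureTheory Topology

namespace PS
variable {d T : ℝ} {F : ℝ → ℝ → ℝ → ℝ} {u : ℝ → ℝ → ℝ} {g h : ℝ → ℝ}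

lemma upper (H : PS d T F u g h) (hd : 0 ≤ d) {T' M : ℝ} (hT : T' < T)
    (h0 : ∀ x ∈ Icc (g 0) (h 0), u 0 x ≤ M) (hgb : ∀ t ∈ Ioc 0 T', u t (g t) ≤ M)
    (hhb : ∀ t ∈ Ioc 0 T', u t (h t) ≤ M)
    (hF : ∀ t ∈ Ioc 0 T', ∀ x ∈ Ioo (g t) (h t), M < u t x → F t x (u t x) < 0) :
    ∀ t ∈ Icc 0 T', ∀ x ∈ Icc (g t) (h t), u t x ≤ M := by
  have hsub : Icc 0 T' ⊆ Ico 0 T := fun t ht => ⟨ht.1, ht.2.trans_lt hT⟩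
  have := H.barrier hd (σ := 1) hT (H.gc.mono hsub) (H.hc.mono hsub) (fun _ _ => le_rfl) (fun _ _ => le_rfl)
    (B := fun _ _ => M) (Bt := fun _ _ => 0) (Bx := fun _ _ => 0) (Bxx := fun _ _ => 0) continuousOn_const
    (fun _ _ _ _ => hasDerivAt_const _ _) (fun _ _ _ _ => hasDerivAt_const _ _) (fun _ _ _ _ => hasDerivAt_const _ _)
    (by simpa using h0) (by simpa using hgb) (by simpa using hhb) (by simpa using hF)
  simpa using this

lemma lower (H : PS d T F u g h) (hd : 0 ≤ d) {T' m K : ℝ} (hK : 0 ≤ K) (hm : 0 ≤ m) (hT : T' < T)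
    (h0 : ∀ x ∈ Icc (g 0) (h 0), m ≤ u 0 x) (hgb : ∀ t ∈ Ioc 0 T', m ≤ u t (g t))
    (hhb : ∀ t ∈ Ioc 0 T', m ≤ u t (h t))
    (hF : ∀ t ∈ Ioc 0 T', ∀ x ∈ Ioo (g t) (h t), u t x < m * Real.exp (-K * t) →
      -(K * (m * Real.exp (-K * t))) < F t x (u t x)) :
    ∀ t ∈ Icc 0 T', ∀ x ∈ Icc (g t) (h t), m * Real.exp (-K * t) ≤ u t x := by
  have hsub : Icc 0 T' ⊆ Ico 0 T := fun t ht => ⟨ht.1, ht.2.trans_lt hT⟩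
  have hle : ∀ t, 0 < t → m * Real.exp (-K * t) ≤ m := fun t ht =>
    mul_le_of_le_one_right hm (Real.exp_le_one_iff.2 (by nlinarith))
  have := H.barrier hd (σ := -1) hT (H.gc.mono hsub) (H.hc.mono hsub) (fun _ _ => le_rfl) (fun _ _ => le_rfl)
    (B := fun t _ => m * Real.exp (-K * t)) (Bt := fun t _ => -(K * (m * Real.exp (-K * t)))) (Bx := fun _ _ => 0) (Bxx := fun _ _ => 0)
    (Continuous.continuousOn (by fun_prop))
    (fun t _ _ _ => by
      have := (((hasDerivAt_id t).const_mul (-K)).exp).const_mul m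
      refine this.congr_deriv ?_
      simp only [id]; ring)
    (fun _ _ _ _ => hasDerivAt_const _ _) (fun _ _ _ _ => hasDerivAt_const _ _)
    (by intro x hx; have := h0 x hx; simp; linarith)
    (by intro t ht; have := hgb t ht; have := hle t ht.1; linarith)
    (by intro t ht; have := hhb t ht; have := hle t ht.1; linarith)
    (by intro t ht x hx hh; have := hF t ht x hx (by linarith); linarith)
  intro t ht x hx
  have := this t ht x hx
  linarith

/-- Comparison of two solutions in the same domain. -/
theorem compare {F' : ℝ → ℝ → ℝ → ℝ} {u' : ℝ → ℝ → ℝ} (H : PS d T F u g h) (H' : PS d T F' u' g h) (hd : 0 ≤ d) {T' L : ℝ}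
    (hT : T' < T) (h0 : ∀ x ∈ Icc (g 0) (h 0), u 0 x ≤ u' 0 x) (hgb : ∀ t ∈ Ioc 0 T', u t (g t) ≤ u' t (g t))
    (hhb : ∀ t ∈ Ioc 0 T', u t (h t) ≤ u' t (h t))
    (hF : ∀ t ∈ Ioc 0 T', ∀ x ∈ Ioo (g t) (h t), u' t x < u t x → F t x (u t x) - F' t x (u' t x) ≤ L * (u t x - u' t x)) :
    ∀ t ∈ Icc 0 T', ∀ x ∈ Icc (g t) (h t), u t x ≤ u' t x := by
  have hsub : Icc 0 T' ⊆ Ico 0 T := fun t ht => ⟨ht.1, ht.2.trans_lt hT⟩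
  have hsub2 : {z : ℝ × ℝ | z.1 ∈ Icc 0 T' ∧ z.2 ∈ Icc (g z.1) (h z.1)} ⊆ {z | z.1 ∈ Ico 0 T ∧ z.2 ∈ Icc (g z.1) (h z.1)} :=
    fun z hz => ⟨hsub hz.1, hz.2⟩
  have key := max_principle (T := T') (g := g) (h := h) (v := fun t x => Real.exp (-(L + 1) * t) * (u t x - u' t x))
    (H.gc.mono hsub) (H.hc.mono hsub) ?_ ?_ ?_ ?_ ?_
  · intro t ht x hx
    have := key t ht x hx
    have h2 := Real.exp_pos (-(L + 1) * t)
    by_contra hc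
    push Not at hc
    have := mul_pos h2 (sub_pos.2 hc)
    linarith
  · exact ContinuousOn.mul (Continuous.continuousOn (by fun_prop)) ((H.uc.mono hsub2).sub (H'.uc.mono hsub2))
  · intro x hx; exact mul_nonpos_of_nonneg_of_nonpos (Real.exp_pos _).le (by linarith [h0 x hx])
  · intro t ht; exact mul_nonpos_of_nonneg_of_nonpos (Real.exp_pos _).le (by linarith [hgb t ht])
  · intro t ht; exact mul_nonpos_of_nonneg_of_nonpos (Real.exp_pos _).le (by linarith [hhb t ht])
  · intro t ht x hx hpos h1 h2 h3
    have htT : t ∈ Ioo 0 T := ⟨ht.1, ht.2.trans_lt hT⟩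
    have hE := Real.exp_pos (-(L + 1) * t)
    have ee : HasDerivAt (fun s => Real.exp (-(L + 1) * s)) (-(L + 1) * Real.exp (-(L + 1) * t)) t := by
      have := (((hasDerivAt_id t).const_mul (-(L + 1))).exp)
      refine this.congr_deriv ?_
      simp only [id]; ring
    set E := Real.exp (-(L + 1) * t)
    have e1 := (ee.mul ((H.ut t htT x hx).hasDerivAt.sub (H'.ut t htT x hx).hasDerivAt)).deriv
    have e1' : deriv (fun s => Real.exp (-(L + 1) * s) * (u s x - u' s x)) t = _ := e1
    have e2 : deriv (fun y => E * (u t y - u' t y)) =ᶠ[𝓝 x] fun y => E * (deriv (u t) y - deriv (u' t) y) := by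
      filter_upwards [Ioo_mem_nhds hx.1 hx.2] with y hy
      exact (((H.ux t htT y hy).hasDerivAt.sub (H'.ux t htT y hy).hasDerivAt).const_mul E).deriv
    have e3 : deriv (fun y => E * (deriv (u t) y - deriv (u' t) y)) x = E * (deriv (deriv (u t)) x - deriv (deriv (u' t)) x) :=
      (((H.uxx t htT x hx).hasDerivAt.sub (H'.uxx t htT x hx).hasDerivAt).const_mul E).deriv
    rw [e1', H.pde t htT x hx, H'.pde t htT x hx] at h1
    change deriv (deriv (fun y => E * (u t y - u' t y))) x ≤ 0 at h3
    rw [e2.deriv_eq, e3] at h3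
    change 0 < E * (u t x - u' t x) at hpos
    have hw : 0 < u t x - u' t x := pos_of_mul_pos_right hpos hE.le |> fun h => h
    have h4 := hF t ht x hx (by linarith)
    have h5 : deriv (deriv (u t)) x - deriv (deriv (u' t)) x ≤ 0 := by
      by_contra hc
      push Not at hc
      linarith [mul_pos hE hc]
    have h6 := mul_nonneg hd (neg_nonneg.2 h5)
    simp only [Pi.sub_apply] at h1
    have h7 : 0 ≤ E * (-(L + 1) * (u t x - u' t x) + (d * deriv (deriv (u t)) x + F t x (u t x) - (d * deriv (deriv (u' t)) x + F' t x (u' t x)))) := by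
      linarith
    have h8 := nonneg_of_mul_nonneg_right h7 hE
    nlinarith

/-- Exponential barrier at the right boundary. -/
theorem right_barrier (H : PS d T F u g h) (hd : 0 < d) {T' σ δ κ A B' w K CF : ℝ} {h' : ℝ → ℝ}
    (hT : T' < T) (hσ : σ = 1 ∨ σ = -1) (hκ : 0 < κ) (hB : 0 < B') (hw : 0 < w) (hAκ : A / δ ≤ κ)
    (hh' : ∀ t ∈ Ioc 0 T', HasDerivAt h (h' t) t) (hh'A : ∀ t ∈ Ioc 0 T', -(d / δ) * A ≤ h' t)
    (hwl : ∀ t ∈ Icc 0 T', g t ≤ h t - w) (hbd : ∀ t ∈ Icc 0 T', u t (h t) = δ)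
    (hF : ∀ t ∈ Ioc 0 T', ∀ x ∈ Ioo (g t) (h t), |F t x (u t x)| ≤ CF)
    (hK : ∀ x ∈ Icc (h 0 - w) (h 0), |u 0 x - δ| ≤ K * (h 0 - x)) (c1 : K ≤ B' * Real.exp (-(κ * w)))
    (hN : ∀ t ∈ Ioc 0 T', σ * u t (h t - w) ≤ σ * δ + B' / κ * (1 - Real.exp (-(κ * w))))
    (c3 : CF < B' * Real.exp (-(κ * w)) * (d * (κ - A / δ))) {t p : ℝ} (ht : t ∈ Ioc 0 T')
    (hp : HasDerivAt (u t) p (h t)) : -B' ≤ σ * p := by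
  have hsub : Icc 0 T' ⊆ Ico 0 T := fun t ht => ⟨ht.1, ht.2.trans_lt hT⟩
  have hσ2 : σ * σ = 1 := by rcases hσ with rfl | rfl <;> norm_num
  have hch := H.hc.mono hsub
  have hch2 : ContinuousOn (fun z : ℝ × ℝ => h z.1) {z | z.1 ∈ Icc 0 T' ∧ z.2 ∈ Icc (h z.1 - w) (h z.1)} :=
    hch.comp continuousOn_fst fun z hz => hz.1
  have ey : ∀ y, HasDerivAt (fun y => Real.exp (-(κ * y))) (-(κ * Real.exp (-(κ * y)))) y := fun y => by
    have := ((hasDerivAt_id y).const_mul κ).neg.exp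
    refine this.congr_deriv ?_
    simp only [id, Pi.neg_apply]; ring
  have hP : ∀ y, HasDerivAt (fun y => δ + σ * (B' / κ * (1 - Real.exp (-(κ * y))))) (σ * (B' * Real.exp (-(κ * y)))) y := fun y => by
    have := ((((ey y).const_sub 1).const_mul (B' / κ)).const_mul σ).const_add δ
    refine this.congr_deriv ?_
    field_simp
  have hP2 : ∀ y, HasDerivAt (fun y => σ * (B' * Real.exp (-(κ * y)))) (-(σ * (B' * κ * Real.exp (-(κ * y))))) y := fun y => by
    have := ((ey y).const_mul B').const_mul σ
    refine this.congr_deriv ?_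
    ring
  have key := H.barrier hd.le (σ := σ) hT (g' := fun t => h t - w) (h' := h) (hch.sub continuousOn_const) hch hwl (fun _ _ => le_rfl)
    (B := fun t x => δ + σ * (B' / κ * (1 - Real.exp (-(κ * (h t - x))))))
    (Bt := fun t x => σ * (B' * Real.exp (-(κ * (h t - x)))) * h' t)
    (Bx := fun t x => -(σ * (B' * Real.exp (-(κ * (h t - x))))))
    (Bxx := fun t x => -(σ * (B' * κ * Real.exp (-(κ * (h t - x)))))) ?_ ?_ ?_ ?_ ?_ ?_ ?_ ?_ t ⟨ht.1.le, ht.2⟩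
  rotate_left
  · have := hch2.sub (continuousOn_snd (s := {z : ℝ × ℝ | z.1 ∈ Icc 0 T' ∧ z.2 ∈ Icc (h z.1 - w) (h z.1)}))
    have hc : Continuous fun y => δ + σ * (B' / κ * (1 - Real.exp (-(κ * y)))) := by fun_prop
    exact hc.comp_continuousOn this
  · intro t ht x hx
    exact HasDerivAt.comp (h₂ := fun y => δ + σ * (B' / κ * (1 - Real.exp (-(κ * y))))) t (hP (h t - x)) ((hh' t ht).sub_const x)
  · intro t ht x hx
    have := HasDerivAt.comp x (hP (h t - x)) ((hasDerivAt_id x).const_sub (h t))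
    refine this.congr_deriv (by simp)
  · intro t ht x hx
    have := (HasDerivAt.comp x (hP2 (h t - x)) ((hasDerivAt_id x).const_sub (h t))).neg
    refine this.congr_deriv (by simp)
  · intro x hx
    have h1 := hK x hx
    have hy0 : 0 ≤ h 0 - x := by linarith [hx.2]
    have hyw : h 0 - x ≤ w := by linarith [hx.1]
    set y := h 0 - x
    have h2 : σ * (u 0 x - δ) ≤ K * y := (le_abs_self _).trans (by
      rw [abs_mul]; rcases hσ with rfl | rfl <;> simpa using h1)
    have h3 : y * Real.exp (-(κ * w)) ≤ (1 - Real.exp (-(κ * y))) / κ := by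
      rw [le_div_iff₀ hκ]
      have h4 : Real.exp (-(κ * w)) ≤ Real.exp (-(κ * y)) := Real.exp_le_exp.2 (by nlinarith)
      have h5 : (κ * y + 1) * Real.exp (-(κ * y)) ≤ 1 := by
        have := mul_le_mul_of_nonneg_right (Real.add_one_le_exp (κ * y)) (Real.exp_pos (-(κ * y))).le
        rwa [← Real.exp_add, add_neg_cancel, Real.exp_zero] at this
      have h6 := mul_le_mul_of_nonneg_left h4 (mul_nonneg hy0 hκ.le)
      nlinarith
    have h7 := mul_le_mul_of_nonneg_left h3 hB.le
    have h8 := mul_le_mul_of_nonneg_right c1 hy0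
    have h9 : σ * (σ * (B' / κ * (1 - Real.exp (-(κ * y))))) = B' * ((1 - Real.exp (-(κ * y))) / κ) := by
      rw [← mul_assoc, hσ2]; ring
    rw [mul_add, h9]
    linarith
  · intro t ht
    have := hN t ht
    simp only [sub_sub_cancel]
    rw [mul_add, ← mul_assoc σ σ, hσ2]; linarith
  · intro t ht
    rw [hbd t ⟨ht.1.le, ht.2⟩]; simp
  · intro t ht x hx hlt
    have hx' : x ∈ Ioo (g t) (h t) := ⟨(hwl t ⟨ht.1.le, ht.2⟩).trans_lt hx.1, hx.2⟩
    have h1 : σ * F t x (u t x) ≤ CF := (le_abs_self _).trans (by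
      rw [abs_mul]; rcases hσ with rfl | rfl <;> simpa using hF t ht x hx')
    have h2 := hh'A t ht
    have h4 : Real.exp (-(κ * w)) ≤ Real.exp (-(κ * (h t - x))) := Real.exp_le_exp.2 (by nlinarith [hx.1])
    set E := Real.exp (-(κ * (h t - x)))
    have hE : 0 < E := Real.exp_pos _
    have h5 := mul_le_mul_of_nonneg_left h2 (mul_pos hB hE).le
    have h6 : B' * Real.exp (-(κ * w)) * (d * (κ - A / δ)) ≤ B' * E * (d * (κ - A / δ)) :=
      mul_le_mul_of_nonneg_right (mul_le_mul_of_nonneg_left h4 hB.le) (mul_nonneg hd.le (by linarith))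
    have h7 : σ * (σ * (B' * E) * h' t) = B' * E * h' t := by rw [← mul_assoc, ← mul_assoc, hσ2, one_mul]
    have h8 : σ * (d * -(σ * (B' * κ * E)) + F t x (u t x)) = -(d * (B' * κ * E)) + σ * F t x (u t x) := by
      have : σ * (d * -(σ * (B' * κ * E)) + F t x (u t x)) = -((σ * σ) * (d * (B' * κ * E))) + σ * F t x (u t x) := by ring
      rw [this, hσ2, one_mul]
    rw [h7, h8]
    have h9 : B' * E * (-(d / δ) * A) = -(B' * E * (d * (A / δ))) := by ring
    nlinarith
  -- conclusion
  have hs := hp.hasDerivWithinAt (s := Iio (h t))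
  rw [hasDerivWithinAt_iff_tendsto_slope' (by simp)] at hs
  refine ge_of_tendsto (hs.const_mul σ) ?_
  filter_upwards [Ioo_mem_nhdsLT (show h t - w < h t by linarith)] with x hx
  have h1 := key x ⟨hx.1.le, hx.2.le⟩
  rw [mul_add, ← mul_assoc σ σ, hσ2, one_mul] at h1
  have h2 : 0 < h t - x := by linarith [hx.2]
  have h3 : B' / κ * (1 - Real.exp (-(κ * (h t - x)))) ≤ B' * (h t - x) := by
    have h4 := Real.add_one_le_exp (-(κ * (h t - x)))
    have h5 : 1 - Real.exp (-(κ * (h t - x))) ≤ κ * (h t - x) := by linarith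
    calc _ ≤ B' / κ * (κ * (h t - x)) := by gcongr
      _ = _ := by field_simp
  rw [slope_def_field, hbd t ⟨ht.1.le, ht.2⟩, ← mul_div_assoc]
  rw [show σ * (u t x - δ) / (x - h t) = -(σ * (u t x - δ) / (h t - x)) by rw [← neg_sub (h t) x, div_neg]]
  rw [neg_le_neg_iff, div_le_iff₀ h2]
  linarith

lemma reflect (H : PS d T F u g h) : PS d T (fun t x v => F t (-x) v) (fun t x => u t (-x)) (fun t => -h t) (fun t => -g t) where
  gc := H.hc.neg
  hc := H.gc.neg
  uc := by
    refine H.uc.comp (f := fun z : ℝ × ℝ => (z.1, -z.2)) (Continuous.continuousOn (by fun_prop)) ?_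
    rintro ⟨t, x⟩ ⟨h1, h2⟩
    exact ⟨h1, le_neg.1 h2.2, neg_le.1 h2.1⟩
  ut t ht x hx := H.ut t ht (-x) ⟨by linarith [hx.2], by linarith [hx.1]⟩
  ux t ht x hx := by
    have := H.ux t ht (-x) ⟨by linarith [hx.2], by linarith [hx.1]⟩
    exact this.comp x differentiableAt_id.neg
  uxx t ht x hx := by
    have := H.uxx t ht (-x) ⟨by linarith [hx.2], by linarith [hx.1]⟩
    have e : deriv (fun x => u t (-x)) = fun x => -deriv (u t) (-x) := funext fun y => deriv_comp_neg (u t) y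
    rw [e]
    exact (this.comp x differentiableAt_id.neg).neg
  pde t ht x hx := by
    have := H.pde t ht (-x) ⟨by linarith [hx.2], by linarith [hx.1]⟩
    have e : deriv (fun x => u t (-x)) = fun x => -deriv (u t) (-x) := funext fun y => deriv_comp_neg (u t) y
    rw [e, deriv.fun_neg, deriv_comp_neg, neg_neg]
    exact this

end PS
end FBP

namespace FBP
open MeasureTheory Topology
namespace Dat
variable {D : Dat} {p : ℝ → ℝ → ℝ} {R : ℝ}

noncomputable def yy (D : Dat) (p : ℝ → ℝ → ℝ) (t x : ℝ) : ℝ := (x - D.gg p t) / D.ll p t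

lemma yy_cont (hp : Adm p R) : Continuous fun z : ℝ × ℝ => D.yy p z.1 z.2 :=
  (continuous_snd.sub ((gg_cont hp.c).comp continuous_fst)).div ((ll_cont hp.c).comp continuous_fst)
    fun z => (ll_pos z.1).ne'

lemma yy_deriv (t x : ℝ) : HasDerivAt (D.yy p t) (1 / D.ll p t) x :=
  ((hasDerivAt_id x).sub_const _).div_const _

noncomputable def uu (D : Dat) (p : ℝ → ℝ → ℝ) (t x : ℝ) : ℝ := D.ww p t (D.yy p t x)

lemma uu_eq (t x : ℝ) : D.uu p t x = D.δ + D.Z p t (D.yy p t x) := rfl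

lemma uu_cont (hp : Adm p R) : Continuous fun z : ℝ × ℝ => D.uu p z.1 z.2 :=
  continuous_const.add ((Z_cont hp).comp (continuous_fst.prodMk (yy_cont hp)))

noncomputable def ox (D : Dat) (p : ℝ → ℝ → ℝ) (t x : ℝ) : ℝ := p t (D.yy p t x)

lemma ox_cont (hp : Adm p R) : Continuous fun z : ℝ × ℝ => D.ox p z.1 z.2 :=
  hp.c.comp (continuous_fst.prodMk (yy_cont hp))

lemma uu_deriv (hp : Adm p R) (t x : ℝ) : HasDerivAt (D.uu p t) (D.ox p t x) x := by
  have h1 := ((Z_deriv (D := D) hp t (D.yy p t x)).comp x (yy_deriv t x)).const_add D.δ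
  refine h1.congr_deriv ?_
  have := (ll_pos (D := D) (p := p) t).ne'
  unfold ox; field_simp

lemma uu_deriv_eq (hp : Adm p R) (t : ℝ) : deriv (D.uu p t) = D.ox p t :=
  funext fun x => (uu_deriv hp t x).deriv

noncomputable def oxx (D : Dat) (p : ℝ → ℝ → ℝ) (t x : ℝ) : ℝ := D.S p t (D.yy p t x) / D.ll p t ^ 2

lemma ll_of (t : ℝ) (hl : D.l1 < D.hh p t - D.gg p t) : D.ll p t = D.hh p t - D.gg p t := max_eq_left hl.le

lemma yy_mem {t x : ℝ} (hl : D.l1 < D.hh p t - D.gg p t) (hx : x ∈ Ioo (D.gg p t) (D.hh p t)) :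
    D.yy p t x ∈ Ioo (0:ℝ) 1 := by
  have hp := ll_pos (D := D) (p := p) t
  constructor
  · exact div_pos (by linarith [hx.1]) hp
  · unfold yy; rw [div_lt_one hp, ll_of t hl]; linarith [hx.2]

lemma ox_deriv (h : Fx D p R) {t x : ℝ} (ht0 : 0 < t) (ht : t ≤ D.T) (hl : D.l1 < D.hh p t - D.gg p t)
    (hx : x ∈ Ioo (D.gg p t) (D.hh p t)) : HasDerivAt (D.ox p t) (D.oxx p t x) x := by
  have h1 := (p_deriv h ht0 ht (yy_mem hl hx)).comp x (yy_deriv t x)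
  refine h1.congr_deriv ?_
  unfold oxx; ring

def dom (D : Dat) (p : ℝ → ℝ → ℝ) (T1 : ℝ) : Set (ℝ × ℝ) :=
  {z | z.1 ∈ Ioo 0 T1 ∧ z.2 ∈ Ioo (D.gg p z.1) (D.hh p z.1)}

lemma yy_maps {T1 : ℝ} (hT1 : T1 ≤ D.T) (hl : ∀ t ∈ Ico 0 T1, D.l1 < D.hh p t - D.gg p t) :
    MapsTo (fun z : ℝ × ℝ => (z.1, D.yy p z.1 z.2)) (D.dom p T1) (Ioo 0 D.T ×ˢ Ioo (0:ℝ) 1) := fun z hz =>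
  ⟨⟨hz.1.1, hz.1.2.trans_le hT1⟩, yy_mem (hl _ ⟨hz.1.1.le, hz.1.2⟩) hz.2⟩

lemma oxx_cont (h : Fx D p R) {T1 : ℝ} (hT1 : T1 ≤ D.T) (hl : ∀ t ∈ Ico 0 T1, D.l1 < D.hh p t - D.gg p t) :
    ContinuousOn (fun z : ℝ × ℝ => D.oxx p z.1 z.2) (D.dom p T1) :=
  ((S_cont h).comp (continuous_fst.prodMk (yy_cont h.a)).continuousOn (yy_maps hT1 hl)).div
    (((ll_cont h.a.c).comp continuous_fst).pow 2).continuousOn fun z _ => (pow_pos (ll_pos z.1) 2).ne'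

lemma ll_deriv (hp : Adm p R) {t : ℝ} (hl : D.l1 < D.hh p t - D.gg p t) :
    HasDerivAt (D.ll p) (D.vh p t - D.vg p t) t := by
  refine ((hh_deriv hp.c t).sub (gg_deriv hp.c t)).congr_of_eventuallyEq ?_
  have hc : Continuous fun t => D.hh p t - D.gg p t := (hh_cont hp.c).sub (gg_cont hp.c)
  filter_upwards [hc.continuousAt.eventually (lt_mem_nhds hl)] with s hs
  exact ll_of s hs

lemma uu_deriv_t (h : Fx D p R) {t x : ℝ} (ht : t ∈ Ioo 0 D.T) (hl : D.l1 < D.hh p t - D.gg p t)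
    (hx : x ∈ Ioo (D.gg p t) (D.hh p t)) :
    HasDerivAt (fun s => D.uu p s x) (D.d * D.oxx p t x + D.F t x (D.uu p t x)) t := by
  have hl0 := (ll_pos (D := D) (p := p) t).ne'
  have hy : HasDerivAt (fun s => D.yy p s x)
      (((0 - D.vg p t) * D.ll p t - (x - D.gg p t) * (D.vh p t - D.vg p t)) / D.ll p t ^ 2) t :=
    ((hasDerivAt_const t x).sub (gg_deriv h.a.c t)).div (ll_deriv h.a hl) hl0
  have h1 := (Z_strict h ht (yy_mem hl hx)).hasFDerivAt.comp_hasDerivAt t ((hasDerivAt_id t).prodMk hy)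
  have h2 := h1.const_add D.δ
  refine h2.congr_deriv ?_
  simp only [ContinuousLinearMap.coprod_apply, ContinuousLinearMap.toSpanSingleton_apply, smul_eq_mul]
  have e : D.gg p t + D.ll p t * D.yy p t x = x := by unfold yy; field_simp; ring
  have e2 : D.ww p t (D.yy p t x) = D.uu p t x := rfl
  unfold Zt NN VV oxx
  rw [e, e2]
  have e3 : x - D.gg p t = D.ll p t * D.yy p t x := by linarith
  rw [e3]
  field_simp
  ring

lemma uu_g (t : ℝ) : D.uu p t (D.gg p t) = D.δ := by rw [uu_eq]; simp [yy, Z_zero]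

lemma uu_h (h : Fx D p R) {t : ℝ} (ht : t ∈ Icc 0 D.T) (hl : D.l1 ≤ D.hh p t - D.gg p t) : D.uu p t (D.hh p t) = D.δ := by
  have e : D.yy p t (D.hh p t) = 1 := by
    unfold yy; rw [show D.ll p t = D.hh p t - D.gg p t from max_eq_left hl]; exact div_self (by linarith [D.hl1])
  rw [uu_eq, e, Z_one h ht, add_zero]

lemma ox_g (t : ℝ) : D.ox p t (D.gg p t) = p t 0 := by simp [ox, yy]

lemma ox_h {t : ℝ} (hl : D.l1 ≤ D.hh p t - D.gg p t) : D.ox p t (D.hh p t) = p t 1 := by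
  have e : D.yy p t (D.hh p t) = 1 := by
    unfold yy; rw [show D.ll p t = D.hh p t - D.gg p t from max_eq_left hl]; exact div_self (by linarith [D.hl1])
  rw [ox, e]

lemma gg_zero : D.gg p 0 = -D.h0 := by simp [gg]
lemma hh_zero : D.hh p 0 = D.h0 := by simp [hh]

lemma uu_init (h : Fx D p R) (hl : D.l1 ≤ 2 * D.h0) (x : ℝ) : D.uu p 0 x = D.δ + D.z0 ((x + D.h0) / (2 * D.h0)) := by
  rw [uu_eq, Z_init h]; unfold yy ll
  rw [gg_zero, hh_zero, max_eq_left (by linarith)]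
  congr 2; ring

lemma ps (h : Fx D p R) {T1 : ℝ} (hT1 : T1 ≤ D.T) (hl : ∀ t ∈ Ico 0 T1, D.l1 < D.hh p t - D.gg p t) :
    PS D.d T1 D.F (D.uu p) (D.gg p) (D.hh p) where
  gc := (gg_cont h.a.c).continuousOn
  hc := (hh_cont h.a.c).continuousOn
  uc := (uu_cont h.a).continuousOn
  ut t ht x hx := (uu_deriv_t h ⟨ht.1, ht.2.trans_le hT1⟩ (hl t ⟨ht.1.le, ht.2⟩) hx).differentiableAt
  ux t ht x hx := (uu_deriv h.a t x).differentiableAt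
  uxx t ht x hx := by
    rw [uu_deriv_eq h.a]
    exact (ox_deriv h ht.1 (ht.2.trans_le hT1).le (hl t ⟨ht.1.le, ht.2⟩) hx).differentiableAt
  pde t ht x hx := by
    rw [uu_deriv_eq h.a, (ox_deriv h ht.1 (ht.2.trans_le hT1).le (hl t ⟨ht.1.le, ht.2⟩) hx).deriv,
      (uu_deriv_t h ⟨ht.1, ht.2.trans_le hT1⟩ (hl t ⟨ht.1.le, ht.2⟩) hx).deriv]

end Dat
end FBP

namespace FBP
open MeasureTheory Topology
namespace Dat
variable {D : Dat} {p : ℝ → ℝ → ℝ} {R : ℝ}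

noncomputable def Rh (D : Dat) (p : ℝ → ℝ → ℝ) (ε t : ℝ) : ℝ :=
  D.d / D.ll p t * (p t (1 - ε) - p t ε) + ((∫ y in (0:ℝ)..(1 - ε), D.NN p t y) - ∫ y in (0:ℝ)..ε, D.NN p t y)

noncomputable def Ee (D : Dat) (p : ℝ → ℝ → ℝ) (ε t : ℝ) : ℝ :=
  (∫ y in (0:ℝ)..(1 - ε), D.ww p t y) - ∫ y in (0:ℝ)..ε, D.ww p t y

lemma Rh_cont (hp : Adm p R) : Continuous fun z : ℝ × ℝ => D.Rh p z.1 z.2 := by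
  have h1 := intervalIntegral.continuous_parametric_primitive_of_continuous (μ := volume) (a₀ := 0) (f := D.NN p) (NN_cont (D := D) hp.c)
  have h2 : Continuous fun z : ℝ × ℝ => p z.2 (1 - z.1) :=
    hp.c.comp (continuous_snd.prodMk (continuous_const.sub continuous_fst))
  have h3 : Continuous fun z : ℝ × ℝ => p z.2 z.1 := hp.c.comp (continuous_snd.prodMk continuous_fst)
  have h4 : Continuous fun z : ℝ × ℝ => D.d / D.ll p z.2 :=
    continuous_const.div ((ll_cont hp.c).comp continuous_snd) fun z => (ll_pos z.2).ne'
  exact (h4.mul (h2.sub h3)).add ((h1.comp (continuous_snd.prodMk (continuous_const.sub continuous_fst))).sub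
    (h1.comp (continuous_snd.prodMk continuous_fst)))

lemma Ee_cont (hp : Adm p R) : Continuous fun z : ℝ × ℝ => D.Ee p z.1 z.2 := by
  have h1 := intervalIntegral.continuous_parametric_primitive_of_continuous (μ := volume) (a₀ := 0) (f := D.ww p) (ww_cont (D := D) hp.c)
  exact ((h1.comp (continuous_snd.prodMk (continuous_const.sub continuous_fst))).sub
    (h1.comp (continuous_snd.prodMk continuous_fst)))

lemma int_Zt (h : Fx D p R) {t ε : ℝ} (ht : t ∈ Ioo 0 D.T) (hε : ε ∈ Ioo (0:ℝ) (1 / 2)) :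
    ∫ y in ε..(1 - ε), D.Zt p t y = D.Rh p ε t := by
  have hl := ll_pos (D := D) (p := p) t
  have hsub : uIcc ε (1 - ε) ⊆ Ioo (0:ℝ) 1 := by
    rw [uIcc_of_le (by linarith [hε.2])]
    intro y hy; exact ⟨by linarith [hy.1, hε.1], by linarith [hy.2, hε.1]⟩
  have hN : Continuous (D.NN p t) := slice_cont (NN_cont h.a.c) t
  have hS : ContinuousOn (D.S p t) (uIcc ε (1 - ε)) :=
    (S_cont h).comp (f := fun y => (t, y)) (by fun_prop) fun y hy => ⟨ht, hsub hy⟩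
  have h1 : ∫ y in ε..(1 - ε), D.S p t y / D.ll p t = p t (1 - ε) - p t ε :=
    intervalIntegral.integral_eq_sub_of_hasDerivAt (fun y hy => p_deriv h ht.1 ht.2.le (hsub hy))
      (hS.div_const _).intervalIntegrable
  unfold Zt
  rw [intervalIntegral.integral_add (f := fun y => D.d / D.ll p t ^ 2 * D.S p t y) ((continuousOn_const.mul hS).intervalIntegrable) (hN.intervalIntegrable _ _)]
  unfold Rh
  rw [intervalIntegral.integral_interval_sub_left (hN.intervalIntegrable _ _) (hN.intervalIntegrable _ _), ← h1,
    ← intervalIntegral.integral_const_mul]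
  congr 1
  refine intervalIntegral.integral_congr fun y _ => ?_
  field_simp

lemma Ee_deriv (h : Fx D p R) {t ε : ℝ} (ht : t ∈ Ioo 0 D.T) (hε : ε ∈ Ioo (0:ℝ) (1 / 2)) :
    HasDerivAt (D.Ee p ε) (D.Rh p ε t) t := by
  have hw : ∀ s, Continuous (D.ww p s) := fun s => slice_cont (ww_cont h.a.c) s
  have e : D.Ee p ε = fun s => ∫ y in ε..(1 - ε), D.ww p s y := by
    funext s
    unfold Ee
    rw [intervalIntegral.integral_interval_sub_left ((hw s).intervalIntegrable _ _) ((hw s).intervalIntegrable _ _)]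
  rw [e, ← int_Zt h ht hε]
  have hsub : uIcc ε (1 - ε) ⊆ Ioo (0:ℝ) 1 := by
    rw [uIcc_of_le (by linarith [hε.2])]
    intro y hy; exact ⟨by linarith [hy.1, hε.1], by linarith [hy.2, hε.1]⟩
  set r := min t (D.T - t) / 2 with hr
  have hr0 : 0 < r := by have := lt_min ht.1 (sub_pos.2 ht.2); positivity
  have hrsub : Icc (t - r) (t + r) ⊆ Ioo 0 D.T := by
    intro s hs
    have h1 := min_le_left t (D.T - t)
    have h2 := min_le_right t (D.T - t)
    constructor
    · linarith [hs.1, ht.1]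
    · linarith [hs.2, ht.2]
  have hcpt : IsCompact (Icc (t - r) (t + r) ×ˢ uIcc ε (1 - ε)) := isCompact_Icc.prod isCompact_uIcc
  obtain ⟨C, hC⟩ := hcpt.exists_bound_of_continuousOn ((Zt_cont h).mono (prod_mono hrsub hsub))
  have hZ : ContinuousOn (D.Zt p t) (uIcc ε (1 - ε)) :=
    (Zt_cont h).comp (f := fun y => (t, y)) (by fun_prop) fun y hy => ⟨ht, hsub hy⟩
  refine (intervalIntegral.hasDerivAt_integral_of_dominated_loc_of_deriv_le (μ := volume) (F := fun s y => D.ww p s y)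
    (F' := fun s y => D.Zt p s y) (s := Icc (t - r) (t + r)) (bound := fun _ => C) (Icc_mem_nhds (by linarith) (by linarith))
    (Eventually.of_forall fun s => (hw s).aestronglyMeasurable)
    ((hw t).intervalIntegrable _ _) hZ.intervalIntegrable.def'.aestronglyMeasurable
    (ae_of_all _ fun y hy s hs => hC (s, y) ⟨hs, uIoc_subset_uIcc hy⟩) intervalIntegrable_const
    (ae_of_all _ fun y hy s hs => ?_)).2
  exact (Z_deriv_t h (hrsub hs) (hsub (uIoc_subset_uIcc hy))).const_add _

lemma E_deriv (h : Fx D p R) {t : ℝ} (ht : t ∈ Ioo 0 D.T) : HasDerivAt (D.Ee p 0) (D.Rh p 0 t) t := by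
  have hc : ∀ ε, Continuous (D.Rh p ε) := fun ε => slice_cont (Rh_cont h.a) ε
  have key : ∀ s ∈ Ioo 0 D.T, D.Ee p 0 s = D.Ee p 0 t + ∫ r in t..s, D.Rh p 0 r := by
    intro s hs
    have hG : Continuous fun ε => D.Ee p ε s - (D.Ee p ε t + ∫ r in t..s, D.Rh p ε r) := by
      have h1 := (Ee_cont (D := D) h.a)
      have h2 : Continuous fun ε => ∫ r in t..s, D.Rh p ε r :=
        intervalIntegral.continuous_parametric_intervalIntegral_of_continuous' (Rh_cont h.a) t s
      exact (h1.comp (continuous_id.prodMk continuous_const)).sub ((h1.comp (continuous_id.prodMk continuous_const)).add h2)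
    have h0 : EqOn (fun ε => D.Ee p ε s - (D.Ee p ε t + ∫ r in t..s, D.Rh p ε r)) (fun _ => 0) (closure (Ioo (0:ℝ) (1 / 2))) := by
      refine EqOn.closure (fun ε hε => ?_) hG continuous_const
      have := intervalIntegral.integral_eq_sub_of_hasDerivAt (a := t) (b := s) (f := D.Ee p ε) (f' := D.Rh p ε)
        (fun r hr => Ee_deriv h (ordConnected_Ioo.uIcc_subset ht hs hr) hε) ((hc ε).intervalIntegrable _ _)
      simp only [this]; ring
    rw [closure_Ioo (by norm_num)] at h0
    have := h0 (show (0:ℝ) ∈ Icc 0 (1/2) by norm_num)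
    simp only at this
    linarith
  have h1 : HasDerivAt (fun s => ∫ r in t..s, D.Rh p 0 r) (D.Rh p 0 t) t :=
    intervalIntegral.integral_hasDerivAt_right ((hc 0).intervalIntegrable _ _)
      ((hc 0).stronglyMeasurableAtFilter _ _) (hc 0).continuousAt
  refine (h1.const_add (D.Ee p 0 t)).congr_of_eventuallyEq ?_
  filter_upwards [Ioo_mem_nhds ht.1 ht.2] with s hs using key s hs

lemma int_pV (h : Fx D p R) {t : ℝ} (ht : t ∈ Icc 0 D.T) :
    D.ll p t * ∫ y in (0:ℝ)..1, p t y * D.VV p t y = (D.vh p t - D.vg p t) * (D.δ - D.Ee p 0 t) := by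
  have hw : Continuous (D.ww p t) := slice_cont (ww_cont h.a.c) t
  have hV : Continuous (D.VV p t) := slice_cont (VV_cont h.a.c) t
  have hpc : Continuous (p t) := slice_cont h.a.c t
  have hd : ∀ y, HasDerivAt (fun y => D.ww p t y * D.VV p t y)
      (D.ll p t * (p t y * D.VV p t y) + (D.vh p t - D.vg p t) * D.ww p t y) y := by
    intro y
    have h1 : HasDerivAt (D.ww p t) (D.ll p t * p t y) y := (Z_deriv h.a t y).const_add _
    have h2 : HasDerivAt (D.VV p t) (D.vh p t - D.vg p t) y := by
      have := (((hasDerivAt_id y).const_sub 1).const_mul (D.vg p t)).add ((hasDerivAt_id y).const_mul (D.vh p t))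
      exact this.congr_deriv (by ring)
    exact (h1.mul h2).congr_deriv (by ring)
  have h3 := intervalIntegral.integral_eq_sub_of_hasDerivAt (a := 0) (b := 1) (fun y _ => hd y)
    (Continuous.intervalIntegrable (by fun_prop) _ _)
  rw [intervalIntegral.integral_add (Continuous.intervalIntegrable (by fun_prop) _ _)
    (Continuous.intervalIntegrable (by fun_prop) _ _), intervalIntegral.integral_const_mul,
    intervalIntegral.integral_const_mul] at h3
  have e1 : D.ww p t 1 = D.δ := by have := Z_one h ht; unfold Z at this; unfold ww; rw [this, add_zero]
  have e0 : D.ww p t 0 = D.δ := by have := Z_zero (D := D) (p := p) t; unfold Z at this; unfold ww; rw [this, add_zero]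
  have e2 : D.Ee p 0 t = ∫ y in (0:ℝ)..1, D.ww p t y := by simp [Ee]
  rw [e1, e0] at h3
  rw [e2]
  unfold VV at h3 ⊢
  simp only [sub_self, sub_zero, mul_zero, mul_one, add_zero, zero_add] at h3
  linarith

lemma E0_eq (t : ℝ) : D.Ee p 0 t = ∫ y in (0:ℝ)..1, D.ww p t y := by simp [Ee]

theorem mass (h : Fx D p R) (hδ : 0 < D.δ) {T1 L : ℝ} (hT1 : T1 ≤ D.T) (hl : ∀ t ∈ Ico 0 T1, D.l1 < D.hh p t - D.gg p t)
    (hg : ∀ t ∈ Ioo 0 T1, D.vg p t = -(D.d / D.δ) * p t 0) (hh : ∀ t ∈ Ioo 0 T1, D.vh p t = -(D.d / D.δ) * p t 1)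
    (hF : ∀ t ∈ Ioo 0 T1, ∀ y ∈ Icc (0:ℝ) 1, -(L * D.ww p t y) ≤ D.F t (D.gg p t + D.ll p t * y) (D.ww p t y)) :
    ∀ t ∈ Ico 0 T1, D.ll p 0 * D.Ee p 0 0 ≤ Real.exp (L * t) * (D.ll p t * D.Ee p 0 t) := by
  intro t ht
  set Q : ℝ → ℝ := fun t => Real.exp (L * t) * (D.ll p t * D.Ee p 0 t) with hQ
  have hEc : Continuous (D.Ee p 0) := slice_cont (Ee_cont h.a) 0
  have hQc : Continuous Q := by have := ll_cont (D := D) h.a.c; fun_prop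
  have hmono : MonotoneOn Q (Icc 0 t) := by
    have hd : ∀ s ∈ Ioo 0 t, ∃ q, 0 ≤ q ∧ HasDerivAt Q q s := by
      intro s hs
      have hs1 : s ∈ Ioo 0 T1 := ⟨hs.1, hs.2.trans ht.2⟩
      have hsT : s ∈ Ioo 0 D.T := ⟨hs.1, hs1.2.trans_le hT1⟩
      have hls := hl s ⟨hs.1.le, hs1.2⟩
      have hll := ll_pos (D := D) (p := p) s
      have h1 := (ll_deriv h.a hls).mul (E_deriv h hsT)
      have h2 : HasDerivAt (fun t => Real.exp (L * t)) (Real.exp (L * s) * (L * 1)) s := ((hasDerivAt_id s).const_mul L).exp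
      refine ⟨_, ?_, h2.mul h1⟩
      have hFc : Continuous fun y => D.F s (D.gg p s + D.ll p s * y) (D.ww p s y) := by
        have hw : Continuous (D.ww p s) := slice_cont (ww_cont h.a.c) s
        exact D.Fc.comp (continuous_const.prodMk ((by fun_prop : Continuous fun y => D.gg p s + D.ll p s * y).prodMk hw))
      have hw : Continuous (D.ww p s) := slice_cont (ww_cont h.a.c) s
      have hV : Continuous (D.VV p s) := slice_cont (VV_cont h.a.c) s
      have hpc : Continuous (p s) := slice_cont h.a.c s
      have e1 : ∫ y in (0:ℝ)..1, D.NN p s y = (∫ y in (0:ℝ)..1, p s y * D.VV p s y) +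
          ∫ y in (0:ℝ)..1, D.F s (D.gg p s + D.ll p s * y) (D.ww p s y) :=
        intervalIntegral.integral_add ((hpc.mul hV).intervalIntegrable _ _) (hFc.intervalIntegrable _ _)
      have e2 := int_pV h ⟨hs.1.le, hsT.2.le⟩
      have e3 : -(L * D.Ee p 0 s) ≤ ∫ y in (0:ℝ)..1, D.F s (D.gg p s + D.ll p s * y) (D.ww p s y) := by
        rw [E0_eq, ← intervalIntegral.integral_const_mul, ← intervalIntegral.integral_neg]
        exact intervalIntegral.integral_mono_on zero_le_one (Continuous.intervalIntegrable (by fun_prop) _ _)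
          (hFc.intervalIntegrable _ _) (hF s hs1)
      have e4 : D.ll p s * D.Rh p 0 s = D.d * (p s 1 - p s 0) + D.ll p s * ∫ y in (0:ℝ)..1, D.NN p s y := by
        unfold Rh; simp only [sub_zero, intervalIntegral.integral_same]; field_simp
      have e5 : D.d * (p s 1 - p s 0) = -(D.vh p s - D.vg p s) * D.δ := by
        rw [hg s hs1, hh s hs1]; field_simp; ring
      have e6 : (D.vh p s - D.vg p s) * D.Ee p 0 s + D.ll p s * D.Rh p 0 s =
          D.ll p s * ∫ y in (0:ℝ)..1, D.F s (D.gg p s + D.ll p s * y) (D.ww p s y) := by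
        rw [e4, e5, e1, mul_add, e2]; ring
      have e7 := mul_le_mul_of_nonneg_left e3 hll.le
      rw [e6]
      have := (Real.exp_pos (L * s)).le
      calc 0 ≤ Real.exp (L * s) * (D.ll p s * (∫ y in (0:ℝ)..1, D.F s (D.gg p s + D.ll p s * y) (D.ww p s y)) + L * (D.ll p s * D.Ee p 0 s)) :=
            mul_nonneg this (by linarith)
        _ = _ := by ring
    refine monotoneOn_of_deriv_nonneg (convex_Icc 0 t) hQc.continuousOn ?_ ?_
    · rw [interior_Icc]; intro s hs; obtain ⟨q, _, hq⟩ := hd s hs; exact hq.differentiableAt.differentiableWithinAt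
    · rw [interior_Icc]; intro s hs; obtain ⟨q, h0, hq⟩ := hd s hs; rw [hq.deriv]; exact h0
  have := hmono ⟨le_rfl, ht.1⟩ ⟨ht.1, le_rfl⟩ ht.1
  simpa [hQ] using this

end Dat
end FBP

namespace FBP
open MeasureTheory Topology

structure Prob where
  (d δ h0 M m CF LF HF α Lq Bq : ℝ)
  (F : ℝ → ℝ → ℝ → ℝ)
  (q0 : ℝ → ℝ)
  hd : 0 < d
  hδ : 0 < δ
  hh0 : 0 < h0
  hm : 0 < m
  hmδ : m < δ
  hδM : δ ≤ M
  hα0 : 0 < α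
  hα1 : α ≤ 1 / 2
  Fc : Continuous (fun z : ℝ × ℝ × ℝ => F z.1 z.2.1 z.2.2)
  Fb : ∀ t x v, |F t x v| ≤ CF
  Fl : ∀ t x v v', |F t x v - F t x v'| ≤ LF * |v - v'|
  Fh : ∀ t x x' v, |F t x v - F t x' v| ≤ HF * |x - x'| ^ α
  F0 : ∀ t x v, v ≤ 0 → F t x v = 0
  FM : ∀ t x v, M < v → F t x v < 0
  ql : ∀ y y', |q0 y - q0 y'| ≤ Lq * |y - y'|
  qb : ∀ y, |q0 y| ≤ Bq
  q_sym0 : ∀ y, q0 (-y) = q0 y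
  q_sym1 : ∀ y, q0 (2 - y) = q0 y
  q_int : ∫ y in (0:ℝ)..1, q0 y = 0
  z_lo : ∀ y ∈ Icc (0:ℝ) 1, m ≤ δ + ∫ r in (0:ℝ)..y, q0 r
  z_hi : ∀ y ∈ Icc (0:ℝ) 1, δ + ∫ r in (0:ℝ)..y, q0 r ≤ M

lemma clamp_lip (a b x y : ℝ) : |max a (min x b) - max a (min y b)| ≤ |x - y| := by
  have h1 : |max a (min x b) - max a (min y b)| ≤ |min x b - min y b| := by
    rw [max_comm a, max_comm a]; exact abs_max_sub_max_le_abs _ _ _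
  exact h1.trans ((abs_min_sub_min_le_max x b y b).trans (by simp))

namespace Prob
variable (P : Prob)

lemma LF0 : 0 ≤ P.LF := by have := P.Fl 0 0 0 1; have h := abs_nonneg (P.F 0 0 0 - P.F 0 0 1); norm_num at this; linarith
lemma CF0 : 0 ≤ P.CF := (abs_nonneg _).trans (P.Fb 0 0 0)
lemma Bq0 : 0 ≤ P.Bq := (abs_nonneg _).trans (P.qb 0)
lemma hM : 0 < P.M := P.hδ.trans_le P.hδM

/-- data with general clamps -/
noncomputable def datG (T l1 Cv Lv : ℝ) (cg ch : ℝ → ℝ → ℝ) (hT : 0 < T) (hl1 : 0 < l1)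
    (cgc : Continuous (fun z : ℝ × ℝ => cg z.1 z.2)) (chc : Continuous (fun z : ℝ × ℝ => ch z.1 z.2))
    (cgb : ∀ t p, |cg t p| ≤ Cv) (chb : ∀ t p, |ch t p| ≤ Cv)
    (cgl : ∀ t p p', |cg t p - cg t p'| ≤ Lv * |p - p'|)
    (chl : ∀ t p p', |ch t p - ch t p'| ≤ Lv * |p - p'|) : Dat where
  d := P.d
  δ := P.δ
  l1 := l1
  T := T
  h0 := P.h0
  Cv := Cv
  Lv := Lv
  CF := P.CF
  LF := P.LF
  HF := P.HF
  α := P.α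
  Lq := P.Lq
  Bq := P.Bq
  cg := cg
  ch := ch
  F := P.F
  q0 := P.q0
  hd := P.hd
  hl1 := hl1
  hT := hT
  hh0 := P.hh0
  hα0 := P.hα0
  hα1 := P.hα1
  cgc := cgc
  chc := chc
  cgb := cgb
  chb := chb
  cgl := cgl
  chl := chl
  Fc := P.Fc
  Fb := P.Fb
  Fl := P.Fl
  Fh := P.Fh
  ql := P.ql
  qb := P.qb
  q_sym0 := P.q_sym0
  q_sym1 := P.q_sym1
  q_int := P.q_int

noncomputable def clm (A B q : ℝ) : ℝ := max (-(P.d / P.δ) * A) (min (-(P.d / P.δ) * q) ((P.d / P.δ) * B))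

lemma dδ : 0 < P.d / P.δ := div_pos P.hd P.hδ

lemma clm_lip (A B q q' : ℝ) : |P.clm A B q - P.clm A B q'| ≤ P.d / P.δ * |q - q'| := by
  refine (clamp_lip _ _ _ _).trans (le_of_eq ?_)
  rw [← mul_sub, abs_mul, abs_neg, abs_of_pos P.dδ]

lemma clm_cont (A B : ℝ) : Continuous (P.clm A B) := by unfold clm; fun_prop

lemma clm_lo (A B q : ℝ) : -(P.d / P.δ) * A ≤ P.clm A B q := le_max_left _ _

lemma clm_hi {A B : ℝ} (hA : 0 ≤ A) (hB : 0 ≤ B) (q : ℝ) : P.clm A B q ≤ (P.d / P.δ) * B :=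
  max_le (by have := mul_nonneg P.dδ.le hA; have := mul_nonneg P.dδ.le hB; linarith) (min_le_right _ _)

lemma clm_bd {A B : ℝ} (hA : 0 ≤ A) (hB : 0 ≤ B) (q : ℝ) : |P.clm A B q| ≤ P.d / P.δ * (A + B) := by
  have h1 := P.clm_lo A B q
  have h2 := P.clm_hi hA hB q
  have := mul_nonneg P.dδ.le hA; have := mul_nonneg P.dδ.le hB
  rw [abs_le]; constructor <;> linarith

lemma clm_eq {A B q : ℝ} (h1 : q ≤ A) (h2 : -B ≤ q) : P.clm A B q = -(P.d / P.δ) * q := by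
  have := mul_le_mul_of_nonneg_left h1 P.dδ.le
  have := mul_le_mul_of_nonneg_left h2 P.dδ.le
  unfold clm
  rw [min_eq_left (by linarith), max_eq_right (by linarith)]

noncomputable def dat (T l1 A B : ℝ) (hT : 0 < T) (hl1 : 0 < l1) (hA : 0 < A) (hB : 0 < B) : Dat :=
  P.datG T l1 (P.d / P.δ * (A + B)) (P.d / P.δ) (fun _ q => P.clm B A q) (fun _ q => P.clm A B q) hT hl1
    ((P.clm_cont B A).comp continuous_snd) ((P.clm_cont A B).comp continuous_snd)
    (fun _ q => add_comm A B ▸ P.clm_bd hB.le hA.le q) (fun _ q => P.clm_bd hA.le hB.le q)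
    (fun _ => P.clm_lip B A) (fun _ => P.clm_lip A B)

end Prob

lemma params {d δ M K CF μ l1 : ℝ} (hd : 0 < d) (hδ : 0 < δ) (hM : 0 < M) (hK : 0 ≤ K) (hCF : 0 ≤ CF) (hμ : 0 < μ)
    (hμ1 : μ ≤ 1) (hl1 : 0 < l1) : ∃ A B B1 κ w B2 κ2 w2 : ℝ, 0 < A ∧ 0 < B ∧ 0 < B1 ∧ 0 < κ ∧ 0 < w ∧ 0 < B2 ∧ 0 < κ2 ∧ 0 < w2 ∧
      B1 ≤ A ∧ B2 ≤ B ∧ w ≤ l1 ∧ w2 ≤ l1 ∧ A / δ ≤ κ ∧ A / δ ≤ κ2 ∧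
      K ≤ B1 * Real.exp (-(κ * w)) ∧ K ≤ B2 * Real.exp (-(κ2 * w2)) ∧
      CF < B1 * Real.exp (-(κ * w)) * (d * (κ - A / δ)) ∧ CF < B2 * Real.exp (-(κ2 * w2)) * (d * (κ2 - A / δ)) ∧
      δ - μ * δ ≤ B1 / κ * (1 - Real.exp (-(κ * w))) ∧ M ≤ B2 / κ2 * (1 - Real.exp (-(κ2 * w2))) := by
  obtain ⟨r, hr⟩ : ∃ z, z = -Real.log (μ / 4) := ⟨_, rfl⟩
  have hr0 : 0 < r := by
    rw [hr, neg_pos]; exact Real.log_neg (by positivity) (by linarith)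
  have hexp : Real.exp (-r) = μ / 4 := by rw [hr, neg_neg, Real.exp_log (by positivity)]
  obtain ⟨A, hA⟩ : ∃ z, z = 1 + 8 * K / μ + 64 * δ * (CF + 1) / (μ ^ 2 * d) + r * δ / l1 := ⟨_, rfl⟩
  have a1 : 0 ≤ 8 * K / μ := by positivity
  have a2 : 0 < 64 * δ * (CF + 1) / (μ ^ 2 * d) := by positivity
  have a3 : 0 < r * δ / l1 := by positivity
  have hA1 : 1 ≤ A := by linarith
  have hA0 : 0 < A := by linarith
  obtain ⟨κ, hκ⟩ : ∃ z, z = A / δ * (1 + μ / 8) := ⟨_, rfl⟩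
  have hκ0 : 0 < κ := by rw [hκ]; positivity
  obtain ⟨κ2, hκ2⟩ : ∃ z, z = 2 * A / δ := ⟨_, rfl⟩
  have hκ20 : 0 < κ2 := by rw [hκ2]; positivity
  obtain ⟨B2, hB2⟩ : ∃ z, z = 4 * κ2 * M + 4 * K / μ + 4 * (CF + 1) * δ / (μ * d * A) := ⟨_, rfl⟩
  have b1 : 0 < 4 * κ2 * M := by positivity
  have b2 : 0 ≤ 4 * K / μ := by positivity
  have b3 : 0 < 4 * (CF + 1) * δ / (μ * d * A) := by positivity
  have e1 : κ * (r / κ) = r := by field_simp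
  have e2 : κ2 * (r / κ2) = r := by field_simp
  have hw : ∀ k, A / δ ≤ k → r / k ≤ l1 := by
    intro k hk
    have : r * δ / l1 ≤ A := by linarith
    rw [div_le_iff₀ hl1] at this
    rw [div_le_iff₀ (by positivity : (0:ℝ) < δ)] at hk
    have hk0 : 0 < k := pos_of_mul_pos_left (hA0.trans_le hk) hδ.le
    rw [div_le_iff₀ hk0]
    have : r * δ ≤ l1 * k * δ := by
      have := mul_le_mul_of_nonneg_right hk hl1.le
      linarith
    exact le_of_mul_le_mul_right this hδ
  have k1 : A / δ ≤ κ := hκ ▸ le_mul_of_one_le_right (by positivity) (by linarith)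
  have k2 : A / δ ≤ κ2 := by rw [hκ2]; exact div_le_div_of_nonneg_right (by linarith) hδ.le
  refine ⟨A, B2, A * (1 - μ / 8), κ, r / κ, B2, κ2, r / κ2, hA0, by linarith, mul_pos hA0 (by linarith), hκ0, by positivity,
    by linarith, hκ20, by positivity, mul_le_of_le_one_right hA0.le (by linarith), le_rfl, hw _ k1, hw _ k2, k1, k2, ?_⟩
  rw [e1, e2, hexp]
  have c1 : 8 * K ≤ A * μ := by
    have : 8 * K / μ ≤ A := by linarith
    rwa [div_le_iff₀ hμ] at this
  have c2 : 64 * δ * (CF + 1) ≤ A * (μ ^ 2 * d) := by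
    have : 64 * δ * (CF + 1) / (μ ^ 2 * d) ≤ A := by linarith
    rwa [div_le_iff₀ (by positivity)] at this
  have c3 : 4 * K ≤ B2 * μ := by
    have : 4 * K / μ ≤ B2 := by linarith
    rwa [div_le_iff₀ hμ] at this
  have c4 : 4 * (CF + 1) * δ ≤ B2 * (μ * d * A) := by
    have : 4 * (CF + 1) * δ / (μ * d * A) ≤ B2 := by linarith
    rwa [div_le_iff₀ (by positivity)] at this
  refine ⟨?_, by linarith, ?_, ?_, ?_, ?_⟩
  · have : 0 ≤ A * μ * (1 / 2 - μ / 8) := by have : 0 ≤ 1 / 2 - μ / 8 := by linarith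
                                             positivity
    linarith
  · have e : A * (1 - μ / 8) * (μ / 4) * (d * (κ - A / δ)) = A * (A * (μ ^ 2 * d)) * (1 - μ / 8) / (32 * δ) := by
      rw [hκ]; field_simp; ring
    rw [e, lt_div_iff₀ (by positivity)]
    have h2 : 64 * δ * (CF + 1) ≤ A * (A * (μ ^ 2 * d)) := c2.trans (le_mul_of_one_le_left (by positivity) hA1)
    have h3 : (64 * δ * (CF + 1)) * (1 / 2) ≤ A * (A * (μ ^ 2 * d)) * (1 - μ / 8) :=
      mul_le_mul h2 (by linarith) (by norm_num) (by positivity)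
    linarith
  · have e : B2 * (μ / 4) * (d * (κ2 - A / δ)) = B2 * (μ * d * A) / (4 * δ) := by
      rw [hκ2]; field_simp; ring
    rw [e, lt_div_iff₀ (by positivity)]
    linarith
  · have e : A * (1 - μ / 8) / κ = δ * (1 - μ / 8) / (1 + μ / 8) := by rw [hκ]; field_simp
    rw [e, div_mul_eq_mul_div, le_div_iff₀ (by positivity)]
    have : (1 - μ) * (1 + μ / 8) ≤ (1 - μ / 8) * (1 - μ / 4) := by nlinarith
    have := mul_le_mul_of_nonneg_left this hδ.le
    linarith
  · rw [div_mul_eq_mul_div, le_div_iff₀ hκ20]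
    have : κ2 * M ≤ 4 * κ2 * M * (3 / 4) := by linarith
    have h1 : 4 * κ2 * M * (3 / 4) ≤ B2 * (1 - μ / 4) := mul_le_mul (by linarith) (by linarith) (by norm_num) (by linarith)
    linarith

end FBP

namespace FBP
open MeasureTheory Topology
namespace Prob
variable {P : Prob}

lemma F_lo {t x v : ℝ} (hv : 0 ≤ v) : -(P.LF * v) ≤ P.F t x v := by
  have h := P.Fl t x v 0
  rw [P.F0 t x 0 le_rfl, sub_zero, sub_zero, abs_of_nonneg hv] at h
  exact (abs_le.1 h).1

lemma up {T T' : ℝ} {u : ℝ → ℝ → ℝ} {g h : ℝ → ℝ} (H : PS P.d T P.F u g h) (hT : T' < T)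
    (h0 : ∀ x ∈ Icc (g 0) (h 0), u 0 x ≤ P.M) (hgb : ∀ t ∈ Ioc 0 T', u t (g t) = P.δ)
    (hhb : ∀ t ∈ Ioc 0 T', u t (h t) = P.δ) : ∀ t ∈ Icc 0 T', ∀ x ∈ Icc (g t) (h t), u t x ≤ P.M :=
  H.upper P.hd.le hT h0 (fun t ht => (hgb t ht).trans_le P.hδM) (fun t ht => (hhb t ht).trans_le P.hδM)
    fun t _ x _ hx => P.FM t x _ hx

lemma low {T T' : ℝ} {u : ℝ → ℝ → ℝ} {g h : ℝ → ℝ} (H : PS P.d T P.F u g h) (hT : T' < T)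
    (h0 : ∀ x ∈ Icc (g 0) (h 0), P.m ≤ u 0 x) (hgb : ∀ t ∈ Ioc 0 T', u t (g t) = P.δ)
    (hhb : ∀ t ∈ Ioc 0 T', u t (h t) = P.δ) : ∀ t ∈ Icc 0 T', ∀ x ∈ Icc (g t) (h t),
      P.m * Real.exp (-(P.LF + 1) * t) ≤ u t x := by
  have hL := P.LF0
  refine H.lower P.hd.le (by linarith) P.hm.le hT h0 (fun t ht => P.hmδ.le.trans_eq (hgb t ht).symm)
    (fun t ht => P.hmδ.le.trans_eq (hhb t ht).symm) ?_
  intro t ht x hx hu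
  have hpos : 0 < P.m * Real.exp (-(P.LF + 1) * t) := mul_pos P.hm (Real.exp_pos _)
  rcases le_or_gt (u t x) 0 with hn | hn
  · rw [P.F0 t x _ hn]
    have := mul_pos (by linarith : 0 < P.LF + 1) hpos
    linarith
  · have h1 := F_lo (P := P) (t := t) (x := x) hn.le
    have h2 := mul_le_mul_of_nonneg_left hu.le hL
    linarith

lemma z0_lin {y : ℝ} (hy : y ∈ Icc (0:ℝ) 1) :
    |∫ r in (0:ℝ)..y, P.q0 r| ≤ P.Bq * y ∧ |∫ r in (0:ℝ)..y, P.q0 r| ≤ P.Bq * (1 - y) := by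
  have hc : Continuous P.q0 := (LipschitzWith.of_dist_le' (K := P.Lq) fun a b => P.ql a b).continuous
  constructor
  · have := int_le_const 0 y P.qb
    rwa [sub_zero, abs_of_nonneg hy.1] at this
  · have h1 := intervalIntegral.integral_add_adjacent_intervals (hc.intervalIntegrable (μ := volume) 0 y) (hc.intervalIntegrable y 1)
    rw [P.q_int] at h1
    have := int_le_const y 1 P.qb
    rw [abs_of_nonneg (by linarith [hy.2] : 0 ≤ 1 - y)] at this
    rw [eq_neg_of_add_eq_zero_left h1, abs_neg]
    exact this

lemma mem01 {x : ℝ} (hx : x ∈ Icc (-P.h0) P.h0) : (x + P.h0) / (2 * P.h0) ∈ Icc (0:ℝ) 1 := by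
  have := P.hh0
  exact ⟨div_nonneg (by linarith [hx.1]) (by linarith), by rw [div_le_one (by linarith)]; linarith [hx.2]⟩

/-- the length threshold -/
noncomputable def l1of (P : Prob) (T : ℝ) : ℝ := P.h0 * (P.m * Real.exp (-(P.LF * T))) / P.M

lemma l1of_pos (T : ℝ) : 0 < P.l1of T :=
  div_pos (mul_pos P.hh0 (mul_pos P.hm (Real.exp_pos _))) P.hM

lemma l1of_lt {T : ℝ} (hT : 0 ≤ T) : P.l1of T < P.h0 := by
  unfold l1of
  rw [div_lt_iff₀ P.hM]
  refine mul_lt_mul_of_pos_left ?_ P.hh0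
  have : Real.exp (-(P.LF * T)) ≤ 1 := Real.exp_le_one_iff.2 (by have := mul_nonneg P.LF0 hT; linarith)
  have := mul_le_of_le_one_right P.hm.le this
  linarith [P.hmδ, P.hδM]

/-- right derivative bound, both sides -/
lemma side {T T' : ℝ} {u : ℝ → ℝ → ℝ} {g h h' : ℝ → ℝ} {F : ℝ → ℝ → ℝ → ℝ} {A B B1 κ w B2 κ2 w2 l1 μ K : ℝ} (H : PS P.d T F u g h) (hT : T' < T)
    (hF : ∀ t x v, |F t x v| ≤ P.CF)
    (hh' : ∀ t ∈ Ioc 0 T', HasDerivAt h (h' t) t) (hh'A : ∀ t ∈ Ioc 0 T', -(P.d / P.δ) * A ≤ h' t)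
    (hwl : ∀ t ∈ Icc 0 T', l1 ≤ h t - g t) (hbd : ∀ t ∈ Icc 0 T', u t (h t) = P.δ)
    (hK0 : ∀ x ∈ Icc (g 0) (h 0), |u 0 x - P.δ| ≤ K * (h 0 - x))
    (hlo : ∀ t ∈ Icc 0 T', ∀ x ∈ Icc (g t) (h t), μ * P.δ ≤ u t x)
    (hhi : ∀ t ∈ Icc 0 T', ∀ x ∈ Icc (g t) (h t), u t x ≤ P.M)
    (hpar : 0 < A ∧ 0 < B ∧ 0 < B1 ∧ 0 < κ ∧ 0 < w ∧ 0 < B2 ∧ 0 < κ2 ∧ 0 < w2 ∧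
      B1 ≤ A ∧ B2 ≤ B ∧ w ≤ l1 ∧ w2 ≤ l1 ∧ A / P.δ ≤ κ ∧ A / P.δ ≤ κ2 ∧
      K ≤ B1 * Real.exp (-(κ * w)) ∧ K ≤ B2 * Real.exp (-(κ2 * w2)) ∧
      P.CF < B1 * Real.exp (-(κ * w)) * (P.d * (κ - A / P.δ)) ∧ P.CF < B2 * Real.exp (-(κ2 * w2)) * (P.d * (κ2 - A / P.δ)) ∧
      P.δ - μ * P.δ ≤ B1 / κ * (1 - Real.exp (-(κ * w))) ∧ P.M ≤ B2 / κ2 * (1 - Real.exp (-(κ2 * w2))))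
    {t q : ℝ} (ht : t ∈ Ioc 0 T') (hq : HasDerivAt (u t) q (h t)) : q ≤ A ∧ -B ≤ q := by
  obtain ⟨p1, p2, p3, p4, p5, p6, p7, p8, p9, p10, p11, p12, p13, p14, p15, p16, p17, p18, p19, p20⟩ := hpar
  have h0 : (0:ℝ) ∈ Icc 0 T' := ⟨le_rfl, ht.1.le.trans ht.2⟩
  have hδ := P.hδ
  have r1 := H.right_barrier (σ := -1) (κ := κ) (B' := B1) (w := w) (K := K) (CF := P.CF) P.hd hT (Or.inr rfl) p4 p3 p5 p13 hh' hh'A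
    (fun t ht => by linarith [hwl t ht]) hbd (fun t _ x _ => hF t x _)
    (fun x hx => hK0 x ⟨by linarith [hx.1, hwl 0 h0], hx.2⟩) p15
    (fun t ht => by
      have hs : t ∈ Icc 0 T' := ⟨ht.1.le, ht.2⟩
      have := hlo t hs (h t - w) ⟨by linarith [hwl t hs], by linarith⟩
      linarith) p17 ht hq
  have r2 := H.right_barrier (σ := 1) (κ := κ2) (B' := B2) (w := w2) (K := K) (CF := P.CF) P.hd hT (Or.inl rfl) p7 p6 p8 p14 hh' hh'A
    (fun t ht => by linarith [hwl t ht]) hbd (fun t _ x _ => hF t x _)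
    (fun x hx => hK0 x ⟨by linarith [hx.1, hwl 0 h0], hx.2⟩) p16
    (fun t ht => by
      have hs : t ∈ Icc 0 T' := ⟨ht.1.le, ht.2⟩
      have := hhi t hs (h t - w2) ⟨by linarith [hwl t hs], by linarith⟩
      linarith) p18 ht hq
  constructor <;> linarith

/-- what the a priori analysis gives for a fixed point on `[0, T1)` -/
structure Good (P : Prob) (D : Dat) (p : ℝ → ℝ → ℝ) (T1 : ℝ) : Prop where
  hl : ∀ t ∈ Ico 0 T1, D.l1 < D.hh p t - D.gg p t
  vg : ∀ t ∈ Ioo 0 T1, D.vg p t = -(P.d / P.δ) * p t 0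
  vh : ∀ t ∈ Ioo 0 T1, D.vh p t = -(P.d / P.δ) * p t 1
  lo : ∀ t ∈ Ico 0 T1, ∀ x ∈ Icc (D.gg p t) (D.hh p t), P.m * Real.exp (-(P.LF + 1) * t) ≤ D.uu p t x
  hi : ∀ t ∈ Ico 0 T1, ∀ x ∈ Icc (D.gg p t) (D.hh p t), D.uu p t x ≤ P.M
  len : ∀ t ∈ Ico 0 T1, 2 * P.l1of D.T ≤ D.hh p t - D.gg p t

theorem apriori (P : Prob) {T : ℝ} (hT : 0 < T) : ∃ (A B : ℝ) (hA : 0 < A) (hB : 0 < B), ∀ p R,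
    (P.dat T (P.l1of T) A B hT (l1of_pos T) hA hB).Fx p R → Good P (P.dat T (P.l1of T) A B hT (l1of_pos T) hA hB) p T := by
  set μ := P.m * Real.exp (-(P.LF + 1) * T) / P.δ with hμ
  have hμ0 : 0 < μ := div_pos (mul_pos P.hm (Real.exp_pos _)) P.hδ
  have hμ1 : μ ≤ 1 := by
    rw [hμ, div_le_one P.hδ]
    have : Real.exp (-(P.LF + 1) * T) ≤ 1 := Real.exp_le_one_iff.2 (by have := mul_nonneg P.LF0 hT.le; linarith)
    exact (mul_le_of_le_one_right P.hm.le this).trans P.hmδ.le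
  have hK : 0 ≤ P.Bq / (2 * P.h0) := div_nonneg P.Bq0 (by linarith [P.hh0])
  obtain ⟨A, B, B1, κ, w, B2, κ2, w2, hpar⟩ := params P.hd P.hδ P.hM hK P.CF0 hμ0 hμ1 (P.l1of_pos T)
  refine ⟨A, B, hpar.1, hpar.2.1, fun p R hfx => ?_⟩
  obtain ⟨D, hD⟩ : ∃ D, D = P.dat T (P.l1of T) A B hT (l1of_pos T) hpar.1 hpar.2.1 := ⟨_, rfl⟩
  rw [← hD] at hfx ⊢
  have dT : D.T = T := by rw [hD]; rfl
  have dl : D.l1 = P.l1of T := by rw [hD]; rfl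
  have dd : D.d = P.d := by rw [hD]; rfl
  have dδ : D.δ = P.δ := by rw [hD]; rfl
  have dh : D.h0 = P.h0 := by rw [hD]; rfl
  have dF : D.F = P.F := by rw [hD]; rfl
  have dq : D.q0 = P.q0 := by rw [hD]; rfl
  have dg : ∀ t, D.vg p t = P.clm B A (p t 0) := fun t => by rw [hD]; rfl
  have dhv : ∀ t, D.vh p t = P.clm A B (p t 1) := fun t => by rw [hD]; rfl
  clear hD
  have hl0 := l1of_lt (P := P) hT.le
  have hlp := P.l1of_pos T
  have hh0 := P.hh0
  have hδ := P.hδ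
  have hg0 : D.gg p 0 = -P.h0 := by rw [Dat.gg_zero, dh]
  have hhh0 : D.hh p 0 = P.h0 := by rw [Dat.hh_zero, dh]
  have hu0 : ∀ x, D.uu p 0 x = P.δ + ∫ r in (0:ℝ)..((x + P.h0) / (2 * P.h0)), P.q0 r := fun x => by
    rw [Dat.uu_init hfx (by rw [dl, dh]; linarith), Dat.z0, dδ, dh, dq]
  have step : ∀ T1, T1 ≤ T → (∀ t ∈ Ico 0 T1, D.l1 < D.hh p t - D.gg p t) → Good P D p T1 := by
    intro T1 hT1 hl
    have H := Dat.ps hfx (T1 := T1) (by rw [dT]; exact hT1) hl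
    rw [dd, dF] at H
    have hbg : ∀ t, D.uu p t (D.gg p t) = P.δ := fun t => by rw [Dat.uu_g, dδ]
    have hbh : ∀ t ∈ Ico 0 T1, D.uu p t (D.hh p t) = P.δ := fun t ht => by
      rw [Dat.uu_h hfx ⟨ht.1, by rw [dT]; exact ht.2.le.trans hT1⟩ (hl t ht).le, dδ]
    have hi0 : ∀ x ∈ Icc (D.gg p 0) (D.hh p 0), D.uu p 0 x ≤ P.M := by
      rw [hg0, hhh0]; intro x hx; rw [hu0]; exact P.z_hi _ (mem01 hx)
    have lo0 : ∀ x ∈ Icc (D.gg p 0) (D.hh p 0), P.m ≤ D.uu p 0 x := by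
      rw [hg0, hhh0]; intro x hx; rw [hu0]; exact P.z_lo _ (mem01 hx)
    have hhi : ∀ t ∈ Ico 0 T1, ∀ x ∈ Icc (D.gg p t) (D.hh p t), D.uu p t x ≤ P.M := fun t ht =>
      up H ht.2 hi0 (fun s _ => hbg s) (fun s hs => hbh s ⟨hs.1.le, hs.2.trans_lt ht.2⟩) t ⟨ht.1, le_rfl⟩
    have hlo : ∀ t ∈ Ico 0 T1, ∀ x ∈ Icc (D.gg p t) (D.hh p t), P.m * Real.exp (-(P.LF + 1) * t) ≤ D.uu p t x := fun t ht =>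
      low H ht.2 lo0 (fun s _ => hbg s) (fun s hs => hbh s ⟨hs.1.le, hs.2.trans_lt ht.2⟩) t ⟨ht.1, le_rfl⟩
    have hloμ : ∀ t ∈ Ico 0 T1, ∀ x ∈ Icc (D.gg p t) (D.hh p t), μ * P.δ ≤ D.uu p t x := by
      intro t ht x hx
      refine le_trans ?_ (hlo t ht x hx)
      rw [hμ, div_mul_cancel₀ _ hδ.ne']
      refine mul_le_mul_of_nonneg_left (Real.exp_le_exp.2 ?_) P.hm.le
      have : t ≤ T := ht.2.le.trans hT1
      have := mul_le_mul_of_nonneg_left this (by linarith [P.LF0] : 0 ≤ P.LF + 1)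
      linarith
    have hKr : ∀ x ∈ Icc (D.gg p 0) (D.hh p 0), |D.uu p 0 x - P.δ| ≤ P.Bq / (2 * P.h0) * (D.hh p 0 - x) := by
      rw [hg0, hhh0]; intro x hx; rw [hu0, add_sub_cancel_left]
      refine (z0_lin (mem01 hx)).2.trans (le_of_eq ?_)
      field_simp; ring
    have hKl : ∀ x ∈ Icc (-D.hh p 0) (-D.gg p 0), |D.uu p 0 (-x) - P.δ| ≤ P.Bq / (2 * P.h0) * (-D.gg p 0 - x) := by
      rw [hg0, hhh0]; intro x hx; rw [hu0, add_sub_cancel_left]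
      refine (z0_lin (mem01 ⟨by linarith [hx.2], by linarith [hx.1]⟩)).1.trans (le_of_eq ?_)
      field_simp; ring
    have hvh : ∀ t ∈ Ioo 0 T1, p t 1 ≤ A ∧ -B ≤ p t 1 := by
      intro t ht
      have hs : ∀ s, s ∈ Icc 0 t → s ∈ Ico 0 T1 := fun s hs => ⟨hs.1, hs.2.trans_lt ht.2⟩
      have hder := Dat.uu_deriv (D := D) hfx.a t (D.hh p t)
      rw [Dat.ox_h (hl t ⟨ht.1.le, ht.2⟩).le] at hder
      exact side H ht.2 P.Fb (fun s _ => Dat.hh_deriv hfx.a.c s) (fun s _ => by rw [dhv]; exact P.clm_lo _ _ _)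
        (fun s h => dl ▸ (hl s (hs s h)).le) (fun s h => hbh s (hs s h)) hKr (fun s h => hloμ s (hs s h))
        (fun s h => hhi s (hs s h)) hpar ⟨ht.1, le_rfl⟩ hder
    have hvg : ∀ t ∈ Ioo 0 T1, p t 0 ≤ B ∧ -A ≤ p t 0 := by
      intro t ht
      have hs : ∀ s, s ∈ Icc 0 t → s ∈ Ico 0 T1 := fun s hs => ⟨hs.1, hs.2.trans_lt ht.2⟩
      have hder : HasDerivAt (fun x => D.uu p t (-x)) (-p t 0) (-D.gg p t) := by
        have h1 := Dat.uu_deriv (D := D) hfx.a t (D.gg p t)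
        rw [Dat.ox_g] at h1
        have h2 : HasDerivAt (D.uu p t) (p t 0) (-(-D.gg p t)) := by rwa [neg_neg]
        have := h2.comp (-D.gg p t) (hasDerivAt_neg (-D.gg p t))
        exact this.congr_deriv (by ring)
      have hm : ∀ s x, x ∈ Icc (-D.hh p s) (-D.gg p s) → -x ∈ Icc (D.gg p s) (D.hh p s) := fun s x hx =>
        ⟨by linarith [hx.2], by linarith [hx.1]⟩
      have := side (u := fun t x => D.uu p t (-x)) H.reflect ht.2 (fun t x v => P.Fb t (-x) v) (fun s _ => (Dat.gg_deriv hfx.a.c s).neg)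
        (fun s _ => by
          rw [dg]; have := P.clm_hi hpar.2.1.le hpar.1.le (p s 0); linarith)
        (fun s h => by have := hl s (hs s h); rw [dl] at this; linarith) (fun s h => by rw [neg_neg]; exact hbg s) hKl (fun s h x hx => hloμ s (hs s h) _ (hm s x hx))
        (fun s h x hx => hhi s (hs s h) _ (hm s x hx)) hpar ⟨ht.1, le_rfl⟩ hder
      constructor <;> linarith [this.1, this.2]
    have hvg' : ∀ t ∈ Ioo 0 T1, D.vg p t = -(P.d / P.δ) * p t 0 := fun t ht => by
      rw [dg]; exact P.clm_eq (hvg t ht).1 (hvg t ht).2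
    have hvh' : ∀ t ∈ Ioo 0 T1, D.vh p t = -(P.d / P.δ) * p t 1 := fun t ht => by
      rw [dhv]; exact P.clm_eq (hvh t ht).1 (hvh t ht).2
    have hwu : ∀ t ∈ Ico 0 T1, ∀ y ∈ Icc (0:ℝ) 1, ∃ x ∈ Icc (D.gg p t) (D.hh p t), D.ww p t y = D.uu p t x := by
      intro t ht y hy
      have hll := Dat.ll_of t (hl t ht)
      have hlpos := Dat.ll_pos (D := D) (p := p) t
      refine ⟨D.gg p t + D.ll p t * y, ⟨by have := mul_nonneg hlpos.le hy.1; linarith, ?_⟩, ?_⟩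
      · have := mul_le_of_le_one_right hlpos.le hy.2; linarith
      · unfold Dat.uu Dat.yy; congr 1; field_simp; ring
    have hmass := Dat.mass hfx (by rw [dδ]; exact hδ) (T1 := T1) (L := P.LF) (by rw [dT]; exact hT1) hl (by rw [dd, dδ]; exact hvg')
      (by rw [dd, dδ]; exact hvh') (fun t ht y hy => by
        rw [dF]
        obtain ⟨x, hx, he⟩ := hwu t ⟨ht.1.le, ht.2⟩ y hy
        exact F_lo (he ▸ (mul_pos P.hm (Real.exp_pos _)).le.trans (hlo t ⟨ht.1.le, ht.2⟩ x hx)))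
    refine ⟨hl, hvg', hvh', hlo, hhi, ?_⟩
    intro t ht
    have hm1 := hmass t ht
    have ht0 : (0:ℝ) ∈ Ico 0 T1 := ⟨le_rfl, ht.1.trans_lt ht.2⟩
    have hw : ∀ s, Continuous (D.ww p s) := fun s => Dat.slice_cont (Dat.ww_cont hfx.a.c) s
    have i1 : P.m ≤ D.Ee p 0 0 := by
      rw [Dat.E0_eq]
      have := intervalIntegral.integral_mono_on (μ := volume) zero_le_one (intervalIntegrable_const (c := P.m)) ((hw 0).intervalIntegrable 0 1)
        (fun y hy => by obtain ⟨x, hx, he⟩ := hwu 0 ht0 y hy; exact he ▸ lo0 x hx)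
      simpa using this
    have i2 : D.Ee p 0 t ≤ P.M := by
      rw [Dat.E0_eq]
      have := intervalIntegral.integral_mono_on (μ := volume) zero_le_one ((hw t).intervalIntegrable 0 1) (intervalIntegrable_const (c := P.M))
        (fun y hy => by obtain ⟨x, hx, he⟩ := hwu t ht y hy; exact he ▸ hhi t ht x hx)
      simpa using this
    rw [dT, ← Dat.ll_of t (hl t ht)]
    have e0 : D.ll p 0 = 2 * P.h0 := by rw [Dat.ll_of 0 (hl 0 ht0), hg0, hhh0]; ring
    rw [e0] at hm1
    have hlpos := Dat.ll_pos (D := D) (p := p) t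
    have hE : Real.exp (P.LF * t) ≤ Real.exp (P.LF * T) :=
      Real.exp_le_exp.2 (mul_le_mul_of_nonneg_left (ht.2.le.trans hT1) P.LF0)
    have j1 : 2 * P.h0 * P.m ≤ 2 * P.h0 * D.Ee p 0 0 := mul_le_mul_of_nonneg_left i1 (by linarith)
    have j2 : Real.exp (P.LF * t) * (D.ll p t * D.Ee p 0 t) ≤ Real.exp (P.LF * T) * (D.ll p t * P.M) := by
      have h1 : D.ll p t * D.Ee p 0 t ≤ D.ll p t * P.M := mul_le_mul_of_nonneg_left i2 hlpos.le
      exact (mul_le_mul_of_nonneg_left h1 (Real.exp_pos _).le).trans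
        (mul_le_mul_of_nonneg_right hE (mul_nonneg hlpos.le P.hM.le))
    unfold l1of
    rw [← mul_div_assoc, div_le_iff₀ P.hM, Real.exp_neg, ← div_eq_mul_inv, ← mul_div_assoc, ← mul_div_assoc, div_le_iff₀ (Real.exp_pos _)]
    linarith
  -- first time
  refine step T le_rfl ?_
  by_contra hcon
  push Not at hcon
  obtain ⟨t0, ht0, hle⟩ := hcon
  have hc : Continuous fun t => D.hh p t - D.gg p t := (Dat.hh_cont hfx.a.c).sub (Dat.gg_cont hfx.a.c)
  set S : Set ℝ := {t | t ∈ Icc 0 t0 ∧ D.hh p t - D.gg p t ≤ D.l1} with hS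
  have hScl : IsClosed S := isClosed_Icc.inter (isClosed_le hc continuous_const)
  have hSne : S.Nonempty := ⟨t0, ⟨ht0.1, le_rfl⟩, hle⟩
  have hSb : BddBelow S := ⟨0, fun t ht => ht.1.1⟩
  have hτ := hScl.csInf_mem hSne hSb
  set τ := sInf S with hτdef
  have hτ0 : 0 < τ := by
    rcases hτ.1.1.eq_or_lt with h | h
    · exfalso
      have := hτ.2
      rw [← h, hg0, hhh0, dl] at this
      linarith
    · exact h
  have hlt : ∀ t ∈ Ico 0 τ, D.l1 < D.hh p t - D.gg p t := by
    intro t ht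
    by_contra hc
    push Not at hc
    have : τ ≤ t := csInf_le hSb ⟨⟨ht.1, ht.2.le.trans hτ.1.2⟩, hc⟩
    linarith [ht.2]
  have G := step τ (hτ.1.2.trans ht0.2.le) hlt
  have hlim : 2 * P.l1of D.T ≤ D.hh p τ - D.gg p τ := by
    refine ge_of_tendsto (hc.continuousAt.tendsto.mono_left nhdsWithin_le_nhds : Tendsto _ (𝓝[<] τ) _) ?_
    filter_upwards [Ioo_mem_nhdsLT hτ0] with s hs
    exact G.len s ⟨hs.1.le, hs.2⟩
  rw [dT] at hlim
  have := hτ.2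
  rw [dl] at this
  linarith

end Prob
end FBP

namespace FBP
open MeasureTheory Topology

structure Of (P : Prob) (D : Dat) : Prop where
  d : D.d = P.d
  δ : D.δ = P.δ
  h0 : D.h0 = P.h0
  F : D.F = P.F
  q0 : D.q0 = P.q0

lemma Prob.dat_of (P : Prob) {T l1 A B : ℝ} (hT : 0 < T) (hl1 : 0 < l1) (hA : 0 < A) (hB : 0 < B) :
    Of P (P.dat T l1 A B hT hl1 hA hB) := ⟨rfl, rfl, rfl, rfl, rfl⟩

/-- agreement of the auxiliary quantities on `[0,t]` -/
structure Agr (D D' : Dat) (p q : ℝ → ℝ → ℝ) (t : ℝ) : Prop where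
  pq : ∀ s ∈ Icc 0 t, ∀ y ∈ Icc (0:ℝ) 1, p s y = q s y
  vg : ∀ s ∈ Icc 0 t, D.vg p s = D'.vg q s
  vh : ∀ s ∈ Icc 0 t, D.vh p s = D'.vh q s
  ll : ∀ s ∈ Icc 0 t, D.ll p s = D'.ll q s

lemma int_congr0 {a b : ℝ → ℝ} {t : ℝ} (ht : 0 ≤ t) (h : ∀ s ∈ Icc 0 t, a s = b s) :
    ∫ s in (0:ℝ)..t, a s = ∫ s in (0:ℝ)..t, b s :=
  intervalIntegral.integral_congr fun s hs => h s (by rwa [uIcc_of_le ht] at hs)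

namespace Agr
variable {P : Prob} {D D' : Dat} {p q : ℝ → ℝ → ℝ} {t : ℝ}

lemma mono (h : Agr D D' p q t) {s : ℝ} (hs : s ≤ t) : Agr D D' p q s :=
  ⟨fun r hr => h.pq r ⟨hr.1, hr.2.trans hs⟩, fun r hr => h.vg r ⟨hr.1, hr.2.trans hs⟩,
    fun r hr => h.vh r ⟨hr.1, hr.2.trans hs⟩, fun r hr => h.ll r ⟨hr.1, hr.2.trans hs⟩⟩

lemma gg (h : Agr D D' p q t) (o : Of P D) (o' : Of P D') (ht : 0 ≤ t) : D.gg p t = D'.gg q t := by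
  unfold Dat.gg; rw [o.h0, o'.h0, int_congr0 ht h.vg]

lemma hh (h : Agr D D' p q t) (o : Of P D) (o' : Of P D') (ht : 0 ≤ t) : D.hh p t = D'.hh q t := by
  unfold Dat.hh; rw [o.h0, o'.h0, int_congr0 ht h.vh]

lemma th (h : Agr D D' p q t) (o : Of P D) (o' : Of P D') (ht : 0 ≤ t) : D.th p t = D'.th q t := by
  unfold Dat.th; rw [o.d, o'.d]; exact int_congr0 ht fun s hs => by rw [h.ll s hs]

lemma pr (h : Agr D D' p q t) (ht : 0 ≤ t) {y : ℝ} (hy : y ∈ Icc (0:ℝ) 1) : Dat.pr p t y = Dat.pr q t y :=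
  int_congr0 hy.1 fun r hr => h.pq t ⟨ht, le_rfl⟩ r ⟨hr.1, hr.2.trans hy.2⟩

lemma NN (h : Agr D D' p q t) (o : Of P D) (o' : Of P D') (ht : 0 ≤ t) {y : ℝ} (hy : y ∈ Icc (0:ℝ) 1) :
    D.NN p t y = D'.NN q t y := by
  have m : t ∈ Icc 0 t := ⟨ht, le_rfl⟩
  unfold Dat.NN Dat.VV Dat.ww
  rw [h.pq t m y hy, h.vg t m, h.vh t m, h.gg o o' ht, h.ll t m, h.pr ht hy, o.F, o'.F, o.δ, o'.δ]

lemma Phi (h : Agr D D' p q t) (o : Of P D) (o' : Of P D') (ht : 0 ≤ t) (y : ℝ) : D.Phi p t y = D'.Phi q t y := by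
  have m : t ∈ Icc 0 t := ⟨ht, le_rfl⟩
  have e1 : ∀ s ∈ Icc 0 t, D.Nt p s = D'.Nt q s := fun s hs => by
    funext ξ; unfold Dat.Nt; rw [(h.mono hs.2).NN o o' hs.1 (tri_mem ξ)]
  unfold Dat.Phi Dat.I0 duh
  rw [h.ll t m, h.th o o' ht, o.q0, o'.q0]
  congr 2
  refine int_congr0 ht fun s hs => ?_
  rw [e1 s hs, (h.mono hs.2).th o o' hs.1]

end Agr

/-- a fixed point with inactive clamps on `[0,T0]` -/
structure Sol (P : Prob) (D : Dat) (p : ℝ → ℝ → ℝ) (R T0 : ℝ) : Prop where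
  o : Of P D
  fx : D.Fx p R
  hT : T0 ≤ D.T
  hl : ∀ t ∈ Icc 0 T0, D.l1 < D.hh p t - D.gg p t
  vg : ∀ t ∈ Icc 0 T0, D.vg p t = -(P.d / P.δ) * p t 0
  vh : ∀ t ∈ Icc 0 T0, D.vh p t = -(P.d / P.δ) * p t 1

lemma Adm.mono {p : ℝ → ℝ → ℝ} {R R' : ℝ} (h : Dat.Adm p R) (hR : R ≤ R') : Dat.Adm p R' :=
  ⟨h.c, fun t y => (h.b t y).trans hR⟩

namespace Sol
variable {P : Prob} {D D' : Dat} {p q : ℝ → ℝ → ℝ} {R R' T0 : ℝ}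

lemma agr (h : Sol P D p R T0) {l1 A : ℝ} (hT : 0 < T0) (hl1 : 0 < l1) (hA : 0 < A) (hll : l1 ≤ D.l1) (hRA : R ≤ A) :
    Agr (P.dat T0 l1 A A hT hl1 hA hA) D p p T0 := by
  have e1 : ∀ s ∈ Icc 0 T0, (P.dat T0 l1 A A hT hl1 hA hA).vg p s = D.vg p s := fun s hs => by
    rw [h.vg s hs]
    have := abs_le.1 ((h.fx.a.b s 0).trans hRA)
    exact P.clm_eq this.2 this.1
  have e2 : ∀ s ∈ Icc 0 T0, (P.dat T0 l1 A A hT hl1 hA hA).vh p s = D.vh p s := fun s hs => by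
    rw [h.vh s hs]
    have := abs_le.1 ((h.fx.a.b s 1).trans hRA)
    exact P.clm_eq this.2 this.1
  refine ⟨fun _ _ _ _ => rfl, e1, e2, fun s hs => ?_⟩
  rw [Dat.ll_of s (h.hl s hs)]
  have g1 : (P.dat T0 l1 A A hT hl1 hA hA).gg p s = D.gg p s := by
    unfold Dat.gg; rw [h.o.h0, int_congr0 hs.1 fun r hr => e1 r ⟨hr.1, hr.2.trans hs.2⟩]; rfl
  have g2 : (P.dat T0 l1 A A hT hl1 hA hA).hh p s = D.hh p s := by
    unfold Dat.hh; rw [h.o.h0, int_congr0 hs.1 fun r hr => e2 r ⟨hr.1, hr.2.trans hs.2⟩]; rfl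
  unfold Dat.ll
  rw [g1, g2]
  exact max_eq_left (hll.trans (h.hl s hs).le)

lemma fixd (h : Sol P D p R T0) {l1 A : ℝ} (hT : 0 < T0) (hl1 : 0 < l1) (hA : 0 < A) (hll : l1 ≤ D.l1) (hRA : R ≤ A) :
    ∀ t ∈ Icc 0 T0, ∀ y, p t y = (P.dat T0 l1 A A hT hl1 hA hA).Phi p t y := fun t ht y => by
  rw [((h.agr hT hl1 hA hll hRA).mono ht.2).Phi (P.dat_of hT hl1 hA hA) h.o ht.1 y]
  exact h.fx.f t ⟨ht.1, ht.2.trans h.hT⟩ y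

lemma eqp (h : Sol P D p R T0) (h' : Sol P D' q R' T0) (hT : 0 < T0) : ∀ t ∈ Icc 0 T0, ∀ y ∈ Icc (0:ℝ) 1, p t y = q t y := by
  have hl1 : 0 < min D.l1 D'.l1 := lt_min D.hl1 D'.hl1
  have hA : 0 < max R R' + 1 := by linarith [h.fx.a.R0, le_max_left R R']
  have hR : R ≤ max R R' + 1 := by linarith [le_max_left R R']
  have hR' : R' ≤ max R R' + 1 := by linarith [le_max_right R R']
  exact Dat.fix_unique (D := P.dat T0 _ _ _ hT hl1 hA hA) (Adm.mono h.fx.a hR) (Adm.mono h'.fx.a hR')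
    (fun t ht y _ => h.fixd hT hl1 hA (min_le_left _ _) hR t ht y)
    (fun t ht y _ => h'.fixd hT hl1 hA (min_le_right _ _) hR' t ht y)

lemma agree (h : Sol P D p R T0) (h' : Sol P D' q R' T0) (hT : 0 < T0) : Agr D D' p q T0 := by
  have e := h.eqp h' hT
  have hb0 : (0:ℝ) ∈ Icc (0:ℝ) 1 := by norm_num
  have hb1 : (1:ℝ) ∈ Icc (0:ℝ) 1 := by norm_num
  have e1 : ∀ s ∈ Icc 0 T0, D.vg p s = D'.vg q s := fun s hs => by rw [h.vg s hs, h'.vg s hs, e s hs 0 hb0]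
  have e2 : ∀ s ∈ Icc 0 T0, D.vh p s = D'.vh q s := fun s hs => by rw [h.vh s hs, h'.vh s hs, e s hs 1 hb1]
  refine ⟨e, e1, e2, fun s hs => ?_⟩
  rw [Dat.ll_of s (h.hl s hs), Dat.ll_of s (h'.hl s hs)]
  unfold Dat.gg Dat.hh
  rw [h.o.h0, h'.o.h0, int_congr0 hs.1 fun r hr => e1 r ⟨hr.1, hr.2.trans hs.2⟩,
    int_congr0 hs.1 fun r hr => e2 r ⟨hr.1, hr.2.trans hs.2⟩]

lemma eqall (h : Sol P D p R T0) (h' : Sol P D' q R' T0) (hT : 0 < T0) {t : ℝ} (ht : t ∈ Icc 0 T0) :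
    p t = q t ∧ D.gg p t = D'.gg q t ∧ D.hh p t = D'.hh q t ∧ D.uu p t = D'.uu q t := by
  have a := (h.agree h' hT).mono ht.2
  have e1 : p t = q t := by
    funext y
    rw [h.fx.f t ⟨ht.1, ht.2.trans h.hT⟩, h'.fx.f t ⟨ht.1, ht.2.trans h'.hT⟩, a.Phi h.o h'.o ht.1]
  refine ⟨e1, a.gg h.o h'.o ht.1, a.hh h.o h'.o ht.1, ?_⟩
  funext x
  unfold Dat.uu Dat.yy Dat.ww Dat.pr
  rw [e1, a.gg h.o h'.o ht.1, a.ll t ⟨ht.1, le_rfl⟩, h.o.δ, h'.o.δ]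

lemma mono (h : Sol P D p R T0) {T1 : ℝ} (h1 : T1 ≤ T0) : Sol P D p R T1 :=
  ⟨h.o, h.fx, h1.trans h.hT, fun t ht => h.hl t ⟨ht.1, ht.2.trans h1⟩, fun t ht => h.vg t ⟨ht.1, ht.2.trans h1⟩,
    fun t ht => h.vh t ⟨ht.1, ht.2.trans h1⟩⟩

end Sol

/-- existence of good solutions on every time interval -/
theorem Prob.sol_exists (P : Prob) {T0 : ℝ} (hT : 0 < T0) : ∃ D p R, Sol P D p R T0 ∧ T0 < D.T ∧
    (∀ t ∈ Icc 0 T0, ∀ x ∈ Icc (D.gg p t) (D.hh p t), 0 < D.uu p t x) ∧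
    (∀ t ∈ Icc 0 T0, ∀ x ∈ Icc (D.gg p t) (D.hh p t), D.uu p t x ≤ P.M) ∧
    (∀ x, D.uu p 0 x = P.δ + ∫ r in (0:ℝ)..((x + P.h0) / (2 * P.h0)), P.q0 r) := by
  have hT1 : 0 < T0 + 1 := by linarith
  obtain ⟨A, B, hA, hB, hG⟩ := P.apriori hT1
  obtain ⟨p, R, hfx⟩ := Dat.fx_exists (P.dat (T0 + 1) (P.l1of (T0 + 1)) A B hT1 (P.l1of_pos _) hA hB)
  have G := hG p R hfx
  obtain ⟨D, hD⟩ : ∃ D, D = P.dat (T0 + 1) (P.l1of (T0 + 1)) A B hT1 (P.l1of_pos _) hA hB := ⟨_, rfl⟩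
  have o : Of P D := by rw [hD]; exact P.dat_of _ _ _ _
  have dT : D.T = T0 + 1 := by rw [hD]; rfl
  have dl : D.l1 = P.l1of (T0 + 1) := by rw [hD]; rfl
  rw [← hD] at G hfx
  have hs : ∀ t ∈ Icc 0 T0, t ∈ Ico 0 (T0 + 1) := fun t ht => ⟨ht.1, by linarith [ht.2]⟩
  have ext : ∀ a b : ℝ → ℝ, Continuous a → Continuous b → (∀ t ∈ Ioo 0 (T0 + 1), a t = b t) → ∀ t ∈ Icc 0 T0, a t = b t := by
    intro a b ha hb hab t ht
    have := EqOn.closure (f := a) (g := b) hab ha hb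
    rw [closure_Ioo hT1.ne] at this
    exact this ⟨ht.1, by linarith [ht.2]⟩
  refine ⟨D, p, R, ⟨o, hfx, by linarith, fun t ht => G.hl t (hs t ht), ?_, ?_⟩, by linarith, ?_, fun t ht => G.hi t (hs t ht), ?_⟩
  · exact ext _ _ (Dat.vg_cont hfx.a.c) (continuous_const.mul (hfx.a.c.comp (continuous_id.prodMk continuous_const))) G.vg
  · exact ext _ _ (Dat.vh_cont hfx.a.c) (continuous_const.mul (hfx.a.c.comp (continuous_id.prodMk continuous_const))) G.vh
  · intro t ht x hx
    exact (mul_pos P.hm (Real.exp_pos _)).trans_le (G.lo t (hs t ht) x hx)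
  · intro x
    rw [Dat.uu_init hfx (by rw [dl, o.h0]; linarith [P.l1of_lt hT1.le, P.hh0]), Dat.z0, o.δ, o.h0, o.q0]

end FBP

namespace FBP
open MeasureTheory Topology

lemma clamp_mem {M : ℝ} (hM : 0 ≤ M) (v : ℝ) : max 0 (min v M) ∈ Icc (0:ℝ) M :=
  ⟨le_max_left _ _, max_le hM (min_le_right _ _)⟩

lemma clamp_id {M v : ℝ} (h : v ∈ Icc (0:ℝ) M) : max 0 (min v M) = v := by
  rw [min_eq_left h.2, max_eq_right h.1]

noncomputable def Fcl (f : ℝ → ℝ → ℝ → ℝ) (M t x v : ℝ) : ℝ := f (max t 0) x (max 0 (min v M))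

lemma max0_mem (t : ℝ) : max t 0 ∈ Ici (0:ℝ) := mem_Ici.2 (le_max_right _ _)

lemma F_data {f : ℝ → ℝ → ℝ → ℝ} {β M : ℝ} (hf2 : CondF2 f β) (hM : 0 < M) :
    ∃ CF LF HF α : ℝ, 0 < α ∧ α ≤ 1 / 2 ∧
      Continuous (fun z : ℝ × ℝ × ℝ => Fcl f M z.1 z.2.1 z.2.2) ∧
      (∀ t x v, |Fcl f M t x v| ≤ CF) ∧
      (∀ t x v v', |Fcl f M t x v - Fcl f M t x v'| ≤ LF * |v - v'|) ∧
      (∀ t x x' v, |Fcl f M t x v - Fcl f M t x' v| ≤ HF * |x - x'| ^ α) := by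
  obtain ⟨hβ, hH, -, h0, hL⟩ := hf2
  obtain ⟨C, hC, hH⟩ := hH M hM
  obtain ⟨L, hL0, hL⟩ := hL M hM
  have b1 : ∀ t x v, |Fcl f M t x v| ≤ L * M := fun t x v => by
    have h1 := hL (max t 0) (max0_mem t) x _ (clamp_mem hM.le v) 0 ⟨le_rfl, hM.le⟩
    rw [h0 _ (max0_mem t), sub_zero, sub_zero, abs_of_nonneg (clamp_mem hM.le v).1] at h1
    exact h1.trans (mul_le_mul_of_nonneg_left (clamp_mem hM.le v).2 hL0.le)
  have b2 : ∀ t x v v', |Fcl f M t x v - Fcl f M t x v'| ≤ L * |v - v'| := fun t x v v' =>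
    (hL _ (max0_mem t) x _ (clamp_mem hM.le v) _ (clamp_mem hM.le v')).trans
      (mul_le_mul_of_nonneg_left (clamp_lip _ _ _ _) hL0.le)
  have hβ2 : 0 < β / 2 := by linarith [hβ.1]
  have b3 : ∀ t t' x x' v, |Fcl f M t x v - Fcl f M t' x' v| ≤ C * (|max t 0 - max t' 0| ^ (β / 2) + |x - x'| ^ β) :=
    fun t t' x x' v => hH _ (max0_mem t) _ (max0_mem t') x x' _ (clamp_mem hM.le v)
  refine ⟨L * M, L, C + 2 * (L * M), min β (1 / 2), lt_min hβ.1 (by norm_num), min_le_right _ _, ?_, b1, b2, ?_⟩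
  · rw [continuous_iff_continuousAt]
    intro z
    rw [ContinuousAt, tendsto_iff_norm_sub_tendsto_zero]
    have lim : Tendsto (fun w : ℝ × ℝ × ℝ => C * (|max w.1 0 - max z.1 0| ^ (β / 2) + |w.2.1 - z.2.1| ^ β) + L * |w.2.2 - z.2.2|)
        (𝓝 z) (𝓝 0) := by
      have hc : Continuous (fun w : ℝ × ℝ × ℝ => C * (|max w.1 0 - max z.1 0| ^ (β / 2) + |w.2.1 - z.2.1| ^ β) + L * |w.2.2 - z.2.2|) := by
        have e1 : Continuous (fun w : ℝ × ℝ × ℝ => |max w.1 0 - max z.1 0| ^ (β / 2)) :=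
          Continuous.rpow_const (by fun_prop) fun _ => Or.inr hβ2.le
        have e2 : Continuous (fun w : ℝ × ℝ × ℝ => |w.2.1 - z.2.1| ^ β) :=
          Continuous.rpow_const (by fun_prop) fun _ => Or.inr hβ.1.le
        fun_prop
      have := hc.tendsto z
      simpa [Real.zero_rpow hβ.1.ne', Real.zero_rpow hβ2.ne'] using this
    refine squeeze_zero (fun _ => norm_nonneg _) (fun w => ?_) lim
    rw [Real.norm_eq_abs]
    have h1 := abs_sub_le (Fcl f M w.1 w.2.1 w.2.2) (Fcl f M z.1 z.2.1 w.2.2) (Fcl f M z.1 z.2.1 z.2.2)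
    have h2 := b3 w.1 z.1 w.2.1 z.2.1 w.2.2
    have h3 := b2 z.1 z.2.1 w.2.2 z.2.2
    linarith
  · intro t x x' v
    have hLM : 0 ≤ L * M := by positivity
    rcases le_total |x - x'| 1 with h | h
    · have h1 := b3 t t x x' v
      rw [sub_self, abs_zero, Real.zero_rpow hβ2.ne', zero_add] at h1
      rcases (abs_nonneg (x - x')).eq_or_lt with h0 | h0
      · rw [← h0, Real.zero_rpow hβ.1.ne'] at h1
        rw [← h0, Real.zero_rpow (lt_min hβ.1 (by norm_num)).ne']; linarith
      have h2 := Real.rpow_le_rpow_of_exponent_ge h0 h (min_le_left β (1/2))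
      have h3 : 0 ≤ |x - x'| ^ (min β (1/2)) := Real.rpow_nonneg (abs_nonneg _) _
      nlinarith [mul_le_mul_of_nonneg_left h2 hC.le, mul_nonneg hLM h3]
    · have h1 : 1 ≤ |x - x'| ^ (min β (1/2)) := Real.one_le_rpow h (lt_min hβ.1 (by norm_num)).le
      have h2 := b1 t x v
      have h3 := b1 t x' v
      rw [abs_le] at h2 h3
      have h4 : |Fcl f M t x v - Fcl f M t x' v| ≤ 2 * (L * M) := by rw [abs_le]; constructor <;> linarith
      nlinarith

lemma q_data {δ h₀ : ℝ} {u₀ : ℝ → ℝ} (hh₀ : 0 < h₀) (hu : InX δ h₀ u₀) : ∃ Lq Bq : ℝ, ∃ q0 : ℝ → ℝ,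
    (∀ y y', |q0 y - q0 y'| ≤ Lq * |y - y'|) ∧ (∀ y, |q0 y| ≤ Bq) ∧ (∀ y, q0 (-y) = q0 y) ∧
    (∀ y, q0 (2 - y) = q0 y) ∧ ∀ y ∈ Icc (0:ℝ) 1, δ + ∫ r in (0:ℝ)..y, q0 r = u₀ (-h₀ + 2 * h₀ * y) := by
  obtain ⟨hc, hl, hr, -⟩ := hu
  have hlt : -h₀ < h₀ := by linarith
  obtain ⟨K, hK⟩ : ∃ K, K = Icc (-h₀) h₀ := ⟨_, rfl⟩
  have uK : UniqueDiffOn ℝ K := hK ▸ uniqueDiffOn_Icc hlt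
  rw [← hK] at hc
  have h2 : ContDiffOn ℝ (1 + 1) u₀ K := by simpa [one_add_one_eq_two] using hc
  have hd1 := ((contDiffOn_succ_iff_derivWithin uK).1 h2).2.2
  have hd0 : DifferentiableOn ℝ u₀ K := hc.differentiableOn (by norm_num)
  obtain ⟨v, hv⟩ : ∃ v, v = derivWithin u₀ K := ⟨_, rfl⟩
  rw [← hv] at hd1
  have hKc : IsCompact K := hK ▸ isCompact_Icc
  have hv1 : DifferentiableOn ℝ v K := hd1.differentiableOn (by norm_num)
  have hv2 : ContinuousOn (derivWithin v K) K := hd1.continuousOn_derivWithin uK le_rfl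
  obtain ⟨B, hB⟩ := hKc.exists_bound_of_continuousOn hv1.continuousOn
  obtain ⟨L, hL⟩ := hKc.exists_bound_of_continuousOn hv2
  have hlip : ∀ x ∈ K, ∀ y ∈ K, ‖v y - v x‖ ≤ L * ‖y - x‖ := fun x hx y hy =>
    (hK ▸ convex_Icc _ _ : Convex ℝ K).norm_image_sub_le_of_norm_derivWithin_le hv1 hL hx hy
  have mem : ∀ y ∈ Icc (0:ℝ) 1, -h₀ + 2 * h₀ * y ∈ K := fun y hy => by
    rw [hK]; constructor <;> nlinarith [hy.1, hy.2]
  have hL0 : 0 ≤ L := (norm_nonneg _).trans (hL _ (mem 0 ⟨le_rfl, zero_le_one⟩))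
  refine ⟨2 * h₀ * (L * (2 * h₀)), 2 * h₀ * B, fun ξ => 2 * h₀ * v (-h₀ + 2 * h₀ * tri ξ), ?_, ?_, ?_, ?_, ?_⟩
  · intro y y'
    have := hlip _ (mem _ (tri_mem y')) _ (mem _ (tri_mem y))
    rw [Real.norm_eq_abs, Real.norm_eq_abs, show -h₀ + 2 * h₀ * tri y - (-h₀ + 2 * h₀ * tri y') = 2 * h₀ * (tri y - tri y') by ring,
      abs_mul, abs_of_pos (by linarith : 0 < 2 * h₀)] at this
    rw [← mul_sub, abs_mul, abs_of_pos (by linarith : 0 < 2 * h₀), mul_assoc (2 * h₀)]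
    refine mul_le_mul_of_nonneg_left (this.trans ?_) (by linarith : 0 ≤ 2 * h₀)
    have := mul_le_mul_of_nonneg_left (tri_lip y y') (by positivity : 0 ≤ L * (2 * h₀))
    linarith
  · intro y
    have := hB _ (mem _ (tri_mem y))
    rw [Real.norm_eq_abs] at this
    rw [abs_mul, abs_of_pos (by linarith : 0 < 2 * h₀)]
    gcongr
  · intro y; simp only [tri_sym0]
  · intro y; simp only [tri_sym1]
  · intro y hy
    have e : ∫ r in (0:ℝ)..y, 2 * h₀ * v (-h₀ + 2 * h₀ * tri r) = ∫ r in (0:ℝ)..y, 2 * h₀ * v (-h₀ + 2 * h₀ * r) := by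
      refine int_congr0 hy.1 fun s hs => ?_
      rw [tri_of_mem ⟨hs.1, hs.2.trans hy.2⟩]
    have ca : Continuous fun r : ℝ => -h₀ + 2 * h₀ * r := by fun_prop
    have mp : MapsTo (fun r : ℝ => -h₀ + 2 * h₀ * r) (Icc 0 y) K := fun r hr => mem r ⟨hr.1, hr.2.trans hy.2⟩
    rw [e, intervalIntegral.integral_eq_sub_of_hasDerivAt_of_le (f := fun r => u₀ (-h₀ + 2 * h₀ * r)) hy.1]
    · simp [hl]
    · exact hd0.continuousOn.comp ca.continuousOn mp
    · intro r hr
      have m1 : -h₀ + 2 * h₀ * r ∈ Ioo (-h₀) h₀ := by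
        have := hr.2.trans_le hy.2; have := hr.1; constructor <;> nlinarith
      have m2 : K ∈ 𝓝 (-h₀ + 2 * h₀ * r) := hK ▸ Icc_mem_nhds m1.1 m1.2
      have e1 : HasDerivAt u₀ (v (-h₀ + 2 * h₀ * r)) (-h₀ + 2 * h₀ * r) := by
        rw [hv]; exact (hd0 _ (mem_of_mem_nhds m2)).hasDerivWithinAt.hasDerivAt m2
      have e2 : HasDerivAt (fun r : ℝ => -h₀ + 2 * h₀ * r) (2 * h₀) r := by
        simpa using ((hasDerivAt_id r).const_mul (2 * h₀)).const_add (-h₀)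
      refine (e1.comp r e2).congr_deriv (mul_comm _ _)
    · refine ContinuousOn.intervalIntegrable ?_
      rw [uIcc_of_le hy.1]
      exact (hv1.continuousOn.comp ca.continuousOn mp).const_mul _

/-- the auxiliary problem attached to the hypotheses -/
structure Prob.Is (P : Prob) (d δ h₀ M₀ : ℝ) (f : ℝ → ℝ → ℝ → ℝ) (u₀ : ℝ → ℝ) : Prop where
  d : P.d = d
  δ : P.δ = δ
  h0 : P.h0 = h₀
  M : M₀ ≤ P.M
  F : ∀ t, 0 ≤ t → ∀ x, ∀ v ∈ Icc 0 P.M, P.F t x v = f t x v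
  lo : ∀ x ∈ Icc (-h₀) h₀, P.m ≤ u₀ x
  hi : ∀ x ∈ Icc (-h₀) h₀, u₀ x ≤ P.M
  q : ∀ x ∈ Icc (-h₀) h₀, P.δ + ∫ r in (0:ℝ)..(x + h₀) / (2 * h₀), P.q0 r = u₀ x

lemma prob_exists {d δ h₀ M₀ β : ℝ} {f : ℝ → ℝ → ℝ → ℝ} {u₀ : ℝ → ℝ}
    (hd : 0 < d) (hδ : 0 < δ) (hh₀ : 0 < h₀)
    (hf2 : CondF2 f β) (hf3 : CondF3 f M₀) (hu₀ : InX δ h₀ u₀) : ∃ P : Prob, P.Is d δ h₀ M₀ f u₀ := by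
  have hlt : -h₀ ≤ h₀ := by linarith
  have hne : (Icc (-h₀) h₀).Nonempty := ⟨h₀, hlt, le_rfl⟩
  obtain ⟨a, ha, hla⟩ := isCompact_Icc.exists_isMinOn hne hu₀.1.continuousOn
  obtain ⟨b, hb, hlb⟩ := isCompact_Icc.exists_isMaxOn hne hu₀.1.continuousOn
  obtain ⟨m, hm⟩ : ∃ m, m = min (δ / 2) (u₀ a) := ⟨_, rfl⟩
  obtain ⟨M, hM⟩ : ∃ M, M = max δ (max M₀ (u₀ b)) := ⟨_, rfl⟩
  have hM1 : δ ≤ M := hM ▸ le_max_left _ _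
  have hM2 : M₀ ≤ M := hM ▸ (le_max_left _ _).trans (le_max_right _ _)
  have hM3 : ∀ x ∈ Icc (-h₀) h₀, u₀ x ≤ M := fun x hx => (hlb hx : u₀ x ≤ u₀ b).trans (hM ▸ (le_max_right _ _).trans (le_max_right _ _))
  have hm3 : ∀ x ∈ Icc (-h₀) h₀, m ≤ u₀ x := fun x hx => (hm ▸ min_le_right _ _ : m ≤ u₀ a).trans (hla hx)
  have hM0 : 0 < M := hδ.trans_le hM1
  obtain ⟨CF, LF, HF, α, hα0, hα1, Fc, Fb, Fl, Fh⟩ := F_data hf2 hM0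
  obtain ⟨Lq, Bq, q0, ql, qb, qs0, qs1, qi⟩ := q_data hh₀ hu₀
  have mem : ∀ y ∈ Icc (0:ℝ) 1, -h₀ + 2 * h₀ * y ∈ Icc (-h₀) h₀ := fun y hy => by
    constructor <;> nlinarith [hy.1, hy.2]
  refine ⟨{ d := d, δ := δ, h0 := h₀, M := M, m := m, CF := CF, LF := LF, HF := HF, α := α, Lq := Lq, Bq := Bq,
            F := Fcl f M, q0 := q0, hd := hd, hδ := hδ, hh0 := hh₀, hm := ?_, hmδ := ?_, hδM := hM1, hα0 := hα0, hα1 := hα1,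
            Fc := Fc, Fb := Fb, Fl := Fl, Fh := Fh, F0 := ?_, FM := ?_, ql := ql, qb := qb, q_sym0 := qs0, q_sym1 := qs1,
            q_int := ?_, z_lo := ?_, z_hi := ?_ }, rfl, rfl, rfl, hM2, ?_, hm3, hM3, ?_⟩
  · rw [hm]; exact lt_min (by linarith) (hu₀.2.2.2 a ha)
  · rw [hm]; exact (min_le_left _ _).trans_lt (by linarith)
  · intro t x v hv
    unfold Fcl
    rw [max_eq_left ((min_le_left _ _).trans hv)]
    exact hf2.2.2.2.1 _ (max0_mem t) x
  · intro t x v hv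
    unfold Fcl
    rw [min_eq_right hv.le, max_eq_right hM0.le]
    exact hf3.2 _ (max0_mem t) x M hM2
  · have := qi 1 ⟨zero_le_one, le_rfl⟩
    rw [show -h₀ + 2 * h₀ * 1 = h₀ by ring, hu₀.2.2.1] at this
    linarith
  · intro y hy; rw [qi y hy]; exact hm3 _ (mem y hy)
  · intro y hy; rw [qi y hy]; exact hM3 _ (mem y hy)
  · intro t ht x v hv
    show Fcl f M t x v = _
    unfold Fcl
    rw [max_eq_left ht, clamp_id hv]
  · intro x hx
    have := qi ((x + h₀) / (2 * h₀)) ⟨div_nonneg (by linarith [hx.1]) (by linarith), by rw [div_le_one (by linarith)]; linarith [hx.2]⟩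
    rw [this]; congr 1; field_simp; ring
end FBP

namespace FBP
open MeasureTheory Topology

section CS
variable {P : Prob} {d δ h₀ M₀ : ℝ} {f : ℝ → ℝ → ℝ → ℝ} {u₀ : ℝ → ℝ} {u : ℝ → ℝ → ℝ} {g h : ℝ → ℝ}

lemma cs_ps (H : ClassicalSolution d δ h₀ f u₀ (Ici (0:ℝ)) u g h) (T : ℝ) {F : ℝ → ℝ → ℝ → ℝ}
    (hF : ∀ t ∈ Ioo 0 T, ∀ x ∈ Ioo (g t) (h t), F t x (u t x) = f t x (u t x)) : PS d T F u g h where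
  gc := H.g_reg.continuousOn.mono fun t ht => ht.1
  hc := H.h_reg.continuousOn.mono fun t ht => ht.1
  uc := H.u_cont.mono fun z hz => ⟨hz.1.1, hz.2⟩
  ut := fun t ht => H.ut_diff t ht.1.le ht.1
  ux := fun t ht x hx => H.ux_diff t ht.1.le ht.1 x (Ioo_subset_Icc_self hx)
  uxx := fun t ht => H.uxx_diff t ht.1.le ht.1
  pde := fun t ht x hx => by rw [hF t ht x hx]; exact H.pde t ht.1.le ht.1 x hx

lemma cs_up (H : ClassicalSolution d δ h₀ f u₀ (Ici (0:ℝ)) u g h) (hP : P.Is d δ h₀ M₀ f u₀) (hf : CondF3 f M₀)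
    {t : ℝ} (ht : 0 ≤ t) : ∀ x ∈ Icc (g t) (h t), u t x ≤ P.M := by
  have h1 := (cs_ps H (t + 1) (F := f) fun _ _ _ _ => rfl).upper (T' := t) (M := P.M) (hP.d ▸ P.hd.le) (by linarith)
    (fun x hx => by
      rw [H.g_init, H.h_init] at hx; rw [H.u_init x hx]; exact hP.hi x hx)
    (fun s hs => by rw [H.bc_g s hs.1.le hs.1, ← hP.δ]; exact P.hδM)
    (fun s hs => by rw [H.bc_h s hs.1.le hs.1, ← hP.δ]; exact P.hδM)
    fun s hs x _ hx => hf.2 s hs.1.le x _ (hP.M.trans hx.le)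
  exact h1 t ⟨ht, le_rfl⟩

lemma cs_low (H : ClassicalSolution d δ h₀ f u₀ (Ici (0:ℝ)) u g h) (hP : P.Is d δ h₀ M₀ f u₀) {T T' : ℝ} (hT : T' < T)
    (H' : PS P.d T P.F u g h) : ∀ t ∈ Icc 0 T', ∀ x ∈ Icc (g t) (h t), P.m * Real.exp (-(P.LF + 1) * t) ≤ u t x :=
  P.low H' hT (fun x hx => by rw [H.g_init, H.h_init] at hx; rw [H.u_init x hx]; exact hP.lo x hx)
    (fun s hs => by rw [H.bc_g s hs.1.le hs.1, ← hP.δ]) (fun s hs => by rw [H.bc_h s hs.1.le hs.1, ← hP.δ])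

lemma cs_pos (H : ClassicalSolution d δ h₀ f u₀ (Ici (0:ℝ)) u g h) (hP : P.Is d δ h₀ M₀ f u₀) (hf : CondF3 f M₀)
    {T : ℝ} : ∀ t ∈ Icc 0 T, ∀ x ∈ Icc (g t) (h t), 0 < u t x := by
  by_contra hcon
  push Not at hcon
  obtain ⟨t0, ht0, x0, hx0, hu0⟩ := hcon
  have gc : ContinuousOn g (Icc 0 T) := H.g_reg.continuousOn.mono fun t ht => ht.1
  have hc : ContinuousOn h (Icc 0 T) := H.h_reg.continuousOn.mono fun t ht => ht.1
  obtain ⟨X, hX⟩ : ∃ X : ℝ × ℝ → ℝ, X = fun z => g z.1 + z.2 * (h z.1 - g z.1) := ⟨_, rfl⟩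
  have Xm : ∀ z ∈ Icc 0 T ×ˢ Icc (0:ℝ) 1, X z ∈ Icc (g z.1) (h z.1) := fun z hz => by
    have h1 := H.g_lt_h z.1 hz.1.1
    have h2 := hz.2.1
    have h3 := hz.2.2
    rw [hX]; constructor <;> simp only <;> nlinarith
  have cX : ContinuousOn X (Icc 0 T ×ˢ Icc (0:ℝ) 1) := by
    have e1 : ContinuousOn (fun z : ℝ × ℝ => g z.1) (Icc 0 T ×ˢ Icc (0:ℝ) 1) :=
      gc.comp continuousOn_fst fun z hz => hz.1
    have e2 : ContinuousOn (fun z : ℝ × ℝ => h z.1) (Icc 0 T ×ˢ Icc (0:ℝ) 1) :=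
      hc.comp continuousOn_fst fun z hz => hz.1
    rw [hX]
    exact e1.add (continuousOn_snd.mul (e2.sub e1))
  have cW : ContinuousOn (fun z : ℝ × ℝ => u z.1 (X z)) (Icc 0 T ×ˢ Icc (0:ℝ) 1) :=
    H.u_cont.comp (continuousOn_fst.prodMk cX) fun z hz => ⟨hz.1.1, Xm z hz⟩
  obtain ⟨S, hS⟩ : ∃ S : Set (ℝ × ℝ), S = (Icc 0 T ×ˢ Icc (0:ℝ) 1) ∩ (fun z : ℝ × ℝ => u z.1 (X z)) ⁻¹' Iic 0 := ⟨_, rfl⟩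
  have cS : IsCompact S := by
    refine (isCompact_Icc.prod isCompact_Icc).of_isClosed_subset ?_ (hS ▸ inter_subset_left)
    rw [hS]
    exact cW.preimage_isClosed_of_isClosed (isClosed_Icc.prod isClosed_Icc) isClosed_Iic
  have neS : S.Nonempty := by
    have hl := H.g_lt_h t0 ht0.1
    refine ⟨(t0, (x0 - g t0) / (h t0 - g t0)), ?_⟩
    rw [hS]
    refine ⟨⟨ht0, div_nonneg (by linarith [hx0.1]) (by linarith), ?_⟩, ?_⟩
    · show (x0 - g t0) / (h t0 - g t0) ≤ 1
      rw [div_le_one (by linarith)]; linarith [hx0.2]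
    · have : X (t0, (x0 - g t0) / (h t0 - g t0)) = x0 := by
        have : h t0 - g t0 ≠ 0 := by linarith
        rw [hX]; simp only; field_simp; ring
      show u t0 (X _) ≤ 0
      rw [this]; exact hu0
  obtain ⟨⟨t1, y1⟩, hz, hmin⟩ := cS.exists_isMinOn neS continuous_fst.continuousOn
  rw [hS] at hz
  obtain ⟨⟨ht1, hy1⟩, hu1⟩ := hz
  simp only at ht1 hy1
  have hu1 : u t1 (X (t1, y1)) ≤ 0 := hu1
  have bef : ∀ t ∈ Ico 0 t1, ∀ x ∈ Icc (g t) (h t), 0 < u t x := by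
    intro t ht x hx
    by_contra hn
    push Not at hn
    have hl := H.g_lt_h t ht.1
    have : (t, (x - g t) / (h t - g t)) ∈ S := by
      rw [hS]
      refine ⟨⟨⟨ht.1, ht.2.le.trans ht1.2⟩, div_nonneg (by linarith [hx.1]) (by linarith), ?_⟩, ?_⟩
      · show (x - g t) / (h t - g t) ≤ 1
        rw [div_le_one (by linarith)]; linarith [hx.2]
      · have : X (t, (x - g t) / (h t - g t)) = x := by
          have : h t - g t ≠ 0 := by linarith
          rw [hX]; simp only; field_simp; ring
        show u t (X _) ≤ 0
        rw [this]; exact hn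
    have := hmin this
    simp only [mem_setOf_eq] at this
    linarith [ht.2]
  have t1pos : 0 < t1 := by
    rcases ht1.1.eq_or_lt with e | e
    · exfalso
      have hm := Xm (t1, y1) ⟨ht1, hy1⟩
      rw [← e] at hu1 hm
      have hm' := hm
      simp only [H.g_init, H.h_init] at hm'
      rw [H.u_init _ hm'] at hu1
      linarith [hP.lo _ hm', P.hm]
    · exact e
  have H' : PS P.d t1 P.F u g h := hP.d ▸ cs_ps H t1 fun t ht x hx =>
    hP.F t ht.1.le x _ ⟨(bef t ⟨ht.1.le, ht.2⟩ x (Ioo_subset_Icc_self hx)).le, cs_up H hP hf ht.1.le x (Ioo_subset_Icc_self hx)⟩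
  have hlow : ∀ t ∈ Ioo 0 t1, P.m * Real.exp (-(P.LF + 1) * t) ≤ u t (X (t, y1)) := fun t ht =>
    cs_low H hP ht.2 H' t ⟨ht.1.le, le_rfl⟩ _ (Xm (t, y1) ⟨⟨ht.1.le, ht.2.le.trans ht1.2⟩, hy1⟩)
  have l1 : Tendsto (fun t => u t (X (t, y1))) (𝓝[Ioo 0 t1] t1) (𝓝 (u t1 (X (t1, y1)))) := by
    have := (cW.comp (f := fun t : ℝ => (t, y1)) (s := Icc 0 T) (by fun_prop) fun t ht => ⟨ht, hy1⟩) t1 ht1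
    exact this.mono_left (nhdsWithin_mono _ fun t ht => ⟨ht.1.le, ht.2.le.trans ht1.2⟩)
  have l2 : Tendsto (fun t => P.m * Real.exp (-(P.LF + 1) * t)) (𝓝[Ioo 0 t1] t1) (𝓝 (P.m * Real.exp (-(P.LF + 1) * t1))) :=
    (Continuous.tendsto (by fun_prop) t1).mono_left nhdsWithin_le_nhds
  have nb : (𝓝[Ioo 0 t1] t1).NeBot := by
    rw [nhdsWithin_Ioo_eq_nhdsLT t1pos]; infer_instance
  have := le_of_tendsto_of_tendsto l2 l1 (by filter_upwards [self_mem_nhdsWithin] with t ht using hlow t ht)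
  have h3 : 0 < P.m * Real.exp (-(P.LF + 1) * t1) := mul_pos P.hm (Real.exp_pos _)
  linarith

lemma cs_ps' (H : ClassicalSolution d δ h₀ f u₀ (Ici (0:ℝ)) u g h) (hP : P.Is d δ h₀ M₀ f u₀) (hf : CondF3 f M₀)
    (T : ℝ) : PS P.d T P.F u g h := hP.d ▸ cs_ps H T fun t ht x hx =>
  hP.F t ht.1.le x _ ⟨(cs_pos H hP hf t ⟨ht.1.le, ht.2.le⟩ x (Ioo_subset_Icc_self hx)).le,
    cs_up H hP hf ht.1.le x (Ioo_subset_Icc_self hx)⟩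
end CS

lemma PS.congr_gh {d T : ℝ} {F : ℝ → ℝ → ℝ → ℝ} {u : ℝ → ℝ → ℝ} {g h g' h' : ℝ → ℝ} (H : PS d T F u g h)
    (hg : ∀ t ∈ Ico 0 T, g' t = g t) (hh : ∀ t ∈ Ico 0 T, h' t = h t) : PS d T F u g' h' where
  gc := H.gc.congr hg
  hc := H.hc.congr hh
  uc := H.uc.mono fun z hz => ⟨hz.1, by have := hz.2; rwa [hg _ hz.1, hh _ hz.1] at this⟩
  ut := fun t ht x hx => H.ut t ht x (by rwa [hg _ ⟨ht.1.le, ht.2⟩, hh _ ⟨ht.1.le, ht.2⟩] at hx)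
  ux := fun t ht x hx => H.ux t ht x (by rwa [hg _ ⟨ht.1.le, ht.2⟩, hh _ ⟨ht.1.le, ht.2⟩] at hx)
  uxx := fun t ht x hx => H.uxx t ht x (by rwa [hg _ ⟨ht.1.le, ht.2⟩, hh _ ⟨ht.1.le, ht.2⟩] at hx)
  pde := fun t ht x hx => H.pde t ht x (by rwa [hg _ ⟨ht.1.le, ht.2⟩, hh _ ⟨ht.1.le, ht.2⟩] at hx)

/-- continuous bounded extension of the velocity of a `C¹` boundary -/
lemma vel {g : ℝ → ℝ} (hg : ContDiffOn ℝ 1 g (Ici (0:ℝ))) {T : ℝ} (hT : 0 < T) : ∃ (a : ℝ → ℝ) (C : ℝ), Continuous a ∧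
    (∀ t, |a t| ≤ C) ∧ (∀ t ∈ Ioc 0 T, a t = deriv g t) ∧ ∀ t ∈ Icc 0 T, g 0 + ∫ s in (0:ℝ)..t, a s = g t := by
  have hc := hg.continuousOn_derivWithin (uniqueDiffOn_Ici 0) le_rfl
  obtain ⟨C, hC⟩ := isCompact_Icc.exists_bound_of_continuousOn (hc.mono (Icc_subset_Ici_self : Icc 0 T ⊆ _))
  have mc : ∀ t : ℝ, max 0 (min t T) ∈ Icc 0 T := fun t => clamp_mem hT.le t
  have ca : Continuous fun t => derivWithin g (Ici 0) (max 0 (min t T)) := by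
    have : Continuous fun t : ℝ => max 0 (min t T) := by fun_prop
    exact hc.comp_continuous this fun t => (mc t).1
  have ea : ∀ t ∈ Ioc 0 T, derivWithin g (Ici 0) (max 0 (min t T)) = deriv g t := fun t ht => by
    rw [clamp_id ⟨ht.1.le, ht.2⟩, derivWithin_of_mem_nhds (Ici_mem_nhds ht.1)]
  refine ⟨_, C, ca, fun t => hC _ (mc t), ea, fun t ht => ?_⟩
  rw [intervalIntegral.integral_eq_sub_of_hasDerivAt_of_le (f := g) ht.1]
  · ring
  · exact hg.continuousOn.mono fun s hs => hs.1
  · intro s hs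
    have h1 : 0 < s := hs.1
    rw [ea s ⟨h1, hs.2.le.trans ht.2⟩]
    exact (((hg.differentiableOn (by norm_num)) s h1.le).differentiableAt (Ici_mem_nhds h1)).hasDerivAt
  · exact ca.intervalIntegrable _ _
end FBP

namespace FBP
open MeasureTheory Topology

lemma deriv_eq_of_eqOn {a b : ℝ} (hab : a < b) {v w : ℝ → ℝ} {x p q : ℝ} (hx : x ∈ Icc a b) (hv : HasDerivAt v p x)
    (hw : HasDerivAt w q x) (he : ∀ y ∈ Icc a b, v y = w y) : p = q := by
  have h1 : HasDerivWithinAt w p (Icc a b) x := hv.hasDerivWithinAt.congr (fun y hy => (he y hy).symm) (he x hx).symm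
  exact (uniqueDiffOn_Icc hab x hx).eq_deriv _ h1 hw.hasDerivWithinAt

theorem cs_sol {P : Prob} {d δ h₀ M₀ : ℝ} {f : ℝ → ℝ → ℝ → ℝ} {u₀ : ℝ → ℝ} {u : ℝ → ℝ → ℝ} {g h : ℝ → ℝ}
    (H : ClassicalSolution d δ h₀ f u₀ (Ici (0:ℝ)) u g h) (hP : P.Is d δ h₀ M₀ f u₀) (hf : CondF3 f M₀)
    {T0 : ℝ} (hT0 : 0 < T0) : ∃ D p R, Sol P D p R T0 ∧ ∀ t ∈ Icc 0 T0, D.gg p t = g t ∧ D.hh p t = h t ∧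
      ∀ x ∈ Icc (g t) (h t), D.uu p t x = u t x := by
  have hT : 0 < T0 + 1 := by linarith
  obtain ⟨a, Ca, ca, ba, ea, ia⟩ := vel H.g_reg hT
  obtain ⟨b, Cb, cb, bb, eb, ib⟩ := vel H.h_reg hT
  have gc : ContinuousOn g (Icc 0 (T0 + 1)) := H.g_reg.continuousOn.mono fun t ht => ht.1
  have hc : ContinuousOn h (Icc 0 (T0 + 1)) := H.h_reg.continuousOn.mono fun t ht => ht.1
  obtain ⟨s, hs, hmin⟩ := isCompact_Icc.exists_isMinOn (nonempty_Icc.2 hT.le) (hc.sub gc)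
  have hls := H.g_lt_h s hs.1
  obtain ⟨l1, hl1⟩ : ∃ l1, l1 = (h s - g s) / 2 := ⟨_, rfl⟩
  have hl0 : 0 < l1 := by linarith
  have hlt : ∀ t ∈ Icc 0 (T0 + 1), l1 < h t - g t := fun t ht => by
    have : h s - g s ≤ h t - g t := hmin ht
    linarith
  obtain ⟨D, hD⟩ : ∃ D, D = P.datG (T0 + 1) l1 (max Ca Cb) 0 (fun t _ => a t) (fun t _ => b t) hT hl0 (ca.comp continuous_fst)
    (cb.comp continuous_fst) (fun t _ => (ba t).trans (le_max_left _ _)) (fun t _ => (bb t).trans (le_max_right _ _))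
    (fun t _ _ => by simp) (fun t _ _ => by simp) := ⟨_, rfl⟩
  have o : Of P D := by rw [hD]; exact ⟨rfl, rfl, rfl, rfl, rfl⟩
  have oT : D.T = T0 + 1 := by rw [hD]; rfl
  have ol : D.l1 = l1 := by rw [hD]; rfl
  obtain ⟨p, R, hfx⟩ := Dat.fx_exists D
  have ovg : ∀ t, D.vg p t = a t := fun t => by rw [hD]; rfl
  have ovh : ∀ t, D.vh p t = b t := fun t => by rw [hD]; rfl
  have eg : ∀ t ∈ Icc 0 (T0 + 1), D.gg p t = g t := fun t ht => by
    rw [← ia t ht, H.g_init, ← hP.h0]; unfold Dat.gg; rw [o.h0, show D.vg p = a from funext ovg]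
  have eh : ∀ t ∈ Icc 0 (T0 + 1), D.hh p t = h t := fun t ht => by
    rw [← ib t ht, H.h_init, ← hP.h0]; unfold Dat.hh; rw [o.h0, show D.vh p = b from funext ovh]
  have hl : ∀ t ∈ Icc 0 (T0 + 1), D.l1 < D.hh p t - D.gg p t := fun t ht => by
    rw [eg t ht, eh t ht, ol]; exact hlt t ht
  have pu : PS P.d (T0 + 1) P.F u g h := cs_ps' H hP hf _
  have pw : PS P.d (T0 + 1) P.F (D.uu p) g h := by
    have := Dat.ps hfx (T1 := T0 + 1) oT.ge fun t ht => hl t ⟨ht.1, ht.2.le⟩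
    rw [o.d, o.F] at this
    exact this.congr_gh (fun t ht => (eg t ⟨ht.1, ht.2.le⟩).symm) (fun t ht => (eh t ⟨ht.1, ht.2.le⟩).symm)
  have lt1 : T0 < T0 + 1 := by linarith
  have m0 : (0:ℝ) ∈ Icc 0 (T0 + 1) := ⟨le_rfl, hT.le⟩
  have i0 : ∀ x ∈ Icc (g 0) (h 0), D.uu p 0 x = u 0 x := fun x hx => by
    rw [H.g_init, H.h_init] at hx
    have hl0 := hl 0 m0
    rw [Dat.gg_zero, Dat.hh_zero] at hl0
    rw [H.u_init x hx, ← hP.q x hx, Dat.uu_init hfx (by linarith), o.δ, o.h0, hP.h0]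
    unfold Dat.z0; rw [o.q0]
  have bg : ∀ t ∈ Ioc 0 T0, D.uu p t (g t) = u t (g t) := fun t ht => by
    rw [H.bc_g t ht.1.le ht.1, ← eg t ⟨ht.1.le, by linarith [ht.2]⟩, Dat.uu_g, o.δ, hP.δ]
  have bh : ∀ t ∈ Ioc 0 T0, D.uu p t (h t) = u t (h t) := fun t ht => by
    have mt : t ∈ Icc 0 (T0 + 1) := ⟨ht.1.le, by linarith [ht.2]⟩
    rw [H.bc_h t ht.1.le ht.1, ← eh t mt, Dat.uu_h hfx (oT ▸ mt) (hl t mt).le, o.δ, hP.δ]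
  have eu : ∀ t ∈ Icc 0 T0, ∀ x ∈ Icc (g t) (h t), D.uu p t x = u t x := by
    intro t ht x hx
    refine le_antisymm ?_ ?_
    · refine pw.compare pu P.hd.le (L := P.LF) lt1 (fun x hx => (i0 x hx).le) (fun t ht => (bg t ht).le) (fun t ht => (bh t ht).le)
        (fun t _ x _ hlt => ?_) t ht x hx
      have := (le_abs_self _).trans (P.Fl t x (D.uu p t x) (u t x))
      rwa [abs_of_pos (by linarith)] at this
    · refine pu.compare pw P.hd.le (L := P.LF) lt1 (fun x hx => (i0 x hx).ge) (fun t ht => (bg t ht).ge) (fun t ht => (bh t ht).ge)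
        (fun t _ x _ hlt => ?_) t ht x hx
      have := (le_abs_self _).trans (P.Fl t x (u t x) (D.uu p t x))
      rwa [abs_of_pos (by linarith)] at this
  have pc : ∀ y, Continuous fun t => p t y := fun y => hfx.a.c.comp (continuous_id.prodMk continuous_const)
  have clo : closure (Ioc 0 T0) = Icc 0 T0 := closure_Ioc hT0.ne
  refine ⟨D, p, R, ⟨o, hfx, by linarith, fun t ht => hl t ⟨ht.1, by linarith [ht.2]⟩, ?_, ?_⟩,
    fun t ht => ⟨eg t ⟨ht.1, by linarith [ht.2]⟩, eh t ⟨ht.1, by linarith [ht.2]⟩, eu t ht⟩⟩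
  · have key : EqOn (D.vg p) (fun t => -(P.d / P.δ) * p t 0) (Ioc 0 T0) := by
      intro t ht
      have mt : t ∈ Icc 0 (T0 + 1) := ⟨ht.1.le, by linarith [ht.2]⟩
      have hlt := H.g_lt_h t ht.1.le
      have mg : g t ∈ Icc (g t) (h t) := ⟨le_rfl, hlt.le⟩
      have e1 := Dat.uu_deriv (D := D) hfx.a t (g t)
      have e2 : D.ox p t (g t) = p t 0 := by rw [← eg t mt, Dat.ox_g]
      have e3 := deriv_eq_of_eqOn hlt mg e1 (H.ux_diff t ht.1.le ht.1 _ mg).hasDerivAt (eu t ⟨ht.1.le, ht.2⟩)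
      show D.vg p t = -(P.d / P.δ) * p t 0
      rw [ovg, ea t ⟨ht.1, mt.2⟩, H.stefan_g t ht.1.le ht.1, ← e3, e2, hP.d, hP.δ]
    intro t ht
    exact key.closure (Dat.vg_cont hfx.a.c) ((pc 0).const_mul _) (clo ▸ ht)
  · have key : EqOn (D.vh p) (fun t => -(P.d / P.δ) * p t 1) (Ioc 0 T0) := by
      intro t ht
      have mt : t ∈ Icc 0 (T0 + 1) := ⟨ht.1.le, by linarith [ht.2]⟩
      have hlt := H.g_lt_h t ht.1.le
      have mg : h t ∈ Icc (g t) (h t) := ⟨hlt.le, le_rfl⟩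
      have e1 := Dat.uu_deriv (D := D) hfx.a t (h t)
      have e2 : D.ox p t (h t) = p t 1 := by rw [← eh t mt, Dat.ox_h (hl t mt).le]
      have e3 := deriv_eq_of_eqOn hlt mg e1 (H.ux_diff t ht.1.le ht.1 _ mg).hasDerivAt (eu t ⟨ht.1.le, ht.2⟩)
      show D.vh p t = -(P.d / P.δ) * p t 1
      rw [ovh, eb t ⟨ht.1, mt.2⟩, H.stefan_h t ht.1.le ht.1, ← e3, e2, hP.d, hP.δ]
    intro t ht
    exact key.closure (Dat.vh_cont hfx.a.c) ((pc 1).const_mul _) (clo ▸ ht)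
end FBP

namespace FBP
open MeasureTheory Topology

structure Rep (P : Prob) (u : ℝ → ℝ → ℝ) (g h : ℝ → ℝ) (D : Dat) (p : ℝ → ℝ → ℝ) (R T : ℝ) : Prop where
  s : Sol P D p R T
  tT : T < D.T
  pos : ∀ t ∈ Icc 0 T, ∀ x ∈ Icc (D.gg p t) (D.hh p t), 0 < D.uu p t x
  up : ∀ t ∈ Icc 0 T, ∀ x ∈ Icc (D.gg p t) (D.hh p t), D.uu p t x ≤ P.M
  ini : ∀ x, D.uu p 0 x = P.δ + ∫ r in (0:ℝ)..((x + P.h0) / (2 * P.h0)), P.q0 r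
  eu : ∀ t ∈ Icc 0 T, u t = D.uu p t
  eg : ∀ t ∈ Icc 0 T, g t = D.gg p t
  eh : ∀ t ∈ Icc 0 T, h t = D.hh p t

lemma glue (P : Prob) : ∃ u g h, ∀ n : ℕ, ∃ D p R, Rep P u g h D p R ((n:ℝ) + 1) := by
  have ex := fun n : ℕ => P.sol_exists (T0 := (n:ℝ) + 1) (by positivity)
  choose D p R hS hT hpos hup hini using ex
  have key : ∀ n : ℕ, ∀ t ∈ Icc 0 ((n:ℝ) + 1), (D ⌊t⌋₊).gg (p ⌊t⌋₊) t = (D n).gg (p n) t ∧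
      (D ⌊t⌋₊).hh (p ⌊t⌋₊) t = (D n).hh (p n) t ∧ (D ⌊t⌋₊).uu (p ⌊t⌋₊) t = (D n).uu (p n) t := by
    intro n t ht
    have h1 : t ≤ (⌊t⌋₊:ℝ) + 1 := (Nat.lt_floor_add_one t).le
    have hp : 0 < min ((⌊t⌋₊:ℝ) + 1) ((n:ℝ) + 1) := lt_min (by positivity) (by positivity)
    exact (((hS ⌊t⌋₊).mono (min_le_left _ _)).eqall ((hS n).mono (min_le_right _ _)) hp ⟨ht.1, le_min h1 ht.2⟩).2
  exact ⟨fun t => (D ⌊t⌋₊).uu (p ⌊t⌋₊) t, fun t => (D ⌊t⌋₊).gg (p ⌊t⌋₊) t, fun t => (D ⌊t⌋₊).hh (p ⌊t⌋₊) t, fun n =>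
    ⟨D n, p n, R n, hS n, hT n, hpos n, hup n, hini n, fun t ht => (key n t ht).2.2, fun t ht => (key n t ht).1, fun t ht => (key n t ht).2.1⟩⟩

lemma loc_cont {S : Set (ℝ × ℝ)} {φ : ℝ × ℝ → ℝ} (H : ∀ n : ℕ, ContinuousOn φ (S ∩ {z | z.1 < (n:ℝ) + 1})) : ContinuousOn φ S := by
  refine continuousOn_of_locally_continuousOn fun z _ => ?_
  exact ⟨{w | w.1 < (⌊z.1⌋₊:ℝ) + 1}, isOpen_lt continuous_fst continuous_const, Nat.lt_floor_add_one z.1, H _⟩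

lemma c1_of {G v : ℝ → ℝ} (hv : Continuous v) (h : ∀ t, HasDerivAt G (v t) t) : ContDiff ℝ 1 G :=
  contDiff_one_iff_deriv.2 ⟨fun t => (h t).differentiableAt, by rw [show deriv G = v from funext fun t => (h t).deriv]; exact hv⟩

section
variable {P : Prob} {u : ℝ → ℝ → ℝ} {g h : ℝ → ℝ}

lemma reg_of {g : ℝ → ℝ} (H : ∀ n : ℕ, ∃ G : ℝ → ℝ, ContDiff ℝ 1 G ∧ ∀ t ∈ Icc 0 ((n:ℝ) + 1), g t = G t) :
    ContDiffOn ℝ 1 g (Ici (0:ℝ)) := by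
  intro t ht
  obtain ⟨G, hG, he⟩ := H ⌊t⌋₊
  have hlt := Nat.lt_floor_add_one t
  refine hG.contDiffAt.contDiffWithinAt.congr_of_eventuallyEq ?_ (he t ⟨ht, hlt.le⟩)
  filter_upwards [self_mem_nhdsWithin, mem_nhdsWithin_of_mem_nhds (Iio_mem_nhds hlt)] with s h1 h2 using he s ⟨h1, h2.le⟩

variable {D : Dat} {p : ℝ → ℝ → ℝ} {R T : ℝ}

lemma Rep.hut (r : Rep P u g h D p R T) {t x : ℝ} (ht : t ∈ Ioo 0 T) (hx : x ∈ Ioo (g t) (h t)) :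
    HasDerivAt (fun s => u s x) (P.d * D.oxx p t x + P.F t x (D.uu p t x)) t := by
  have m : t ∈ Icc 0 T := ⟨ht.1.le, ht.2.le⟩
  rw [r.eg t m, r.eh t m] at hx
  have := Dat.uu_deriv_t r.s.fx (t := t) (x := x) ⟨ht.1, ht.2.trans r.tT⟩ (r.s.hl t m) hx
  rw [r.s.o.d, r.s.o.F] at this
  refine this.congr_of_eventuallyEq ?_
  filter_upwards [Ioo_mem_nhds ht.1 ht.2] with s hs
  rw [r.eu s ⟨hs.1.le, hs.2.le⟩]

lemma Rep.hux (r : Rep P u g h D p R T) {t : ℝ} (ht : t ∈ Icc 0 T) (x : ℝ) :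
    HasDerivAt (u t) (D.ox p t x) x := by
  rw [r.eu t ht]; exact Dat.uu_deriv r.s.fx.a t x

lemma Rep.hux' (r : Rep P u g h D p R T) {t : ℝ} (ht : t ∈ Icc 0 T) : deriv (u t) = D.ox p t :=
  funext fun x => (r.hux ht x).deriv

lemma Rep.huxx (r : Rep P u g h D p R T) {t x : ℝ} (ht : t ∈ Ioo 0 T) (hx : x ∈ Ioo (g t) (h t)) :
    HasDerivAt (deriv (u t)) (D.oxx p t x) x := by
  have m : t ∈ Icc 0 T := ⟨ht.1.le, ht.2.le⟩
  rw [r.eg t m, r.eh t m] at hx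
  rw [r.hux' m]
  exact Dat.ox_deriv r.s.fx ht.1 (ht.2.trans r.tT).le (r.s.hl t m) hx

lemma Rep.oxxc (r : Rep P u g h D p R T) {S : Set (ℝ × ℝ)} (hS : ∀ z ∈ S, z.1 ∈ Ioo 0 T ∧ z.2 ∈ Ioo (g z.1) (h z.1)) :
    ContinuousOn (fun z : ℝ × ℝ => D.oxx p z.1 z.2) S := by
  refine (Dat.oxx_cont r.s.fx r.tT.le fun t ht => r.s.hl t ⟨ht.1, ht.2.le⟩).mono fun z hz => ?_
  obtain ⟨h1, h2⟩ := hS z hz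
  have m : z.1 ∈ Icc 0 T := ⟨h1.1.le, h1.2.le⟩
  rw [r.eg _ m, r.eh _ m] at h2
  exact ⟨h1, h2⟩

lemma Rep.dg (r : Rep P u g h D p R T) {t : ℝ} (ht : t ∈ Ioo 0 T) : deriv g t = -(P.d / P.δ) * p t 0 := by
  have m : t ∈ Icc 0 T := ⟨ht.1.le, ht.2.le⟩
  rw [← r.s.vg t m]
  refine ((Dat.gg_deriv (D := D) r.s.fx.a.c t).congr_of_eventuallyEq ?_).deriv
  filter_upwards [Ioo_mem_nhds ht.1 ht.2] with s hs
  rw [r.eg s ⟨hs.1.le, hs.2.le⟩]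

lemma Rep.dh (r : Rep P u g h D p R T) {t : ℝ} (ht : t ∈ Ioo 0 T) : deriv h t = -(P.d / P.δ) * p t 1 := by
  have m : t ∈ Icc 0 T := ⟨ht.1.le, ht.2.le⟩
  rw [← r.s.vh t m]
  refine ((Dat.hh_deriv (D := D) r.s.fx.a.c t).congr_of_eventuallyEq ?_).deriv
  filter_upwards [Ioo_mem_nhds ht.1 ht.2] with s hs
  rw [r.eh s ⟨hs.1.le, hs.2.le⟩]

end

theorem glue_cs {P : Prob} {d δ h₀ M₀ : ℝ} {f : ℝ → ℝ → ℝ → ℝ} {u₀ : ℝ → ℝ} (hP : P.Is d δ h₀ M₀ f u₀)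
    {u : ℝ → ℝ → ℝ} {g h : ℝ → ℝ} (H : ∀ n : ℕ, ∃ D p R, Rep P u g h D p R ((n:ℝ) + 1)) :
    ClassicalSolution d δ h₀ f u₀ (Ici (0:ℝ)) u g h ∧ ∀ t, 0 ≤ t → ∀ x ∈ Icc (g t) (h t), 0 < u t x := by
  have at0 : ∀ t : ℝ, 0 ≤ t → ∃ D p R T, Rep P u g h D p R T ∧ t ∈ Icc 0 T ∧ t < T := fun t ht => by
    obtain ⟨D, p, R, r⟩ := H ⌊t⌋₊
    exact ⟨D, p, R, _, r, ⟨ht, (Nat.lt_floor_add_one t).le⟩, Nat.lt_floor_add_one t⟩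
  constructor
  swap
  · intro t ht x hx
    obtain ⟨D, p, R, T, r, m, -⟩ := at0 t ht
    rw [r.eg t m, r.eh t m] at hx
    rw [r.eu t m]; exact r.pos t m x hx
  exact
  { g_reg := reg_of fun n => by
      obtain ⟨D, p, R, r⟩ := H n
      exact ⟨D.gg p, c1_of (Dat.vg_cont r.s.fx.a.c) (Dat.gg_deriv r.s.fx.a.c), r.eg⟩
    h_reg := reg_of fun n => by
      obtain ⟨D, p, R, r⟩ := H n
      exact ⟨D.hh p, c1_of (Dat.vh_cont r.s.fx.a.c) (Dat.hh_deriv r.s.fx.a.c), r.eh⟩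
    g_lt_h := fun t ht => by
      obtain ⟨D, p, R, T, r, m, -⟩ := at0 t ht
      have := r.s.hl t m
      have := D.hl1
      rw [r.eg t m, r.eh t m]; linarith
    u_cont := loc_cont fun n => by
      obtain ⟨D, p, R, r⟩ := H n
      refine (Dat.uu_cont (D := D) r.s.fx.a).continuousOn.congr fun z hz => ?_
      have h1 : 0 ≤ z.1 := hz.1.1
      have h2 : z.1 < (n:ℝ) + 1 := hz.2
      simp only; rw [r.eu z.1 ⟨h1, h2.le⟩]
    ux_cont := loc_cont fun n => by
      obtain ⟨D, p, R, r⟩ := H n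
      refine (Dat.ox_cont (D := D) r.s.fx.a).continuousOn.congr fun z hz => ?_
      have h1 : 0 ≤ z.1 := hz.1.1
      have h2 : z.1 < (n:ℝ) + 1 := hz.2
      exact congrFun (r.hux' ⟨h1, h2.le⟩) _
    ut_diff := fun t ht ht0 x hx => by
      obtain ⟨D, p, R, T, r, m, hT⟩ := at0 t ht
      exact (r.hut ⟨ht0, hT⟩ hx).differentiableAt
    ux_diff := fun t ht ht0 x hx => by
      obtain ⟨D, p, R, T, r, m, hT⟩ := at0 t ht
      exact (r.hux m x).differentiableAt
    uxx_diff := fun t ht ht0 x hx => by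
      obtain ⟨D, p, R, T, r, m, hT⟩ := at0 t ht
      exact (r.huxx ⟨ht0, hT⟩ hx).differentiableAt
    ut_cont := loc_cont fun n => by
      obtain ⟨D, p, R, r⟩ := H n
      refine ContinuousOn.congr (f := fun z : ℝ × ℝ => P.d * D.oxx p z.1 z.2 + P.F z.1 z.2 (D.uu p z.1 z.2)) ?_
        fun z hz => (r.hut ⟨hz.1.2.1, hz.2⟩ hz.1.2.2).deriv
      refine ((r.oxxc fun z hz => ⟨⟨hz.1.2.1, hz.2⟩, hz.1.2.2⟩).const_mul _).add (Continuous.continuousOn ?_)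
      exact P.Fc.comp (continuous_fst.prodMk (continuous_snd.prodMk (Dat.uu_cont (D := D) r.s.fx.a)))
    uxx_cont := loc_cont fun n => by
      obtain ⟨D, p, R, r⟩ := H n
      exact (r.oxxc fun z hz => ⟨⟨hz.1.2.1, hz.2⟩, hz.1.2.2⟩).congr fun z hz => (r.huxx ⟨hz.1.2.1, hz.2⟩ hz.1.2.2).deriv
    pde := fun t ht ht0 x hx => by
      obtain ⟨D, p, R, T, r, m, hT⟩ := at0 t ht
      have hx' : x ∈ Icc (D.gg p t) (D.hh p t) := by
        have := Ioo_subset_Icc_self hx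
        rwa [r.eg t m, r.eh t m] at this
      rw [(r.hut ⟨ht0, hT⟩ hx).deriv, (r.huxx ⟨ht0, hT⟩ hx).deriv, r.eu t m,
        hP.F t ht x _ ⟨(r.pos t m x hx').le, r.up t m x hx'⟩, hP.d]
    bc_g := fun t ht ht0 => by
      obtain ⟨D, p, R, T, r, m, hT⟩ := at0 t ht
      rw [r.eu t m, r.eg t m, Dat.uu_g, r.s.o.δ, hP.δ]
    bc_h := fun t ht ht0 => by
      obtain ⟨D, p, R, T, r, m, hT⟩ := at0 t ht
      rw [r.eu t m, r.eh t m, Dat.uu_h r.s.fx ⟨m.1, m.2.trans r.tT.le⟩ (r.s.hl t m).le, r.s.o.δ, hP.δ]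
    stefan_g := fun t ht ht0 => by
      obtain ⟨D, p, R, T, r, m, hT⟩ := at0 t ht
      rw [r.dg ⟨ht0, hT⟩, r.hux' m, r.eg t m, Dat.ox_g, hP.d, hP.δ]
    stefan_h := fun t ht ht0 => by
      obtain ⟨D, p, R, T, r, m, hT⟩ := at0 t ht
      rw [r.dh ⟨ht0, hT⟩, r.hux' m, r.eh t m, Dat.ox_h (r.s.hl t m).le, hP.d, hP.δ]
    g_init := by
      obtain ⟨D, p, R, T, r, m, hT⟩ := at0 0 le_rfl
      rw [r.eg 0 m, Dat.gg_zero, r.s.o.h0, hP.h0]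
    h_init := by
      obtain ⟨D, p, R, T, r, m, hT⟩ := at0 0 le_rfl
      rw [r.eh 0 m, Dat.hh_zero, r.s.o.h0, hP.h0]
    u_init := fun x hx => by
      obtain ⟨D, p, R, T, r, m, hT⟩ := at0 0 le_rfl
      rw [r.eu 0 m, r.ini, hP.h0, hP.q x hx] }

end FBP

/-- global existence and uniqueness (Theorem 3.6). -/
theorem global_existence_uniqueness (d δ h₀ M₀ β : ℝ) (f : ℝ → ℝ → ℝ → ℝ)
    (u₀ : ℝ → ℝ)
    (hd : 0 < d) (hδ : 0 < δ) (hh₀ : 0 < h₀)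
    (hf2 : CondF2 f β) (hf3 : CondF3 f M₀) (hu₀ : InX δ h₀ u₀) :
    ∃ (u : ℝ → ℝ → ℝ) (g h : ℝ → ℝ),
      ClassicalSolution d δ h₀ f u₀ (Ici (0:ℝ)) u g h ∧
      (∀ t > 0, ∀ x ∈ Icc (g t) (h t), 0 < u t x) ∧
      ∀ (u' : ℝ → ℝ → ℝ) (g' h' : ℝ → ℝ),
        ClassicalSolution d δ h₀ f u₀ (Ici (0:ℝ)) u' g' h' →
        ∀ t ∈ Ici (0:ℝ), g' t = g t ∧ h' t = h t ∧
          ∀ x ∈ Icc (g t) (h t), u' t x = u t x := by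
  obtain ⟨P, hP⟩ := FBP.prob_exists hd hδ hh₀ hf2 hf3 hu₀
  obtain ⟨u, g, h, H⟩ := FBP.glue P
  obtain ⟨hcs, hpos⟩ := FBP.glue_cs hP H
  refine ⟨u, g, h, hcs, fun t ht => hpos t ht.le, ?_⟩
  intro u' g' h' H' t ht
  obtain ⟨D, p, R, r⟩ := H ⌊t⌋₊
  have hT : (0:ℝ) < (⌊t⌋₊:ℝ) + 1 := by positivity
  obtain ⟨D', p', R', hS, hE⟩ := FBP.cs_sol H' hP hf3 hT
  have m : t ∈ Icc (0:ℝ) ((⌊t⌋₊:ℝ) + 1) := ⟨ht, (Nat.lt_floor_add_one t).le⟩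
  obtain ⟨-, e1, e2, e3⟩ := hS.eqall r.s hT m
  obtain ⟨a1, a2, a3⟩ := hE t m
  have b1 : g' t = g t := by rw [← a1, e1, r.eg t m]
  have b2 : h' t = h t := by rw [← a2, e2, r.eh t m]
  refine ⟨b1, b2, fun x hx => ?_⟩
  rw [← b1, ← b2] at hx
  rw [← a3 x hx, e3, r.eu t m]
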